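/- Stokes estimate under Navier boundary conditions with constant independent of the horizontal length: let q ∈ (1,∞), μ > 0, k₀ ≤ 0, k₁ ≤ 0. There exists a constant C > 0, depending only on q, μ, k₀, k₁ (and not on R), such that for every R > 0, every continuous f : Ω_R → ℝ², and every pair (u,p) with u = (u₁,u₂) : Ω_R → ℝ² twice continuously differentiable and p : Ω_R → ℝ continuously differentiable satisfying −μΔu + ∇p = f and ∂₁u₁ + ∂₂u₂ = 0 on Ω_R, u = 0 on the lateral sides {±R}×[0,1], and the Navier boundary conditions u₂(x₁,0) = u₂(x₁,1) = 0, ∂₂u₁(x₁,1) = (k₁/μ)·u₁(x₁,1), ∂₂u₁(x₁,0) = −(k₀/μ)·u₁(x₁,0) for all x₁ ∈ [-R,R], one has ‖∇²u‖_{L^q(Ω_R)} + ‖∇p‖_{L^q(Ω_R)} ≤ C·(‖f‖_{L^q(Ω_R)} + ‖u‖_{W^{1,q}(Ω_R)}). -/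

import Mathlib

open MeasureTheory Set

noncomputable section

/-- first partial derivative in the horizontal direction -/
def pd1 (u : ℝ × ℝ → ℝ) (x : ℝ × ℝ) : ℝ := fderiv ℝ u x (1, 0)

/-- first partial derivative in the vertical direction -/
def pd2 (u : ℝ × ℝ → ℝ) (x : ℝ × ℝ) : ℝ := fderiv ℝ u x (0, 1)

/-- the rectangle `Ω_R = [-R,R] × [0,1]` -/
def OmegaR (R : ℝ) : Set (ℝ × ℝ) := (Icc (-R) R) ×ˢ (Icc (0 : ℝ) 1)

/-- `L^q` norm of a scalar function on a planar region -/
def lqNorm (q : ℝ) (Ω : Set (ℝ × ℝ)) (f : ℝ × ℝ → ℝ) : ℝ :=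
  (∫ x in Ω, |f x| ^ q) ^ (1 / q)

/-- `L^q` norm of a planar vector field (components `f`, `g`) -/
def lqNormVec (q : ℝ) (Ω : Set (ℝ × ℝ)) (f g : ℝ × ℝ → ℝ) : ℝ :=
  ((lqNorm q Ω f) ^ q + (lqNorm q Ω g) ^ q) ^ (1 / q)

/-- `W^{1,q}` norm of a planar vector field, taken over all components -/
def w1qNormVec (q : ℝ) (Ω : Set (ℝ × ℝ)) (u1 u2 : ℝ × ℝ → ℝ) : ℝ :=
  ((lqNorm q Ω u1) ^ q + (lqNorm q Ω u2) ^ q +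
    (lqNorm q Ω (pd1 u1)) ^ q + (lqNorm q Ω (pd2 u1)) ^ q +
    (lqNorm q Ω (pd1 u2)) ^ q + (lqNorm q Ω (pd2 u2)) ^ q) ^ (1 / q)

/-- `L^q` norm of all second-order partial derivatives of a planar vector field -/
def hessLqNorm (q : ℝ) (Ω : Set (ℝ × ℝ)) (u1 u2 : ℝ × ℝ → ℝ) : ℝ :=
  ((lqNorm q Ω (pd1 (pd1 u1))) ^ q + (lqNorm q Ω (pd1 (pd2 u1))) ^ q +
    (lqNorm q Ω (pd2 (pd1 u1))) ^ q + (lqNorm q Ω (pd2 (pd2 u1))) ^ q +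
    (lqNorm q Ω (pd1 (pd1 u2))) ^ q + (lqNorm q Ω (pd1 (pd2 u2))) ^ q +
    (lqNorm q Ω (pd2 (pd1 u2))) ^ q + (lqNorm q Ω (pd2 (pd2 u2))) ^ q) ^ (1 / q)

open scoped ContDiff Topology
open Filter

local notation "Ex" => (1, 0)
local notation "Ey" => (0, 1)
local notation "il" => (Or.inl rfl)
local notation "ir" => (Or.inr rfl)
local notation "fp" => fun _ => (by positivity)
local notation "R0" => (0:ℝ)
local notation "Rf" x:max => (-x.1, x.2)
local notation "Ek" τ:max z:max x:max => Real.exp (-(τ * |z.2 - x.2|))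
local notation:max "nO" q:max R:max => lqNorm q (OmegaR R)
local notation "W3" f:max g:max u:max v:max w:max R:max z:max => (|f z| + |g z|) * (|u z| + |v z| + |w z| / R)
local notation "bn" => (by norm_num)
local notation "bf" => (by fun_prop)
local notation "bs" => (by simp)
local notation "bp" => (by positivity)
local notation "bL" => (by linarith)

theorem mlL {a b c : ℝ} (h : b ≤ c) (h0 : 0 ≤ a) : a * b ≤ a * c := mul_le_mul_of_nonneg_left h h0
theorem mlR {a b c : ℝ} (h : b ≤ c) (h0 : 0 ≤ a) : b * a ≤ c * a := mul_le_mul_of_nonneg_right h h0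
theorem Ef {α : Type*} {p : α → Prop} {f : Filter α} (h : ∀ x, p x) : ∀ᶠ x in f, p x := Eventually.of_forall h


/-- directional derivative -/
def dd (e : ℝ × ℝ) (u : ℝ × ℝ → ℝ) (x : ℝ × ℝ) : ℝ := fderiv ℝ u x e

abbrev P2 := ℝ × ℝ
local notation "F2" => P2 → ℝ

theorem pd1_eq (u : F2) : pd1 u = dd Ex u := rfl
theorem pd2_eq (u : F2) : pd2 u = dd Ey u := rfl

theorem dd_cd {n m : WithTop ℕ∞} {f : F2} (e : P2) (hf : ContDiff ℝ n f) (h : m + 1 ≤ n) :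
    ContDiff ℝ m (dd e f) := (hf.fderiv_right h).clm_apply contDiff_const

theorem dd_cont {f : F2} (e : P2) (hf : ContDiff ℝ 1 f) : Continuous (dd e f) :=
  (dd_cd e hf (m := 0) bs).continuous

theorem dd_hda {f : F2} (hf : Differentiable ℝ f) (e x : P2) (t : ℝ) :
    HasDerivAt (fun t : ℝ => f (x + t • e)) (dd e f (x + t • e)) t := by
  have h : HasDerivAt (fun t : ℝ => x + t • e) e t := by
    simpa using ((hasDerivAt_id t).smul_const e).const_add x
  exact (hf _).hasFDerivAt.comp_hasDerivAt t h

theorem pd1_hda {f : F2} (hf : Differentiable ℝ f) (x y : ℝ) :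
    HasDerivAt (fun t : ℝ => f (t, y)) (pd1 f (x, y)) x :=
  (hf _).hasFDerivAt.comp_hasDerivAt x ((hasDerivAt_id x).prodMk (hasDerivAt_const x y))

theorem pd2_hda {f : F2} (hf : Differentiable ℝ f) (x y : ℝ) :
    HasDerivAt (fun t : ℝ => f (x, t)) (pd2 f (x, y)) y :=
  (hf _).hasFDerivAt.comp_hasDerivAt y ((hasDerivAt_const y x).prodMk (hasDerivAt_id y))

theorem dd_comm {f : F2} (hf : ContDiff ℝ 2 f) (e e' : P2) :
    dd e (dd e' f) = dd e' (dd e f) := by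
  have key : ∀ a b x, dd a (dd b f) x = fderiv ℝ (fderiv ℝ f) x a b := by
    intro a b x
    have : HasFDerivAt (fun y => fderiv ℝ f y b) ((fderiv ℝ (fderiv ℝ f) x).flip b) x := by
      have h1 := ((hf.fderiv_right (m := 1) bn).differentiable bn x).hasFDerivAt
      simpa using h1.clm_apply (hasFDerivAt_const b x)
    show fderiv ℝ (fun y => fderiv ℝ f y b) x a = _
    rw [this.fderiv]; rfl
  funext x
  rw [key, key]
  exact (hf.contDiffAt.isSymmSndFDerivAt bs).eq e e'

theorem dd_add {f g : F2} (hf : Differentiable ℝ f) (hg : Differentiable ℝ g) (e : P2) :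
    dd e (fun x => f x + g x) = fun x => dd e f x + dd e g x := by
  funext x; simp only [dd]; rw [fderiv_fun_add (hf x) (hg x)]; rfl
theorem dd_sub {f g : F2} (hf : Differentiable ℝ f) (hg : Differentiable ℝ g) (e : P2) :
    dd e (fun x => f x - g x) = fun x => dd e f x - dd e g x := by
  funext x; simp only [dd]; rw [fderiv_fun_sub (hf x) (hg x)]; rfl
theorem dd_mul {f g : F2} (hf : Differentiable ℝ f) (hg : Differentiable ℝ g) (e : P2) :
    dd e (fun x => f x * g x) = fun x => dd e f x * g x + f x * dd e g x := by
  funext x; simp only [dd]; rw [fderiv_fun_mul (hf x) (hg x)]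
  simp; ring
theorem dd_cmul {f : F2} (hf : Differentiable ℝ f) (c : ℝ) (e : P2) :
    dd e (fun x => c * f x) = fun x => c * dd e f x := by
  funext x; simp only [dd]; rw [fderiv_const_mul (hf x)]; rfl
theorem dd_neg (f : F2) (e : P2) :
    dd e (fun x => - f x) = fun x => - dd e f x := by
  funext x; simp only [dd]; rw [fderiv_fun_neg]; rfl

/-- diagonal affine map -/
def aff (s₁ t₁ s₂ t₂ : ℝ) (x : P2) : P2 := (s₁ * x.1 + t₁, s₂ * x.2 + t₂)

theorem aff_cd (s₁ t₁ s₂ t₂ : ℝ) {n : WithTop ℕ∞} : ContDiff ℝ n (aff s₁ t₁ s₂ t₂) := by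
  unfold aff; fun_prop

theorem dd_aff {f : F2} (hf : Differentiable ℝ f) (s₁ t₁ s₂ t₂ : ℝ) (e : P2) :
    dd e (fun x => f (aff s₁ t₁ s₂ t₂ x)) =
      fun x => dd (s₁ * e.1, s₂ * e.2) f (aff s₁ t₁ s₂ t₂ x) := by
  funext x
  have h : HasFDerivAt (aff s₁ t₁ s₂ t₂)
      ((s₁ • ContinuousLinearMap.fst ℝ ℝ ℝ).prod (s₂ • ContinuousLinearMap.snd ℝ ℝ ℝ)) x := by
    have h1 := (hasFDerivAt_fst (𝕜 := ℝ) (p := x)).const_mul s₁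
    have h2 := (hasFDerivAt_snd (𝕜 := ℝ) (p := x)).const_mul s₂
    exact (h1.add_const t₁).prodMk (h2.add_const t₂)
  have := (hf (aff s₁ t₁ s₂ t₂ x)).hasFDerivAt.comp x h
  simp only [dd]
  rw [show (fun x => f (aff s₁ t₁ s₂ t₂ x)) = f ∘ aff s₁ t₁ s₂ t₂ from rfl, this.fderiv]
  simp

theorem dd_smul (f : F2) (c : ℝ) (e x : P2) : dd (c • e) f x = c * dd e f x := by
  simp [dd]

theorem pd1_aff {f : F2} (hf : Differentiable ℝ f) (s₁ t₁ s₂ t₂ : ℝ) :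
    pd1 (fun x => f (aff s₁ t₁ s₂ t₂ x)) = fun x => s₁ * pd1 f (aff s₁ t₁ s₂ t₂ x) := by
  rw [pd1_eq, dd_aff hf]; funext x
  rw [pd1_eq, ← dd_smul]; simp
theorem pd2_aff {f : F2} (hf : Differentiable ℝ f) (s₁ t₁ s₂ t₂ : ℝ) :
    pd2 (fun x => f (aff s₁ t₁ s₂ t₂ x)) = fun x => s₂ * pd2 f (aff s₁ t₁ s₂ t₂ x) := by
  rw [pd2_eq, dd_aff hf]; funext x
  rw [pd2_eq, ← dd_smul]; simp

theorem dd_cs {f : F2} (e : P2) (hf : HasCompactSupport f) : HasCompactSupport (dd e f) :=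
  hf.fderiv_apply ℝ e

/-- test functions -/
def TF (f : F2) : Prop := ContDiff ℝ ∞ f ∧ HasCompactSupport f

theorem TF.dd {f : F2} (hf : TF f) (e : P2) : TF (dd e f) :=
  ⟨dd_cd e hf.1 bs, dd_cs e hf.2⟩
theorem TF.cont {f : F2} (hf : TF f) : Continuous f := hf.1.continuous
theorem TF.diff {f : F2} (hf : TF f) : Differentiable ℝ f := hf.1.differentiable bs
theorem TF.int {f : F2} (hf : TF f) : Integrable f :=
  hf.cont.integrable_of_hasCompactSupport hf.2

def QQ : Set P2 := Ioi 0 ×ˢ Ioi 0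

theorem QQ_meas : MeasurableSet QQ := measurableSet_Ioi.prod measurableSet_Ioi

theorem int_QQ_pd1 {W : F2} (hW : ContDiff ℝ 1 W) (hs : HasCompactSupport W)
    (h0 : ∀ y, 0 ≤ y → W (0, y) = 0) : ∫ x in QQ, pd1 W x = 0 := by
  have hi : Integrable (pd1 W) := (dd_cont _ hW).integrable_of_hasCompactSupport (dd_cs _ hs)
  rw [QQ, Measure.volume_eq_prod, ← setIntegral_prod_swap,
    setIntegral_prod _ (by
      rw [← Measure.volume_eq_prod]; exact (hi.swap).integrableOn)]
  rw [setIntegral_congr_fun (g := fun _ => 0) measurableSet_Ioi]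
  · simp
  intro y hy
  have hc : HasCompactSupport (fun t : ℝ => W (t, y)) :=
    hs.comp_isClosedEmbedding (g := fun t : ℝ => (t, y))
      ((isometry_iff_dist_eq.2 (by intro a b; simp [Prod.dist_eq])).isClosedEmbedding)
  have := hc.integral_Ioi_deriv_eq (hW.comp bf) 0
  simp only [Prod.swap]
  simp only [Function.comp_def, h0 y (le_of_lt hy)] at this
  refine Eq.trans (setIntegral_congr_fun measurableSet_Ioi fun x _ => ?_) (this.trans neg_zero)
  exact ((pd1_hda (hW.differentiable bn) x y).deriv).symm

theorem int_QQ_pd2 {W : F2} (hW : ContDiff ℝ 1 W) (hs : HasCompactSupport W)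
    (h0 : ∀ x, 0 ≤ x → W (x, 0) = 0) : ∫ x in QQ, pd2 W x = 0 := by
  have hi : Integrable (pd2 W) := (dd_cont _ hW).integrable_of_hasCompactSupport (dd_cs _ hs)
  rw [QQ, Measure.volume_eq_prod,
    setIntegral_prod _ (by
      rw [← Measure.volume_eq_prod]; exact hi.integrableOn)]
  rw [setIntegral_congr_fun (g := fun _ => 0) measurableSet_Ioi]
  · simp
  intro x hx
  have hc : HasCompactSupport (fun t : ℝ => W (x, t)) :=
    hs.comp_isClosedEmbedding (g := fun t : ℝ => (x, t))
      ((isometry_iff_dist_eq.2 (by intro a b; simp [Prod.dist_eq])).isClosedEmbedding)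
  have := hc.integral_Ioi_deriv_eq (hW.comp bf) 0
  simp only [Function.comp_def, h0 x (le_of_lt hx)] at this
  simp only
  refine Eq.trans (setIntegral_congr_fun measurableSet_Ioi fun y _ => ?_) (this.trans neg_zero)
  exact ((pd2_hda (hW.differentiable bn) x y).deriv).symm

theorem int_dd_zero {W : F2} (hW : ContDiff ℝ 1 W) (e : P2)
    (h1 : Integrable W) (h2 : Integrable (dd e W)) : ∫ x, dd e W x = 0 := by
  have := integral_bilinear_hasLineDerivAt_right_eq_neg_left_of_integrable (μ := (volume : Measure P2))
    (f := fun _ => (1 : ℝ)) (f' := fun _ => 0) (g := W) (g' := dd e W) (v := e)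
    (B := ContinuousLinearMap.mul ℝ ℝ) bs (by simpa using h2) (by simpa using h1)
    (fun x _ => by simpa using (hasFDerivAt_const (𝕜 := ℝ) (1:ℝ) x).hasLineDerivAt e)
    (fun x _ => ((hW.differentiable bn) x).hasFDerivAt.hasLineDerivAt e)
  simpa using this

theorem dual_cc {p : ℝ} (hp : 1 < p) {v w : F2} {O : Set P2} {M : ℝ} (hM : 0 ≤ M)
    (hv : Continuous v) (hw : Continuous w) (hwc : HasCompactSupport w) (hwO : tsupport w ⊆ O)
    (h : ∀ Θ : F2, TF Θ → tsupport Θ ⊆ O → |∫ x, v x * Θ x| ≤ M * (∫ x, |Θ x| ^ p) ^ (1 / p)) :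
    |∫ x, v x * w x| ≤ M * (∫ x, |w x| ^ p) ^ (1 / p) := by
  have hp0 : 0 < p := bL
  set K := tsupport w
  have hK : IsCompact K := hwc
  have key : ∀ ε : ℝ, 0 < ε → |∫ x in K, v x * w x| ≤
      M * (∫ x in K, (|w x| + ε) ^ p) ^ (1 / p) + ε * ∫ x in K, |v x| := by
    intro ε hε
    obtain ⟨g, hg, hgd, hgs⟩ := hw.exists_contDiff_approx (⊤ : ℕ∞) (ε := fun _ => ε)
      continuous_const (fun _ => hε)
    have hgK : tsupport g ⊆ K := closure_mono hgs
    have hgc : HasCompactSupport g := hK.of_isClosed_subset (isClosed_tsupport _) hgK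
    have h1 := h g ⟨hg, hgc⟩ (hgK.trans hwO)
    have hg0 : ∀ x, x ∉ K → g x = 0 := fun x hx => image_eq_zero_of_notMem_tsupport (fun hh => hx (hgK hh))
    rw [← setIntegral_eq_integral_of_forall_compl_eq_zero (s := K) (fun x hx => by rw [hg0 x hx, mul_zero]),
      ← setIntegral_eq_integral_of_forall_compl_eq_zero (s := K) (f := fun x => |g x| ^ p)
        (fun x hx => by rw [hg0 x hx, abs_zero, Real.zero_rpow hp0.ne'])] at h1
    have hb : ∀ x, |g x - w x| ≤ ε := fun x => (hgd x).le
    have ig : IntegrableOn (fun x => v x * g x) K := (hv.mul hg.continuous).continuousOn.integrableOn_compact hK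
    have iw : IntegrableOn (fun x => v x * w x) K := (hv.mul hw).continuousOn.integrableOn_compact hK
    have h2 : |∫ x in K, v x * w x - v x * g x| ≤ ε * ∫ x in K, |v x| := by
      rw [← integral_const_mul]
      refine abs_integral_le_integral_abs.trans (integral_mono_of_nonneg
        (Ef fun x => abs_nonneg _)
        ((continuous_const.mul hv.abs).continuousOn.integrableOn_compact hK)
        (Ef fun x => ?_))
      show |v x * w x - v x * g x| ≤ ε * |v x|
      rw [← mul_sub, abs_mul, abs_sub_comm, mul_comm]
      exact mlR (hb x) (abs_nonneg _)
    rw [integral_sub iw ig] at h2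
    have h3 : (∫ x in K, |g x| ^ p) ≤ ∫ x in K, (|w x| + ε) ^ p := by
      refine integral_mono ((hg.continuous.abs.rpow_const (fun _ => Or.inr hp0.le)).continuousOn.integrableOn_compact hK)
        (((hw.abs.add continuous_const).rpow_const (fun _ => Or.inr hp0.le)).continuousOn.integrableOn_compact hK)
        (fun x => Real.rpow_le_rpow (abs_nonneg _) ?_ hp0.le)
      have := abs_sub_abs_le_abs_sub (g x) (w x)
      linarith [hb x]
    have h4 : (∫ x in K, |g x| ^ p) ^ (1 / p) ≤ (∫ x in K, (|w x| + ε) ^ p) ^ (1 / p) :=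
      Real.rpow_le_rpow (integral_nonneg fp) h3 bp
    have h5 := mlL h4 hM
    have := abs_sub_abs_le_abs_sub (∫ x in K, v x * w x) (∫ x in K, v x * g x)
    linarith
  have hw0 : ∀ x, x ∉ K → w x = 0 := fun x hx => image_eq_zero_of_notMem_tsupport hx
  rw [← setIntegral_eq_integral_of_forall_compl_eq_zero (s := K) (fun x hx => by rw [hw0 x hx, mul_zero]),
      ← setIntegral_eq_integral_of_forall_compl_eq_zero (s := K) (f := fun x => |w x| ^ p)
        (fun x hx => by rw [hw0 x hx, abs_zero, Real.zero_rpow hp0.ne'])]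
  have hc : Continuous fun ε : ℝ => M * (∫ x in K, (|w x| + ε) ^ p) ^ (1 / p) + ε * ∫ x in K, |v x| := by
    have : Continuous fun ε : ℝ => ∫ x in K, (|w x| + ε) ^ p := by
      apply continuous_parametric_integral_of_continuous _ hK
      exact ((hw.abs.comp continuous_snd).add continuous_fst).rpow_const (fun _ => Or.inr hp0.le)
    exact (continuous_const.mul (this.rpow_const (fun _ => Or.inr bp))).add
      (continuous_id.mul continuous_const)
  have ht := (hc.tendsto 0).mono_left (nhdsWithin_le_nhds (s := Ioi 0))
  have := ge_of_tendsto ht (eventually_mem_nhdsWithin.mono fun ε hε => key ε hε)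
  simpa using this

theorem dual_bound {p q : ℝ} (hpq : p.HolderConjugate q) {v : F2} {O : Set P2} {M : ℝ}
    (hM : 0 ≤ M) (hv : Continuous v) (hO : IsOpen O)
    (KK : ℕ → Set P2) (hKm : Monotone KK) (hKc : ∀ n, IsCompact (KK n)) (hKU : ⋃ n, KK n = O)
    (h : ∀ Θ : F2, TF Θ → tsupport Θ ⊆ O → |∫ x, v x * Θ x| ≤ M * (∫ x, |Θ x| ^ p) ^ (1 / p)) :
    IntegrableOn (fun x => |v x| ^ q) O ∧ ∫ x in O, |v x| ^ q ≤ M ^ q := by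
  have hp0 := hpq.pos
  have hq0 := hpq.symm.pos
  have hq1 := hpq.symm.lt
  have hvq : Continuous fun x => |v x| ^ q := hv.abs.rpow_const (fun _ => Or.inr hq0.le)
  have hK : ∀ K : Set P2, IsCompact K → K ⊆ O → ∫ x in K, |v x| ^ q ≤ M ^ q := by
    intro K hK hKO
    obtain ⟨χ, hχ1, (hχc : HasCompactSupport χ), hχO, hχ⟩ :=
      exists_continuousMap_one_of_isCompact_subset_isOpen hK hO hKO
    set s : ℝ → ℝ := fun t => max t 0 ^ (q - 1) - max (-t) 0 ^ (q - 1)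
    have hs : Continuous s := ((continuous_id.max continuous_const).rpow_const
      (fun _ => Or.inr bL)).sub ((continuous_neg.max continuous_const).rpow_const
      (fun _ => Or.inr bL))
    have hq' : q - 1 ≠ 0 := bL
    have hsa : ∀ t, |s t| = |t| ^ (q - 1) := by
      intro t
      rcases le_total 0 t with ht | ht
      · simp [s, ht, Real.zero_rpow hq', abs_of_nonneg, Real.rpow_nonneg]
      · simp [s, ht, Real.zero_rpow hq', abs_of_nonpos, abs_of_nonneg (Real.rpow_nonneg (neg_nonneg.2 ht) (q-1))]
    have hst : ∀ t, t * s t = |t| ^ q := by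
      intro t
      have e : ∀ t : ℝ, 0 ≤ t → t * t ^ (q - 1) = t ^ q := fun t ht => by
        rcases ht.eq_or_lt with rfl | ht
        · simp [Real.zero_rpow hq0.ne']
        · rw [Real.rpow_sub_one ht.ne']; field_simp
      rcases le_total 0 t with ht | ht
      · simp [s, ht, Real.zero_rpow hq', abs_of_nonneg, e t ht]
      · simp [s, ht, Real.zero_rpow hq', abs_of_nonpos]
        rw [← e (-t) bL]; ring
    set w : F2 := fun x => χ x * s (v x)
    have hw : Continuous w := χ.continuous.mul (hs.comp hv)
    have hwc : HasCompactSupport w := hχc.mul_right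
    have h1 := dual_cc hpq.lt hM hv hw hwc ((tsupport_mul_subset_left).trans hχO) h
    have e1 : ∀ x, v x * w x = χ x * |v x| ^ q := fun x => by
      rw [← hst]; simp only [w]; ring
    simp only [e1] at h1
    set X := ∫ x, χ x * |v x| ^ q
    have hint : Integrable fun x => χ x * |v x| ^ q :=
      (χ.continuous.mul hvq).integrable_of_hasCompactSupport hχc.mul_right
    have hX : 0 ≤ X := integral_nonneg fun x => mul_nonneg (hχ x).1 bp
    have h2 : ∫ x, |w x| ^ p ≤ X := by
      refine integral_mono ((hw.abs.rpow_const (fun _ => Or.inr hp0.le)).integrable_of_hasCompactSupport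
        (hwc.comp_left (g := fun t => |t| ^ p) (by simp [Real.zero_rpow hp0.ne']))) hint fun x => ?_
      simp only [w]
      rw [abs_mul, hsa, Real.mul_rpow (abs_nonneg _) bp, ← Real.rpow_mul (abs_nonneg _),
        hpq.symm.sub_one_mul_conj, abs_of_nonneg (hχ x).1]
      refine mlR ?_ bp
      have := Real.rpow_le_rpow_of_exponent_ge' (hχ x).1 (hχ x).2 zero_le_one hpq.lt.le
      simpa using this
    rw [abs_of_nonneg hX] at h1
    have h3 : X ≤ M * X ^ (1 / p) := h1.trans (mlL
      (Real.rpow_le_rpow (integral_nonneg fp) h2 bp) hM)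
    have h4 : X ≤ M ^ q := by
      rcases hX.eq_or_lt with h0 | h0
      · rw [← h0]; positivity
      have e2 : X ^ (1 / q) ≤ M := by
        have e3 : X = X ^ (1 / q) * X ^ (1 / p) := by
          rw [← Real.rpow_add h0, add_comm, one_div, one_div, hpq.inv_add_inv_eq_one, Real.rpow_one]
        have e4 : 0 < X ^ (1 / p) := bp
        nth_rw 1 [e3] at h3
        exact le_of_mul_le_mul_right h3 e4
      calc X = (X ^ (1 / q)) ^ q := by rw [← Real.rpow_mul hX]; field_simp; simp
        _ ≤ M ^ q := Real.rpow_le_rpow bp e2 hq0.le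
    refine le_trans ?_ h4
    rw [setIntegral_congr_fun (g := fun x => χ x * |v x| ^ q) hK.measurableSet
      (fun x hx => by simp [hχ1 hx])]
    exact setIntegral_le_integral hint (Ef fun x => mul_nonneg (hχ x).1 bp)
  have hl : ∫⁻ x in O, ENNReal.ofReal (|v x| ^ q) ≤ ENNReal.ofReal (M ^ q) := by
    rw [← hKU, setLIntegral_iUnion_of_directed _ (directed_of_isDirected_le hKm)]
    refine iSup_le fun n => ?_
    rw [← ofReal_integral_eq_lintegral_ofReal (hvq.continuousOn.integrableOn_compact (hKc n))
      (Ef fp)]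
    exact ENNReal.ofReal_le_ofReal (hK _ (hKc n) (hKU ▸ subset_iUnion KK n))
  have hi : IntegrableOn (fun x => |v x| ^ q) O := by
    refine ⟨hvq.aestronglyMeasurable, ?_⟩
    rw [hasFiniteIntegral_iff_ofReal (Ef fp)]
    exact hl.trans_lt ENNReal.ofReal_lt_top
  refine ⟨hi, ?_⟩
  rw [integral_eq_lintegral_of_nonneg_ae (Ef fp) hi.1]
  exact ENNReal.toReal_le_of_le_ofReal bp hl

section cvs
variable {α : Type*} [MeasurableSpace α] (ν : Measure α) [IsFiniteMeasure ν] (s : α → P2)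

def cv {F : Type} [NormedAddCommGroup F] [NormedSpace ℝ F] (f : P2 → F) (x : P2) : F := ∫ a, f (x + s a) ∂ν

theorem cs_bdd {X F : Type*} [TopologicalSpace X] [NormedAddCommGroup F] {f : X → F} (hf : Continuous f) (hs : HasCompactSupport f) :
    ∃ C, 0 < C ∧ ∀ x, ‖f x‖ ≤ C := by
  obtain ⟨C, hC⟩ := hf.bounded_above_of_compact_support hs
  exact ⟨max C 1, by positivity, fun x => (hC x).trans (le_max_left _ _)⟩

variable {ν s} {F : Type} [NormedAddCommGroup F] [NormedSpace ℝ F]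

theorem cv_int (hs : Measurable s) {f : P2 → F} (hf : Continuous f) (hfc : HasCompactSupport f) (x : P2) :
    Integrable (fun a => f (x + s a)) ν := by
  obtain ⟨C, -, hC⟩ := cs_bdd hf hfc
  refine Integrable.of_bound (hf.comp_aestronglyMeasurable (hs.const_add x).aestronglyMeasurable) C
    (Ef fun a => hC _)

theorem cv_fd (hs : Measurable s) {f : P2 → F} (hf : ContDiff ℝ 1 f) (hfc : HasCompactSupport f) (x : P2) :
    HasFDerivAt (cv ν s f) (cv ν s (fderiv ℝ f) x) x := by
  have hf' : Continuous (fderiv ℝ f) := hf.continuous_fderiv bn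
  obtain ⟨C, -, hC⟩ := cs_bdd hf' (hfc.fderiv ℝ)
  refine hasFDerivAt_integral_of_dominated_of_fderiv_le (F' := fun y a => fderiv ℝ f (y + s a)) (s := univ) (bound := fun _ => C) univ_mem
    (Ef fun y => (cv_int hs hf.continuous hfc y).1) (cv_int hs hf.continuous hfc x)
    (cv_int hs hf' (hfc.fderiv ℝ) x).1 (Ef fun a y _ => hC _) (integrable_const _)
    (Ef fun a y _ => ?_)
  have h1 : HasFDerivAt (fun y => y + s a) (ContinuousLinearMap.id ℝ P2) y := (hasFDerivAt_id y).add_const _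
  have := ((hf.differentiable bn) (y + s a)).hasFDerivAt.comp y h1
  rwa [ContinuousLinearMap.comp_id] at this

theorem cv_cdn (hs : Measurable s) (n : ℕ) : ∀ {F : Type} [NormedAddCommGroup F] [NormedSpace ℝ F]
    {f : P2 → F}, ContDiff ℝ n f → HasCompactSupport f → ContDiff ℝ n (cv ν s f) := by
  induction n with
  | zero =>
    intro F _ _ f hf hfc
    have hf' : Continuous f := hf.continuous
    obtain ⟨C, -, hC⟩ := cs_bdd hf' hfc
    refine contDiff_zero.2 (continuous_of_dominated (bound := fun _ => C) (fun x => (cv_int hs hf' hfc x).1)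
      (fun x => Ef fun a => hC _) (integrable_const _)
      (Ef fun a => bf))
  | succ n ih =>
    intro F _ _ f hf hfc
    have h1 : ContDiff ℝ 1 f := hf.of_le bs
    push_cast
    rw [contDiff_succ_iff_fderiv]
    refine ⟨fun x => (cv_fd hs h1 hfc x).differentiableAt, by simp, ?_⟩
    rw [show fderiv ℝ (cv ν s f) = cv ν s (fderiv ℝ f) from funext fun x => (cv_fd hs h1 hfc x).fderiv]
    exact ih (hf.fderiv_right bs) (hfc.fderiv ℝ)

theorem cv_cd (hs : Measurable s) {f : F2} (hf : TF f) : ContDiff ℝ ∞ (cv ν s f) :=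
  contDiff_infty.2 fun n => cv_cdn hs n (hf.1.of_le (by exact_mod_cast le_top)) hf.2

theorem dd_cv (hs : Measurable s) {f : F2} (hf : TF f) (e : P2) :
    dd e (cv ν s f) = cv ν s (dd e f) := by
  funext x
  have h1 : ContDiff ℝ 1 f := hf.1.of_le bs
  rw [dd, (cv_fd hs h1 hf.2 x).fderiv, cv,
    ContinuousLinearMap.integral_apply (cv_int hs (h1.continuous_fderiv bn) (hf.2.fderiv ℝ) x)]
  rfl

theorem cv_dr (hs : Measurable s) (hsi : Integrable s ν) {f : F2} (hf : TF f) (x : P2) (r : ℝ) :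
    HasDerivAt (fun r : ℝ => cv ν (fun a => r • s a) f x)
      (∫ a, ((s a).1 * pd1 f (x + r • s a) + (s a).2 * pd2 f (x + r • s a)) ∂ν) r := by
  have h1 : ContDiff ℝ 1 f := hf.1.of_le bs
  have hc : Continuous (fderiv ℝ f) := h1.continuous_fderiv bn
  obtain ⟨C, -, hC⟩ := cs_bdd hc (hf.2.fderiv ℝ)
  have e : ∀ z v : P2, v.1 * pd1 f z + v.2 * pd2 f z = fderiv ℝ f z v := fun z v => by
    have : v = v.1 • (Ex : P2) + v.2 • (Ey : P2) := by ext <;> simp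
    conv_rhs => rw [this]
    rw [map_add, map_smul, map_smul]; rfl
  have hm : ∀ r : ℝ, AEStronglyMeasurable (fun a => fderiv ℝ f (x + r • s a) (s a)) ν := fun r =>
    (by fun_prop : Continuous fun z : P2 × P2 => fderiv ℝ f z.1 z.2).comp_aestronglyMeasurable
      (((hs.const_smul r).const_add x).prodMk hs).aestronglyMeasurable
  simp only [e]
  refine (hasDerivAt_integral_of_dominated_loc_of_deriv_le (F' := fun r a => fderiv ℝ f (x + r • s a) (s a)) (s := univ) (bound := fun a => C * ‖s a‖) univ_mem
    (Ef fun r => (cv_int (hs.const_smul r) hf.cont hf.2 x).1)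
    (cv_int (hs.const_smul r) hf.cont hf.2 x) (hm r) ?_ (hsi.norm.const_mul C) ?_).2
  · exact Ef fun a r _ => (ContinuousLinearMap.le_opNorm _ _).trans
      (mlR (hC _) (norm_nonneg _))
  · refine Ef fun a r _ => ?_
    exact dd_hda hf.diff (s a) x r

end cvs

def gd (v : P2) : ℝ := Real.exp (-(v.1 ^ 2 + v.2 ^ 2))
theorem gd_pos (v : P2) : 0 < gd v := Real.exp_pos _
theorem gd_cd : ContDiff ℝ ∞ gd := by unfold gd; fun_prop
theorem gd_cont : Continuous gd := gd_cd.continuous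

theorem gd_int_pow (k l : ℕ) : Integrable fun v : P2 => gd v * (|v.1| ^ k * |v.2| ^ l) := by
  have h : ∀ k : ℕ, Integrable fun t : ℝ => Real.exp (-t ^ 2) * |t| ^ k := by
    intro k
    have := (integrable_rpow_mul_exp_neg_mul_sq (b := 1) one_pos (s := k) (by have : R0 ≤ k := bp
                                                                              linarith)).norm
    refine this.congr (Ef fun t => ?_)
    simp [abs_mul, mul_comm]
  refine ((h k).mul_prod (h l)).congr (Ef fun v => ?_)
  simp only [gd]; rw [neg_add, Real.exp_add]; ring

theorem gd_int : Integrable gd := by simpa using gd_int_pow 0 0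

/-- gaussian measure -/
def gm : Measure P2 := volume.withDensity fun v => ENNReal.ofReal (gd v)

instance : IsFiniteMeasure gm := isFiniteMeasure_withDensity_ofReal gd_int.2

theorem gm_integral (f : F2) : ∫ v, f v ∂gm = ∫ v, gd v * f v := by
  rw [gm, integral_withDensity_eq_integral_toReal_smul (by have := gd_cont; fun_prop) bs]
  simp [ENNReal.toReal_ofReal (gd_pos _).le]

theorem gm_integrable {f : F2} : Integrable f gm ↔ Integrable fun v => gd v * f v := by
  rw [gm, integrable_withDensity_iff_integrable_smul' (by have := gd_cont; fun_prop) bs]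
  simp [ENNReal.toReal_ofReal (gd_pos _).le]

theorem gm_int_pow (k l : ℕ) : Integrable (fun v : P2 => |v.1| ^ k * |v.2| ^ l) gm :=
  gm_integrable.2 (gd_int_pow k l)

theorem gm_int1 : Integrable (fun v : P2 => v.1) gm :=
  (gm_int_pow 1 0).mono bf bs
theorem gm_int2 : Integrable (fun v : P2 => v.2) gm :=
  (gm_int_pow 0 1).mono bf bs
theorem gm_int_id : Integrable (fun v : P2 => v) gm := gm_int1.prodMk gm_int2

theorem gm_ibp (e x : P2) (r : ℝ) {P h : F2} (hP : ContDiff ℝ 1 P) (hh : ContDiff ℝ 1 h)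
    (hc : HasCompactSupport h) (i1 : Integrable P gm) (i2 : Integrable (fun v => (v.1 * e.1 + v.2 * e.2) * P v) gm)
    (i3 : Integrable (dd e P) gm) :
    r * ∫ v, P v * dd e h (x + r • v) ∂gm =
      ∫ v, (2 * (v.1 * e.1 + v.2 * e.2) * P v - dd e P v) * h (x + r • v) ∂gm := by
  obtain ⟨C, -, hC⟩ := cs_bdd hh.continuous hc
  obtain ⟨C', -, hC'⟩ := cs_bdd (dd_cont e hh) (dd_cs e hc)
  have hg : ContDiff ℝ 1 gd := gd_cd.of_le bs
  have hha : ContDiff ℝ 1 fun v => h (x + r • v) := hh.comp bf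
  have hgd : dd e gd = fun v => -(2 * (v.1 * e.1 + v.2 * e.2)) * gd v := by
    funext v
    have h1 := (hasFDerivAt_fst (𝕜 := ℝ) (p := v)).pow 2
    have h2 := (hasFDerivAt_snd (𝕜 := ℝ) (p := v)).pow 2
    have := ((h1.add h2).neg.exp).fderiv
    show fderiv ℝ (fun v : P2 => Real.exp (-(v.1 ^ 2 + v.2 ^ 2))) v e = _
    erw [this]; simp [gd]; ring
  have hdh : dd e (fun v => h (x + r • v)) = fun v => r * dd e h (x + r • v) := by
    funext v
    have h1 : HasFDerivAt (fun v : P2 => x + r • v) (r • ContinuousLinearMap.id ℝ P2) v :=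
      ((hasFDerivAt_id v).const_smul r).const_add x
    have := (((hh.differentiable bn) (x + r • v)).hasFDerivAt.comp v h1).fderiv
    simp only [dd]
    erw [this]; simp
  have cont1 : Continuous fun v : P2 => h (x + r • v) := hha.continuous
  have cont2 : Continuous fun v : P2 => dd e h (x + r • v) := (dd_cont e hh).comp bf
  have j1 : Integrable (fun v => P v * h (x + r • v)) gm :=
    i1.mul_bdd (c := C) cont1.aestronglyMeasurable (Ef fun v => hC _)
  have j2 : Integrable (fun v => P v * dd e h (x + r • v)) gm :=
    i1.mul_bdd (c := C') cont2.aestronglyMeasurable (Ef fun v => hC' _)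
  have j3 : Integrable (fun v => (2 * (v.1 * e.1 + v.2 * e.2) * P v - dd e P v) * h (x + r • v)) gm := by
    refine Integrable.mul_bdd (c := C) ?_ cont1.aestronglyMeasurable (Ef fun v => hC _)
    exact ((i2.const_mul 2).sub i3).congr (Ef fun v => by simp; ring)
  have hW : dd e (fun v => gd v * (P v * h (x + r • v))) = fun v =>
      gd v * (r * (P v * dd e h (x + r • v)) -
        (2 * (v.1 * e.1 + v.2 * e.2) * P v - dd e P v) * h (x + r • v)) := by
    rw [dd_mul (hg.differentiable bn) ((hP.mul hha).differentiable bn),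
      dd_mul (hP.differentiable bn) (hha.differentiable bn), hgd, hdh]
    funext v; ring
  have h0 := int_dd_zero (hg.mul (hP.mul hha)) e (gm_integrable.1 j1)
    (by rw [hW]; exact gm_integrable.1 ((j2.const_mul r).sub j3))
  rw [hW, ← gm_integral, integral_sub (j2.const_mul r) j3, integral_const_mul] at h0
  linarith

section cvs
variable {α : Type*} [MeasurableSpace α] {ν : Measure α} [IsFiniteMeasure ν] {s : α → P2}

theorem cv_prod_int (hs : Measurable s) {g f : F2} (hg : Continuous g) {C : ℝ} (hC : ∀ x, |g x| ≤ C)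
    (hf : Continuous f) (hi : Integrable f) :
    Integrable (fun z : P2 × α => g z.1 * f (z.1 + s z.2)) (volume.prod ν) := by
  have hm : AEStronglyMeasurable (fun z : P2 × α => f (z.1 + s z.2)) (volume.prod ν) :=
    hf.comp_aestronglyMeasurable (measurable_fst.add (hs.comp measurable_snd)).aestronglyMeasurable
  have h1 : Integrable (fun z : P2 × α => f (z.1 + s z.2)) (volume.prod ν) := by
    rw [integrable_prod_iff' hm]
    refine ⟨Ef fun a => hi.comp_add_right (s a), ?_⟩
    have : (fun a => ∫ x : P2, ‖f (x + s a)‖) = fun _ => ∫ x, ‖f x‖ := by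
      funext a; exact integral_add_right_eq_self (fun x => ‖f x‖) (s a)
    simp only [this]; exact integrable_const _
  exact h1.bdd_mul (c := C) (hg.comp_aestronglyMeasurable measurable_fst.aestronglyMeasurable)
    (Ef fun z => hC _)

theorem cv_fubini (hs : Measurable s) {g f : F2} (hg : Continuous g) {C : ℝ} (hC : ∀ x, |g x| ≤ C)
    (hf : Continuous f) (hi : Integrable f) :
    ∫ x, g x * cv ν s f x = ∫ a, ∫ x, g x * f (x + s a) ∂volume ∂ν := by
  rw [integral_integral_swap (f := fun a x => g x * f (x + s a))]
  · simp only [cv, integral_const_mul]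
  · exact (cv_prod_int hs hg hC hf hi).swap

theorem cv_L1 (hs : Measurable s) {f : F2} (hf : Continuous f) (hi : Integrable f) :
    Integrable (cv ν s f) ∧ ∫ x, |cv ν s f x| ≤ ν.real univ * ∫ x, |f x| := by
  have h1 := cv_prod_int (ν := ν) hs (g := fun _ => 1) continuous_const (C := 1) bs hf hi
  simp only [one_mul] at h1
  have h2 : Integrable (cv ν s f) := h1.integral_prod_left
  have h3 := cv_prod_int (ν := ν) hs (g := fun _ => 1) continuous_const (C := 1) bs hf.abs hi.abs
  simp only [one_mul] at h3
  refine ⟨h2, ?_⟩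
  calc ∫ x, |cv ν s f x| ≤ ∫ x, ∫ a, |f (x + s a)| ∂ν := by
        refine integral_mono h2.abs h3.integral_prod_left fun x => ?_
        exact abs_integral_le_integral_abs
    _ = ∫ a, ∫ x, |f (x + s a)| ∂volume ∂ν := (integral_integral_swap (f := fun a x => |f (x + s a)|) h3.swap).symm
    _ = ∫ a, (∫ x, |f x|) ∂ν := by
        congr 1; funext a; exact integral_add_right_eq_self (fun x => |f x|) (s a)
    _ = _ := bs

theorem cv_bdd {f : F2} {C : ℝ} (hC : ∀ x, |f x| ≤ C) (x : P2) :
    |cv ν s f x| ≤ C * ν.real univ :=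
  norm_integral_le_of_norm_le_const (μ := ν) (f := fun a => f (x + s a)) (Ef fun a => hC _)

theorem cv_refl {f : F2} {φ : α → α} (hφ : MeasurePreserving φ ν ν) (hs : Measurable s)
    (hf : Continuous f) (T : P2 →+ P2)
    (h : ∀ a, s (φ a) = T (s a)) (x : P2) : cv ν s (fun y => f (T y)) x = cv ν s f (T x) := by
  have := integral_map (μ := ν) hφ.measurable.aemeasurable (f := fun a => f (T x + s a))
    (hf.comp_aestronglyMeasurable (by rw [hφ.map_eq]; exact (hs.const_add _).aestronglyMeasurable))
  rw [hφ.map_eq] at this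
  simp only [cv, map_add]; rw [this]; simp only [h]

end cvs

/-- reflections -/
def rfl2 (s t : ℝ) : P2 →+ P2 where
  toFun x := (s * x.1, t * x.2)
  map_zero' := bs
  map_add' x y := by ext <;> simp [mul_add]

@[simp] theorem rfl2_apply (s t : ℝ) (x : P2) : rfl2 s t x = (s * x.1, t * x.2) := rfl

theorem rfl2_vol {s t : ℝ} (hs : s ^ 2 = 1) (ht : t ^ 2 = 1) : MeasurePreserving (rfl2 s t) (volume : Measure P2) volume := by
  have h : ∀ s : ℝ, s ^ 2 = 1 → MeasurePreserving (fun x : ℝ => s * x) volume volume := by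
    intro s hs
    rcases sq_eq_one_iff.1 hs with rfl | rfl
    · simpa using! MeasurePreserving.id (volume : Measure ℝ)
    · simpa using! Measure.measurePreserving_neg (volume : Measure ℝ)
  exact (h s hs).prod (h t ht)

theorem rfl2_gm {s t : ℝ} (hs : s ^ 2 = 1) (ht : t ^ 2 = 1) : MeasurePreserving (rfl2 s t) gm gm := by
  have h0 := rfl2_vol hs ht
  refine ⟨h0.measurable, ?_⟩
  ext A hA
  rw [Measure.map_apply h0.measurable hA, gm, withDensity_apply _ hA, withDensity_apply _ (h0.measurable hA),
    ← h0.setLIntegral_comp_preimage hA (by have := gd_cont; fun_prop)]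
  have : ∀ v : P2, gd (rfl2 s t v) = gd v := fun v => by
    simp only [gd, rfl2_apply, mul_pow, hs, ht, one_mul]
  simp only [this]

def Sr (r : ℝ) (f : F2) : F2 := cv gm (fun v => r • v) f
def Kr (r : ℝ) (f : F2) : F2 := cv (gm.prod gm) (fun z => r • (z.1 + z.2)) f
def rm (T : ℝ) : Measure ℝ := (volume.restrict (Ioc 0 T)).withDensity fun r => ENNReal.ofReal r
instance (T : ℝ) : IsFiniteMeasure (rm T) := isFiniteMeasure_withDensity_ofReal
  ((continuous_id.integrableOn_Icc (a := 0) (b := T)).mono_set Ioc_subset_Icc_self).2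
def nm (T : ℝ) : Measure (ℝ × P2 × P2) := (rm T).prod (gm.prod gm)
instance (T : ℝ) : IsFiniteMeasure (nm T) := by unfold nm; infer_instance
def NT (T : ℝ) (f : F2) : F2 := cv (nm T) (fun z => z.1 • (z.2.1 + z.2.2)) f

theorem rm_integral (T : ℝ) (f : ℝ → ℝ) : ∫ r, f r ∂(rm T) = ∫ r in Ioc 0 T, r * f r := by
  rw [rm, integral_withDensity_eq_integral_toReal_smul bf bs]
  refine setIntegral_congr_fun measurableSet_Ioc fun r hr => ?_
  simp [ENNReal.toReal_ofReal hr.1.le]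

theorem Sm (r : ℝ) : Measurable fun v : P2 => r • v := bf
theorem Km (r : ℝ) : Measurable fun z : P2 × P2 => r • (z.1 + z.2) := bf
theorem Nm : Measurable fun z : ℝ × P2 × P2 => z.1 • (z.2.1 + z.2.2) := bf

theorem cv_joint {α : Type*} [MeasurableSpace α] {ν : Measure α} [IsFiniteMeasure ν] {s : α → P2} (hs : Measurable s)
    {f : F2} (hf : TF f) : Continuous fun z : ℝ × P2 => cv ν (fun a => z.1 • s a) f z.2 := by
  obtain ⟨C, -, hC⟩ := cs_bdd hf.cont hf.2
  refine continuous_of_dominated (bound := fun _ => C) (fun z => (cv_int (hs.const_smul z.1) hf.cont hf.2 z.2).1)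
    (fun z => Ef fun a => hC _) (integrable_const _)
    (Ef fun a => ?_)
  have := hf.cont
  fun_prop

theorem Sr_joint {f : F2} (hf : TF f) : Continuous fun z : ℝ × P2 => Sr z.1 f z.2 :=
  cv_joint measurable_id hf
theorem Kr_joint {f : F2} (hf : TF f) : Continuous fun z : ℝ × P2 => Kr z.1 f z.2 :=
  cv_joint (s := fun z : P2 × P2 => z.1 + z.2) bf hf

theorem NT_eq (T : ℝ) {f : F2} (hf : TF f) (x : P2) : NT T f x = ∫ r in Ioc 0 T, r * Kr r f x := by
  rw [NT, cv, nm, integral_prod, rm_integral]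
  · rfl
  · exact cv_int Nm hf.cont hf.2 x

def lap (f : F2) (x : P2) : ℝ := dd Ex (dd Ex f) x + dd Ey (dd Ey f) x

theorem TF.lap {f : F2} (hf : TF f) : TF (lap f) :=
  ⟨((hf.dd _).dd _).1.add ((hf.dd _).dd _).1, ((hf.dd _).dd _).2.add ((hf.dd _).dd _).2⟩

theorem gm_ibp1 (e x : P2) (r : ℝ) {f : F2} (hf : TF f) :
    ∫ v, (v.1 * e.1 + v.2 * e.2) * f (x + r • v) ∂gm = r / 2 * Sr r (dd e f) x := by
  have := gm_ibp e x r (P := fun _ => 1) contDiff_const (hf.1.of_le bs) hf.2 (integrable_const _)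
    (by simp only [mul_one]; exact (gm_int1.mul_const e.1).add (gm_int2.mul_const e.2))
    (by have : dd e (fun _ : P2 => (1:ℝ)) = fun _ => 0 := by funext x; simp [dd]
        rw [this]; exact integrable_const _)
  have h0 : ∀ v, dd e (fun _ : P2 => (1:ℝ)) v = 0 := fun v => by simp [dd]
  simp only [h0, one_mul, mul_one, sub_zero, mul_assoc (2:ℝ), integral_const_mul] at this
  rw [Sr, cv]; linarith

theorem gm_rad (x : P2) (r : ℝ) {f : F2} (hf : TF f) :
    ∫ v, (v.1 * pd1 f (x + r • v) + v.2 * pd2 f (x + r • v)) ∂gm = r / 2 * Sr r (lap f) x := by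
  have hb : ∀ (e : P2), ∃ C, ∀ x, |dd e f x| ≤ C := fun e => by
    obtain ⟨C, -, hC⟩ := cs_bdd (hf.dd e).cont (hf.dd e).2; exact ⟨C, hC⟩
  obtain ⟨C1, h1⟩ := hb Ex
  obtain ⟨C2, h2⟩ := hb Ey
  have hc := fun e : P2 => (hf.dd e).cont
  have i1 := gm_ibp1 Ex x r (hf.dd Ex)
  have i2 := gm_ibp1 Ey x r (hf.dd Ey)
  simp only [mul_one, mul_zero, add_zero, zero_add] at i1 i2
  have j1 : Integrable (fun v : P2 => v.1 * pd1 f (x + r • v)) gm :=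
    gm_int1.mul_bdd (c := C1) ((hc Ex).comp bf).aestronglyMeasurable (Ef fun _ => h1 _)
  have j2 : Integrable (fun v : P2 => v.2 * pd2 f (x + r • v)) gm :=
    gm_int2.mul_bdd (c := C2) ((hc Ey).comp bf).aestronglyMeasurable (Ef fun _ => h2 _)
  rw [integral_add j1 j2]
  erw [i1, i2]
  rw [← mul_add, Sr, Sr, Sr, cv, cv, ← integral_add]
  · rfl
  · exact cv_int (Sm r) ((hf.dd _).dd _).cont ((hf.dd _).dd _).2 x
  · exact cv_int (Sm r) ((hf.dd _).dd _).cont ((hf.dd _).dd _).2 x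

theorem Sr_dr {f : F2} (hf : TF f) (x : P2) (r : ℝ) :
    HasDerivAt (fun r => Sr r f x) (r / 2 * Sr r (lap f) x) r := by
  rw [← gm_rad x r hf]; exact cv_dr measurable_id gm_int_id hf x r

theorem Kr_eq {f : F2} (hf : TF f) (x : P2) (r : ℝ) : Kr r f x = Sr r (Sr r f) x := by
  rw [Kr, cv, integral_prod _ (cv_int (Km r) hf.cont hf.2 x)]
  simp only [Sr, cv, smul_add, add_assoc]

theorem Kr_dr {f : F2} (hf : TF f) (x : P2) (r : ℝ) :
    HasDerivAt (fun r => Kr r f x) (r * Kr r (lap f) x) r := by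
  have hi : Integrable (fun z : P2 × P2 => z.1 + z.2) (gm.prod gm) :=
    (gm_int_id.comp_fst gm).add (gm_int_id.comp_snd gm)
  have h := cv_dr (s := fun z : P2 × P2 => z.1 + z.2) bf hi hf x r
  refine h.congr_deriv ?_
  have hb : ∀ (e : P2), ∃ C, ∀ x, |dd e f x| ≤ C := fun e => by
    obtain ⟨C, -, hC⟩ := cs_bdd (hf.dd e).cont (hf.dd e).2; exact ⟨C, hC⟩
  obtain ⟨C1, h1⟩ := hb Ex
  obtain ⟨C2, h2⟩ := hb Ey
  have c1 : Continuous (pd1 f) := (hf.dd Ex).cont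
  have c2 : Continuous (pd2 f) := (hf.dd Ey).cont
  have J : ∀ {φ ψ : P2 × P2 → ℝ}, Integrable φ (gm.prod gm) → Integrable ψ (gm.prod gm) →
      Integrable (fun z => φ z * pd1 f (x + r • (z.1 + z.2)) + ψ z * pd2 f (x + r • (z.1 + z.2))) (gm.prod gm) :=
    fun hφ hψ => (hφ.mul_bdd (c := C1) (Continuous.aestronglyMeasurable (c1.comp bf)) (Ef fun _ => h1 _)).add
      (hψ.mul_bdd (c := C2) (Continuous.aestronglyMeasurable (c2.comp bf)) (Ef fun _ => h2 _))
  have ja := J (gm_int1.comp_fst gm) (gm_int2.comp_fst gm)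
  have jb := J (gm_int1.comp_snd gm) (gm_int2.comp_snd gm)
  have e1 : ∫ z, ((z.1 + z.2).1 * pd1 f (x + r • (z.1 + z.2)) + (z.1 + z.2).2 * pd2 f (x + r • (z.1 + z.2))) ∂(gm.prod gm)
    = (∫ z, (z.1.1 * pd1 f (x + r • (z.1 + z.2)) + z.1.2 * pd2 f (x + r • (z.1 + z.2))) ∂(gm.prod gm))
     + ∫ z, (z.2.1 * pd1 f (x + r • (z.1 + z.2)) + z.2.2 * pd2 f (x + r • (z.1 + z.2))) ∂(gm.prod gm) := by
    rw [← integral_add ja jb]; congr 1; funext z; simp; ring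
  have e3 : ∫ z, (z.2.1 * pd1 f (x + r • (z.1 + z.2)) + z.2.2 * pd2 f (x + r • (z.1 + z.2))) ∂(gm.prod gm)
      = r / 2 * Kr r (lap f) x := by
    rw [integral_prod _ jb, Kr_eq hf.lap, Sr, cv, ← integral_const_mul]
    congr 1; funext v
    rw [← gm_rad _ r hf]
    simp only [smul_add, add_assoc]
  have e2 : ∫ z, (z.1.1 * pd1 f (x + r • (z.1 + z.2)) + z.1.2 * pd2 f (x + r • (z.1 + z.2))) ∂(gm.prod gm)
      = r / 2 * Kr r (lap f) x := by
    rw [← e3, ← integral_prod_swap]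
    congr 1; funext z; simp [add_comm]
  rw [e1, e2, e3]; ring

def c0 : ℝ := (gm.prod gm).real univ
theorem c0_pos : 0 < c0 := by
  have : gm univ ≠ 0 := by
    rw [gm, withDensity_apply _ MeasurableSet.univ, Measure.restrict_univ]
    rw [← ofReal_integral_eq_lintegral_ofReal gd_int (Ef fun v => (gd_pos v).le)]
    have : 0 < ∫ v, gd v := by
      rw [integral_pos_iff_support_of_nonneg (fun v => (gd_pos v).le) gd_int]
      have : Function.support gd = univ := by ext v; simp [(gd_pos v).ne']
      rw [this]; simp
    simpa using this
  rw [c0, measureReal_def]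
  refine ENNReal.toReal_pos ?_ (measure_ne_top _ _)
  rw [← univ_prod_univ, Measure.prod_prod]; exact mul_ne_zero this this

theorem lap_NT {T : ℝ} (hT : 0 ≤ T) {f : F2} (hf : TF f) (x : P2) :
    lap (NT T f) x = Kr T f x - c0 * f x := by
  have h1 : lap (NT T f) x = NT T (lap f) x := by
    have h := fun e : P2 => dd_cv (ν := nm T) Nm hf e
    have h' := fun e : P2 => dd_cv (ν := nm T) Nm (hf.dd e) e
    simp only [lap, NT]
    rw [h, h, h', h', cv, cv, ← integral_add]
    · rfl
    · exact cv_int Nm ((hf.dd _).dd _).cont ((hf.dd _).dd _).2 x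
    · exact cv_int Nm ((hf.dd _).dd _).cont ((hf.dd _).dd _).2 x
  rw [h1, NT_eq T hf.lap, ← intervalIntegral.integral_of_le hT,
    intervalIntegral.integral_eq_sub_of_hasDerivAt (fun r _ => Kr_dr hf x r)]
  · congr 1; simp [Kr, cv, c0]
  · have := Kr_joint hf.lap
    exact Continuous.intervalIntegrable bf _ _

theorem Sr_adj {g f : F2} (hg : TF g) (hf : TF f) (r : ℝ) :
    ∫ x, Sr r g x * Sr r f x = ∫ x, g x * Kr r f x := by
  have cS : Continuous (Sr r f) := (cv_cd (Sm r) hf).continuous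
  obtain ⟨C, -, hC⟩ := cs_bdd hf.cont hf.2
  obtain ⟨C', -, hC'⟩ := cs_bdd hg.cont hg.2
  have hL := cv_L1 (ν := gm) (Sm r) hf.cont hf.int
  calc ∫ x, Sr r g x * Sr r f x = ∫ x, Sr r f x * cv gm (fun v => r • v) g x := by congr 1; funext x; exact mul_comm _ _
    _ = ∫ v, ∫ x, Sr r f x * g (x + r • v) ∂volume ∂gm :=
      cv_fubini (Sm r) cS (cv_bdd hC) hg.cont hg.int
    _ = ∫ v, ∫ x, g x * Sr r f (x + (-r) • v) ∂volume ∂gm := by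
      congr 1; funext v
      rw [← integral_add_right_eq_self (fun x => g x * Sr r f (x + (-r) • v)) (r • v)]
      congr 1; funext x; rw [mul_comm]; congr 2; simp
    _ = ∫ x, g x * cv gm (fun v => (-r) • v) (Sr r f) x := (cv_fubini (Sm (-r)) hg.cont hC' cS hL.1).symm
    _ = _ := by
      congr 1; funext x; congr 1
      rw [Kr_eq hf]
      have := (rfl2_gm (s := -1) (t := -1) bn bn)
      show ∫ v, Sr r f (x + (-r) • v) ∂gm = ∫ v, Sr r f (x + r • v) ∂gm
      conv_lhs => rw [← this.map_eq]
      rw [integral_map this.measurable.aemeasurable (Continuous.aestronglyMeasurable bf)]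
      congr 1; funext v; congr 2; ext <;> simp

theorem NT_refl (T : ℝ) {s t : ℝ} (hs : s ^ 2 = 1) (ht : t ^ 2 = 1) {f : F2} (hf : Continuous f) (x : P2) :
    NT T (fun y => f (rfl2 s t y)) x = NT T f (rfl2 s t x) := by
  refine cv_refl (φ := Prod.map id (Prod.map (rfl2 s t) (rfl2 s t)))
    ((MeasurePreserving.id (rm T)).prod ((rfl2_gm hs ht).prod (rfl2_gm hs ht))) Nm hf (rfl2 s t) (fun a => ?_) x
  simp; constructor <;> ring

theorem Kr_decay {f : F2} (hf : TF f) {T : ℝ} (hT : 0 < T) (x : P2) :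
    |Kr T f x| ≤ gm.real univ * (∫ y, |f y|) * (T ^ 2)⁻¹ := by
  rw [Kr_eq hf, Sr]
  have : ∀ y, |Sr T f y| ≤ (∫ z, |f z|) * (T ^ 2)⁻¹ := by
    intro y
    rw [Sr, cv, gm_integral]
    have hfi : Integrable fun v : P2 => |f (y + T • v)| := by
      refine Continuous.integrable_of_hasCompactSupport (by have := hf.cont; fun_prop) ?_
      have h := hf.2.comp_homeomorph ((Homeomorph.smulOfNeZero T hT.ne').trans (Homeomorph.addLeft y))
      exact h.abs
    calc |∫ v, gd v * f (y + T • v)| ≤ ∫ v, |gd v * f (y + T • v)| := abs_integral_le_integral_abs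
      _ ≤ ∫ v, |f (y + T • v)| := by
        refine integral_mono_of_nonneg (Ef fun v => abs_nonneg _) hfi (Ef fun v => ?_)
        simp only [abs_mul, abs_of_pos (gd_pos v)]
        refine mul_le_of_le_one_left (abs_nonneg _) ?_
        simp only [gd]; rw [Real.exp_le_one_iff]; nlinarith [sq_nonneg v.1, sq_nonneg v.2]
      _ = (T ^ 2)⁻¹ * ∫ v, |f (y + v)| := by
        rw [Measure.integral_comp_smul volume (fun v => |f (y + v)|) T]
        simp [abs_of_pos hT]
      _ = _ := by rw [integral_add_left_eq_self (fun v => |f v|), mul_comm]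
  have := cv_bdd (ν := gm) (s := fun v => T • v) this x
  linarith

theorem bell_alg {η ζ n c Ns Nms B a b m σ : ℝ} (hn : 0 < n) (hNs : 0 < Ns) (hNN : Ns * Nms = 1)
    (hσ0 : 0 ≤ σ) (hσ : σ ≤ 1 / 2) (hζ : ζ ^ 2 ≤ n) (h1 : η ^ 2 * (Ns / n) ≤ Nms)
    (h3 : η ^ 2 * (η ^ 2 * c ^ 2) * (Ns / n ^ 2) ≤ B) :
    2 * Ns * b ^ 2 + 8 * σ * (η * ζ * (Ns / n)) * a * b
      - 4 * σ * (1 - σ) * (η ^ 2 * (Ns / n ^ 2)) * (ζ * a + m * (η * c) * b) ^ 2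
      ≥ Ns * b ^ 2 - 6 * Nms * a ^ 2 - 2 * m ^ 2 * B * b ^ 2 := by
  have hNms : 0 < Nms := by
    by_contra h; nlinarith
  have hσσ : σ * (1 - σ) ≤ 1 / 4 := by nlinarith [sq_nonneg (σ - 1/2)]
  have hσσ0 : 0 ≤ σ * (1 - σ) := mul_nonneg hσ0 bL
  have hL : 0 ≤ η ^ 2 * (Ns / n ^ 2) := bp
  have e1 : η ^ 2 * (Ns / n ^ 2) * ζ ^ 2 ≤ Nms := by
    have : η ^ 2 * (Ns / n ^ 2) * ζ ^ 2 ≤ η ^ 2 * (Ns / n ^ 2) * n := mlL hζ hL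
    have e : η ^ 2 * (Ns / n ^ 2) * n = η ^ 2 * (Ns / n) := by field_simp
    linarith
  have hX : (η * ζ * (Ns / n)) ^ 2 ≤ 1 := by
    have : (η * ζ * (Ns / n)) ^ 2 = (η ^ 2 * (Ns / n ^ 2) * ζ ^ 2) * Ns := by field_simp
    rw [this, ← hNN, mul_comm Ns]; exact mlR e1 hNs.le
  set X := η * ζ * (Ns / n) with hXd
  have hX1 : |X| ≤ 1 := (sq_le_one_iff_abs_le_one X).1 hX
  have cross : -(Ns * b ^ 2 + 4 * Nms * a ^ 2) ≤ 8 * σ * X * a * b := by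
    have i1 : |8 * σ * X * a * b| ≤ 4 * |a * b| := by
      rw [show 8 * σ * X * a * b = (8 * σ) * X * (a * b) by ring, abs_mul, abs_mul, abs_of_nonneg (by linarith : 0 ≤ 8 * σ)]
      refine mlR ?_ (abs_nonneg _)
      nlinarith [abs_nonneg X]
    have i2 : 4 * |a * b| ≤ Ns * b ^ 2 + 4 * Nms * a ^ 2 := by
      have : 0 ≤ Ns * (|b| - 2 * Nms * |a|) ^ 2 := bp
      have e : Ns * (|b| - 2 * Nms * |a|) ^ 2 = Ns * b ^ 2 - 4 * (Ns * Nms) * (|a| * |b|) + 4 * (Ns * Nms) * Nms * a ^ 2 := by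
        rw [← sq_abs a, ← sq_abs b]; ring
      rw [e, hNN] at this
      rw [abs_mul]; linarith
    linarith [neg_abs_le (8 * σ * X * a * b)]
  have sqb : (ζ * a + m * (η * c) * b) ^ 2 ≤ 2 * (ζ ^ 2 * a ^ 2) + 2 * (m ^ 2 * (η ^ 2 * c ^ 2) * b ^ 2) := by
    nlinarith [sq_nonneg (ζ * a - m * (η * c) * b)]
  have t1 : 4 * σ * (1 - σ) * (η ^ 2 * (Ns / n ^ 2)) * (ζ * a + m * (η * c) * b) ^ 2 ≤
      1 * ((η ^ 2 * (Ns / n ^ 2)) * (2 * (ζ ^ 2 * a ^ 2) + 2 * (m ^ 2 * (η ^ 2 * c ^ 2) * b ^ 2))) := by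
    rw [mul_assoc (4 * σ * (1 - σ))]
    exact mul_le_mul bL (mlL sqb hL) bp bn
  have t2 : (η ^ 2 * (Ns / n ^ 2)) * (2 * (ζ ^ 2 * a ^ 2)) ≤ 2 * Nms * a ^ 2 := by
    nlinarith [mlR e1 (sq_nonneg a)]
  have t3 : (η ^ 2 * (Ns / n ^ 2)) * (2 * (m ^ 2 * (η ^ 2 * c ^ 2) * b ^ 2)) ≤ 2 * m ^ 2 * B * b ^ 2 := by
    have := mlR h3 (by positivity : 0 ≤ 2 * m ^ 2 * b ^ 2)
    linarith
  linarith

structure BP where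
  (p q K e : ℝ)
  hpq : p.HolderConjugate q
  hp2 : p ≤ 2
  he : 0 < e
  hK : 0 < K
  hK1 : 7 ≤ K * (p * (p - 1))
  hK2 : 2 * (q - 1) ^ 2 ≤ K * q

namespace BP
variable (P : BP)
def m := P.q - 1
def σ := 1 - P.p / 2
def Y (η : ℝ) := η ^ 2 + P.e
def W (ζ : ℝ) := ζ ^ 2 + P.e ^ P.m
def N (ζ η : ℝ) := ζ ^ 2 + P.Y η ^ P.m
def Q (ζ η : ℝ) := P.K * (P.W ζ ^ (P.p / 2) - P.W 0 ^ (P.p / 2)) + P.K * (P.Y η ^ (P.q / 2) - P.Y 0 ^ (P.q / 2)) + η ^ 2 * P.N ζ η ^ P.σ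
def Q1 (ζ η : ℝ) := P.K * (P.p * ζ * P.W ζ ^ (P.p / 2 - 1)) + 2 * P.σ * (η ^ 2 * ζ * P.N ζ η ^ (P.σ - 1))
def Q2 (ζ η : ℝ) := P.K * (P.q * η * P.Y η ^ (P.q / 2 - 1)) + 2 * (η * P.N ζ η ^ P.σ) +
  2 * P.m * P.σ * (η ^ 3 * P.Y η ^ (P.m - 1) * P.N ζ η ^ (P.σ - 1))
def Q11 (ζ η : ℝ) := P.K * (P.p * P.W ζ ^ (P.p / 2 - 1) + P.p * (P.p - 2) * ζ ^ 2 * P.W ζ ^ (P.p / 2 - 1 - 1)) +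
  2 * P.σ * (η ^ 2 * P.N ζ η ^ (P.σ - 1)) + 4 * P.σ * (P.σ - 1) * (η ^ 2 * ζ ^ 2 * P.N ζ η ^ (P.σ - 1 - 1))
def Q12 (ζ η : ℝ) := 4 * P.σ * (η * ζ * P.N ζ η ^ (P.σ - 1)) +
  4 * P.m * P.σ * (P.σ - 1) * (η ^ 3 * ζ * P.Y η ^ (P.m - 1) * P.N ζ η ^ (P.σ - 1 - 1))
def Q22 (ζ η : ℝ) := P.K * (P.q * P.Y η ^ (P.q / 2 - 1) + P.q * (P.q - 2) * η ^ 2 * P.Y η ^ (P.q / 2 - 1 - 1)) +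
  2 * P.N ζ η ^ P.σ + 10 * P.m * P.σ * (η ^ 2 * P.Y η ^ (P.m - 1) * P.N ζ η ^ (P.σ - 1)) +
  4 * P.m * (P.m - 1) * P.σ * (η ^ 4 * P.Y η ^ (P.m - 1 - 1) * P.N ζ η ^ (P.σ - 1)) +
  4 * P.m ^ 2 * P.σ * (P.σ - 1) * (η ^ 4 * (P.Y η ^ (P.m - 1)) ^ 2 * P.N ζ η ^ (P.σ - 1 - 1))

theorem Ypos (η) : 0 < P.Y η := by have := P.he; unfold Y; positivity
theorem Wpos (ζ) : 0 < P.W ζ := by have := P.he; unfold W; positivity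
theorem Npos (ζ η) : 0 < P.N ζ η := by have := P.Ypos η; unfold N; positivity

theorem hp1 : 1 < P.p := P.hpq.lt
theorem hpq1 : (P.p - 1) * (P.q - 1) = 1 := by
  have := P.hpq.mul_eq_add; linarith
theorem hq2 : 2 ≤ P.q := by
  have := P.hpq1; have := P.hp1; have := P.hp2; nlinarith
theorem hm : 1 ≤ P.m := by have := P.hq2; unfold m; linarith
theorem hσ0 : 0 ≤ P.σ := by have := P.hp2; unfold σ; linarith
theorem hσ : P.σ ≤ 1 / 2 := by have := P.hp1; unfold σ; linarith
theorem mσ : P.m * P.σ = P.q / 2 - 1 := by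
  have := P.hpq1; unfold m σ; nlinarith

set_option maxHeartbeats 1000000 in
theorem bell (ζ η a b : ℝ) : P.N ζ η ^ (-P.σ) * a ^ 2 + P.N ζ η ^ P.σ * b ^ 2 ≤
    P.Q11 ζ η * a ^ 2 + 2 * P.Q12 ζ η * a * b + P.Q22 ζ η * b ^ 2 := by
  have hn := P.Npos ζ η
  have hy := P.Ypos η
  have hw := P.Wpos ζ
  have hp1 := P.hp1
  have hp2 := P.hp2
  have hq2 := P.hq2
  have hm := P.hm
  have hσ0 := P.hσ0
  have hσ := P.hσ
  have hmσ := P.mσ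
  have hK := P.hK
  set n := P.N ζ η with hnd
  set y := P.Y η with hyd
  set w := P.W ζ with hwd
  set σ := P.σ with hσd
  set m := P.m with hmd
  set z := y ^ m with hzd
  have hz : 0 < z := bp
  have hnz : n = ζ ^ 2 + z := rfl
  have hzn : z ≤ n := by rw [hnz]; exact le_add_of_nonneg_left (sq_nonneg ζ)
  have hηy : η ^ 2 ≤ y := by have := P.he; simp only [hyd, Y]; linarith
  have hwn : w ≤ n := by
    rw [hnz]; simp only [hwd, W]
    gcongr
    rw [hzd]; exact Real.rpow_le_rpow P.he.le (by simp only [hyd, Y]; exact le_add_of_nonneg_left (sq_nonneg η)) bL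
  have en1 : n ^ (σ - 1) = n ^ σ / n := by rw [Real.rpow_sub_one hn.ne']
  have en2 : n ^ (σ - 1 - 1) = n ^ σ / n ^ 2 := by
    rw [Real.rpow_sub_one hn.ne', en1, div_div, sq]
  have ey1 : y ^ (m - 1) = z / y := by rw [Real.rpow_sub_one hy.ne']
  have ey2 : y ^ (m - 1 - 1) = z / y ^ 2 := by rw [Real.rpow_sub_one hy.ne', ey1, div_div, sq]
  have hNN : n ^ σ * n ^ (-σ) = 1 := by rw [← Real.rpow_add hn]; simp
  have hB : y ^ (P.q / 2 - 1) = z ^ σ := by rw [hzd, ← Real.rpow_mul hy.le, hmσ]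
  have h1 : η ^ 2 * (n ^ σ / n) ≤ n ^ (-σ) := by
    have i1 : η ^ 2 ≤ n ^ (P.p - 1) := by
      refine hηy.trans ?_
      have : y = z ^ (P.p - 1) := by
        rw [hzd, ← Real.rpow_mul hy.le, mul_comm, hmd]
        unfold BP.m; rw [P.hpq1, Real.rpow_one]
      rw [this]; exact Real.rpow_le_rpow hz.le hzn bL
    calc η ^ 2 * (n ^ σ / n) ≤ n ^ (P.p - 1) * (n ^ σ / n) := mlR i1 bp
      _ = n ^ (-σ) := by
        rw [← en1, ← Real.rpow_add hn]; congr 1; rw [hσd]; unfold BP.σ; ring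
  have h3 : η ^ 2 * (η ^ 2 * (z / y) ^ 2) * (n ^ σ / n ^ 2) ≤ z ^ σ := by
    have i1 : η ^ 2 * (η ^ 2 * (z / y) ^ 2) ≤ z ^ 2 := by
      rw [← mul_assoc, ← sq, ← mul_pow]
      refine pow_le_pow_left₀ bp ?_ 2
      calc η ^ 2 * (z / y) ≤ y * (z / y) := mlR hηy bp
        _ = z := by field_simp
    have i2 : n ^ σ / n ^ 2 ≤ z ^ σ / z ^ 2 := by
      have := Real.rpow_le_rpow_of_nonpos hz hzn (by linarith : σ - 2 ≤ 0)
      rw [Real.rpow_sub hn, Real.rpow_sub hz] at this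
      simpa using this
    calc _ ≤ z ^ 2 * (z ^ σ / z ^ 2) := mul_le_mul i1 i2 bp bp
      _ = z ^ σ := by field_simp
  have key := bell_alg (a := a) (b := b) (m := m) hn (by positivity : 0 < n ^ σ) hNN hσ0 hσ (hnz ▸ le_add_of_nonneg_right hz.le : ζ ^ 2 ≤ n) h1 h3
  have hA : n ^ (-σ) * 7 ≤ P.K * (P.p * w ^ (P.p / 2 - 1) + P.p * (P.p - 2) * ζ ^ 2 * w ^ (P.p / 2 - 1 - 1)) := by
    have e : w ^ (P.p / 2 - 1) = w ^ (-σ) := by congr 1; rw [hσd]; unfold BP.σ; ring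
    have i1 : n ^ (-σ) ≤ w ^ (-σ) := Real.rpow_le_rpow_of_nonpos hw hwn bL
    have i2 : ζ ^ 2 * (w ^ (-σ) / w) ≤ w ^ (-σ) := by
      have : ζ ^ 2 ≤ w := by simp only [hwd, W]; exact le_add_of_nonneg_right (Real.rpow_pos_of_pos P.he _).le
      calc _ ≤ w * (w ^ (-σ) / w) := mlR this bp
        _ = _ := by field_simp
    rw [Real.rpow_sub_one hw.ne' (P.p / 2 - 1), e]
    have i3 : P.p * (P.p - 1) * w ^ (-σ) ≤ P.p * w ^ (-σ) + P.p * (P.p - 2) * ζ ^ 2 * (w ^ (-σ) / w) := by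
      linarith [mlL i2 (mul_nonneg bL bL : 0 ≤ P.p * (2 - P.p))]
    calc n ^ (-σ) * 7 ≤ w ^ (-σ) * (P.K * (P.p * (P.p - 1))) := mul_le_mul i1 P.hK1 bn bp
      _ = P.K * (P.p * (P.p - 1) * w ^ (-σ)) := by ring
      _ ≤ _ := mlL i3 hK.le
  have hBB : 2 * m ^ 2 * z ^ σ ≤ P.K * (P.q * y ^ (P.q / 2 - 1) + P.q * (P.q - 2) * η ^ 2 * y ^ (P.q / 2 - 1 - 1)) := by
    have i1 : 0 ≤ P.q * (P.q - 2) * η ^ 2 * y ^ (P.q / 2 - 1 - 1) := by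
      have : 0 ≤ P.q - 2 := bL
      positivity
    rw [hB]
    have := mlR P.hK2 (by positivity : 0 ≤ z ^ σ)
    have i2 := mul_nonneg hK.le i1
    have hmq : m = P.q - 1 := rfl
    rw [mul_add, hmq, ← mul_assoc]
    exact this.trans (le_add_of_nonneg_right i2)
  have hA' := mlR hA (sq_nonneg a)
  have hB' := mlR hBB (sq_nonneg b)
  simp only [Q11, Q12, Q22, ← hnd, ← hyd, ← hwd, ← hσd, ← hmd, en1, en2, ey1, ey2]
  have pos1 : 0 ≤ 2 * σ * (η ^ 2 * (n ^ σ / n)) * a ^ 2 := bp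
  have pos2 : 0 ≤ 10 * m * σ * (η ^ 2 * (z / y) * (n ^ σ / n)) * b ^ 2 := bp
  have pos3 : 0 ≤ 4 * m * (m - 1) * σ * (η ^ 4 * (z / y ^ 2) * (n ^ σ / n)) * b ^ 2 := by
    have : 0 ≤ m - 1 := bL
    positivity
  generalize n ^ σ / n ^ 2 = L2 at *
  generalize n ^ σ / n = L1 at *
  generalize z / y ^ 2 = L4 at *
  generalize z / y = L3 at *
  linarith

end BP

theorem rpow_add_le2 {a b s : ℝ} (ha : 0 ≤ a) (hb : 0 ≤ b) (hs : 0 ≤ s) :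
    (a + b) ^ s ≤ 2 ^ s * (a ^ s + b ^ s) := by
  have h : ∀ {a b : ℝ}, 0 ≤ a → 0 ≤ b → a ≤ b → (a + b) ^ s ≤ 2 ^ s * (a ^ s + b ^ s) := by
    intro a b ha hb hab
    calc (a + b) ^ s ≤ (2 * b) ^ s := Real.rpow_le_rpow bp bL hs
      _ = 2 ^ s * b ^ s := Real.mul_rpow bn hb
      _ ≤ _ := by
        have : 0 ≤ a ^ s := bp
        gcongr; linarith
  rcases le_total a b with hab | hab
  · exact h ha hb hab
  · rw [add_comm a b, add_comm (a ^ s)]; exact h hb ha hab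

namespace BP
variable (P : BP)

theorem Q_nonneg (ζ η : ℝ) : 0 ≤ P.Q ζ η := by
  have hp := P.hp1; have hq := P.hq2; have hK := P.hK; have he := P.he
  have h1 : P.W 0 ^ (P.p / 2) ≤ P.W ζ ^ (P.p / 2) :=
    Real.rpow_le_rpow (P.Wpos 0).le (by simp [W]; positivity) bL
  have h2 : P.Y 0 ^ (P.q / 2) ≤ P.Y η ^ (P.q / 2) :=
    Real.rpow_le_rpow (P.Ypos 0).le (by simp [Y]; positivity) bL
  have h3 := P.Npos ζ η
  have : 0 ≤ P.W ζ ^ (P.p / 2) - P.W 0 ^ (P.p / 2) := bL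
  have : 0 ≤ P.Y η ^ (P.q / 2) - P.Y 0 ^ (P.q / 2) := bL
  unfold Q; positivity

theorem Q_zero : P.Q 0 0 = 0 := by simp [Q]

theorem abs_rpow_two (x s : ℝ) : (x ^ 2) ^ (s / 2) = |x| ^ s := by
  rw [← sq_abs, ← Real.rpow_natCast, ← Real.rpow_mul (abs_nonneg x)]; congr 1; push_cast; ring

theorem Q_le (ζ η : ℝ) : P.Q ζ η ≤ (2 * P.K + 2) * (2 ^ (P.q / 2)) * (|ζ| ^ P.p + |η| ^ P.q + 2 * P.e ^ (P.q / 2)) := by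
  have hp := P.hp1; have hp2 := P.hp2; have hq := P.hq2; have hK := P.hK; have he := P.he; have hm := P.hm
  have hy := P.Ypos η
  have hpq : P.p ≤ P.q := bL
  have t1 : (2:ℝ) ^ (P.p / 2) ≤ 2 ^ (P.q / 2) := Real.rpow_le_rpow_of_exponent_le bn bL
  have t0 : (2:ℝ) ^ P.σ ≤ 2 := by
    calc (2:ℝ) ^ P.σ ≤ 2 ^ (1:ℝ) := Real.rpow_le_rpow_of_exponent_le bn (by linarith [P.hσ])
      _ = 2 := bs
  have t2 : (2:ℝ) ≤ 2 ^ (P.q / 2) := by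
    calc (2:ℝ) = 2 ^ (1:ℝ) := bs
      _ ≤ _ := Real.rpow_le_rpow_of_exponent_le bn bL
  have hE : (P.e ^ P.m) ^ (P.p / 2) = P.e ^ (P.q / 2) := by
    rw [← Real.rpow_mul he.le]; congr 1; have := P.hpq1; unfold m; linarith
  have hA : P.W ζ ^ (P.p / 2) ≤ 2 ^ (P.q / 2) * (|ζ| ^ P.p + P.e ^ (P.q / 2)) := by
    have := rpow_add_le2 (sq_nonneg ζ) (by positivity : 0 ≤ P.e ^ P.m) (by linarith : 0 ≤ P.p / 2)
    rw [abs_rpow_two, hE] at this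
    exact this.trans (mlR t1 bp)
  have hB : P.Y η ^ (P.q / 2) ≤ 2 ^ (P.q / 2) * (|η| ^ P.q + P.e ^ (P.q / 2)) := by
    have := rpow_add_le2 (sq_nonneg η) he.le (by linarith : 0 ≤ P.q / 2)
    rwa [abs_rpow_two] at this
  have hM : η ^ 2 * P.N ζ η ^ P.σ ≤ 2 * (|ζ| ^ P.p + P.Y η ^ (P.q / 2)) := by
    have i0 : η ^ 2 ≤ P.Y η := by unfold Y; linarith
    have hn := P.Npos ζ η
    have i1 : η ^ 2 * P.N ζ η ^ P.σ ≤ P.Y η * P.N ζ η ^ P.σ := mlR i0 bp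
    have z0 : 0 ≤ |ζ| ^ P.p := bp
    have y0 : 0 ≤ P.Y η ^ (P.q / 2) := bp
    refine i1.trans ?_
    rcases le_total (ζ ^ 2) (P.Y η ^ P.m) with h | h
    · have : P.N ζ η ^ P.σ ≤ 2 * P.Y η ^ (P.m * P.σ) := by
        calc P.N ζ η ^ P.σ ≤ (2 * P.Y η ^ P.m) ^ P.σ := Real.rpow_le_rpow hn.le (by unfold N; linarith) P.hσ0
          _ = 2 ^ P.σ * P.Y η ^ (P.m * P.σ) := by rw [Real.mul_rpow bn bp, ← Real.rpow_mul hy.le]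
          _ ≤ _ := mlR t0 bp
      calc P.Y η * P.N ζ η ^ P.σ ≤ P.Y η * (2 * P.Y η ^ (P.m * P.σ)) := mlL this hy.le
        _ = 2 * P.Y η ^ (P.q / 2) := by
          rw [P.mσ, Real.rpow_sub_one hy.ne']; field_simp
        _ ≤ _ := by linarith
    · have i2 : P.Y η ≤ (ζ ^ 2) ^ (P.p - 1) := by
        calc P.Y η = (P.Y η ^ P.m) ^ (P.p - 1) := by
              rw [← Real.rpow_mul hy.le, mul_comm]; unfold m; rw [P.hpq1, Real.rpow_one]
          _ ≤ _ := Real.rpow_le_rpow bp h bL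
      have i3 : P.N ζ η ^ P.σ ≤ 2 * (ζ ^ 2) ^ P.σ := by
        calc P.N ζ η ^ P.σ ≤ (2 * ζ ^ 2) ^ P.σ := Real.rpow_le_rpow hn.le (by unfold N; linarith) P.hσ0
          _ = 2 ^ P.σ * (ζ ^ 2) ^ P.σ := by rw [Real.mul_rpow bn bp]
          _ ≤ _ := mlR t0 bp
      have hζ : 0 < ζ ^ 2 := lt_of_lt_of_le bp h
      calc P.Y η * P.N ζ η ^ P.σ ≤ (ζ ^ 2) ^ (P.p - 1) * (2 * (ζ ^ 2) ^ P.σ) :=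
            mul_le_mul i2 i3 bp bp
        _ = 2 * (ζ ^ 2) ^ (P.p / 2) := by
          rw [mul_left_comm, ← Real.rpow_add hζ]; congr 2; unfold σ; ring
        _ = 2 * |ζ| ^ P.p := by rw [abs_rpow_two]
        _ ≤ _ := bL
  have hW0 : 0 ≤ P.W 0 ^ (P.p / 2) := (Real.rpow_pos_of_pos (P.Wpos 0) _).le
  have hY0 : 0 ≤ P.Y 0 ^ (P.q / 2) := (Real.rpow_pos_of_pos (P.Ypos 0) _).le
  have a0 : 0 ≤ |ζ| ^ P.p := bp
  have b0 : 0 ≤ |η| ^ P.q := bp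
  have e0 : 0 < P.e ^ (P.q / 2) := bp
  have k1 := mlL hA hK.le
  have k2 := mlL hB hK.le
  have k3 := mul_nonneg hK.le hW0
  have k4 := mul_nonneg hK.le hY0
  have k5 := mlR t2 a0
  have k6 := mul_nonneg hK.le (mul_nonneg (by positivity : R0 ≤ 2 ^ (P.q / 2)) a0)
  have k7 := mul_nonneg hK.le (mul_nonneg (by positivity : R0 ≤ 2 ^ (P.q / 2)) b0)
  have k8 := mul_nonneg hK.le (mul_nonneg (by positivity : R0 ≤ 2 ^ (P.q / 2)) e0.le)
  have k9 := mul_nonneg (by positivity : R0 ≤ 2 ^ (P.q / 2)) e0.le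
  have k10 := mul_nonneg (by positivity : R0 ≤ 2 ^ (P.q / 2)) a0
  unfold Q
  linarith

variable {F G : ℝ → ℝ} {F' G' t : ℝ}

theorem dY (hG : HasDerivAt G G' t) : HasDerivAt (fun t => P.Y (G t)) (2 * G t * G') t := by
  have := (hG.pow 2).add_const P.e
  refine this.congr_deriv ?_; simp
theorem dW (hF : HasDerivAt F F' t) : HasDerivAt (fun t => P.W (F t)) (2 * F t * F') t := by
  have := (hF.pow 2).add_const (P.e ^ P.m)
  refine this.congr_deriv ?_; simp
theorem dYr (s : ℝ) (hG : HasDerivAt G G' t) : HasDerivAt (fun t => P.Y (G t) ^ s) (2 * G t * G' * s * P.Y (G t) ^ (s - 1)) t :=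
  (P.dY hG).rpow_const (Or.inl (P.Ypos _).ne')
theorem dWr (s : ℝ) (hF : HasDerivAt F F' t) : HasDerivAt (fun t => P.W (F t) ^ s) (2 * F t * F' * s * P.W (F t) ^ (s - 1)) t :=
  (P.dW hF).rpow_const (Or.inl (P.Wpos _).ne')
theorem dNr (s : ℝ) (hF : HasDerivAt F F' t) (hG : HasDerivAt G G' t) :
    HasDerivAt (fun t => P.N (F t) (G t) ^ s)
      ((2 * F t * F' + 2 * G t * G' * P.m * P.Y (G t) ^ (P.m - 1)) * s * P.N (F t) (G t) ^ (s - 1)) t := by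
  have h := (hF.pow 2).add (P.dYr P.m hG)
  refine (HasDerivAt.rpow_const (f := fun t => P.N (F t) (G t)) (h.congr_deriv ?_) (Or.inl (P.Npos _ _).ne'))
  simp

theorem dQ (hF : HasDerivAt F F' t) (hG : HasDerivAt G G' t) :
    HasDerivAt (fun t => P.Q (F t) (G t)) (P.Q1 (F t) (G t) * F' + P.Q2 (F t) (G t) * G') t := by
  have := ((((P.dWr (P.p / 2) hF).sub_const (P.W 0 ^ (P.p / 2))).const_mul P.K).add
    (((P.dYr (P.q / 2) hG).sub_const (P.Y 0 ^ (P.q / 2))).const_mul P.K)).add ((hG.pow 2).mul (P.dNr P.σ hF hG))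
  refine this.congr_deriv ?_
  simp only [Q1, Q2]; push_cast; simp only [Pi.pow_apply]; ring

theorem dQ1 (hF : HasDerivAt F F' t) (hG : HasDerivAt G G' t) :
    HasDerivAt (fun t => P.Q1 (F t) (G t)) (P.Q11 (F t) (G t) * F' + P.Q12 (F t) (G t) * G') t := by
  have := (((hF.const_mul P.p).mul (P.dWr (P.p / 2 - 1) hF)).const_mul P.K).add
    ((((hG.pow 2).mul hF).mul (P.dNr (P.σ - 1) hF hG)).const_mul (2 * P.σ))
  refine this.congr_deriv ?_
  simp only [Q11, Q12]; push_cast; simp only [Pi.mul_apply, Pi.pow_apply]; ring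

theorem dQ2 (hF : HasDerivAt F F' t) (hG : HasDerivAt G G' t) :
    HasDerivAt (fun t => P.Q2 (F t) (G t)) (P.Q12 (F t) (G t) * F' + P.Q22 (F t) (G t) * G') t := by
  have := ((((hG.const_mul P.q).mul (P.dYr (P.q / 2 - 1) hG)).const_mul P.K).add
    ((hG.mul (P.dNr P.σ hF hG)).const_mul 2)).add
    ((((hG.pow 3).mul (P.dYr (P.m - 1) hG)).mul (P.dNr (P.σ - 1) hF hG)).const_mul (2 * P.m * P.σ))
  refine this.congr_deriv ?_
  simp only [Q12, Q22]; push_cast; simp only [Pi.mul_apply, Pi.pow_apply]; ring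

theorem cY (s : ℝ) : ContDiff ℝ 1 fun z : P2 => P.Y z.2 ^ s :=
  ContDiff.rpow_const_of_ne (by unfold Y; fun_prop) fun z => (P.Ypos _).ne'
theorem cW (s : ℝ) : ContDiff ℝ 1 fun z : P2 => P.W z.1 ^ s :=
  ContDiff.rpow_const_of_ne (by unfold W; fun_prop) fun z => (P.Wpos _).ne'
theorem cN (s : ℝ) : ContDiff ℝ 1 fun z : P2 => P.N z.1 z.2 ^ s :=
  ContDiff.rpow_const_of_ne (by have := P.cY P.m; unfold N; fun_prop) fun z => (P.Npos _ _).ne'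

theorem contQ : ContDiff ℝ 1 (fun z : P2 => P.Q z.1 z.2) ∧ ContDiff ℝ 1 (fun z : P2 => P.Q1 z.1 z.2) ∧ ContDiff ℝ 1 (fun z : P2 => P.Q2 z.1 z.2)
    ∧ ContDiff ℝ 1 (fun z : P2 => P.Q11 z.1 z.2) ∧ ContDiff ℝ 1 (fun z : P2 => P.Q12 z.1 z.2) ∧ ContDiff ℝ 1 (fun z : P2 => P.Q22 z.1 z.2) := by
  have h1 := P.cY; have h2 := P.cW; have h3 := P.cN
  unfold Q Q1 Q2 Q11 Q12 Q22
  refine ⟨?_, ?_, ?_, ?_, ?_, ?_⟩ <;> fun_prop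

end BP

theorem Sr_cd (r : ℝ) {f : F2} (hf : TF f) : ContDiff ℝ ∞ (Sr r f) := cv_cd (Sm r) hf
theorem Sr_cont (r : ℝ) {f : F2} (hf : TF f) : Continuous (Sr r f) := (Sr_cd r hf).continuous
theorem Sr_dd (r : ℝ) {f : F2} (hf : TF f) (e : P2) : dd e (Sr r f) = Sr r (dd e f) := dd_cv (Sm r) hf e
theorem Sr_L1 (r : ℝ) {f : F2} (hf : TF f) :
    Integrable (Sr r f) ∧ ∫ x, |Sr r f x| ≤ gm.real univ * ∫ x, |f x| := cv_L1 (Sm r) hf.cont hf.int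
theorem Sr_bdd {f : F2} (hf : TF f) : ∃ C, 0 < C ∧ ∀ r x, |Sr r f x| ≤ C := by
  obtain ⟨C, h0, hC⟩ := cs_bdd hf.cont hf.2
  have h1 : 0 ≤ gm.real univ := bp
  exact ⟨C * gm.real univ + 1, by positivity, fun r x => (cv_bdd hC x).trans bL⟩
theorem Sr_lap (r : ℝ) {f : F2} (hf : TF f) (x : P2) : Sr r (lap f) x =
    Sr r (dd Ex (dd Ex f)) x + Sr r (dd Ey (dd Ey f)) x := by
  rw [Sr, Sr, Sr, cv, cv, cv, ← integral_add]
  · rfl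
  · exact cv_int (Sm r) ((hf.dd _).dd _).cont ((hf.dd _).dd _).2 x
  · exact cv_int (Sm r) ((hf.dd _).dd _).cont ((hf.dd _).dd _).2 x

theorem int_bdd_mul {φ h : F2} {C : ℝ} (hφ : Continuous φ) (hC : ∀ x, |φ x| ≤ C) (hh : Integrable h) :
    Integrable fun x => φ x * h x :=
  hh.bdd_mul (c := C) hφ.aestronglyMeasurable (Ef fun x => hC x)

section flow
variable (P : BP) {f g : F2} (hf : TF f) (hg : TF g)
include hf hg

theorem flow_bdd {q : ℝ → ℝ → ℝ} (hq : Continuous fun z : P2 => q z.1 z.2) :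
    ∃ C, ∀ r x, |q (Sr r f x) (Sr r g x)| ≤ C := by
  obtain ⟨A, -, hA⟩ := Sr_bdd hf
  obtain ⟨B, -, hB⟩ := Sr_bdd hg
  obtain ⟨C, hC⟩ := (isCompact_Icc (a := ((-A, -B) : P2)) (b := (A, B))).exists_bound_of_continuousOn hq.continuousOn
  refine ⟨C, fun r x => hC (Sr r f x, Sr r g x) ?_⟩
  have h1 := abs_le.1 (hA r x); have h2 := abs_le.1 (hB r x)
  exact ⟨⟨h1.1, h2.1⟩, ⟨h1.2, h2.2⟩⟩

local notation "Qf" P:max r:max f:max g:max e:max x:max => BP.Q11 P (Sr r f x) (Sr r g x) * Sr r (dd e f) x ^ 2 + 2 * BP.Q12 P (Sr r f x) (Sr r g x) * Sr r (dd e f) x * Sr r (dd e g) x + BP.Q22 P (Sr r f x) (Sr r g x) * Sr r (dd e g) x ^ 2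
local notation "Qg" P:max r:max f:max g:max e:max x:max => BP.Q1 P (Sr r f x) (Sr r g x) * Sr r (dd e (dd e f)) x + BP.Q2 P (Sr r f x) (Sr r g x) * Sr r (dd e (dd e g)) x

theorem flow_slice (r : ℝ) (e : P2) :
    Integrable (fun x => Qg P r f g e x)
    ∧ Integrable (fun x => Qf P r f g e x)
    ∧ ∫ x, (Qg P r f g e x)
      = - ∫ x, (Qf P r f g e x) := by
  obtain ⟨d0, d1, d2, d11, d12, d22⟩ := P.contQ
  obtain ⟨C1, b1⟩ := flow_bdd hf hg d1.continuous
  obtain ⟨C2, b2⟩ := flow_bdd hf hg d2.continuous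
  obtain ⟨C11, b11⟩ := flow_bdd hf hg d11.continuous
  obtain ⟨C12, b12⟩ := flow_bdd hf hg d12.continuous
  obtain ⟨C22, b22⟩ := flow_bdd hf hg d22.continuous
  have sf := Sr_cont r hf; have sg := Sr_cont r hg
  have pr : Continuous fun x => (Sr r f x, Sr r g x) := sf.prodMk sg
  have k1 := d1.continuous.comp pr; have k2 := d2.continuous.comp pr
  have k11 := d11.continuous.comp pr; have k12 := d12.continuous.comp pr; have k22 := d22.continuous.comp pr
  have ia := (Sr_L1 r (hf.dd e)).1; have ib := (Sr_L1 r (hg.dd e)).1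
  obtain ⟨A, -, ba⟩ := Sr_bdd (hf.dd e); obtain ⟨B, -, bb⟩ := Sr_bdd (hg.dd e)
  have ca := Sr_cont r (hf.dd e); have cb := Sr_cont r (hg.dd e)
  have I1 : Integrable (fun x => Qg P r f g e x) :=
    (int_bdd_mul k1 (b1 r) (Sr_L1 r ((hf.dd e).dd e)).1).add (int_bdd_mul k2 (b2 r) (Sr_L1 r ((hg.dd e).dd e)).1)
  have I2 : Integrable (fun x => Qf P r f g e x) := by
    have := ((int_bdd_mul k11 (b11 r) (int_bdd_mul ca (ba r) ia)).add
      ((int_bdd_mul k12 (b12 r) (int_bdd_mul ca (ba r) ib)).const_mul 2)).add (int_bdd_mul k22 (b22 r) (int_bdd_mul cb (bb r) ib))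
    refine this.congr (Ef fun x => ?_)
    simp; ring
  refine ⟨I1, I2, ?_⟩
  set W : F2 := fun x => P.Q1 (Sr r f x) (Sr r g x) * Sr r (dd e f) x + P.Q2 (Sr r f x) (Sr r g x) * Sr r (dd e g) x with hWd
  have le1 : (1 : WithTop ℕ∞) ≤ ∞ := bs
  have c1 : ∀ {h}, TF h → ContDiff ℝ 1 (Sr r h) := fun hh => (Sr_cd r hh).of_le bs
  have hpr : ContDiff ℝ 1 fun x => (Sr r f x, Sr r g x) := (c1 hf).prodMk (c1 hg)
  have hW : ContDiff ℝ 1 W := ((d1.comp hpr).mul (c1 (hf.dd e))).add ((d2.comp hpr).mul (c1 (hg.dd e)))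
  have iW : Integrable W := (int_bdd_mul k1 (b1 r) ia).add (int_bdd_mul k2 (b2 r) ib)
  have dW : dd e W = fun x => (Qf P r f g e x) +
       (Qg P r f g e x) := by
    funext x
    have sl : ∀ {h}, TF h → HasDerivAt (fun t : ℝ => Sr r h (x + t • e)) (Sr r (dd e h) x) 0 := fun {h} hh => by
      have := dd_hda ((c1 hh).differentiable bn) e x 0
      rw [Sr_dd r hh e] at this; simpa using this
    have hF := sl hf; have hG := sl hg
    have h1 := ((P.dQ1 hF hG).mul (sl (hf.dd e))).add ((P.dQ2 hF hG).mul (sl (hg.dd e)))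
    have h2 := dd_hda (hW.differentiable bn) e x 0
    have := h2.unique h1
    simp only [zero_smul, add_zero] at this
    rw [this]; ring
  have h0 := int_dd_zero hW e iW (by rw [dW]; exact I2.add I1)
  rw [dW, integral_add I2 I1] at h0
  linarith

set_option maxHeartbeats 1000000 in
theorem flow_main {T : ℝ} (hT : 0 ≤ T) {e e' : P2} (he : e = Ex ∨ e = Ey) (he' : e' = Ex ∨ e' = Ey) :
    ∫ r in Ioc 0 T, r * ∫ x, |Sr r (dd e f) x| * |Sr r (dd e' g) x| ≤ ∫ x, P.Q (Sr 0 f x) (Sr 0 g x) := by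
  obtain ⟨d0, d1, d2, d11, d12, d22⟩ := P.contQ
  obtain ⟨C1, b1⟩ := flow_bdd hf hg d1.continuous
  obtain ⟨C2, b2⟩ := flow_bdd hf hg d2.continuous
  set H : ℝ × P2 → ℝ := fun z => z.1 / 2 * (P.Q1 (Sr z.1 f z.2) (Sr z.1 g z.2) * Sr z.1 (lap f) z.2 + P.Q2 (Sr z.1 f z.2) (Sr z.1 g z.2) * Sr z.1 (lap g) z.2) with hH
  have jf := Sr_joint hf; have jg := Sr_joint hg
  have jlf := Sr_joint hf.lap; have jlg := Sr_joint hg.lap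
  have pr : Continuous fun z : ℝ × P2 => (Sr z.1 f z.2, Sr z.1 g z.2) := jf.prodMk jg
  have k1 : Continuous fun z : ℝ × P2 => P.Q1 (Sr z.1 f z.2) (Sr z.1 g z.2) := d1.continuous.comp pr
  have k2 : Continuous fun z : ℝ × P2 => P.Q2 (Sr z.1 f z.2) (Sr z.1 g z.2) := d2.continuous.comp pr
  have cH : Continuous H := bf
  have slc : ∀ r, Continuous fun x => (r, x) := fun r : ℝ => (by fun_prop : Continuous fun x : P2 => (r, x))
  have Hx : ∀ r, Integrable (fun x => H (r, x)) := fun r =>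
    ((int_bdd_mul (k1.comp (slc r)) (b1 r) (Sr_L1 r hf.lap).1).add (int_bdd_mul (k2.comp (slc r)) (b2 r) (Sr_L1 r hg.lap).1)).const_mul (r / 2)
  have HI : Integrable H ((volume.restrict (Ioc 0 T)).prod volume) := by
    rw [integrable_prod_iff cH.aestronglyMeasurable]
    refine ⟨Ef Hx, ?_⟩
    refine Integrable.of_bound (C := T / 2 * (C1 * (gm.real univ * ∫ x, |lap f x|) + C2 * (gm.real univ * ∫ x, |lap g x|)))
      (cH.norm.aestronglyMeasurable.integral_prod_right') ?_
    rw [ae_restrict_iff' measurableSet_Ioc]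
    refine Ef fun r hr => ?_
    rw [Real.norm_of_nonneg (integral_nonneg fun x => norm_nonneg _)]
    have hC1 : 0 ≤ C1 := (abs_nonneg _).trans (b1 0 0)
    have hC2 : 0 ≤ C2 := (abs_nonneg _).trans (b2 0 0)
    have L1 := Sr_L1 r hf.lap; have L2 := Sr_L1 r hg.lap
    calc ∫ x, ‖H (r, x)‖ ≤ ∫ x, T / 2 * (C1 * |Sr r (lap f) x| + C2 * |Sr r (lap g) x|) := by
          refine integral_mono (Hx r).norm (((L1.1.abs.const_mul C1).add (L2.1.abs.const_mul C2)).const_mul _) fun x => ?_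
          simp only [hH, Real.norm_eq_abs, abs_mul]
          rw [abs_of_nonneg (by linarith [hr.1] : 0 ≤ r / 2)]
          refine mul_le_mul (by linarith [hr.2]) ((abs_add_le _ _).trans ?_) (abs_nonneg _) bL
          rw [abs_mul, abs_mul]
          exact add_le_add (mlR (b1 r x) (abs_nonneg _)) (mlR (b2 r x) (abs_nonneg _))
      _ = T / 2 * (C1 * (∫ x, |Sr r (lap f) x|) + C2 * ∫ x, |Sr r (lap g) x|) := by
          rw [integral_const_mul, integral_add (L1.1.abs.const_mul C1) (L2.1.abs.const_mul C2), integral_const_mul, integral_const_mul]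
      _ ≤ _ := by
          refine mlL (add_le_add (mlL L1.2 hC1) (mlL L2.2 hC2)) bL
  have ftc : ∀ x, ∫ r in Ioc 0 T, H (r, x) = P.Q (Sr T f x) (Sr T g x) - P.Q (Sr 0 f x) (Sr 0 g x) := by
    intro x
    rw [← intervalIntegral.integral_of_le hT, intervalIntegral.integral_eq_sub_of_hasDerivAt
      (f := fun r => P.Q (Sr r f x) (Sr r g x)) (fun r _ => ?_)]
    · exact Continuous.intervalIntegrable bf _ _
    · exact (P.dQ (Sr_dr hf x r) (Sr_dr hg x r)).congr_deriv (by simp only [hH]; ring)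
  have swap : ∫ r in Ioc 0 T, ∫ x, H (r, x) = ∫ x, (P.Q (Sr T f x) (Sr T g x) - P.Q (Sr 0 f x) (Sr 0 g x)) := by
    rw [integral_integral_swap (f := fun r x => H (r, x)) HI]
    simp only [ftc]
  have step : ∀ r ∈ Ioc 0 T, r * ∫ x, |Sr r (dd e f) x| * |Sr r (dd e' g) x| ≤ - ∫ x, H (r, x) := by
    intro r hr
    obtain ⟨A1, A2, A3⟩ := flow_slice P hf hg r Ex
    obtain ⟨B1, B2, B3⟩ := flow_slice P hf hg r Ey
    have e1 : ∫ x, H (r, x) = r / 2 * (-(∫ x, (Qf P r f g Ex x)) - ∫ x, (Qf P r f g Ey x)) := by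
      rw [sub_eq_add_neg, ← A3, ← B3, ← integral_add A1 B1, ← integral_const_mul]
      congr 1; funext x; simp only [hH, Sr_lap r hf, Sr_lap r hg]; ring
    have key : 2 * ∫ x, |Sr r (dd e f) x| * |Sr r (dd e' g) x| ≤ (∫ x, (Qf P r f g Ex x)) + ∫ x, (Qf P r f g Ey x) := by
      rw [← integral_add A2 B2, ← integral_const_mul]
      refine integral_mono_of_nonneg (Ef fp) (A2.add B2) (Ef fun x => ?_)
      have q1 := P.bell (Sr r f x) (Sr r g x) (Sr r (dd Ex f) x) (Sr r (dd Ex g) x)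
      have q2 := P.bell (Sr r f x) (Sr r g x) (Sr r (dd Ey f) x) (Sr r (dd Ey g) x)
      have hn := P.Npos (Sr r f x) (Sr r g x)
      have hNN : P.N (Sr r f x) (Sr r g x) ^ P.σ * P.N (Sr r f x) (Sr r g x) ^ (-P.σ) = 1 := by rw [← Real.rpow_add hn]; simp
      have a0 : 0 < P.N (Sr r f x) (Sr r g x) ^ P.σ := bp
      have b0 : 0 < P.N (Sr r f x) (Sr r g x) ^ (-P.σ) := bp
      refine le_trans ?_ (add_le_add q1 q2)
      generalize P.N (Sr r f x) (Sr r g x) ^ P.σ = s at *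
      generalize P.N (Sr r f x) (Sr r g x) ^ (-P.σ) = t at *
      have young : ∀ a b : ℝ, 2 * (|a| * |b|) ≤ t * a ^ 2 + s * b ^ 2 := by
        intro a b
        have h1 : 0 ≤ s * (|b| - t * |a|) ^ 2 := bp
        have h2 : s * (|b| - t * |a|) ^ 2 = s * b ^ 2 - 2 * (s * t) * (|a| * |b|) + (s * t) * t * a ^ 2 := by
          rw [← sq_abs a, ← sq_abs b]; ring
        rw [h2, hNN] at h1; linarith
      have z1 := mul_nonneg b0.le (sq_nonneg (Sr r (dd Ex f) x))
      have z2 := mul_nonneg b0.le (sq_nonneg (Sr r (dd Ey f) x))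
      have z3 := mul_nonneg a0.le (sq_nonneg (Sr r (dd Ex g) x))
      have z4 := mul_nonneg a0.le (sq_nonneg (Sr r (dd Ey g) x))
      have y := young (Sr r (dd e f) x) (Sr r (dd e' g) x)
      simp only
      rcases he with rfl | rfl <;> rcases he' with rfl | rfl <;> linarith
    rw [e1]
    have := mlL key (by linarith [hr.1] : 0 ≤ r / 2)
    linarith
  have i0 : Integrable (fun x => P.Q (Sr T f x) (Sr T g x) - P.Q (Sr 0 f x) (Sr 0 g x)) := by
    have := HI.integral_prod_right
    simpa only [ftc] using this
  have iQ0 : Integrable (fun x => P.Q (Sr 0 f x) (Sr 0 g x)) := by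
    have e0 : ∀ {h : F2} x, Sr 0 h x = gm.real univ * h x := fun {h} x => by simp [Sr, cv]
    simp only [e0]
    have := hf.cont; have := hg.cont
    have cp : Continuous fun x => (gm.real univ * f x, gm.real univ * g x) := bf
    have cq := d0.continuous.comp cp
    simp only [Function.comp_def] at cq
    refine Continuous.integrable_of_hasCompactSupport cq ?_
    refine (hf.2.isCompact.union hg.2.isCompact).of_isClosed_subset (isClosed_tsupport _) (closure_minimal ?_ (hf.2.isCompact.union hg.2.isCompact).isClosed)
    intro x hx
    by_contra hn
    simp only [mem_union, not_or] at hn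
    apply hx
    have a1 := image_eq_zero_of_notMem_tsupport hn.1
    have a2 := image_eq_zero_of_notMem_tsupport hn.2
    simp [a1, a2, P.Q_zero]
  calc ∫ r in Ioc 0 T, r * ∫ x, |Sr r (dd e f) x| * |Sr r (dd e' g) x| ≤ ∫ r in Ioc 0 T, - ∫ x, H (r, x) := by
        refine integral_mono_of_nonneg ?_ HI.integral_prod_left.neg ?_
        · rw [EventuallyLE, ae_restrict_iff' measurableSet_Ioc]
          exact Ef fun r hr => mul_nonneg hr.1.le (integral_nonneg fp)
        · rw [EventuallyLE, ae_restrict_iff' measurableSet_Ioc]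
          exact Ef step
    _ = ∫ x, -(P.Q (Sr T f x) (Sr T g x) - P.Q (Sr 0 f x) (Sr 0 g x)) := by rw [integral_neg, swap, integral_neg]
    _ ≤ _ := by
        refine integral_mono i0.neg iQ0 fun x => ?_
        have := P.Q_nonneg (Sr T f x) (Sr T g x)
        simp only [Pi.neg_apply]
        linarith
end flow

def JJ (T : ℝ) (e e' : P2) (f g : F2) : ℝ := ∫ r in Ioc 0 T, r * ∫ x, |Sr r (dd e f) x| * |Sr r (dd e' g) x|

def unitv (e : P2) : Prop := e = Ex ∨ e = Ey

theorem TF.rpow_int {f : F2} (hf : TF f) {p : ℝ} (hp : 0 < p) : Integrable fun x => |f x| ^ p := by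
  have := hf.cont
  refine Continuous.integrable_of_hasCompactSupport (Continuous.rpow_const bf fun x => Or.inr hp.le) ?_
  refine hf.2.of_isClosed_subset (isClosed_tsupport _) (closure_mono fun x hx => ?_)
  intro h0; apply hx; simp [h0, hp.ne']

theorem JJ_le0 {p q : ℝ} (hpq : p.HolderConjugate q) (hp2 : p ≤ 2) : ∃ C, 0 < C ∧ ∀ (T : ℝ), 0 ≤ T → ∀ (f g : F2), TF f → TF g →
    ∀ e e', unitv e → unitv e' → JJ T e e' f g ≤ C * (∫ x, |f x| ^ p) + C * ∫ x, |g x| ^ q := by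
  have hp1 := hpq.lt; have hq1 := hpq.symm.lt
  have hp0 : 0 < p - 1 := bL
  have hp00 : 0 < p := bL
  have hq0 : 0 < q := bL
  set K := 7 / (p * (p - 1)) + 2 * (q - 1) ^ 2 / q with hKd
  have hK : 0 < K := bp
  have hK1 : 7 ≤ K * (p * (p - 1)) := by
    rw [hKd, add_mul, div_mul_cancel₀ _ bp]
    have : 0 ≤ 2 * (q - 1) ^ 2 / q * (p * (p - 1)) := bp
    linarith
  have hK2 : 2 * (q - 1) ^ 2 ≤ K * q := by
    rw [hKd, add_mul, div_mul_cancel₀ _ bp]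
    have : 0 ≤ 7 / (p * (p - 1)) * q := bp
    linarith
  set c := gm.real univ
  have hc : 0 ≤ c := bp
  set A := (2 * K + 2) * (2 ^ (q / 2)) with hA
  have hA0 : 0 < A := bp
  refine ⟨A * (c ^ p + c ^ q + 1), by positivity, fun T hT f g hf hg e e' he he' => ?_⟩
  set S := tsupport f ∪ tsupport g
  have hS : IsCompact S := hf.2.isCompact.union hg.2.isCompact
  have e0 : ∀ {h : F2} x, Sr 0 h x = c * h x := fun {h} x => by simp [Sr, cv, c]
  have main : ∀ ε : ℝ, 0 < ε → JJ T e e' f g ≤ A * (c ^ p * (∫ x, |f x| ^ p) + c ^ q * (∫ x, |g x| ^ q) + 2 * ε ^ (q / 2) * volume.real S) := by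
    intro ε hε
    let P : BP := ⟨p, q, K, ε, hpq, hp2, hε, hK, hK1, hK2⟩
    refine (flow_main P hf hg hT he he').trans ?_
    have i1 : Integrable fun x => c ^ p * |f x| ^ p := (hf.rpow_int hp00).const_mul _
    have i2 : Integrable fun x => c ^ q * |g x| ^ q := (hg.rpow_int hq0).const_mul _
    have i12 : Integrable fun x => c ^ p * |f x| ^ p + c ^ q * |g x| ^ q := i1.add i2
    have i3 : Integrable fun x => S.indicator (fun _ => 2 * ε ^ (q / 2)) x :=
      ((integrableOn_const hS.measure_lt_top.ne).integrable_indicator hS.measurableSet)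
    have hi : Integrable fun x => c ^ p * |f x| ^ p + c ^ q * |g x| ^ q + S.indicator (fun _ => 2 * ε ^ (q / 2)) x := i12.add i3
    calc ∫ x, P.Q (Sr 0 f x) (Sr 0 g x) ≤ ∫ x, A * (c ^ p * |f x| ^ p + c ^ q * |g x| ^ q + S.indicator (fun _ => 2 * ε ^ (q / 2)) x) := by
          refine integral_mono_of_nonneg (Ef fun x => P.Q_nonneg _ _) (hi.const_mul A) (Ef fun x => ?_)
          simp only [e0]
          by_cases hx : x ∈ S
          · have := P.Q_le (c * f x) (c * g x)
            rw [abs_mul, abs_mul, abs_of_nonneg hc, Real.mul_rpow hc (abs_nonneg _), Real.mul_rpow hc (abs_nonneg _)] at this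
            rw [indicator_of_mem hx]
            exact this
          · simp only [S, mem_union, not_or] at hx
            have a1 := image_eq_zero_of_notMem_tsupport hx.1
            have a2 := image_eq_zero_of_notMem_tsupport hx.2
            rw [a1, a2, mul_zero, P.Q_zero]
            have : 0 ≤ S.indicator (fun _ => 2 * ε ^ (q / 2)) x := indicator_nonneg (fun _ _ => bp) x
            positivity
      _ = _ := by
          rw [integral_const_mul, integral_add i12 i3, integral_add i1 i2, integral_indicator hS.measurableSet,
            integral_const_mul, integral_const_mul, setIntegral_const, smul_eq_mul]
          ring
  have lim : JJ T e e' f g ≤ A * (c ^ p * (∫ x, |f x| ^ p) + c ^ q * (∫ x, |g x| ^ q) + 2 * R0 ^ (q / 2) * volume.real S) := by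
    refine ge_of_tendsto (x := 𝓝[>] R0) (f := fun ε : ℝ => A * (c ^ p * (∫ x, |f x| ^ p) + c ^ q * (∫ x, |g x| ^ q) + 2 * ε ^ (q / 2) * volume.real S))
      (Tendsto.mono_left (Continuous.tendsto ?_ 0) nhdsWithin_le_nhds) ?_
    · have : Continuous fun ε : ℝ => ε ^ (q / 2) := Continuous.rpow_const continuous_id fun x => Or.inr bp
      fun_prop
    · filter_upwards [self_mem_nhdsWithin] with ε hε using main ε hε
  rw [Real.zero_rpow bp] at lim
  have n1 : 0 ≤ ∫ x, |f x| ^ p := integral_nonneg fp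
  have n2 : 0 ≤ ∫ x, |g x| ^ q := integral_nonneg fp
  have hcp : 0 ≤ c ^ p := bp
  have hcq : 0 ≤ c ^ q := bp
  have z1 := mul_nonneg hA0.le (mul_nonneg hcq n1)
  have z2 := mul_nonneg hA0.le (mul_nonneg hcp n2)
  have z3 := mul_nonneg hA0.le n1
  have z4 := mul_nonneg hA0.le n2
  linarith

theorem Sr_cmul (r l : ℝ) (f : F2) (x : P2) : Sr r (fun y => l * f y) x = l * Sr r f x := by
  simp [Sr, cv, integral_const_mul]

theorem JJ_scale (T : ℝ) (e e' : P2) {f g : F2} (hf : TF f) (hg : TF g) {l k : ℝ} (hl : 0 ≤ l) (hk : 0 ≤ k) :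
    JJ T e e' (fun x => l * f x) (fun x => k * g x) = l * k * JJ T e e' f g := by
  simp only [JJ, dd_cmul hf.diff, dd_cmul hg.diff, Sr_cmul]
  rw [← integral_const_mul]; congr 1; funext r
  rw [mul_left_comm]; congr 1; rw [← integral_const_mul]; congr 1; funext x
  rw [abs_mul, abs_mul, abs_of_nonneg hl, abs_of_nonneg hk]; ring

theorem TF.cmul {f : F2} (hf : TF f) (l : ℝ) : TF fun x => l * f x :=
  ⟨contDiff_const.mul hf.1, hf.2.mul_left⟩

theorem JJ_le1 {p q : ℝ} (hpq : p.HolderConjugate q) (hp2 : p ≤ 2) : ∃ C, 0 < C ∧ ∀ (T : ℝ), 0 ≤ T → ∀ (f g : F2), TF f → TF g →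
    ∀ e e', unitv e → unitv e' → JJ T e e' f g ≤ C * ((∫ x, |f x| ^ p) ^ (1 / p) * (∫ x, |g x| ^ q) ^ (1 / q)) := by
  obtain ⟨C, hC, H⟩ := JJ_le0 hpq hp2
  have hp1 := hpq.lt; have hq1 := hpq.symm.lt
  refine ⟨2 * C, by positivity, fun T hT f g hf hg e e' he he' => ?_⟩
  have n1 : 0 ≤ ∫ x, |f x| ^ p := integral_nonneg fp
  have n2 : 0 ≤ ∫ x, |g x| ^ q := integral_nonneg fp
  have norm : ∀ {p : ℝ} {h : F2}, 1 < p → ∀ δ : ℝ, 0 < δ → ∫ x, |((∫ x, |h x| ^ p) ^ (1 / p) + δ)⁻¹ * h x| ^ p ≤ 1 := by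
    intro p h hp δ hδ
    have n : 0 ≤ ∫ x, |h x| ^ p := integral_nonneg fp
    set a := (∫ x, |h x| ^ p) ^ (1 / p) with ha
    have ha0 : 0 ≤ a := bp
    have hpow : ∫ x, |h x| ^ p = a ^ p := by rw [ha, ← Real.rpow_mul n, one_div_mul_cancel bL, Real.rpow_one]
    simp only [abs_mul, abs_of_nonneg (by positivity : 0 ≤ (a + δ)⁻¹), Real.mul_rpow (by positivity : 0 ≤ (a + δ)⁻¹) (abs_nonneg _)]
    rw [integral_const_mul, hpow, ← Real.mul_rpow bp ha0]
    refine Real.rpow_le_one bp ?_ bL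
    rw [inv_mul_le_iff₀ bp]; linarith
  have main : ∀ δ : ℝ, 0 < δ → JJ T e e' f g ≤ 2 * C * (((∫ x, |f x| ^ p) ^ (1 / p) + δ) * ((∫ x, |g x| ^ q) ^ (1 / q) + δ)) := by
    intro δ hδ
    set a := (∫ x, |f x| ^ p) ^ (1 / p) with ha
    set b := (∫ x, |g x| ^ q) ^ (1 / q) with hb
    have ha0 : 0 ≤ a := bp
    have hb0 : 0 ≤ b := bp
    have h := H T hT _ _ (hf.cmul (a + δ)⁻¹) (hg.cmul (b + δ)⁻¹) e e' he he'
    rw [JJ_scale T e e' hf hg bp bp] at h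
    have i1 := mlL (norm hp1 δ hδ (h := f)) hC.le
    have i2 := mlL (norm hq1 δ hδ (h := g)) hC.le
    have : (a + δ)⁻¹ * (b + δ)⁻¹ * JJ T e e' f g ≤ 2 * C := bL
    rw [← mul_inv, inv_mul_le_iff₀ bp] at this
    linarith
  have lim := ge_of_tendsto (x := 𝓝[>] R0) (f := fun δ : ℝ => 2 * C * (((∫ x, |f x| ^ p) ^ (1 / p) + δ) * ((∫ x, |g x| ^ q) ^ (1 / q) + δ)))
      (Tendsto.mono_left (Continuous.tendsto bf 0) nhdsWithin_le_nhds)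
      (by filter_upwards [self_mem_nhdsWithin] with ε hε using main ε hε)
  simpa using lim

theorem JJ_le {p q : ℝ} (hpq : p.HolderConjugate q) : ∃ C, 0 < C ∧ ∀ (T : ℝ), 0 ≤ T → ∀ (f g : F2), TF f → TF g →
    ∀ e e', unitv e → unitv e' → JJ T e e' f g ≤ C * ((∫ x, |f x| ^ p) ^ (1 / p) * (∫ x, |g x| ^ q) ^ (1 / q)) := by
  rcases le_total p 2 with h | h
  · exact JJ_le1 hpq h
  · have hq : q ≤ 2 := by
      have := hpq.mul_eq_add; have := hpq.lt; have := hpq.symm.lt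
      nlinarith
    obtain ⟨C, hC, H⟩ := JJ_le1 hpq.symm hq
    refine ⟨C, hC, fun T hT f g hf hg e e' he he' => ?_⟩
    have := H T hT g f hg hf e' e he' he
    rw [mul_comm ((∫ x, |g x| ^ q) ^ (1 / q))] at this
    simpa [JJ, mul_comm] using this

theorem NT_cd (T : ℝ) {f : F2} (hf : TF f) : ContDiff ℝ ∞ (NT T f) := cv_cd Nm hf
theorem NT_dd (T : ℝ) {f : F2} (hf : TF f) (e : P2) : dd e (NT T f) = NT T (dd e f) := dd_cv Nm hf e

theorem NT_pair (T : ℝ) {g f : F2} (hg : TF g) (hf : TF f) (e e' : P2) :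
    |∫ x, g x * dd e (dd e' (NT T f)) x| ≤ JJ T e e' g f := by
  rw [NT_dd T hf, NT_dd T (hf.dd e')]
  obtain ⟨C, -, hC⟩ := cs_bdd hg.cont hg.2
  set h := dd e (dd e' f)
  have hh : TF h := (hf.dd e').dd e
  have hK : ∀ r, ∫ x, g x * Kr r h x = - ∫ x, Sr r (dd e g) x * Sr r (dd e' f) x := by
    intro r
    rw [← Sr_adj hg hh]
    have c1 : ∀ {h}, TF h → ContDiff ℝ 1 (Sr r h) := fun hh => (Sr_cd r hh).of_le bs
    have cd := (c1 hg).mul (c1 (hf.dd e'))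
    have dW : dd e (fun x => Sr r g x * Sr r (dd e' f) x) = fun x => Sr r (dd e g) x * Sr r (dd e' f) x + Sr r g x * Sr r h x := by
      rw [dd_mul ((c1 hg).differentiable bn) ((c1 (hf.dd e')).differentiable bn), Sr_dd r hg, Sr_dd r (hf.dd e')]
    obtain ⟨A, -, hA⟩ := Sr_bdd hg
    obtain ⟨B, -, hB⟩ := Sr_bdd (hg.dd e)
    have i1 := int_bdd_mul (Sr_cont r (hg.dd e)) (hB r) (Sr_L1 r (hf.dd e')).1
    have i2 := int_bdd_mul (Sr_cont r hg) (hA r) (Sr_L1 r hh).1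
    have i3 := int_bdd_mul (Sr_cont r hg) (hA r) (Sr_L1 r (hf.dd e')).1
    have h0 := int_dd_zero cd e i3 (by rw [dW]; exact i1.add i2)
    rw [dW, integral_add i1 i2] at h0; linarith
  have hF : ∫ x, g x * NT T h x = ∫ r in Ioc 0 T, r * ∫ x, g x * Kr r h x := by
    have e1 : ∫ x, g x * NT T h x = ∫ x, ∫ r in Ioc 0 T, r * (g x * Kr r h x) := by
      congr 1; funext x; rw [NT_eq T hh, ← integral_const_mul]; congr 1; funext r; ring
    rw [e1, integral_integral_swap]
    · simp only [integral_const_mul]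
    · have cK := Kr_joint hh
      have cont : Continuous (Function.uncurry fun (x : P2) (r : ℝ) => r * (g x * Kr r h x)) := by
        have := hg.cont
        have h2 : Continuous fun z : P2 × ℝ => Kr z.2 h z.1 := cK.comp (by fun_prop : Continuous fun z : P2 × ℝ => (z.2, z.1))
        simp only [Function.uncurry_def]; fun_prop
      have : IntegrableOn (Function.uncurry fun (x : P2) (r : ℝ) => r * (g x * Kr r h x)) (tsupport g ×ˢ Icc 0 T) (volume.prod volume) :=
        cont.continuousOn.integrableOn_compact (hg.2.isCompact.prod isCompact_Icc)
      have h3 : IntegrableOn (Function.uncurry fun (x : P2) (r : ℝ) => r * (g x * Kr r h x)) (univ ×ˢ Ioc 0 T) (volume.prod volume) := by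
        have h4 := this.mono_set (prod_mono_right Ioc_subset_Icc_self)
        refine IntegrableOn.of_forall_sdiff_eq_zero h4 (MeasurableSet.univ.prod measurableSet_Ioc) fun z hz => ?_
        have : z.1 ∉ tsupport g := fun h => hz.2 ⟨h, hz.1.2⟩
        simp [Function.uncurry, image_eq_zero_of_notMem_tsupport this]
      rw [IntegrableOn, ← Measure.prod_restrict, Measure.restrict_univ] at h3
      exact h3
  show |∫ x, g x * NT T h x| ≤ _
  rw [hF, JJ]
  have intJ : IntegrableOn (fun r => r * ∫ x, |Sr r (dd e g) x| * |Sr r (dd e' f) x|) (Ioc 0 T) := by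
    obtain ⟨B, hB0, hB⟩ := Sr_bdd (hg.dd e)
    have c1 := Sr_joint (hg.dd e); have c2 := Sr_joint (hf.dd e')
    have hm : StronglyMeasurable fun r => ∫ x, |Sr r (dd e g) x| * |Sr r (dd e' f) x| :=
      StronglyMeasurable.integral_prod_right' (f := fun z : ℝ × P2 => |Sr z.1 (dd e g) z.2| * |Sr z.1 (dd e' f) z.2|)
        (by have : Continuous (fun z : ℝ × P2 => |Sr z.1 (dd e g) z.2| * |Sr z.1 (dd e' f) z.2|) := bf
            exact this.stronglyMeasurable)
    refine Integrable.of_bound (C := T * (B * (gm.real univ * ∫ x, |dd e' f x|))) ((continuous_id.stronglyMeasurable.mul hm).aestronglyMeasurable) ?_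
    rw [ae_restrict_iff' measurableSet_Ioc]
    refine Ef fun r hr => ?_
    have n0 : 0 ≤ ∫ x, |Sr r (dd e g) x| * |Sr r (dd e' f) x| := integral_nonneg fp
    rw [Real.norm_of_nonneg (mul_nonneg hr.1.le n0)]
    refine mul_le_mul hr.2 ?_ n0 (hr.1.le.trans hr.2)
    have L := Sr_L1 r (hf.dd e')
    calc _ ≤ ∫ x, B * |Sr r (dd e' f) x| := integral_mono_of_nonneg (Ef fp) (L.1.abs.const_mul B)
            (Ef fun x => mlR (hB r x) (abs_nonneg _))
      _ ≤ _ := by rw [integral_const_mul]; exact mlL L.2 hB0.le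
  refine abs_integral_le_integral_abs.trans (integral_mono_of_nonneg (Ef fun r => abs_nonneg _) intJ ?_)
  rw [EventuallyLE, ae_restrict_iff' measurableSet_Ioc]
  refine Ef fun r hr => ?_
  rw [abs_mul, abs_of_pos hr.1, hK, abs_neg]
  refine mlL (abs_integral_le_integral_abs.trans ?_) hr.1.le
  exact le_of_eq (by congr 1; funext x; exact abs_mul _ _)

theorem NT_Lq {p q : ℝ} (hpq : p.HolderConjugate q) : ∃ C, 0 < C ∧ ∀ (T : ℝ), 0 ≤ T → ∀ (f : F2), TF f →
    ∀ e e', unitv e → unitv e' → Integrable (fun x => |dd e (dd e' (NT T f)) x| ^ q) ∧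
      ∫ x, |dd e (dd e' (NT T f)) x| ^ q ≤ (C * (∫ x, |f x| ^ q) ^ (1 / q)) ^ q := by
  obtain ⟨C, hC, H⟩ := JJ_le hpq
  refine ⟨C, hC, fun T hT f hf e e' he he' => ?_⟩
  have hq := hpq.symm.lt
  have n0 : 0 ≤ ∫ x, |f x| ^ q := integral_nonneg fp
  have hv : Continuous (dd e (dd e' (NT T f))) := by
    rw [NT_dd T hf, NT_dd T (hf.dd e')]; exact (NT_cd T ((hf.dd e').dd e)).continuous
  have := dual_bound hpq (M := C * (∫ x, |f x| ^ q) ^ (1 / q)) bp hv isOpen_univ (fun n : ℕ => Metric.closedBall (0 : P2) n)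
    (fun m n h => Metric.closedBall_subset_closedBall (by exact_mod_cast h)) (fun n => isCompact_closedBall _ _)
    (Metric.iUnion_closedBall_nat 0) (fun Θ hΘ _ => by
      have h1 := (NT_pair T hΘ hf e e').trans (H T hT Θ f hΘ hf e e' he he')
      simp only [mul_comm (dd e (dd e' (NT T f)) _)]
      linarith)
  simpa [IntegrableOn] using this

def bt (v : P2) : ℝ := 1 - (v.1 ^ 2 + v.2 ^ 2)
def bM (v : P2) : ℝ := expNegInvGlue (bt v)
def bm (v : P2) : ℝ := 2 * ((bt v)⁻¹ ^ 2 * expNegInvGlue (bt v))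

theorem bt_box {v : P2} (h : 0 < bt v) : v ∈ Icc (-1 : ℝ) 1 ×ˢ Icc (-1 : ℝ) 1 := by
  simp only [bt] at h
  exact ⟨abs_le.1 (abs_le_one_iff_mul_self_le_one.2 (by nlinarith [sq_nonneg v.2])), abs_le.1 (abs_le_one_iff_mul_self_le_one.2 (by nlinarith [sq_nonneg v.1]))⟩

theorem box_cs {f : F2} (h : ∀ v, bt v ≤ 0 → f v = 0) : HasCompactSupport f :=
  HasCompactSupport.intro (isCompact_Icc.prod isCompact_Icc : IsCompact (Icc (-1 : ℝ) 1 ×ˢ Icc (-1 : ℝ) 1)) fun v hv =>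
    h v (not_lt.1 fun h' => hv (bt_box h'))

theorem bM_tf : TF bM := by
  refine ⟨expNegInvGlue.contDiff.comp (by unfold bt; fun_prop), box_cs fun v h => expNegInvGlue.zero_of_nonpos h⟩

theorem bm_tf : TF bm := by
  refine ⟨contDiff_const.mul ?_, box_cs fun v h => by simp [bm, expNegInvGlue.zero_of_nonpos h]⟩
  have := (expNegInvGlue.contDiff_polynomial_eval_inv_mul (n := ⊤) (Polynomial.X ^ 2)).comp (by unfold bt; fun_prop : ContDiff ℝ ∞ bt)
  simpa [Function.comp_def] using this

theorem dd_bM (e v : P2) : dd e bM v = -(v.1 * e.1 + v.2 * e.2) * bm v := by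
  have h1 := (expNegInvGlue.hasDerivAt_polynomial_eval_inv_mul 1 (bt v))
  simp only [Polynomial.eval_one, one_mul, Polynomial.derivative_one, sub_zero, mul_one, Polynomial.eval_pow, Polynomial.eval_X] at h1
  have h2 : HasFDerivAt bt (-(((2 : ℕ) * v.1 ^ 1) • ContinuousLinearMap.fst ℝ ℝ ℝ + ((2 : ℕ) * v.2 ^ 1) • ContinuousLinearMap.snd ℝ ℝ ℝ)) v := by
    have := ((hasFDerivAt_fst (𝕜 := ℝ) (p := v)).pow 2).add ((hasFDerivAt_snd (𝕜 := ℝ) (p := v)).pow 2)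
    refine (this.const_sub 1).congr_fderiv ?_
    simp
  have h3 := h1.comp_hasFDerivAt v h2
  rw [dd, show bM = (fun x => expNegInvGlue x) ∘ bt from rfl, h3.fderiv]
  simp [bm]; ring

theorem bm_nonneg (v : P2) : 0 ≤ bm v := by
  have := expNegInvGlue.nonneg (bt v); unfold bm; positivity

theorem bM_nonneg (v : P2) : 0 ≤ bM v := expNegInvGlue.nonneg (bt v)

def cm : ℝ := ∫ v, bm v

theorem cm_pos : 0 < cm := by
  refine bm_tf.cont.integral_pos_of_hasCompactSupport_nonneg_nonzero bm_tf.2 bm_nonneg (x := 0) ?_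
  have := expNegInvGlue.pos_of_pos (zero_lt_one)
  simp [bm, bt, this.ne']

theorem bM_box {v : P2} (h : bM v ≠ 0) : 0 < bt v := not_le.1 fun h' => h (expNegInvGlue.zero_of_nonpos h')

theorem dd_sh {g : F2} (hg : Differentiable ℝ g) (e z : P2) (s : ℝ) : dd e (fun v => g (z + s • v)) = fun v => s * dd e g (z + s • v) := by
  have := dd_aff hg s z.1 s z.2 e
  have h : ∀ v : P2, aff s z.1 s z.2 v = z + s • v := fun v => by simp [aff, Prod.ext_iff, add_comm]
  simp only [h] at this
  rw [this]; funext v; rw [← dd_smul]; rfl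

theorem int_cs {f g : F2} (hf : TF f) (hg : Continuous g) : Integrable fun v => f v * g v :=
  (hf.cont.mul hg).integrable_of_hasCompactSupport hf.2.mul_right

theorem ibp_cs {f g : F2} (hf : TF f) (hg : ContDiff ℝ 1 g) (e z : P2) (s : ℝ) :
    ∫ v, dd e f v * g (z + s • v) = - (s * ∫ v, f v * dd e g (z + s • v)) := by
  have cg : ContDiff ℝ 1 fun v => g (z + s • v) := hg.comp bf
  have cW : ContDiff ℝ 1 (fun v => f v * g (z + s • v)) := (hf.1.of_le bs).mul cg
  have d := dd_mul hf.diff (cg.differentiable bn) e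
  rw [dd_sh (hg.differentiable bn)] at d
  have c1 := dd_cont e hg
  have i1 := int_cs (hf.dd e) cg.continuous
  have i2 : Integrable fun v => f v * (s * dd e g (z + s • v)) := int_cs hf bf
  have h0 := int_dd_zero cW e (int_cs hf cg.continuous) (by rw [d]; exact i1.add i2)
  rw [d, integral_add i1 i2] at h0
  rw [← integral_const_mul]
  have : ∫ v, s * (f v * dd e g (z + s • v)) = ∫ v, f v * (s * dd e g (z + s • v)) := by congr 1; funext v; ring
  rw [this]; linarith

theorem dd_lin (g : F2) (v x : P2) : dd v g x = v.1 * dd Ex g x + v.2 * dd Ey g x := by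
  simp only [dd, ← smul_eq_mul, ← map_smul, ← map_add]; congr 1; simp

theorem mv {h : F2} (hh : ContDiff ℝ 2 h) {s ε : ℝ} (hs : 0 ≤ s) (z : P2)
    (hl : ∀ σ ∈ Icc 0 s, ∀ v, 0 < bt v → |lap h (z + σ • v)| ≤ ε) :
    |(∫ v, bm v * h (z + s • v)) - cm * h z| ≤ s * (s * (ε * ∫ v, bM v)) := by
  have h1 : ContDiff ℝ 1 h := hh.of_le bn
  have hd := h1.differentiable bn
  have c1 := dd_cont Ex h1
  have c2 := dd_cont Ey h1
  have ch := hh.continuous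
  have cdd : Continuous fun w : P2 × P2 => dd w.1 h w.2 := by
    rw [show (fun w : P2 × P2 => dd w.1 h w.2) = fun w => w.1.1 * dd Ex h w.2 + w.1.2 * dd Ey h w.2 from funext fun w => dd_lin h w.1 w.2]; fun_prop
  have d1 : ∀ e, ContDiff ℝ 1 (dd e h) := fun e => dd_cd e hh bn
  have cl : Continuous (lap h) := by
    have a := dd_cont Ex (d1 Ex); have b := dd_cont Ey (d1 Ey)
    unfold lap; fun_prop
  have step : ∀ σ : ℝ, ∫ v, bm v * dd v h (z + σ • v) = σ * ∫ v, bM v * lap h (z + σ • v) := by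
    intro σ
    have i1 := ibp_cs bM_tf (d1 Ex) Ex z σ
    have i2 := ibp_cs bM_tf (d1 Ey) Ey z σ
    have cc : ∀ e e', Continuous (dd e (dd e' h)) := fun e e' => dd_cont e (d1 e')
    have c3 := cc Ex Ex; have c4 := cc Ey Ey
    have e1 : ∫ v, bM v * lap h (z + σ • v) = (∫ v, bM v * dd Ex (dd Ex h) (z + σ • v)) + ∫ v, bM v * dd Ey (dd Ey h) (z + σ • v) := by
      rw [← integral_add (int_cs bM_tf bf) (int_cs bM_tf bf)]
      congr 1; funext v; rw [lap]; ring
    have e2 : ∫ v, bm v * dd v h (z + σ • v) = -((∫ v, dd Ex bM v * dd Ex h (z + σ • v)) + ∫ v, dd Ey bM v * dd Ey h (z + σ • v)) := by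
      rw [← integral_add (int_cs (bM_tf.dd _) bf) (int_cs (bM_tf.dd _) bf), ← integral_neg]
      congr 1; funext v; rw [dd_bM, dd_bM, dd_lin h v]; ring
    rw [e1, e2, i1, i2]; ring
  have e0 : (∫ v, bm v * h (z + s • v)) - cm * h z = ∫ v, ∫ σ in Ioc 0 s, bm v * dd v h (z + σ • v) := by
    rw [cm, ← integral_mul_const, ← integral_sub (int_cs bm_tf bf) (bm_tf.int.mul_const _)]
    congr 1; funext v
    rw [integral_const_mul, ← mul_sub, ← intervalIntegral.integral_of_le hs,
      intervalIntegral.integral_eq_sub_of_hasDerivAt (fun t _ => dd_hda hd v z t)]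
    · simp
    · exact Continuous.intervalIntegrable (cdd.comp (by fun_prop : Continuous fun σ : ℝ => (v, z + σ • v))) _ _
  have sw : ∫ v, ∫ σ in Ioc 0 s, bm v * dd v h (z + σ • v) = ∫ σ in Ioc 0 s, ∫ v, bm v * dd v h (z + σ • v) := by
    rw [integral_integral_swap]
    have cont : Continuous (Function.uncurry fun (v : P2) (σ : ℝ) => bm v * dd v h (z + σ • v)) := by
      have := bm_tf.cont
      have h2 := cdd.comp (by fun_prop : Continuous fun w : P2 × ℝ => (w.1, z + w.2 • w.1))
      simp only [Function.comp_def] at h2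
      simp only [Function.uncurry_def]; fun_prop
    have : IntegrableOn (Function.uncurry fun (v : P2) (σ : ℝ) => bm v * dd v h (z + σ • v)) (tsupport bm ×ˢ Icc 0 s) (volume.prod volume) :=
      cont.continuousOn.integrableOn_compact (bm_tf.2.isCompact.prod isCompact_Icc)
    have h3 : IntegrableOn (Function.uncurry fun (v : P2) (σ : ℝ) => bm v * dd v h (z + σ • v)) (univ ×ˢ Ioc 0 s) (volume.prod volume) := by
      have h4 := this.mono_set (prod_mono_right Ioc_subset_Icc_self)
      refine IntegrableOn.of_forall_sdiff_eq_zero h4 (MeasurableSet.univ.prod measurableSet_Ioc) fun z hz => ?_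
      have : z.1 ∉ tsupport bm := fun h => hz.2 ⟨h, hz.1.2⟩
      simp [Function.uncurry, image_eq_zero_of_notMem_tsupport this]
    rw [IntegrableOn, ← Measure.prod_restrict, Measure.restrict_univ] at h3
    exact h3
  rw [e0, sw, ← intervalIntegral.integral_of_le hs, ← Real.norm_eq_abs]
  simp only [step]
  have := intervalIntegral.norm_integral_le_of_norm_le_const (a := 0) (b := s) (C := s * (ε * ∫ v, bM v)) (f := fun σ => σ * ∫ v, bM v * lap h (z + σ • v)) (fun σ hσ => ?_)
  · rw [sub_zero, abs_of_nonneg hs] at this; linarith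
  · rw [uIoc_of_le hs] at hσ
    rw [norm_mul, Real.norm_of_nonneg hσ.1.le]
    refine mul_le_mul hσ.2 ?_ (norm_nonneg _) hs
    rw [← integral_const_mul]
    refine norm_integral_le_of_norm_le (bM_tf.int.const_mul ε) (Ef fun v => ?_)
    rw [norm_mul, Real.norm_of_nonneg (bM_nonneg v), Real.norm_eq_abs, mul_comm]
    by_cases hb : bM v = 0
    · simp [hb]
    · exact mlR (hl σ ⟨hσ.1.le, hσ.2⟩ v (bM_box hb)) (bM_nonneg v)

theorem mv_grad {h : F2} (hh : ContDiff ℝ 3 h) (e : P2) {s ε : ℝ} (hs : 0 < s) (z : P2)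
    (hl : ∀ σ ∈ Icc 0 s, ∀ v, 0 < bt v → |lap (dd e h) (z + σ • v)| ≤ ε) :
    cm * (s * |dd e h z|) ≤ (∫ v, |dd e bm v| * |h (z + s • v)|) + s * (s * (s * (ε * ∫ v, bM v))) := by
  have m := mv (dd_cd e hh bn) hs.le z hl
  have i := ibp_cs bm_tf (hh.of_le bn) e z s
  have i2 : |∫ v, dd e bm v * h (z + s • v)| ≤ ∫ v, |dd e bm v| * |h (z + s • v)| := by
    refine abs_integral_le_integral_abs.trans (le_of_eq (by congr 1; funext v; exact abs_mul _ _))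
  rw [i, abs_neg, abs_mul, abs_of_pos hs] at i2
  have tri := abs_sub_abs_le_abs_sub (cm * dd e h z) (∫ v, bm v * dd e h (z + s • v))
  rw [abs_sub_comm, abs_mul, abs_of_pos cm_pos] at tri
  have := mlL (tri.trans m) hs.le
  linarith

theorem cs_rpow_int {f : F2} (hf : Continuous f) (hc : HasCompactSupport f) {p : ℝ} (hp : 0 < p) : Integrable fun x => |f x| ^ p := by
  refine Continuous.integrable_of_hasCompactSupport (Continuous.rpow_const bf fun x => Or.inr hp.le) ?_
  refine hc.of_isClosed_subset (isClosed_tsupport _) (closure_mono fun x hx => ?_)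
  intro h0; apply hx; simp [h0, hp.ne']

theorem holder {α : Type*} [MeasurableSpace α] {ν : Measure α} {p q : ℝ} (hpq : p.HolderConjugate q) {f g : α → ℝ}
    (mf : AEStronglyMeasurable f ν) (mg : AEStronglyMeasurable g ν) (hf : Integrable (fun x => |f x| ^ p) ν) (hg : Integrable (fun x => |g x| ^ q) ν) :
    Integrable (fun x => |f x| * |g x|) ν ∧ ∫ x, |f x| * |g x| ∂ν ≤ (∫ x, |f x| ^ p ∂ν) ^ (1 / p) * (∫ x, |g x| ^ q ∂ν) ^ (1 / q) := by
  have M : ∀ {p : ℝ} {f : α → ℝ}, 0 < p → AEStronglyMeasurable f ν → Integrable (fun x => |f x| ^ p) ν → MemLp f (ENNReal.ofReal p) ν := by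
    intro p f hp mf hf
    refine (integrable_norm_rpow_iff mf (by simpa using hp) bs).1 ?_
    simpa [ENNReal.toReal_ofReal hp.le] using hf
  have Mf := (M hpq.pos mf hf).abs
  have Mg := (M hpq.symm.pos mg hg).abs
  haveI := hpq.ennrealOfReal
  exact ⟨Mf.integrable_mul Mg, integral_mul_le_Lp_mul_Lq_of_nonneg hpq (Ef fun x => abs_nonneg _) (Ef fun x => abs_nonneg _) Mf Mg⟩

def shr (v : P2) (x : P2) : P2 := (-x.1 + x.1 / 2 * v.1, x.2 + x.1 / 2 * v.2)

theorem shr_int {v : P2} (hv : v.1 ≤ 1) {g : F2} (hg : Continuous g) (h0 : ∀ x, 0 ≤ g x) (hi : Integrable g) :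
    Integrable (fun x => g (shr v x)) ∧ ∫ x, g (shr v x) ≤ 2 * ∫ x, g x := by
  let L : P2 →ₗ[ℝ] P2 := Matrix.toLin (Module.Basis.finTwoProd ℝ) (Module.Basis.finTwoProd ℝ) !![-(1 - v.1 / 2), 0; v.2 / 2, 1]
  have hL : ∀ x, L x = shr v x := fun x => by
    rw [show x = (x.1, x.2) from rfl, Matrix.toLin_finTwoProd_apply]; simp only [shr, Prod.mk.injEq]; constructor <;> ring
  have hdet : LinearMap.det L = -(1 - v.1 / 2) := by
    rw [LinearMap.det_toLin, Matrix.det_fin_two_of]; ring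
  have hm := Measure.map_linearMap_addHaar_eq_smul_addHaar (μ := (volume : Measure P2)) (f := L) (by rw [hdet]; linarith)
  have cL : Continuous L := LinearMap.continuous_of_finiteDimensional L
  have e : (fun x => g (shr v x)) = g ∘ L := by funext x; simp [hL]
  have hb : |(LinearMap.det L)⁻¹| ≤ 2 := by
    rw [hdet, inv_neg, abs_neg, abs_of_pos (inv_pos.2 bL), inv_le_comm₀ bL bn]; linarith
  constructor
  · rw [e, ← integrable_map_measure hg.aestronglyMeasurable cL.aemeasurable, hm]
    exact hi.smul_measure bs
  · have : ∫ x, g (shr v x) = ∫ x, g x ∂(Measure.map L volume) := by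
      rw [integral_map cL.aemeasurable hg.aestronglyMeasurable]; simp only [hL]
    rw [this, hm, integral_smul_measure, ENNReal.toReal_ofReal (abs_nonneg _), smul_eq_mul]
    exact mlR hb (integral_nonneg h0)

theorem pairL {p q : ℝ} (hpq : p.HolderConjugate q) : ∃ C, 0 < C ∧ ∀ (h b : F2) (e : P2) (ε : ℝ), unitv e → ContDiff ℝ 3 h →
    Integrable (fun x => |h x| ^ p) → Continuous b → HasCompactSupport b → (∀ z : P2, z.1 < 0 → |lap (dd e h) z| ≤ ε) →
    ∫ x in QQ, |b x| * (x.1 * |dd e h (Rf x)|) ≤ C * ((∫ x in QQ, |b x| ^ q) ^ (1 / q) * (∫ x, |h x| ^ p) ^ (1 / p)) +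
      C * (ε * ∫ x in QQ, |b x| * x.1 ^ 3) := by
  have hp := hpq.lt; have hp0 := hpq.pos; have hq0 := hpq.symm.pos
  set A := (∫ v, |dd Ex bm v|) + ∫ v, |dd Ey bm v| with hA
  have n1 : 0 ≤ ∫ v, |dd Ex bm v| := integral_nonneg fun v => abs_nonneg _
  have n2 : 0 ≤ ∫ v, |dd Ey bm v| := integral_nonneg fun v => abs_nonneg _
  have n3 : 0 ≤ ∫ v, bM v := integral_nonneg fun v => bM_nonneg v
  have hA0 : 0 ≤ A := bp
  have hc := cm_pos
  refine ⟨4 / cm * A + 1 / cm * (∫ v, bM v) + 1, by positivity, fun h b e ε he hh hi hb hbc hl => ?_⟩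
  have hAe : ∫ v, |dd e bm v| ≤ A := by rcases he with rfl | rfl <;> linarith
  have hε : 0 ≤ ε := (abs_nonneg _).trans (hl (-1, 0) bn)
  have ch := hh.continuous
  have csh : Continuous fun w : P2 × P2 => shr w.2 w.1 := by unfold shr; fun_prop
  have cD := (bm_tf.dd e).cont
  -- pointwise
  have pt : ∀ x ∈ QQ, |b x| * (x.1 * |dd e h (Rf x)|) ≤ 2 / cm * (∫ v, |b x| * (|dd e bm v| * |h (shr v x)|)) + 1 / cm * (∫ v, bM v) * ε * (|b x| * x.1 ^ 3) := by
    intro x hx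
    have hx1 : 0 < x.1 := hx.1
    have := mv_grad hh e (s := x.1 / 2) (ε := ε) bL (Rf x) (fun σ hσ v hv => hl _ (by
      have := (bt_box hv).1
      simp only [Prod.fst_add, Prod.smul_fst, smul_eq_mul]
      nlinarith [this.2, hσ.1, hσ.2]))
    have e2 : ∀ v, ((Rf x) : P2) + (x.1 / 2) • v = shr v x := fun v => rfl
    simp only [e2] at this
    rw [integral_const_mul]
    set I := ∫ v, |dd e bm v| * |h (shr v x)|
    have h3 : x.1 * |dd e h (Rf x)| ≤ 2 / cm * I + 1 / cm * (∫ v, bM v) * ε * x.1 ^ 3 := by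
      rw [div_mul_eq_mul_div, div_mul_eq_mul_div, div_mul_eq_mul_div, div_mul_eq_mul_div, ← add_div, le_div_iff₀ hc]
      have : 0 ≤ x.1 ^ 3 * ε * ∫ v, bM v := bp
      linarith
    calc _ ≤ |b x| * (2 / cm * I + 1 / cm * (∫ v, bM v) * ε * x.1 ^ 3) := mlL h3 (abs_nonneg _)
      _ = _ := by ring
  have cF : Continuous fun w : P2 × P2 => |b w.1| * (|dd e bm w.2| * |h (shr w.2 w.1)|) := bf
  have iF : Integrable (fun w : P2 × P2 => |b w.1| * (|dd e bm w.2| * |h (shr w.2 w.1)|)) (volume.prod volume) := by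
    refine cF.integrable_of_hasCompactSupport (HasCompactSupport.intro (hbc.isCompact.prod (bm_tf.dd e).2.isCompact) fun w hw => ?_)
    by_cases h1 : w.1 ∈ tsupport b
    · have : w.2 ∉ tsupport (dd e bm) := fun h2 => hw ⟨h1, h2⟩
      simp [image_eq_zero_of_notMem_tsupport this]
    · simp [image_eq_zero_of_notMem_tsupport h1]
  have iF2 : Integrable (fun w : P2 × P2 => |b w.1| * (|dd e bm w.2| * |h (shr w.2 w.1)|)) ((volume.restrict QQ).prod volume) := by
    rw [← Measure.restrict_univ (μ := (volume : Measure P2)), Measure.restrict_restrict_of_subset (subset_univ _), Measure.prod_restrict]; exact iF.integrableOn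
  have i3 : Integrable (fun x : P2 => |b x| * x.1 ^ 3) := by
    refine Continuous.integrable_of_hasCompactSupport bf (HasCompactSupport.mul_right (hbc.comp_left (g := abs) abs_zero))
  have i3' : IntegrableOn (fun x : P2 => |b x| * x.1 ^ 3) QQ := i3.integrableOn
  have i1 : IntegrableOn (fun x => ∫ v, |b x| * (|dd e bm v| * |h (shr v x)|)) QQ := iF2.integral_prod_left
  have n4 : 0 ≤ ∫ x in QQ, |b x| * x.1 ^ 3 := setIntegral_nonneg QQ_meas fun x hx => by have : 0 < x.1 := hx.1; positivity
  set Nb := (∫ x in QQ, |b x| ^ q) ^ (1 / q) with hNb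
  set Nh := (∫ x, |h x| ^ p) ^ (1 / p) with hNh
  have nb : 0 ≤ ∫ x in QQ, |b x| ^ q := integral_nonneg fp
  have nh : 0 ≤ ∫ x, |h x| ^ p := integral_nonneg fp
  have hNb0 : 0 ≤ Nb := bp
  have hNh0 : 0 ≤ Nh := bp
  have key : ∀ v, ∫ x in QQ, |b x| * (|dd e bm v| * |h (shr v x)|) ≤ |dd e bm v| * (2 * (Nb * Nh)) := by
    intro v
    by_cases hv : v ∈ tsupport (dd e bm)
    · have hv1 : v.1 ≤ 1 := by
        have s1 : tsupport (dd e bm) ⊆ Icc (-1 : ℝ) 1 ×ˢ Icc (-1 : ℝ) 1 :=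
          (tsupport_fderiv_apply_subset ℝ e).trans (closure_minimal (fun w hw => by
            refine bt_box (not_le.1 fun h' => hw ?_); simp [bm, expNegInvGlue.zero_of_nonpos h']) (isClosed_Icc.prod isClosed_Icc))
        exact (s1 hv).1.2
      have S := shr_int hv1 (g := fun x => |h x| ^ p) (Continuous.rpow_const bf fun x => Or.inr hp0.le) (fp) hi
      have cs : Continuous (shr v) := by unfold shr; fun_prop
      have H := (holder hpq.symm (ν := volume.restrict QQ) (f := b) (g := fun x => h (shr v x)) hb.aestronglyMeasurable (ch.comp cs).aestronglyMeasurable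
        (cs_rpow_int hb hbc hq0).integrableOn S.1.integrableOn).2
      have e1 : ∫ x in QQ, |b x| * (|dd e bm v| * |h (shr v x)|) = |dd e bm v| * ∫ x in QQ, |b x| * |h (shr v x)| := by
        rw [← integral_const_mul]; congr 1; funext x; ring
      rw [e1]
      refine mlL (H.trans ?_) (abs_nonneg _)
      rw [← hNb, mul_left_comm]
      refine mlL ?_ hNb0
      calc (∫ x in QQ, |h (shr v x)| ^ p) ^ (1 / p) ≤ (2 * ∫ x, |h x| ^ p) ^ (1 / p) := by
            refine Real.rpow_le_rpow (integral_nonneg fp) ((setIntegral_le_integral S.1 (Ef fp)).trans S.2) bp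
        _ = 2 ^ (1 / p) * Nh := Real.mul_rpow bn nh
        _ ≤ 2 * Nh := by
            refine mlR ?_ hNh0
            calc (2:ℝ) ^ (1 / p) ≤ 2 ^ (1:ℝ) := Real.rpow_le_rpow_of_exponent_le bn (by rw [div_le_one hp0]; exact hp.le)
              _ = 2 := Real.rpow_one _
    · simp [image_eq_zero_of_notMem_tsupport hv]
  have fin : ∫ x in QQ, ∫ v, |b x| * (|dd e bm v| * |h (shr v x)|) ≤ A * (2 * (Nb * Nh)) := by
    rw [integral_integral_swap iF2]
    calc _ ≤ ∫ v, |dd e bm v| * (2 * (Nb * Nh)) := integral_mono_of_nonneg (Ef fun v => integral_nonneg fp)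
            ((bm_tf.dd e).int.abs.mul_const _) (Ef key)
      _ ≤ _ := by rw [integral_mul_const]; exact mlR hAe bp
  calc _ ≤ ∫ x in QQ, (2 / cm * (∫ v, |b x| * (|dd e bm v| * |h (shr v x)|)) + 1 / cm * (∫ v, bM v) * ε * (|b x| * x.1 ^ 3)) := by
        refine integral_mono_of_nonneg ?_ ((i1.const_mul _).add (i3'.const_mul _)) ((ae_restrict_iff' QQ_meas).2 (Ef pt))
        refine (ae_restrict_iff' QQ_meas).2 (Ef fun x hx => ?_)
        have : 0 < x.1 := hx.1
        simp only [Pi.zero_apply]; positivity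
    _ = 2 / cm * (∫ x in QQ, ∫ v, |b x| * (|dd e bm v| * |h (shr v x)|)) + 1 / cm * (∫ v, bM v) * ε * ∫ x in QQ, |b x| * x.1 ^ 3 := by
        rw [integral_add (i1.const_mul _) (i3'.const_mul _), integral_const_mul, integral_const_mul]
    _ ≤ 2 / cm * (A * (2 * (Nb * Nh))) + 1 / cm * (∫ v, bM v) * ε * ∫ x in QQ, |b x| * x.1 ^ 3 := by
        have := mlL fin (by positivity : 0 ≤ 2 / cm); linarith
    _ ≤ _ := by
        have a1 : 0 ≤ (1 / cm * (∫ v, bM v) + 1) * (Nb * Nh) := bp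
        have a2 : 0 ≤ (4 / cm * A + 1) * (ε * ∫ x in QQ, |b x| * x.1 ^ 3) := bp
        have a3 : 2 / cm * (A * (2 * (Nb * Nh))) = 4 / cm * A * (Nb * Nh) := by ring
        rw [a3]; linarith

def ML (q : ℝ) (Ω : Set P2) (f : F2) : Prop := MemLp f (ENNReal.ofReal q) (volume.restrict Ω)

theorem ML_iff {q : ℝ} (hq : 1 < q) {Ω : Set P2} {f : F2} (hf : AEStronglyMeasurable f (volume.restrict Ω)) :
    ML q Ω f ↔ IntegrableOn (fun x => |f x| ^ q) Ω := by
  have := integrable_norm_rpow_iff (p := ENNReal.ofReal q) hf (by simp; linarith) bs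
  rw [ENNReal.toReal_ofReal bL] at this
  exact this.symm

theorem ML_int {q : ℝ} (hq : 1 < q) {Ω : Set P2} {f : F2} (hf : ML q Ω f) : IntegrableOn (fun x => |f x| ^ q) Ω := (ML_iff hq hf.1).1 hf

theorem ML_cs {q : ℝ} {Ω : Set P2} {f : F2} (hf : Continuous f) (hc : HasCompactSupport f) : ML q Ω f :=
  (hf.memLp_of_hasCompactSupport hc).restrict Ω

theorem ML_cpt {q : ℝ} {Ω : Set P2} (hΩ : IsCompact Ω) {f : F2} (hf : ContinuousOn f Ω) : ML q Ω f := by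
  obtain ⟨C, hC⟩ := hΩ.exists_bound_of_continuousOn hf
  haveI : IsFiniteMeasure (volume.restrict Ω) := ⟨by simpa using hΩ.measure_lt_top⟩
  exact MemLp.of_bound (hf.aestronglyMeasurable hΩ.measurableSet) C ((ae_restrict_iff' hΩ.measurableSet).2 (Ef hC))

theorem lq_eq {q : ℝ} (hq : 1 < q) {Ω : Set P2} {f : F2} (hf : ML q Ω f) :
    lqNorm q Ω f = (eLpNorm f (ENNReal.ofReal q) (volume.restrict Ω)).toReal := by
  rw [hf.eLpNorm_eq_integral_rpow_norm (by simp; linarith) bs, ENNReal.toReal_ofReal bp, ENNReal.toReal_ofReal bL]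
  simp [lqNorm]

theorem lq_nonneg (q : ℝ) (Ω : Set P2) (f : F2) : 0 ≤ lqNorm q Ω f :=
  Real.rpow_nonneg (integral_nonneg fp) _

theorem lq_add {q : ℝ} (hq : 1 < q) {Ω : Set P2} {f g : F2} (hf : ML q Ω f) (hg : ML q Ω g) :
    lqNorm q Ω (fun x => f x + g x) ≤ lqNorm q Ω f + lqNorm q Ω g := by
  rw [lq_eq hq hf, lq_eq hq hg, lq_eq hq (f := fun x => f x + g x) (hf.add hg), ← ENNReal.toReal_add hf.2.ne hg.2.ne]
  exact ENNReal.toReal_mono (ENNReal.add_ne_top.2 ⟨hf.2.ne, hg.2.ne⟩) (eLpNorm_add_le hf.1 hg.1 (by simpa using hq.le))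

theorem lq_mono {q : ℝ} (hq : 1 < q) {Ω : Set P2} (hΩ : MeasurableSet Ω) {f g : F2} (hg : ML q Ω g) (h : ∀ x ∈ Ω, |f x| ≤ |g x|) :
    lqNorm q Ω f ≤ lqNorm q Ω g := by
  refine Real.rpow_le_rpow (integral_nonneg fp) ?_ bp
  refine integral_mono_of_nonneg (Ef fp) (ML_int hq hg) ((ae_restrict_iff' hΩ).2 (Ef fun x hx => ?_))
  exact Real.rpow_le_rpow (abs_nonneg _) (h x hx) bL

theorem lq_cmul {q : ℝ} (hq : 1 < q) (Ω : Set P2) (c : ℝ) (f : F2) : lqNorm q Ω (fun x => c * f x) = |c| * lqNorm q Ω f := by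
  simp only [lqNorm, abs_mul, Real.mul_rpow (abs_nonneg _) (abs_nonneg _)]
  rw [integral_const_mul, Real.mul_rpow bp (integral_nonneg fp), ← Real.rpow_mul (abs_nonneg _), mul_one_div_cancel bL, Real.rpow_one]

theorem lq_sub_set {q : ℝ} (hq : 1 < q) {Ω Ω' : Set P2} {f : F2} (hf : ML q Ω' f) (h : Ω ⊆ Ω') : lqNorm q Ω f ≤ lqNorm q Ω' f := by
  refine Real.rpow_le_rpow (integral_nonneg fp) ?_ bp
  exact setIntegral_mono_set (ML_int hq hf) (Ef fp) h.eventuallyLE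

theorem lq_pow {q : ℝ} (hq : 1 < q) (Ω : Set P2) (f : F2) : lqNorm q Ω f ^ q = ∫ x in Ω, |f x| ^ q := by
  rw [lqNorm, ← Real.rpow_mul (integral_nonneg fp), one_div_mul_cancel bL, Real.rpow_one]

theorem lq_le {q : ℝ} (hq : 1 < q) {Ω : Set P2} {f : F2} {M : ℝ} (hM : 0 ≤ M) (h : ∫ x in Ω, |f x| ^ q ≤ M ^ q) : lqNorm q Ω f ≤ M := by
  rw [← lq_pow hq] at h
  exact (Real.rpow_le_rpow_iff (lq_nonneg _ _ _) hM bL).1 h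

theorem lq_holder {p q : ℝ} (hpq : p.HolderConjugate q) {Ω : Set P2} {f g : F2} (hf : ML p Ω f) (hg : ML q Ω g) :
    IntegrableOn (fun x => |f x| * |g x|) Ω ∧ ∫ x in Ω, |f x| * |g x| ≤ lqNorm p Ω f * lqNorm q Ω g :=
  holder hpq hf.1 hg.1 (ML_int hpq.lt hf) (ML_int hpq.symm.lt hg)

theorem ML_cmul {q : ℝ} {Ω : Set P2} {f : F2} (hf : ML q Ω f) (c : ℝ) : ML q Ω fun x => c * f x := hf.const_mul c
theorem ML_add {q : ℝ} {Ω : Set P2} {f g : F2} (hf : ML q Ω f) (hg : ML q Ω g) : ML q Ω fun x => f x + g x := hf.add hg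

theorem lq_abs_le {Ω : Set P2} {f g : F2} (i : IntegrableOn (fun x => |f x| * |g x|) Ω) : |∫ x in Ω, f x * g x| ≤ ∫ x in Ω, |f x| * |g x| := by
  refine abs_integral_le_integral_abs.trans (le_of_eq (by congr 1; funext x; exact abs_mul _ _))

theorem NT_lq {p q : ℝ} (hpq : p.HolderConjugate q) : ∃ C, 0 < C ∧ ∀ (T : ℝ), 0 ≤ T → ∀ (f : F2), TF f →
    ∀ e e', unitv e → unitv e' → ML q univ (dd e (dd e' (NT T f))) ∧ lqNorm q univ (dd e (dd e' (NT T f))) ≤ C * lqNorm q univ f := by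
  obtain ⟨C, hC, H⟩ := NT_Lq hpq
  refine ⟨C, hC, fun T hT f hf e e' he he' => ?_⟩
  have := H T hT f hf e e' he he'
  have hq := hpq.symm.lt
  have cont : Continuous (dd e (dd e' (NT T f))) := by
    rw [NT_dd T hf, NT_dd T (hf.dd e')]; exact (NT_cd T ((hf.dd e').dd e)).continuous
  have n0 := lq_nonneg q univ f
  refine ⟨(ML_iff hq cont.aestronglyMeasurable).2 this.1.integrableOn, lq_le hq bp ?_⟩
  rw [setIntegral_univ]; simpa [lqNorm] using this.2

theorem ibp1 {a g : F2} (ha : ContDiff ℝ 1 a) (hc : HasCompactSupport a) (hg : ContDiff ℝ 1 g) (h0 : ∀ y, 0 ≤ y → a (0, y) = 0 ∨ g (0, y) = 0) :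
    ∫ x in QQ, pd1 a x * g x = - ∫ x in QQ, a x * pd1 g x := by
  have := int_QQ_pd1 (ha.mul hg) hc.mul_right (fun y hy => by rcases h0 y hy with h | h <;> simp [h])
  have da := dd_cont Ex ha; have dg := dd_cont Ex hg
  have ca := ha.continuous; have cg := hg.continuous
  have i1 : Integrable fun x => pd1 a x * g x := (da.mul cg).integrable_of_hasCompactSupport (dd_cs Ex hc).mul_right
  have i2 : Integrable fun x => a x * pd1 g x := (ca.mul dg).integrable_of_hasCompactSupport hc.mul_right
  rw [pd1_eq, dd_mul (ha.differentiable bn) (hg.differentiable bn)] at this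
  have h2 := integral_add i1.integrableOn i2.integrableOn (μ := volume.restrict QQ)
  simp only [pd1_eq] at *
  linarith

theorem ibp2 {a g : F2} (ha : ContDiff ℝ 1 a) (hc : HasCompactSupport a) (hg : ContDiff ℝ 1 g) (h0 : ∀ x, 0 ≤ x → a (x, 0) = 0 ∨ g (x, 0) = 0) :
    ∫ x in QQ, pd2 a x * g x = - ∫ x in QQ, a x * pd2 g x := by
  have := int_QQ_pd2 (ha.mul hg) hc.mul_right (fun y hy => by rcases h0 y hy with h | h <;> simp [h])
  have da := dd_cont Ey ha; have dg := dd_cont Ey hg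
  have ca := ha.continuous; have cg := hg.continuous
  have i1 : Integrable fun x => pd2 a x * g x := (da.mul cg).integrable_of_hasCompactSupport (dd_cs Ey hc).mul_right
  have i2 : Integrable fun x => a x * pd2 g x := (ca.mul dg).integrable_of_hasCompactSupport hc.mul_right
  rw [pd2_eq, dd_mul (ha.differentiable bn) (hg.differentiable bn)] at this
  have h2 := integral_add i1.integrableOn i2.integrableOn (μ := volume.restrict QQ)
  simp only [pd2_eq] at *
  linarith

structure QH (U1 U2 F G1 G2 : F2) : Prop where
  u1 : ContDiff ℝ 2 U1
  u2 : ContDiff ℝ 2 U2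
  s1 : HasCompactSupport U1
  s2 : HasCompactSupport U2
  f : ContDiff ℝ 1 F
  sf : HasCompactSupport F
  g1 : Continuous G1
  g2 : Continuous G2
  t1 : HasCompactSupport G1
  t2 : HasCompactSupport G2
  hF : ∀ x : P2, 0 ≤ x.1 → 0 ≤ x.2 → F x = pd1 U2 x - pd2 U1 x
  hd : ∀ x : P2, 0 ≤ x.1 → 0 ≤ x.2 → pd1 U1 x + pd2 U2 x = 0
  hx : ∀ y, 0 ≤ y → U1 (0, y) = 0 ∧ U2 (0, y) = 0
  hy : ∀ x, 0 ≤ x → U2 (x, 0) = 0 ∧ pd2 U1 (x, 0) = 0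
  hw : ∀ φ : F2, ContDiff ℝ ∞ φ → (∀ y, φ (0, y) = 0) → (∀ x, φ (x, 0) = 0) →
    ∫ x in QQ, (pd1 F x * pd1 φ x + pd2 F x * pd2 φ x) = ∫ x in QQ, (G1 x * pd1 φ x + G2 x * pd2 φ x)

theorem bdry1 {g : F2} (hg : Differentiable ℝ g) {x y : ℝ} (h : ∀ t, x ≤ t → g (t, y) = 0) : pd1 g (x, y) = 0 := by
  have h1 := (pd1_hda hg x y).hasDerivWithinAt (s := Ici x)
  have h2 : HasDerivWithinAt (fun t : ℝ => g (t, y)) 0 (Ici x) x :=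
    (hasDerivWithinAt_const x (Ici x) R0).congr (fun t ht => h t ht) (h x le_rfl)
  exact (uniqueDiffWithinAt_Ici x).eq_deriv _ h1 h2

theorem bdry2 {g : F2} (hg : Differentiable ℝ g) {x y : ℝ} (h : ∀ t, y ≤ t → g (x, t) = 0) : pd2 g (x, y) = 0 := by
  have h1 := (pd2_hda hg x y).hasDerivWithinAt (s := Ici y)
  have h2 : HasDerivWithinAt (fun t : ℝ => g (x, t)) 0 (Ici y) y :=
    (hasDerivWithinAt_const y (Ici y) R0).congr (fun t ht => h t ht) (h y le_rfl)
  exact (uniqueDiffWithinAt_Ici y).eq_deriv _ h1 h2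

theorem QH.F0 {U1 U2 F G1 G2 : F2} (H : QH U1 U2 F G1 G2) {x : ℝ} (hx : 0 ≤ x) : F (x, 0) = 0 := by
  rw [H.hF _ hx le_rfl, (H.hy x hx).2, bdry1 (H.u2.differentiable bn) fun t ht => (H.hy t (hx.trans ht)).1, sub_zero]

abbrev SM (f : F2) := ContDiff ℝ ∞ f
theorem SM.dd {f : F2} (hf : SM f) (e : P2) : SM (dd e f) := dd_cd e hf bs
theorem SM.p1 {f : F2} (hf : SM f) : SM (pd1 f) := hf.dd _
theorem SM.p2 {f : F2} (hf : SM f) : SM (pd2 f) := hf.dd _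
theorem SM.of {f : F2} (hf : SM f) {n : ℕ} : ContDiff ℝ n f := hf.of_le (by exact_mod_cast le_top)
theorem SM.c1 {f : F2} (hf : SM f) : ContDiff ℝ 1 f := hf.of (n := 1)
theorem SM.c2 {f : F2} (hf : SM f) : ContDiff ℝ 2 f := hf.of (n := 2)
theorem SM.di {f : F2} (hf : SM f) : Differentiable ℝ f := hf.differentiable bs
theorem SM.lap {f : F2} (hf : SM f) : SM (lap f) := ((hf.dd _).dd _).add ((hf.dd _).dd _)

theorem lap_pd1 {g : F2} (hg : SM g) : lap (pd1 g) = pd1 (lap g) := by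
  rw [show lap g = fun x => dd Ex (dd Ex g) x + dd Ey (dd Ey g) x from rfl, pd1_eq, pd1_eq, dd_add ((hg.dd _).dd _).di ((hg.dd _).dd _).di]
  funext x
  rw [lap, dd_comm hg.c2 Ey Ex, dd_comm (hg.dd Ey).c2 Ey Ex]

theorem dd_fst : pd1 (fun x : P2 => 2 * x.1) = (fun _ => 2) ∧ pd2 (fun x : P2 => 2 * x.1) = fun _ => 0 := by
  have : ∀ x, HasFDerivAt (fun x : P2 => 2 * x.1) ((2:ℝ) • ContinuousLinearMap.fst ℝ ℝ ℝ) x := fun x => (hasFDerivAt_fst (𝕜 := ℝ) (p := x)).const_mul 2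
  constructor <;> funext x <;> simp [pd1, pd2, (this x).fderiv]

def ph (E g : F2) (x : P2) : ℝ := E x - g x + 2 * x.1 * pd1 g x

theorem xsm : SM (fun x : P2 => 2 * x.1) := contDiff_const.mul contDiff_fst
theorem SM.ad {f g : F2} (hf : SM f) (hg : SM g) : SM (fun x => f x + g x) := ContDiff.add hf hg
theorem SM.sb {f g : F2} (hf : SM f) (hg : SM g) : SM (fun x => f x - g x) := ContDiff.sub hf hg
theorem SM.ml {f g : F2} (hf : SM f) (hg : SM g) : SM (fun x => f x * g x) := ContDiff.mul hf hg
theorem ph_sm {E g : F2} (hE : SM E) (hg : SM g) : SM (ph E g) := SM.ad (hE.sb hg) (xsm.ml hg.p1)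

theorem ph_1 {E g : F2} (hE : SM E) (hg : SM g) : pd1 (ph E g) = fun x => pd1 E x + pd1 g x + 2 * x.1 * pd1 (pd1 g) x := by
  have a := dd_add (hE.sb hg).di (xsm.ml hg.p1).di Ex
  have b := dd_mul xsm.di hg.p1.di Ex
  have c := dd_sub hE.di hg.di Ex
  have d := dd_fst.1
  simp only [← pd1_eq] at a b c
  funext x
  refine (congrFun a x).trans ?_
  rw [b, d]; refine (congrArg₂ _ (congrFun c x) rfl).trans ?_
  ring

theorem ph_2 {E g : F2} (hE : SM E) (hg : SM g) : pd2 (ph E g) = fun x => pd2 E x - pd2 g x + 2 * x.1 * pd1 (pd2 g) x := by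
  have a := dd_add (hE.sb hg).di (xsm.ml hg.p1).di Ey
  have b := dd_mul xsm.di hg.p1.di Ey
  have c := dd_sub hE.di hg.di Ey
  have d := dd_fst.2
  have k := dd_comm hg.c2 Ey Ex
  simp only [← pd1_eq, ← pd2_eq] at a b c k
  funext x
  refine (congrFun a x).trans ?_
  rw [b, d, k]; refine (congrArg₂ _ (congrFun c x) rfl).trans ?_
  ring

theorem ph_lap {E g : F2} (hE : SM E) (hg : SM g) (x : P2) :
    pd1 (pd1 (ph E g)) x + pd2 (pd2 (ph E g)) x = lap E x - lap g x + 4 * pd1 (pd1 g) x + 2 * x.1 * pd1 (lap g) x := by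
  rw [ph_1 hE hg, ph_2 hE hg, ← lap_pd1 hg]
  have a := dd_add (hE.p1.ad hg.p1).di (xsm.ml hg.p1.p1).di Ex
  have b := dd_mul xsm.di hg.p1.p1.di Ex
  have c := dd_add hE.p1.di hg.p1.di Ex
  have d := dd_fst.1
  have a' := dd_add (hE.p2.sb hg.p2).di (xsm.ml hg.p2.p1).di Ey
  have b' := dd_mul xsm.di hg.p2.p1.di Ey
  have c' := dd_sub hE.p2.di hg.p2.di Ey
  have d' := dd_fst.2
  have k : pd1 (pd2 g) = pd2 (pd1 g) := dd_comm hg.c2 Ex Ey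
  simp only [← pd1_eq, ← pd2_eq] at a b c a' b' c'
  have r1 := congrFun a x
  have r2 := congrFun a' x
  have r3 := congrFun c x
  have r4 := congrFun c' x
  rw [b, d] at r1; rw [b', d'] at r2
  refine (congrArg₂ (· + ·) r1 r2).trans ?_
  simp only [lap, ← pd1_eq, ← pd2_eq]
  have r3' : pd1 (fun x => pd1 E x + pd1 g x) x = pd1 (pd1 E) x + pd1 (pd1 g) x := r3
  have r4' : pd2 (fun x => pd2 E x - pd2 g x) x = pd2 (pd2 E) x - pd2 (pd2 g) x := r4
  rw [r3', r4', k]; ring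

theorem QH.id1 {U1 U2 F G1 G2 : F2} (H : QH U1 U2 F G1 G2) {E g : F2} (hE : SM E) (hg : SM g)
    (hgE : ∀ x y, g (x, y) = E (-x, y)) (hE0 : ∀ x, E (x, 0) = 0) :
    ∫ x in QQ, (G1 x * pd1 (ph E g) x + G2 x * pd2 (ph E g) x) = - (∫ x in QQ, F x * lap E x) + (∫ x in QQ, F x * lap g x)
      + 4 * (∫ x in QQ, U2 x * pd1 (lap g) x) - ∫ x in QQ, 2 * x.1 * F x * pd1 (lap g) x := by
  have hg0 : ∀ x, g (x, 0) = 0 := fun x => by rw [hgE, hE0]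
  have e0 : ∀ y, g (0, y) = E (0, y) := fun y => by rw [hgE, neg_zero]
  have pg : ∀ y, pd1 g (0, y) = - pd1 E (0, y) := by
    intro y
    have h1 := pd1_hda hg.di 0 y
    have h2 := (pd1_hda hE.di (-0) y).scomp R0 (hasDerivAt_neg 0)
    have : (fun t : ℝ => g (t, y)) = (fun t => E (t, y)) ∘ Neg.neg := by funext t; simp [hgE]
    rw [this] at h1
    have := h1.unique h2
    simpa using this
  have hφ := ph_sm hE hg
  have cF := H.f.continuous
  have cU := H.u2.continuous
  rw [← H.hw (ph E g) hφ (fun y => by simp [ph, e0]) (fun x => by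
    simp [ph, hE0, hg0, bdry1 hg.di fun t _ => hg0 t])]
  have iF : ∀ {k}, Continuous k → Integrable (fun x => F x * k x) (volume.restrict QQ) := fun hk =>
    ((cF.mul hk).integrable_of_hasCompactSupport H.sf.mul_right).integrableOn
  have iU : ∀ {k}, Continuous k → Integrable (fun x => U2 x * k x) (volume.restrict QQ) := fun hk =>
    ((cU.mul hk).integrable_of_hasCompactSupport H.s2.mul_right).integrableOn
  have iX : ∀ {a k : F2}, Continuous a → HasCompactSupport a → Continuous k → Integrable (fun x => a x * k x) (volume.restrict QQ) := fun ha hs hk =>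
    ((ha.mul hk).integrable_of_hasCompactSupport hs.mul_right).integrableOn
  have d1F : Continuous (pd1 F) := dd_cont Ex H.f
  have d2F : Continuous (pd2 F) := dd_cont Ey H.f
  have s1F : HasCompactSupport (pd1 F) := dd_cs Ex H.sf
  have s2F : HasCompactSupport (pd2 F) := dd_cs Ey H.sf
  have A : ∫ x in QQ, (pd1 F x * pd1 (ph E g) x + pd2 F x * pd2 (ph E g) x) = - ∫ x in QQ, F x * (pd1 (pd1 (ph E g)) x + pd2 (pd2 (ph E g)) x) := by
    rw [integral_add (iX d1F s1F hφ.p1.continuous) (iX d2F s2F hφ.p2.continuous),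
      ibp1 H.f H.sf hφ.p1.c1 (fun y _ => Or.inr (by rw [ph_1 hE hg]; simp [pg])), ibp2 H.f H.sf hφ.p2.c1 (fun x hx => Or.inl (H.F0 hx))]
    simp only [mul_add]
    rw [integral_add (iF hφ.p1.p1.continuous) (iF hφ.p2.p2.continuous)]; ring
  have B : ∫ x in QQ, F x * pd1 (pd1 g) x = - ∫ x in QQ, U2 x * pd1 (lap g) x := by
    have u1 : ContDiff ℝ 1 U1 := H.u1.of_le bn
    have u2 : ContDiff ℝ 1 U2 := H.u2.of_le bn
    have d1 : Continuous (pd1 U2) := dd_cont Ex u2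
    have d2 : Continuous (pd2 U1) := dd_cont Ey u1
    have t1 : HasCompactSupport (pd1 U2) := dd_cs Ex H.s2
    have t2 : HasCompactSupport (pd2 U1) := dd_cs Ey H.s1
    have q1 : ∫ x in QQ, F x * pd1 (pd1 g) x = (∫ x in QQ, pd1 U2 x * pd1 (pd1 g) x) - ∫ x in QQ, pd2 U1 x * pd1 (pd1 g) x := by
      rw [← integral_sub (iX d1 t1 hg.p1.p1.continuous) (iX d2 t2 hg.p1.p1.continuous)]
      refine setIntegral_congr_fun QQ_meas fun x hx => ?_
      simp only [H.hF x (le_of_lt hx.1) (le_of_lt hx.2)]; ring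
    have p0 : ∀ x, pd1 g (x, 0) = 0 := fun x => bdry1 hg.di fun t _ => hg0 t
    have q2 := ibp1 u2 H.s2 hg.p1.p1.c1 (fun y hy => Or.inl (H.hx y hy).2)
    have q3 := ibp2 u1 H.s1 hg.p1.p1.c1 (fun x _ => Or.inr (bdry1 hg.p1.di fun t _ => p0 t))
    have q4 := ibp1 u1 H.s1 hg.p1.p2.c1 (fun y hy => Or.inl (H.hx y hy).1)
    have q5 := ibp2 u2 H.s2 hg.p1.p2.c1 (fun x hx => Or.inl (H.hy x hx).1)
    have k : pd1 (pd2 (pd1 g)) = pd2 (pd1 (pd1 g)) := dd_comm hg.p1.c2 Ex Ey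
    have q6 : ∫ x in QQ, pd1 U1 x * pd2 (pd1 g) x = - ∫ x in QQ, pd2 U2 x * pd2 (pd1 g) x := by
      rw [← integral_neg]
      refine setIntegral_congr_fun QQ_meas fun x hx => ?_
      have := H.hd x (le_of_lt hx.1) (le_of_lt hx.2)
      simp only [show pd1 U1 x = - pd2 U2 x by linarith]; ring
    have q7 : ∫ x in QQ, U2 x * pd1 (lap g) x = (∫ x in QQ, U2 x * pd1 (pd1 (pd1 g)) x) + ∫ x in QQ, U2 x * pd2 (pd2 (pd1 g)) x := by
      rw [← integral_add (iU hg.p1.p1.p1.continuous) (iU hg.p1.p2.p2.continuous), ← lap_pd1 hg]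
      congr 1; funext x; simp only [lap, ← pd1_eq, ← pd2_eq]; ring
    rw [k] at q4
    rw [q1, q2, q3, q7]; linarith
  have cl := hE.lap.continuous; have cg := hg.lap.continuous; have cg1 := hg.lap.p1.continuous; have cg2 := hg.p1.p1.continuous
  have i4 : Integrable (fun x => 2 * x.1 * F x * pd1 (lap g) x) (volume.restrict QQ) := by
    refine (iF (k := fun x => 2 * x.1 * pd1 (lap g) x) bf).congr (Ef fun x => ?_)
    simp only; ring
  have fin : ∫ x in QQ, F x * (pd1 (pd1 (ph E g)) x + pd2 (pd2 (ph E g)) x) = (∫ x in QQ, F x * lap E x) - (∫ x in QQ, F x * lap g x) + 4 * (∫ x in QQ, F x * pd1 (pd1 g) x) + ∫ x in QQ, 2 * x.1 * F x * pd1 (lap g) x := by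
    have j1 : Integrable (fun x => F x * lap E x - F x * lap g x) (volume.restrict QQ) := (iF cl).sub (iF cg)
    have j2 : Integrable (fun x => F x * lap E x - F x * lap g x + 4 * (F x * pd1 (pd1 g) x)) (volume.restrict QQ) := j1.add ((iF cg2).const_mul 4)
    rw [← integral_const_mul, ← integral_sub (iF cl) (iF cg), ← integral_add j1 ((iF cg2).const_mul 4), ← integral_add j2 i4]
    congr 1; funext x; rw [ph_lap hE hg]; ring
  rw [A, fin, B]; ring

theorem van {S : F2} (h : ∀ x : P2, x.1 < 0 → S x = 0) (e : P2) : ∀ x : P2, x.1 < 0 → dd e S x = 0 := by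
  intro x hx
  have : S =ᶠ[𝓝 x] fun _ => 0 := by
    filter_upwards [(isOpen_lt continuous_fst continuous_const).mem_nhds (show x.1 < 0 from hx)] with y hy using h y hy
  rw [dd, this.fderiv_eq]; simp

def kd (W : F2) : ℝ := gm.real univ * ∫ y, |W y|

theorem int_err {a k : F2} {ε : ℝ} (ia : IntegrableOn a QQ) (h : ∀ x ∈ QQ, |k x| ≤ ε) : |∫ x in QQ, a x * k x| ≤ (∫ x in QQ, |a x|) * ε := by
  rw [← integral_mul_const, ← Real.norm_eq_abs]
  refine norm_integral_le_of_norm_le (ia.abs.mul_const ε) ?_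
  refine (ae_restrict_iff' QQ_meas).2 (Ef fun x hx => ?_)
  rw [Real.norm_eq_abs, abs_mul]
  exact mlL (h x hx) (abs_nonneg _)

theorem rho_eq (x : P2) : aff (-1) 0 1 0 x = (Rf x) := by simp [aff]
theorem rho_shr (x : P2) : shr 0 x = (Rf x) := by simp [shr]

theorem ML_rho {p : ℝ} (hp : 1 < p) {h : F2} (hc : Continuous h) (hm : ML p univ h) :
    ML p QQ (fun x => h (Rf x)) ∧ lqNorm p QQ (fun x => h (Rf x)) ≤ 2 * lqNorm p univ h := by
  have i := ML_int hp hm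
  rw [integrableOn_univ] at i
  have p0 : 0 ≤ p := bL
  have c : Continuous fun x => |h x| ^ p := hc.abs.rpow_const fun _ => Or.inr p0
  obtain ⟨i1, i2⟩ := shr_int (v := 0) bs c (fp) i
  simp only [rho_shr] at i1 i2
  have c' : Continuous fun x : P2 => h (Rf x) := bf
  refine ⟨(ML_iff hp c'.aestronglyMeasurable).2 i1.integrableOn, lq_le hp (by have := lq_nonneg p univ h; positivity) ?_⟩
  rw [Real.mul_rpow bn (lq_nonneg _ _ _), lq_pow hp, Measure.restrict_univ]
  refine (setIntegral_le_integral i1 (Ef fp)).trans (i2.trans ?_)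
  refine mlR ?_ (integral_nonneg fp)
  calc (2:ℝ) = 2 ^ (1:ℝ) := bs
    _ ≤ 2 ^ p := Real.rpow_le_rpow_of_exponent_le bn hp.le

theorem lap_small {S : F2} (hS : TF S) (h : ∀ x : P2, x.1 < 0 → S x = 0) {T : ℝ} (hT : 0 < T) (z : P2) (hz : z.1 < 0) :
    |lap (NT T S) z| ≤ kd S * (T ^ 2)⁻¹ := by
  rw [lap_NT hT.le hS, h z hz, mul_zero, sub_zero]; exact Kr_decay hS hT z

theorem Gk_bd {p q : ℝ} (hpq : p.HolderConjugate q) : ∃ C, 0 < C ∧ ∀ (S b : F2) (e e' : P2), TF S → (∀ x : P2, x.1 < 0 → S x = 0) → unitv e → unitv e' →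
    Continuous b → HasCompactSupport b → ∃ M, ∀ T, 0 < T → ∀ ψ : F2, Continuous ψ →
    (∀ x ∈ QQ, |ψ x| ≤ |dd e' (dd e (NT T S)) x| + |dd e' (dd e (NT T S)) (Rf x)| + 2 * (x.1 * |dd Ex (dd e' (dd e (NT T S))) (Rf x)|)) →
    |∫ x in QQ, b x * ψ x| ≤ C * (lqNorm q QQ b * lqNorm p univ S) + M * (T ^ 2)⁻¹ := by
  obtain ⟨C1, hC1, H1⟩ := NT_lq hpq.symm
  obtain ⟨C2, hC2, H2⟩ := pairL hpq
  refine ⟨3 * C1 + 2 * (C2 * C1), by positivity, fun S b e e' hS h0 he he' cb sb => ?_⟩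
  set W := dd Ex (dd e' (dd e S)) with hW
  refine ⟨2 * (C2 * (kd W * ∫ x in QQ, |b x| * x.1 ^ 3)), fun T hT ψ cψ hψ => ?_⟩
  obtain ⟨m1, n1⟩ := H1 T hT.le S hS e' e he' he
  have hp := hpq.lt
  have hsm : SM (dd e' (dd e (NT T S))) := ((show SM (NT T S) from NT_cd T hS).dd e).dd e'
  have hlap : ∀ z : P2, z.1 < 0 → |lap (dd Ex (dd e' (dd e (NT T S)))) z| ≤ kd W * (T ^ 2)⁻¹ := by
    intro z hz
    rw [NT_dd T hS, NT_dd T (hS.dd e), NT_dd T ((hS.dd e).dd e')]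
    exact lap_small (((hS.dd e).dd e').dd _) (van (van (van h0 e) e') _) hT z hz
  set h := dd e' (dd e (NT T S)) with hh
  have ch : Continuous h := hsm.continuous
  obtain ⟨m2, n2⟩ := ML_rho hp ch m1
  have i := ML_int hp m1
  rw [integrableOn_univ] at i
  have P := H2 h b Ex _ il (hsm.of (n := 3)) i cb sb hlap
  have mb : ML q QQ b := ML_cs cb sb
  have m1' : ML p QQ h := m1.mono_measure (Measure.restrict_mono (subset_univ _) le_rfl)
  obtain ⟨i1, k1⟩ := lq_holder hpq m1' mb
  obtain ⟨i2, k2⟩ := lq_holder hpq m2 mb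
  have n3 := lq_sub_set hpq.lt m1 (subset_univ QQ)
  have cd : Continuous (dd Ex h) := dd_cont _ hsm.c1
  have i3 : IntegrableOn (fun x => |b x| * (x.1 * |dd Ex h (Rf x)|)) QQ :=
    (Continuous.integrable_of_hasCompactSupport (f := fun x => |b x| * (x.1 * |dd Ex h (Rf x)|)) bf (HasCompactSupport.mul_right sb.abs)).integrableOn
  have i12 : Integrable (fun x => |h x| * |b x| + |h (Rf x)| * |b x|) (volume.restrict QQ) := i1.add i2
  have i123 : Integrable (fun x => |h x| * |b x| + |h (Rf x)| * |b x| + 2 * (|b x| * (x.1 * |dd Ex h (Rf x)|))) (volume.restrict QQ) := i12.add (i3.const_mul 2)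
  have st : |∫ x in QQ, b x * ψ x| ≤ ∫ x in QQ, (|h x| * |b x| + |h (Rf x)| * |b x| + 2 * (|b x| * (x.1 * |dd Ex h (Rf x)|))) := by
    rw [← Real.norm_eq_abs]
    refine norm_integral_le_of_norm_le i123 ((ae_restrict_iff' QQ_meas).2 (Ef fun x hx => ?_))
    rw [Real.norm_eq_abs, abs_mul]
    refine (mlL (hψ x hx) (abs_nonneg _)).trans (le_of_eq ?_); ring
  rw [integral_add i12 (i3.const_mul 2), integral_add i1 i2, integral_const_mul] at st
  have e1 : (∫ x in QQ, |b x| ^ q) ^ (1 / q) = lqNorm q QQ b := rfl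
  have e2 : (∫ x, |h x| ^ p) ^ (1 / p) = lqNorm p univ h := by rw [lqNorm, Measure.restrict_univ]
  rw [e1, e2] at P
  have nb := lq_nonneg q QQ b
  have A : lqNorm p univ h * lqNorm q QQ b ≤ C1 * lqNorm p univ S * lqNorm q QQ b := mlR n1 nb
  have A1 := mlR n3 nb
  have A2 := mlR n2 nb
  have A3 : C2 * (lqNorm q QQ b * lqNorm p univ h) ≤ C2 * (C1 * lqNorm p univ S * lqNorm q QQ b) := by
    rw [mul_comm (lqNorm q QQ b)]; exact mlL A hC2.le
  have : C2 * (kd W * (T ^ 2)⁻¹ * ∫ x in QQ, |b x| * x.1 ^ 3) = C2 * (kd W * ∫ x in QQ, |b x| * x.1 ^ 3) * (T ^ 2)⁻¹ := by ring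
  rw [this] at P
  linarith

theorem F_pair {p q : ℝ} (hpq : p.HolderConjugate q) : ∃ C, 0 < C ∧ ∀ (U1 U2 F G1 G2 S : F2) (e : P2), QH U1 U2 F G1 G2 → TF S → (∀ x : P2, x.1 < 0 → S x = 0) → unitv e →
    (∀ x y, dd e S (x, -y) = - dd e S (x, y)) → 
    |∫ x in QQ, F x * dd e S x| ≤ C * ((lqNorm q QQ G1 + lqNorm q QQ G2) * lqNorm p univ S) := by
  obtain ⟨C, hC, H⟩ := Gk_bd hpq
  refine ⟨C / c0, div_pos hC c0_pos, fun U1 U2 F G1 G2 S e hQ hS h0 he hodd => ?_⟩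
  obtain ⟨M1, H1⟩ := H S G1 e Ex hS h0 he il hQ.g1 hQ.t1
  obtain ⟨M2, H2⟩ := H S G2 e Ey hS h0 he ir hQ.g2 hQ.t2
  set D := dd e S with hDd
  have hD : TF D := hS.dd e
  have v0 : ∀ x : P2, x.1 < 0 → D x = 0 := van h0 e
  have v1 : ∀ x : P2, x.1 < 0 → pd1 D x = 0 := van v0 _
  have cF := hQ.f.continuous
  have cU := hQ.u2.continuous
  have iF : Integrable F := cF.integrable_of_hasCompactSupport hQ.sf
  have iU : Integrable U2 := cU.integrable_of_hasCompactSupport hQ.s2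
  have iX : Integrable (fun x => 2 * x.1 * F x) := Continuous.integrable_of_hasCompactSupport bf hQ.sf.mul_left
  set M3 := 2 * ((∫ x in QQ, |F x|) * kd D) + 4 * ((∫ x in QQ, |U2 x|) * kd (pd1 D)) + (∫ x in QQ, |2 * x.1 * F x|) * kd (pd1 D)
  have key : ∀ T : ℝ, 0 < T → c0 * |∫ x in QQ, F x * D x| ≤ C * ((lqNorm q QQ G1 + lqNorm q QQ G2) * lqNorm p univ S) + (M1 + M2 + M3) * (T ^ 2)⁻¹ := by
    intro T hT
    set E := NT T D with hEd
    have hES : E = dd e (NT T S) := (NT_dd T hS e).symm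
    have hE : SM E := NT_cd T hD
    have E0 : ∀ x, E (x, 0) = 0 := by
      intro x
      have r := NT_refl T (s := 1) (t := -1) bn bn hD.cont (x, 0)
      have a1 : (fun y => D (rfl2 1 (-1) y)) = fun y => - D y := by
        funext y; rw [← hodd]; simp [rfl2]
      have a2 : rfl2 1 (-1) ((x, 0) : P2) = (x, 0) := by simp [rfl2]
      rw [a1, a2] at r
      have a3 : NT T (fun y => - D y) (x, 0) = - NT T D (x, 0) := by
        simp only [NT, cv]; exact integral_neg _
      rw [a3] at r; linarith
    set g : F2 := fun x => E (aff (-1) 0 1 0 x) with hgd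
    have hg : SM g := hE.comp (aff_cd _ _ _ _)
    have g1 : pd1 g = fun x => -1 * pd1 E (aff (-1) 0 1 0 x) := pd1_aff hE.di _ _ _ _
    have g2 : pd2 g = fun x => 1 * pd2 E (aff (-1) 0 1 0 x) := pd2_aff hE.di _ _ _ _
    have co : ∀ {f : F2}, SM f → SM fun x => f (aff (-1) 0 1 0 x) := fun hf => hf.comp (aff_cd _ _ _ _)
    have g11 : pd1 (pd1 g) = fun x => pd1 (pd1 E) (aff (-1) 0 1 0 x) := by
      rw [g1, pd1_eq, dd_cmul (co hE.p1).di, ← pd1_eq, pd1_aff hE.p1.di]; funext x; ring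
    have g12 : pd1 (pd2 g) = fun x => - pd1 (pd2 E) (aff (-1) 0 1 0 x) := by
      rw [g2, pd1_eq, dd_cmul (co hE.p2).di, ← pd1_eq, pd1_aff hE.p2.di]; funext x; ring
    have g22 : pd2 (pd2 g) = fun x => pd2 (pd2 E) (aff (-1) 0 1 0 x) := by
      rw [g2, pd2_eq, dd_cmul (co hE.p2).di, ← pd2_eq, pd2_aff hE.p2.di]; funext x; ring
    have hl : lap g = fun x => lap E (aff (-1) 0 1 0 x) := by
      funext x; simp only [lap, ← pd1_eq, ← pd2_eq]; rw [g11, g22]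
    have hl1 : pd1 (lap g) = fun x => -1 * lap (NT T (pd1 D)) (aff (-1) 0 1 0 x) := by
      rw [hl, pd1_aff hE.lap.di, ← lap_pd1 hE]; funext x; rw [hEd, pd1_eq, NT_dd T hD]; rfl
    have id := hQ.id1 hE hg (fun x y => by simp [hgd, aff]) E0
    have ng : ∀ x ∈ QQ, (aff (-1) 0 1 0 x).1 < 0 := fun x hx => by
      have : 0 < x.1 := hx.1
      simp [aff, this]
    have r1 : |∫ x in QQ, F x * lap g x| ≤ (∫ x in QQ, |F x|) * (kd D * (T ^ 2)⁻¹) := 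
      int_err iF.integrableOn fun x hx => by rw [hl]; exact lap_small hD v0 hT _ (ng x hx)
    have b1 : ∀ x ∈ QQ, |pd1 (lap g) x| ≤ kd (pd1 D) * (T ^ 2)⁻¹ := fun x hx => by
      rw [hl1]; simp only [neg_mul, one_mul, abs_neg]; exact lap_small (hD.dd _) v1 hT _ (ng x hx)
    have r2 : |∫ x in QQ, U2 x * pd1 (lap g) x| ≤ (∫ x in QQ, |U2 x|) * (kd (pd1 D) * (T ^ 2)⁻¹) := int_err iU.integrableOn b1
    have r3 : |∫ x in QQ, 2 * x.1 * F x * pd1 (lap g) x| ≤ (∫ x in QQ, |2 * x.1 * F x|) * (kd (pd1 D) * (T ^ 2)⁻¹) := int_err iX.integrableOn b1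
    have r4 : |∫ x in QQ, F x * Kr T D x| ≤ (∫ x in QQ, |F x|) * (kd D * (T ^ 2)⁻¹) := int_err iF.integrableOn fun x _ => Kr_decay hD hT x
    have cK : Continuous (Kr T D) := (cv_cd (Km T) hD).continuous
    have r5 : ∫ x in QQ, F x * lap E x = (∫ x in QQ, F x * Kr T D x) - c0 * ∫ x in QQ, F x * D x := by
      have j1 : IntegrableOn (fun x => F x * Kr T D x) QQ := ((cF.mul cK).integrable_of_hasCompactSupport hQ.sf.mul_right).integrableOn
      have j2 : IntegrableOn (fun x => F x * D x) QQ := ((cF.mul hD.cont).integrable_of_hasCompactSupport hQ.sf.mul_right).integrableOn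
      rw [← integral_const_mul, ← integral_sub j1 (j2.const_mul c0)]
      congr 1; funext x; rw [hEd, lap_NT hT.le hD]; ring
    have hφ := ph_sm hE hg
    have q1 := H1 T hT (pd1 (ph E g)) hφ.p1.continuous fun x hx => by
      rw [ph_1 hE hg, g11, g1, ← hES]
      simp only [rho_eq, ← pd1_eq]
      have : 0 < x.1 := hx.1
      refine (abs_add_le _ _).trans (add_le_add ((abs_add_le _ _).trans (le_of_eq ?_)) (le_of_eq ?_))
      · simp
      · rw [abs_mul, abs_mul, abs_two, abs_of_pos this]; ring
    have q2 := H2 T hT (pd2 (ph E g)) hφ.p2.continuous fun x hx => by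
      rw [ph_2 hE hg, g12, g2, ← hES]
      simp only [rho_eq, ← pd1_eq, ← pd2_eq]
      have : 0 < x.1 := hx.1
      refine (abs_add_le _ _).trans (add_le_add ((abs_sub _ _).trans (le_of_eq ?_)) (le_of_eq ?_))
      · simp
      · rw [abs_mul, abs_mul, abs_two, abs_of_pos this, abs_neg]; ring
    have j1 : IntegrableOn (fun x => G1 x * pd1 (ph E g) x) QQ := ((hQ.g1.mul hφ.p1.continuous).integrable_of_hasCompactSupport hQ.t1.mul_right).integrableOn
    have j2 : IntegrableOn (fun x => G2 x * pd2 (ph E g) x) QQ := ((hQ.g2.mul hφ.p2.continuous).integrable_of_hasCompactSupport hQ.t2.mul_right).integrableOn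
    rw [integral_add j1 j2, r5] at id
    rw [← abs_of_pos c0_pos, ← abs_mul]
    have : c0 * ∫ x in QQ, F x * D x = (∫ x in QQ, G1 x * pd1 (ph E g) x) + (∫ x in QQ, G2 x * pd2 (ph E g) x) + (∫ x in QQ, F x * Kr T D x) - (∫ x in QQ, F x * lap g x) - 4 * (∫ x in QQ, U2 x * pd1 (lap g) x) + ∫ x in QQ, 2 * x.1 * F x * pd1 (lap g) x := bL
    rw [this]
    have M3e : M3 * (T ^ 2)⁻¹ = 2 * ((∫ x in QQ, |F x|) * (kd D * (T ^ 2)⁻¹)) + 4 * ((∫ x in QQ, |U2 x|) * (kd (pd1 D) * (T ^ 2)⁻¹)) + (∫ x in QQ, |2 * x.1 * F x|) * (kd (pd1 D) * (T ^ 2)⁻¹) := by ring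
    rw [add_mul, add_mul, M3e]
    rw [abs_le] at *
    constructor <;> linarith [q1.1, q1.2, q2.1, q2.2, r1.1, r1.2, r2.1, r2.2, r3.1, r3.2, r4.1, r4.2]
  have lim : Tendsto (fun T : ℝ => C * ((lqNorm q QQ G1 + lqNorm q QQ G2) * lqNorm p univ S) + (M1 + M2 + M3) * (T ^ 2)⁻¹) atTop (𝓝 (C * ((lqNorm q QQ G1 + lqNorm q QQ G2) * lqNorm p univ S) + (M1 + M2 + M3) * 0)) :=
    tendsto_const_nhds.add (((tendsto_pow_atTop bn).inv_tendsto_atTop).const_mul _)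
  rw [mul_zero, add_zero] at lim
  have := ge_of_tendsto lim (eventually_atTop.2 ⟨1, fun T hT => key T bL⟩)
  rw [div_mul_eq_mul_div, le_div_iff₀ c0_pos]; linarith

theorem QQ_open : IsOpen QQ := isOpen_Ioi.prod isOpen_Ioi

theorem dd_congr_QQ {f g : F2} (h : ∀ x ∈ QQ, f x = g x) (e : P2) : ∀ x ∈ QQ, dd e f x = dd e g x := fun x hx => by
  rw [dd, dd, Filter.EventuallyEq.fderiv_eq (f₁ := f) (f := g)]
  filter_upwards [QQ_open.mem_nhds hx] with y hy using h y hy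

def af (s t : ℝ) (f : F2) (x : P2) : ℝ := f (aff s 0 t 0 x)

theorem af_rfl (s t : ℝ) (f : F2) : af s t f = fun x => f (rfl2 s t x) := by
  funext x; simp [af, aff, rfl2]

theorem aff2 {s t : ℝ} (hs : s ^ 2 = 1) (ht : t ^ 2 = 1) (x : P2) : aff s 0 t 0 (aff s 0 t 0 x) = x := by
  refine Prod.ext ?_ ?_
  · simp only [aff]; linear_combination x.1 * hs
  · simp only [aff]; linear_combination x.2 * ht

theorem TF.af {f : F2} (hf : TF f) {s t : ℝ} (hs : s ^ 2 = 1) (ht : t ^ 2 = 1) : TF (af s t f) := by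
  refine ⟨hf.1.comp (aff_cd _ _ _ _), ?_⟩
  exact hf.2.comp_homeomorph (Homeomorph.mk ⟨aff s 0 t 0, aff s 0 t 0, aff2 hs ht, aff2 hs ht⟩
    (aff_cd (n := 0) _ _ _ _).continuous (aff_cd (n := 0) _ _ _ _).continuous)

theorem lq_af {f : F2} (hf : Continuous f) {s t : ℝ} (hs : s ^ 2 = 1) (ht : t ^ 2 = 1) {p : ℝ} (hp : 0 ≤ p) : lqNorm p univ (af s t f) = lqNorm p univ f := by
  rw [lqNorm, lqNorm, af_rfl, Measure.restrict_univ]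
  congr 1
  have c : Continuous fun x => |f x| ^ p := hf.abs.rpow_const fun _ => Or.inr hp
  have m := rfl2_vol hs ht
  have := integral_map (μ := volume) m.measurable.aemeasurable (f := fun x => |f x| ^ p) c.aestronglyMeasurable
  rw [m.map_eq] at this; exact this.symm

theorem af_van {f : F2} (hf : tsupport f ⊆ QQ) {s t : ℝ} (h : s = -1 ∨ t = -1) {x : P2} (h1 : 0 ≤ x.1) (h2 : 0 ≤ x.2) : af s t f x = 0 := by
  show f (aff s 0 t 0 x) = 0
  refine image_eq_zero_of_notMem_tsupport fun hx => ?_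
  have hm : 0 < s * x.1 + 0 ∧ 0 < t * x.2 + 0 := hf hx
  rcases h with h | h <;> rw [h] at hm
  · linarith [hm.1]
  · linarith [hm.2]

theorem ts0 {f : F2} (hf : tsupport f ⊆ QQ) {x : P2} (h : x.1 ≤ 0 ∨ x.2 ≤ 0) : f x = 0 := by
  refine image_eq_zero_of_notMem_tsupport fun hx => ?_
  have hm : 0 < x.1 ∧ 0 < x.2 := hf hx
  rcases h with h | h
  · linarith [hm.1]
  · linarith [hm.2]

theorem sym1 {f : F2} (hf : Differentiable ℝ f) {s t c : ℝ} (hs : s ^ 2 = 1) (h : ∀ x, f (aff s 0 t 0 x) = c * f x) (x : P2) :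
    dd Ex f (aff s 0 t 0 x) = c * s * dd Ex f x := by
  have a := pd1_aff hf s 0 t 0
  rw [show (fun x => f (aff s 0 t 0 x)) = fun x => c * f x from funext h, pd1_eq, dd_cmul hf, pd1_eq] at a
  have b := congrFun a x
  linear_combination (-dd Ex f (aff s 0 t 0 x)) * hs - s * b
theorem sym2 {f : F2} (hf : Differentiable ℝ f) {s t c : ℝ} (ht : t ^ 2 = 1) (h : ∀ x, f (aff s 0 t 0 x) = c * f x) (x : P2) :
    dd Ey f (aff s 0 t 0 x) = c * t * dd Ey f x := by
  have a := pd2_aff hf s 0 t 0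
  rw [show (fun x => f (aff s 0 t 0 x)) = fun x => c * f x from funext h, pd2_eq, dd_cmul hf, pd2_eq] at a
  have b := congrFun a x
  linear_combination (-dd Ey f (aff s 0 t 0 x)) * ht - t * b

theorem NT_sym {f : F2} (hf : Continuous f) {s t c : ℝ} (hs : s ^ 2 = 1) (ht : t ^ 2 = 1) (h : ∀ x, f (aff s 0 t 0 x) = c * f x) (T : ℝ) (x : P2) :
    NT T f (aff s 0 t 0 x) = c * NT T f x := by
  have r := NT_refl T hs ht hf x
  rw [← af_rfl, show af s t f = fun x => c * f x from funext h] at r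
  have a : rfl2 s t x = aff s 0 t 0 x := by simp [aff, rfl2]
  rw [a] at r; rw [← r]
  simp only [NT, cv]; exact (integral_const_mul _ _)

def KQ (n : ℕ) : Set P2 := Icc (1 / ((n:ℝ) + 1)) (n + 1) ×ˢ Icc (1 / ((n:ℝ) + 1)) (n + 1)

theorem KQ_mono : Monotone KQ := by
  intro m n h
  have h' : (m:ℝ) ≤ n := by exact_mod_cast h
  have : Icc (1 / ((m:ℝ) + 1)) (m + 1) ⊆ Icc (1 / ((n:ℝ) + 1)) (n + 1) := Icc_subset_Icc (one_div_le_one_div_of_le bp bL) bL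
  exact prod_mono this this
theorem KQ_union : ⋃ n, KQ n = QQ := by
  ext x; simp only [mem_iUnion]
  constructor
  · rintro ⟨n, h1, h2⟩
    have : R0 < 1 / ((n:ℝ) + 1) := bp
    exact ⟨this.trans_le h1.1, this.trans_le h2.1⟩
  · rintro ⟨h1, h2⟩
    have h1 : 0 < x.1 := h1
    have h2 : 0 < x.2 := h2
    obtain ⟨n, hn⟩ := exists_nat_gt (max (max x.1 x.2) (max (1 / x.1) (1 / x.2)))
    simp only [max_lt_iff] at hn
    refine ⟨n, ⟨?_, by linarith⟩, ⟨?_, by linarith⟩⟩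
    · rw [one_div_le bp h1]; linarith
    · rw [one_div_le bp h2]; linarith

theorem dualQ {p q : ℝ} (hpq : p.HolderConjugate q) {v : F2} {M : ℝ} (hM : 0 ≤ M) (hv : Continuous v)
    (h : ∀ Θ : F2, TF Θ → tsupport Θ ⊆ QQ → |∫ x in QQ, v x * Θ x| ≤ M * lqNorm p univ Θ) : lqNorm q QQ v ≤ M := by
  refine lq_le hpq.symm.lt hM (dual_bound hpq hM hv QQ_open KQ KQ_mono (fun n => isCompact_Icc.prod isCompact_Icc) KQ_union fun Θ hΘ hs => ?_).2
  have := h Θ hΘ hs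
  rw [lqNorm, Measure.restrict_univ, setIntegral_eq_integral_of_forall_compl_eq_zero] at this
  · exact this
  · intro x hx
    rw [image_eq_zero_of_notMem_tsupport (f := Θ) fun h => hx (hs h), mul_zero]

theorem ibp_e {a Θ : F2} (ha : ContDiff ℝ 1 a) (hc : HasCompactSupport a) (hg : TF Θ) (hs : tsupport Θ ⊆ QQ) {e : P2} (he : unitv e) :
    ∫ x in QQ, dd e a x * Θ x = - ∫ x in QQ, a x * dd e Θ x := by
  rcases he with rfl | rfl
  · exact ibp1 ha hc (SM.c1 hg.1) fun y _ => Or.inr (ts0 hs (Or.inl le_rfl))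
  · exact ibp2 ha hc (SM.c1 hg.1) fun y _ => Or.inr (ts0 hs (Or.inr le_rfl))

theorem F_bd {p q : ℝ} (hpq : p.HolderConjugate q) : ∃ C, 0 < C ∧ ∀ (U1 U2 F G1 G2 : F2) (e : P2), QH U1 U2 F G1 G2 → unitv e →
    lqNorm q QQ (dd e F) ≤ C * (lqNorm q QQ G1 + lqNorm q QQ G2) := by
  obtain ⟨C, hC, H⟩ := F_pair hpq
  refine ⟨2 * C, by positivity, fun U1 U2 F G1 G2 e hQ he => ?_⟩
  have n1 := lq_nonneg q QQ G1
  have n2 := lq_nonneg q QQ G2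
  refine dualQ hpq bp (dd_cont e hQ.f) fun Θ hΘ hs => ?_
  obtain ⟨τ, hτ, hτe⟩ : ∃ τ : ℝ, τ ^ 2 = 1 ∧ ((e = Ex ∧ τ = -1) ∨ (e = Ey ∧ τ = 1)) := by
    rcases he with h | h
    · exact ⟨-1, by norm_num, Or.inl ⟨h, rfl⟩⟩
    · exact ⟨1, by norm_num, Or.inr ⟨h, rfl⟩⟩
  have hA : TF (af 1 (-1) Θ) := hΘ.af bn bn
  set S : F2 := fun x => Θ x + τ * af 1 (-1) Θ x with hSd
  have hS : TF S := ⟨hΘ.1.add (hA.cmul τ).1, hΘ.2.add (hA.cmul τ).2⟩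
  have hv : ∀ x : P2, x.1 < 0 → S x = 0 := fun x hx => by
    simp only [hSd, af]
    rw [ts0 hs (Or.inl hx.le), ts0 hs (Or.inl (by simp [aff, hx.le]))]; simp
  have sy : ∀ x, S (aff 1 0 (-1) 0 x) = τ * S x := fun x => by
    simp only [hSd, af, aff2 (show (1:ℝ)^2 = 1 by norm_num) (show (-1:ℝ)^2 = 1 by norm_num)]
    linear_combination (- Θ (aff 1 0 (-1) 0 x)) * hτ
  have od : ∀ x y, dd e S (x, -y) = - dd e S (x, y) := by
    intro x y
    have ee : aff 1 0 (-1) 0 (x, y) = (x, -y) := by simp [aff]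
    rcases hτe with ⟨rfl, rfl⟩ | ⟨rfl, rfl⟩
    · have := sym1 hS.diff bn sy (x, y)
      rw [ee] at this; linarith
    · have := sym2 hS.diff bn sy (x, y)
      rw [ee] at this; linarith
  have K := H U1 U2 F G1 G2 S e hQ hS hv he od
  have eq : ∫ x in QQ, dd e F x * Θ x = - ∫ x in QQ, F x * dd e S x := by
    rw [ibp_e hQ.f hQ.sf hΘ hs he]
    congr 1
    refine setIntegral_congr_fun QQ_meas fun x hx => ?_
    beta_reduce
    rw [dd_congr_QQ (f := S) (g := Θ) (fun x hx => by
      simp only [hSd]; rw [af_van hs ir (le_of_lt hx.1) (le_of_lt hx.2)]; ring) e x hx]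
  rw [eq, abs_neg]
  have nS : lqNorm p univ S ≤ 2 * lqNorm p univ Θ := by
    have := lq_add hpq.lt (Ω := univ) (ML_cs hΘ.cont hΘ.2) (ML_cs (hA.cmul τ).cont (hA.cmul τ).2)
    rw [lq_cmul hpq.lt, lq_af hΘ.cont bn bn hpq.nonneg] at this
    have a : |τ| = 1 := by rcases hτe with ⟨_, rfl⟩ | ⟨_, rfl⟩ <;> simp
    rw [a] at this; linarith
  refine K.trans ?_
  calc C * ((lqNorm q QQ G1 + lqNorm q QQ G2) * lqNorm p univ S) ≤ C * ((lqNorm q QQ G1 + lqNorm q QQ G2) * (2 * lqNorm p univ Θ)) := by gcongr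
    _ = _ := by ring

theorem lap_F {U1 U2 F G1 G2 : F2} (H : QH U1 U2 F G1 G2) (e : P2) : ∀ x ∈ QQ, dd e F x = dd e (pd1 U2) x - dd e (pd2 U1) x := by
  intro x hx
  rw [dd_congr_QQ (g := fun x => pd1 U2 x - pd2 U1 x) (fun x hx => H.hF x (le_of_lt hx.1) (le_of_lt hx.2)) e x hx, dd_sub]
  · exact (dd_cd (m := 1) Ex H.u2 bn).differentiable bn
  · exact (dd_cd (m := 1) Ey H.u1 bn).differentiable bn

theorem div_F {U1 U2 F G1 G2 : F2} (H : QH U1 U2 F G1 G2) (e : P2) : ∀ x ∈ QQ, dd e (pd1 U1) x = - dd e (pd2 U2) x := by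
  intro x hx
  rw [dd_congr_QQ (g := fun x => - pd2 U2 x) (fun x hx => by linarith [H.hd x (le_of_lt hx.1) (le_of_lt hx.2)]) e x hx, dd_neg]

theorem U_bd {p q : ℝ} (hpq : p.HolderConjugate q) : ∃ C, 0 < C ∧ ∀ (U1 U2 F G1 G2 : F2) (e : P2), QH U1 U2 F G1 G2 → unitv e →
    lqNorm q QQ (dd e (pd1 U1)) ≤ C * lqNorm q QQ (pd2 F) := by
  obtain ⟨C, hC, H⟩ := NT_lq hpq.symm
  refine ⟨4 * C / c0, div_pos bp c0_pos, fun U1 U2 F G1 G2 e hQ he => ?_⟩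
  have n1 := lq_nonneg q QQ (pd2 F)
  have c0p := c0_pos
  have u1 : ContDiff ℝ 1 U1 := hQ.u1.of_le bn
  have d1 : ContDiff ℝ 1 (pd1 U1) := dd_cd Ex hQ.u1 bn
  have d2 : ContDiff ℝ 1 (pd2 U1) := dd_cd Ey hQ.u1 bn
  have z1 : HasCompactSupport (pd1 U1) := dd_cs Ex hQ.s1
  have z2 : HasCompactSupport (pd2 U1) := dd_cs Ey hQ.s1
  have cF2 : Continuous (pd2 F) := dd_cont Ey hQ.f
  have sF2 : HasCompactSupport (pd2 F) := dd_cs Ey hQ.sf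
  refine dualQ hpq bp (dd_cont e d1) fun Θ hΘ hs => ?_
  obtain ⟨s, hs2, hse⟩ : ∃ s : ℝ, s ^ 2 = 1 ∧ ((e = Ex ∧ s = 1) ∨ (e = Ey ∧ s = -1)) := by
    rcases he with h | h
    · exact ⟨1, by norm_num, Or.inl ⟨h, rfl⟩⟩
    · exact ⟨-1, by norm_num, Or.inr ⟨h, rfl⟩⟩
  have as : |s| = 1 := by rcases hse with ⟨_, rfl⟩ | ⟨_, rfl⟩ <;> simp
  have o1 : (1:ℝ) ^ 2 = 1 := bn
  have o2 : (-1:ℝ) ^ 2 = 1 := bn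
  have hA := (hΘ.af o2 o1).cmul (-s)
  have hB := (hΘ.af o1 o2).cmul s
  have hC' := (hΘ.af o2 o2).cmul (-1)
  set S : F2 := fun x => (Θ x + -s * af (-1) 1 Θ x) + (s * af 1 (-1) Θ x + -1 * af (-1) (-1) Θ x) with hSd
  have hS : TF S := ⟨(hΘ.1.add hA.1).add (hB.1.add hC'.1), (hΘ.2.add hA.2).add (hB.2.add hC'.2)⟩
  have nS : lqNorm p univ S ≤ 4 * lqNorm p univ Θ := by
    have ml : ∀ {f}, TF f → ML p univ f := fun h => ML_cs h.cont h.2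
    have a1 := lq_add hpq.lt (ML_add (ml hΘ) (ml hA)) (ML_add (ml hB) (ml hC'))
    have a2 := lq_add hpq.lt (ml hΘ) (ml hA)
    have a3 := lq_add hpq.lt (ml hB) (ml hC')
    rw [lq_cmul hpq.lt, lq_af hΘ.cont o2 o1 hpq.nonneg, abs_neg, as] at a2
    rw [lq_cmul hpq.lt, lq_cmul hpq.lt, lq_af hΘ.cont o1 o2 hpq.nonneg, lq_af hΘ.cont o2 o2 hpq.nonneg, as] at a3
    simp only [abs_neg, abs_one] at a3
    linarith
  have m11 : ∀ (a b c d : ℝ) (x : P2), aff a 0 b 0 (aff c 0 d 0 x) = aff (a * c) 0 (b * d) 0 x := fun a b c d x => by simp [aff, mul_assoc]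
  have i11 : ∀ x : P2, aff 1 0 1 0 x = x := fun x => by simp [aff]
  have sx : ∀ x, S (aff (-1) 0 1 0 x) = -s * S x := fun x => by
    simp only [hSd, af, m11]; norm_num
    rw [i11]; linear_combination (Θ (aff 1 0 (-1) 0 x) - Θ (aff (-1) 0 1 0 x)) * hs2
  have sy : ∀ x, S (aff 1 0 (-1) 0 x) = s * S x := fun x => by
    simp only [hSd, af, m11]; norm_num
    rw [i11]; linear_combination (Θ (aff (-1) 0 1 0 x) - Θ (aff 1 0 (-1) 0 x)) * hs2
  set D := dd e (dd Ex S) with hDd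
  have hD : TF D := (hS.dd _).dd e
  have dx : ∀ x, D (aff (-1) 0 1 0 x) = -1 * D x := by
    intro x
    have q1 := sym1 hS.diff o2 sx
    rcases hse with ⟨rfl, rfl⟩ | ⟨rfl, rfl⟩
    · have := sym1 (hS.dd Ex).diff o2 q1 x
      rw [hDd, this]; ring
    · have := sym2 (hS.dd Ex).diff o1 q1 x
      rw [hDd, this]; ring
  have dy : ∀ x, D (aff 1 0 (-1) 0 x) = 1 * D x := by
    intro x
    have q1 := sym1 hS.diff o1 sy
    rcases hse with ⟨rfl, rfl⟩ | ⟨rfl, rfl⟩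
    · have := sym1 (hS.dd Ex).diff o1 q1 x
      rw [hDd, this]; ring
    · have := sym2 (hS.dd Ex).diff o2 q1 x
      rw [hDd, this]; ring
  have iU : Integrable U1 := u1.continuous.integrable_of_hasCompactSupport hQ.s1
  have iX : ∀ {a k : F2}, Continuous a → HasCompactSupport a → Continuous k → IntegrableOn (fun x => a x * k x) QQ := fun ha hs hk =>
    ((ha.mul hk).integrable_of_hasCompactSupport hs.mul_right).integrableOn
  have eq : ∫ x in QQ, dd e (pd1 U1) x * Θ x = ∫ x in QQ, U1 x * D x := by
    rw [ibp_e d1 z1 hΘ hs he, pd1_eq, ibp_e u1 hQ.s1 (hΘ.dd e) ((tsupport_fderiv_apply_subset ℝ e).trans hs) il, neg_neg]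
    refine setIntegral_congr_fun QQ_meas fun x hx => ?_
    beta_reduce
    rw [dd_comm (SM.c2 hΘ.1), hDd, dd_congr_QQ (f := dd Ex S) (g := dd Ex Θ) (dd_congr_QQ (fun x hx => by
      have h1 : R0 ≤ x.1 := le_of_lt hx.1
      have h2 : R0 ≤ x.2 := le_of_lt hx.2
      simp only [hSd]; rw [af_van hs il h1 h2, af_van hs il h1 h2, af_van hs ir h1 h2]; ring) _) e x hx]
  rw [eq]
  have key : ∀ T : ℝ, 0 < T → c0 * |∫ x in QQ, U1 x * D x| ≤ C * (4 * lqNorm p univ Θ) * lqNorm q QQ (pd2 F) + (∫ x in QQ, |U1 x|) * kd D * (T ^ 2)⁻¹ := by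
    intro T hT
    set B := NT T D with hBd
    have hB : SM B := NT_cd T hD
    have bx : ∀ x, B (aff (-1) 0 1 0 x) = -1 * B x := NT_sym hD.cont o2 o1 dx T
    have by' : ∀ x, B (aff 1 0 (-1) 0 x) = 1 * B x := NT_sym hD.cont o1 o2 dy T
    have B0 : ∀ y, B (0, y) = 0 := fun y => by
      have := bx (0, y); simp only [aff] at this; norm_num at this; linarith
    have B1 : ∀ x, pd2 B (x, 0) = 0 := fun x => by
      have := sym2 hB.di o2 by' (x, 0); simp only [aff] at this; norm_num at this; rw [pd2_eq]; linarith
    have w1 := ibp1 u1 hQ.s1 hB.p1.c1 fun y hy => Or.inl (hQ.hx y hy).1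
    have w2 := ibp1 d1 z1 hB.c1 fun y hy => Or.inr (B0 y)
    have w3 := ibp2 u1 hQ.s1 hB.p2.c1 fun x hx => Or.inr (B1 x)
    have w4 := ibp2 d2 z2 hB.c1 fun x hx => Or.inl (hQ.hy x hx).2
    have cK : Continuous (Kr T D) := (cv_cd (Km T) hD).continuous
    have a1 : ∫ x in QQ, U1 x * lap B x = (∫ x in QQ, U1 x * pd1 (pd1 B) x) + ∫ x in QQ, U1 x * pd2 (pd2 B) x := by
      rw [← integral_add (iX u1.continuous hQ.s1 hB.p1.p1.continuous) (iX u1.continuous hQ.s1 hB.p2.p2.continuous)]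
      congr 1; funext x; simp only [lap, pd1_eq, pd2_eq]; ring
    have a2 : ∫ x in QQ, U1 x * lap B x = (∫ x in QQ, U1 x * Kr T D x) - c0 * ∫ x in QQ, U1 x * D x := by
      rw [← integral_const_mul, ← integral_sub (iX u1.continuous hQ.s1 cK) ((iX u1.continuous hQ.s1 hD.cont).const_mul c0)]
      congr 1; funext x; rw [hBd, lap_NT hT.le hD]; ring
    have a3 : ∫ x in QQ, pd2 F x * B x = - ((∫ x in QQ, pd1 (pd1 U1) x * B x) + ∫ x in QQ, pd2 (pd2 U1) x * B x) := by
      have y1 : IntegrableOn (fun x => pd1 (pd1 U1) x * B x) QQ := iX (dd_cont Ex d1) (dd_cs Ex z1) hB.continuous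
      have y2 : IntegrableOn (fun x => pd2 (pd2 U1) x * B x) QQ := iX (dd_cont Ey d2) (dd_cs Ey z2) hB.continuous
      rw [← integral_add y1 y2, ← integral_neg]
      refine setIntegral_congr_fun QQ_meas fun x hx => ?_
      have t1 := lap_F hQ Ey x hx
      have t2 := div_F hQ Ex x hx
      have t3 := congrFun (dd_comm hQ.u2 Ex Ey) x
      simp only [pd1_eq, pd2_eq] at *
      rw [t1]; linear_combination (B x) * t2 - B x * t3
    have r1 : |∫ x in QQ, U1 x * Kr T D x| ≤ (∫ x in QQ, |U1 x|) * (kd D * (T ^ 2)⁻¹) := int_err iU.integrableOn fun x _ => Kr_decay hD hT x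
    obtain ⟨mB, nB⟩ := H T hT.le S hS e Ex he il
    rw [NT_dd T hS, NT_dd T (hS.dd _)] at mB nB
    have mB' : ML p QQ B := mB.mono_measure (Measure.restrict_mono (subset_univ _) le_rfl)
    obtain ⟨l1, l2⟩ := lq_holder hpq.symm (ML_cs (Ω := QQ) cF2 sF2) mB'
    have l3 := (lq_abs_le l1).trans l2
    have l4 := (lq_sub_set hpq.lt mB (subset_univ QQ)).trans (nB.trans (mlL nS hC.le))
    have l5 := mlL l4 n1
    have : c0 * ∫ x in QQ, U1 x * D x = (∫ x in QQ, U1 x * Kr T D x) + ∫ x in QQ, pd2 F x * B x := bL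
    rw [← abs_of_pos c0_pos, ← abs_mul, this]
    refine (abs_add_le _ _).trans ?_
    linarith
  have lim : Tendsto (fun T : ℝ => C * (4 * lqNorm p univ Θ) * lqNorm q QQ (pd2 F) + (∫ x in QQ, |U1 x|) * kd D * (T ^ 2)⁻¹) atTop (𝓝 (C * (4 * lqNorm p univ Θ) * lqNorm q QQ (pd2 F) + (∫ x in QQ, |U1 x|) * kd D * 0)) :=
    tendsto_const_nhds.add (((tendsto_pow_atTop bn).inv_tendsto_atTop).const_mul _)
  rw [mul_zero, add_zero] at lim
  have := ge_of_tendsto lim (eventually_atTop.2 ⟨1, fun T hT => key T bL⟩)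
  rw [div_mul_eq_mul_div, div_mul_eq_mul_div, le_div_iff₀ c0_pos]; linarith

theorem quarter {p q : ℝ} (hpq : p.HolderConjugate q) : ∃ C, 0 < C ∧ ∀ (U1 U2 F G1 G2 : F2), QH U1 U2 F G1 G2 → ∀ U e e', (U = U1 ∨ U = U2) → unitv e → unitv e' →
    lqNorm q QQ (dd e (dd e' U)) ≤ C * (lqNorm q QQ G1 + lqNorm q QQ G2) := by
  obtain ⟨C1, hC1, H1⟩ := F_bd hpq
  obtain ⟨C2, hC2, H2⟩ := U_bd hpq
  refine ⟨C1 + C2 * C1, by positivity, fun U1 U2 F G1 G2 H U e e' hU he he' => ?_⟩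
  set N := lqNorm q QQ G1 + lqNorm q QQ G2
  have N0 : 0 ≤ N := add_nonneg (lq_nonneg _ _ _) (lq_nonneg _ _ _)
  have hq := hpq.symm.lt
  have x1 : unitv Ex := Or.inl rfl
  have x2 : unitv Ey := Or.inr rfl
  have f1 := H1 U1 U2 F G1 G2 Ex H x1
  have f2 := H1 U1 U2 F G1 G2 Ey H x2
  have uu : ∀ e, unitv e → lqNorm q QQ (dd e (pd1 U1)) ≤ C2 * C1 * N := fun e he => by
    refine (H2 U1 U2 F G1 G2 e H he).trans ?_
    rw [mul_assoc]; exact mlL f2 hC2.le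
  have a0 : 0 ≤ C1 * N := bp
  have a1 : 0 ≤ C2 * C1 * N := bp
  have mF : ∀ e, ML q QQ (dd e F) := fun e => ML_cs (dd_cont e H.f) (dd_cs e H.sf)
  have mU : ∀ e, ML q QQ (dd e (pd1 U1)) := fun e => ML_cs (dd_cont e (dd_cd Ex H.u1 bn)) (dd_cs e (dd_cs _ H.s1))
  have comb : ∀ {v : F2} {e e'' : P2}, unitv e → unitv e'' → (∀ x ∈ QQ, |v x| ≤ |dd e F x| + |dd e'' (pd1 U1) x|) → lqNorm q QQ v ≤ (C1 + C2 * C1) * N := by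
    intro v e e'' he he'' h
    have mm := ML_add (mF e).abs (mU e'').abs
    have b := lq_mono hq QQ_meas (f := v) mm fun x hx => (h x hx).trans (le_abs_self _)
    have c := lq_add hq (mF e).abs (mU e'').abs
    have d1 := lq_mono hq QQ_meas (f := |dd e F|) (mF e) fun x _ => bs
    have d2 := lq_mono hq QQ_meas (f := |dd e'' (pd1 U1)|) (mU e'') fun x _ => bs
    have d3 := H1 U1 U2 F G1 G2 e H he
    have d4 := uu e'' he''
    rw [add_mul]; linarith
  have k1 := dd_comm H.u1 Ex Ey
  have k2 := dd_comm H.u2 Ex Ey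
  rcases hU with rfl | rfl <;> rcases he with rfl | rfl <;> rcases he' with rfl | rfl
  · exact comb x1 x1 fun x _ => by rw [pd1_eq]; linarith [abs_nonneg (dd Ex F x)]
  · exact comb x1 x2 fun x _ => by rw [pd1_eq, k1]; linarith [abs_nonneg (dd Ex F x)]
  · exact comb x1 x2 fun x _ => by rw [pd1_eq]; linarith [abs_nonneg (dd Ex F x)]
  · refine comb x2 x1 fun x hx => ?_
    have t1 := lap_F H Ey x hx
    have t2 := div_F H Ex x hx
    have t3 := congrFun k2 x
    simp only [pd1_eq, pd2_eq] at *
    rw [show dd Ey (dd Ey U) x = - dd Ey F x - dd Ex (dd Ex U) x by linarith]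
    refine (abs_sub _ _).trans ?_; rw [abs_neg]
  · refine comb x1 x2 fun x hx => ?_
    have t1 := lap_F H Ex x hx
    have t2 := div_F H Ey x hx
    have t3 := congrFun k1 x
    simp only [pd1_eq, pd2_eq] at *
    rw [show dd Ex (dd Ex U) x = dd Ex F x + dd Ey (dd Ex U1) x by linarith]
    exact abs_add_le _ _
  · refine comb x1 x1 fun x hx => ?_
    have t2 := div_F H Ex x hx
    simp only [pd1_eq, pd2_eq] at *
    rw [← abs_neg, ← t2]; linarith [abs_nonneg (dd Ex F x)]
  · refine comb x1 x1 fun x hx => ?_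
    have t2 := div_F H Ex x hx
    simp only [pd1_eq, pd2_eq] at *
    rw [← k2, ← abs_neg, ← t2]; linarith [abs_nonneg (dd Ex F x)]
  · refine comb x1 x2 fun x hx => ?_
    have t2 := div_F H Ey x hx
    simp only [pd1_eq, pd2_eq] at *
    rw [← abs_neg, ← t2]; linarith [abs_nonneg (dd Ex F x)]

theorem jens {q : ℝ} (hq : 1 < q) {g : ℝ → ℝ} (hg : Continuous g) {L : ℝ} (hL : 0 < L) :
    (∫ t in Ioc 0 L, |g t|) ^ q ≤ L ^ (q - 1) * ∫ t in Ioc 0 L, |g t| ^ q := by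
  have hpq : (Real.conjExponent q).HolderConjugate q := (Real.HolderConjugate.conjExponent hq).symm
  set p := Real.conjExponent q
  have q0 : 0 < q := bL
  have c : Continuous fun t => |g t| ^ q := hg.abs.rpow_const fun _ => Or.inr q0.le
  have ii : ∀ {f : ℝ → ℝ}, Continuous f → IntegrableOn f (Ioc 0 L) := fun hf => (hf.integrableOn_Icc (a := 0) (b := L)).mono_set Ioc_subset_Icc_self
  have h := (holder hpq (ν := volume.restrict (Ioc 0 L)) (f := fun _ => 1) (g := g) bf hg.aestronglyMeasurable (by simpa using ii continuous_const) (ii c)).2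
  simp only [abs_one, one_mul, Real.one_rpow, integral_const, smul_eq_mul, mul_one] at h
  have : (volume.restrict (Ioc 0 L)).real univ = L := by simp [Measure.real, hL.le]
  rw [this] at h
  have n : 0 ≤ ∫ t in Ioc 0 L, |g t| ^ q := integral_nonneg fp
  have := Real.rpow_le_rpow (integral_nonneg fun _ => abs_nonneg _) h q0.le
  rw [Real.mul_rpow bp bp, ← Real.rpow_mul n, one_div_mul_cancel q0.ne', Real.rpow_one, ← Real.rpow_mul hL.le] at this
  have e : 1 / p * q = q - 1 := by
    have := hpq.symm.inv_add_inv_eq_one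
    field_simp at this ⊢; have := hpq.ne_zero; have h1 := hpq.sub_one_mul_conj; linarith
  rwa [e] at this

theorem Hy {q : ℝ} (hq : 1 < q) {h : F2} (hc : Continuous h) (hs : HasCompactSupport h) {L : ℝ} (hL : 0 < L) (hv : ∀ x y, L ≤ y → h (x, y) = 0) :
    ∃ H : F2, Continuous H ∧ HasCompactSupport H ∧ (∀ φ : F2, ContDiff ℝ 1 φ → (∀ x, φ (x, 0) = 0) → ∫ x in QQ, (h x * φ x - H x * pd2 φ x) = 0) ∧
      lqNorm q QQ H ≤ L * lqNorm q QQ h := by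
  set H : F2 := fun x => - ∫ t in L..|x.2|, h (x.1, t) with hH
  have q0 : 0 < q := bL
  have cH : Continuous H := by
    have := intervalIntegral.continuous_parametric_primitive_of_continuous (μ := volume) (a₀ := L) (f := fun x t : ℝ => h (x, t)) bf
    exact (this.comp (f := fun x : P2 => (x.1, |x.2|)) bf).neg
  have zH : ∀ x : P2, L ≤ |x.2| → H x = 0 := fun x hx => by
    rw [hH]; simp only
    rw [intervalIntegral.integral_congr (g := fun _ => 0)]; · simp
    intro t ht; rw [uIcc_of_le hx] at ht; exact hv _ _ ht.1
  obtain ⟨R, hR⟩ := hs.isCompact.isBounded.subset_closedBall (0 : P2)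
  have sH : HasCompactSupport H := by
    refine HasCompactSupport.intro (K := Icc (-|R|) |R| ×ˢ Icc (-L) L) (isCompact_Icc.prod isCompact_Icc) fun x hx => ?_
    by_cases h1 : L ≤ |x.2|
    · exact zH x h1
    · have h2 : ¬ |x.1| ≤ |R| := fun h2 => hx ⟨abs_le.1 h2, abs_le.1 (not_le.1 h1).le⟩
      rw [hH]; simp only
      rw [intervalIntegral.integral_congr (g := fun _ => 0)]; · simp
      intro t _
      refine image_eq_zero_of_notMem_tsupport fun hm => h2 ?_
      have := mem_closedBall_zero_iff.1 (hR hm)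
      exact ((norm_fst_le (x.1, t)).trans this).trans (le_abs_self _)
  have dH : ∀ x t, 0 < t → HasDerivAt (fun t => H (x, t)) (- h (x, t)) t := by
    intro x t ht
    have c1 : Continuous fun t => h (x, t) := bf
    have := (intervalIntegral.integral_hasDerivAt_right (c1.intervalIntegrable L t) (c1.stronglyMeasurableAtFilter _ _) c1.continuousAt).neg
    refine this.congr_of_eventuallyEq ?_
    filter_upwards [lt_mem_nhds ht] with s hs
    simp [hH, abs_of_pos hs]
  have slice : ∀ {f : F2}, HasCompactSupport f → ∀ x, HasCompactSupport fun t : ℝ => f (x, t) := fun hf x =>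
    hf.comp_isClosedEmbedding (g := fun t : ℝ => (x, t)) ((isometry_iff_dist_eq.2 (by intro a b; simp [Prod.dist_eq])).isClosedEmbedding)
  refine ⟨H, cH, sH, fun φ hφ φ0 => ?_, ?_⟩
  · have cφ := hφ.continuous
    have cd : Continuous (pd2 φ) := dd_cont Ey hφ
    have hi : Integrable fun x => h x * φ x - H x * pd2 φ x := 
      ((hc.mul cφ).integrable_of_hasCompactSupport hs.mul_right).sub ((cH.mul cd).integrable_of_hasCompactSupport sH.mul_right)
    rw [QQ, Measure.volume_eq_prod, setIntegral_prod _ (by rw [← Measure.volume_eq_prod]; exact hi.integrableOn)]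
    rw [setIntegral_congr_fun (g := fun _ => 0) measurableSet_Ioi]
    · simp
    intro x hx
    have sw : HasCompactSupport fun t : ℝ => -(H (x, t) * φ (x, t)) := by
      have := (slice sH x).mul_right (f' := fun t => φ (x, t))
      exact this.neg
    have si : HasCompactSupport fun t : ℝ => h (x, t) * φ (x, t) - H (x, t) * pd2 φ (x, t) :=
      (slice (f := fun z => h z * φ z - H z * pd2 φ z) (HasCompactSupport.sub hs.mul_right sH.mul_right) x)
    have r := integral_Ioi_of_hasDerivAt_of_tendsto (a := 0) (m := 0) (f := fun t : ℝ => -(H (x, t) * φ (x, t))) (f' := fun t : ℝ => h (x, t) * φ (x, t) - H (x, t) * pd2 φ (x, t))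
      (Continuous.continuousWithinAt bf) (fun t ht => by
        refine ((dH x t ht).mul (pd2_hda (hφ.differentiable bn) x t)).neg.congr_deriv ?_; ring) 
      ((Continuous.integrable_of_hasCompactSupport bf si).integrableOn) (by
        have := sw.is_zero_at_infty
        exact this.mono_left (atTop_le_cocompact))
    simp only [φ0] at r
    simpa using r
  · refine lq_le hq (by have := lq_nonneg q QQ h; positivity) ?_
    rw [Real.mul_rpow hL.le (lq_nonneg _ _ _), lq_pow hq, ← integral_const_mul]
    have i1 : Integrable fun x => |H x| ^ q := cs_rpow_int cH sH q0
    have i2 : Integrable fun x => L ^ q * |h x| ^ q := (cs_rpow_int hc hs q0).const_mul _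
    have mm : ((volume : Measure P2).restrict QQ) = (volume.restrict (Ioi 0)).prod (volume.restrict (Ioi 0)) := by
      rw [QQ, Measure.volume_eq_prod, Measure.prod_restrict]
    have j1 : Integrable (fun x => |H x| ^ q) ((volume.restrict (Ioi R0)).prod (volume.restrict (Ioi R0))) := by rw [← mm]; exact i1.integrableOn
    have j2 : Integrable (fun x => L ^ q * |h x| ^ q) ((volume.restrict (Ioi R0)).prod (volume.restrict (Ioi R0))) := by rw [← mm]; exact i2.integrableOn
    rw [mm, integral_prod _ j1, integral_prod _ j2]
    refine integral_mono j1.integral_prod_left j2.integral_prod_left fun x => ?_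
    simp only
    rw [integral_const_mul]
    have cg : Continuous fun t => h (x, t) := bf
    have cq : Continuous fun t => |h (x, t)| ^ q := cg.abs.rpow_const fun _ => Or.inr q0.le
    have b : ∀ t ∈ Ioi R0, |H (x, t)| ^ q ≤ (Ioc 0 L).indicator (fun _ => (∫ t in Ioc 0 L, |h (x, t)|) ^ q) t := by
      intro t ht
      have t0 : 0 < t := ht
      by_cases htL : t ≤ L
      · rw [indicator_of_mem (show t ∈ Ioc 0 L from ⟨ht, htL⟩)]
        refine Real.rpow_le_rpow (abs_nonneg _) ?_ q0.le
        rw [hH]; simp only [abs_neg]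
        rw [abs_of_pos t0, intervalIntegral.integral_symm, abs_neg, intervalIntegral.integral_of_le htL]
        refine (abs_integral_le_integral_abs).trans ?_
        exact setIntegral_mono_set ((cg.abs.integrableOn_Icc (a := 0) (b := L)).mono_set Ioc_subset_Icc_self) (Ef fun _ => abs_nonneg _) (Ioc_subset_Ioc_left t0.le).eventuallyLE
      · rw [zH _ (by rw [abs_of_pos t0]; exact (not_le.1 htL).le), abs_zero, Real.zero_rpow q0.ne']
        exact indicator_nonneg (fun _ _ => by have : 0 ≤ ∫ t in Ioc 0 L, |h (x, t)| := integral_nonneg fun _ => abs_nonneg _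
                                              positivity) _
    have iL : IntegrableOn (fun _ : ℝ => (∫ t in Ioc 0 L, |h (x, t)|) ^ q) (Ioc 0 L) := integrableOn_const bs
    have s1 : Integrable (fun t => |h (x, t)| ^ q) := by
      refine cq.integrable_of_hasCompactSupport ?_
      exact (slice hs x).comp_left (g := fun r => |r| ^ q) (by simp [q0.ne'])
    calc ∫ t in Ioi 0, |H (x, t)| ^ q ≤ ∫ t in Ioi 0, (Ioc 0 L).indicator (fun _ => (∫ t in Ioc 0 L, |h (x, t)|) ^ q) t := by
          refine integral_mono_of_nonneg (Ef fp) ((integrable_indicator_iff measurableSet_Ioc).2 iL).integrableOn ((ae_restrict_iff' measurableSet_Ioi).2 (Ef b))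
      _ = L * (∫ t in Ioc 0 L, |h (x, t)|) ^ q := by
          rw [setIntegral_indicator measurableSet_Ioc, inter_eq_right.2 Ioc_subset_Ioi_self]; simp [Measure.real, hL.le]
      _ ≤ L * (L ^ (q - 1) * ∫ t in Ioc 0 L, |h (x, t)| ^ q) := mlL (jens hq cg hL) hL.le
      _ = L ^ q * ∫ t in Ioc 0 L, |h (x, t)| ^ q := by
          rw [← mul_assoc, Real.rpow_sub_one hL.ne', mul_div_cancel₀ _ hL.ne']
      _ ≤ L ^ q * ∫ t in Ioi 0, |h (x, t)| ^ q := by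
          refine mlL ?_ bp
          exact setIntegral_mono_set s1.integrableOn (Ef fp) Ioc_subset_Ioi_self.eventuallyLE

theorem QQ_swap (f : F2) : ∫ x in QQ, f x.swap = ∫ x in QQ, f x := by
  rw [QQ, Measure.volume_eq_prod]; exact setIntegral_prod_swap _ _ _

theorem Hx {q : ℝ} (hq : 1 < q) {h : F2} (hc : Continuous h) (hs : HasCompactSupport h) {L : ℝ} (hL : 0 < L) (hv : ∀ x y, L ≤ x → h (x, y) = 0) :
    ∃ H : F2, Continuous H ∧ HasCompactSupport H ∧ (∀ φ : F2, ContDiff ℝ 1 φ → (∀ y, φ (0, y) = 0) → ∫ x in QQ, (h x * φ x - H x * pd1 φ x) = 0) ∧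
      lqNorm q QQ H ≤ L * lqNorm q QQ h := by
  have ss : ∀ {f : F2}, HasCompactSupport f → HasCompactSupport fun x : P2 => f x.swap := fun hf => hf.comp_homeomorph (Homeomorph.prodComm ℝ ℝ)
  obtain ⟨H, c, s, e, b⟩ := Hy hq (h := fun x => h x.swap) (hc.comp continuous_swap) (ss hs) hL fun x y hy => hv y x hy
  refine ⟨fun x => H x.swap, c.comp continuous_swap, ss s, fun φ hφ φ0 => ?_, ?_⟩
  · have := e (fun x => φ x.swap) (hφ.comp (by unfold Prod.swap; fun_prop)) fun x => φ0 x
    rw [← QQ_swap] at this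
    simp only [Prod.swap_swap] at this
    rw [← this]
    congr 1; funext x
    have d1 := pd1_hda (hφ.differentiable bn) x.1 x.2
    have d2 := pd2_hda (f := fun x => φ x.swap) ((hφ.comp (f := Prod.swap) (by unfold Prod.swap; fun_prop)).differentiable bn) x.2 x.1
    rw [d1.unique d2]; rfl
  · have e1 : lqNorm q QQ (fun x => H x.swap) = lqNorm q QQ H := by rw [lqNorm, QQ_swap (fun x => |H x| ^ q)]; rfl
    have e2 : lqNorm q QQ (fun x => h x.swap) = lqNorm q QQ h := by rw [lqNorm, QQ_swap (fun x => |h x| ^ q)]; rfl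
    rw [e1, ← e2]; exact b

structure WF (ℓ κ K r : ℝ) (θ : ℕ → ℕ → F2) : Prop where
  sm : ∀ i j, SM (θ i j)
  cs : ∀ i j, HasCompactSupport (θ i j)
  d1 : ∀ i j, dd Ex (θ i j) = θ (i+1) j
  d2 : ∀ i j, dd Ey (θ i j) = θ i (j+1)
  bd : ∀ i j, i + j ≤ 3 → ∀ x, |θ i j x| ≤ K * r ^ (i + j)
  bl : ∀ x, ℓ * |θ 1 0 x| ≤ K ∧ ℓ * |θ 2 0 x| ≤ K * r ∧ |θ 0 1 x| ≤ K ∧ |θ 0 2 x| ≤ K * r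
  v : ∀ i j (x : P2), (ℓ ≤ x.1 ∨ 1 ≤ x.2) → θ i j x = 0
  b0 : ∀ x : ℝ, θ 0 1 (x, 0) = -(κ / 2) * θ 0 0 (x, 0)
  lo : ∀ x : P2, 0 ≤ x.1 → x.1 ≤ ℓ / 2 → 0 ≤ x.2 → x.2 ≤ 1 / 2 → 1 ≤ K * θ 0 0 x

theorem idv_cd {b : ℝ → ℝ} (hb : ContDiff ℝ ∞ b) (i : ℕ) : ContDiff ℝ ∞ (iteratedDeriv i b) := by
  induction i with
  | zero => simpa using hb
  | succ n ih => rw [iteratedDeriv_succ]; exact (contDiff_infty_iff_deriv.1 ih).2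

theorem idv_cs {b : ℝ → ℝ} (hb : HasCompactSupport b) (i : ℕ) : HasCompactSupport (iteratedDeriv i b) := by
  induction i with
  | zero => simpa using hb
  | succ n ih => rw [iteratedDeriv_succ]; exact ih.deriv

theorem idv_van {b : ℝ → ℝ} (hb : ∀ x, 3/4 < x → b x = 0) (i : ℕ) : ∀ x, 3/4 < x → iteratedDeriv i b x = 0 := by
  induction i with
  | zero => simpa using hb
  | succ n ih =>
    intro x hx; rw [iteratedDeriv_succ]
    have : iteratedDeriv n b =ᶠ[𝓝 x] fun _ => 0 := by filter_upwards [lt_mem_nhds hx] with y hy using ih y hy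
    rw [this.deriv_eq]; simp

theorem idv_hda {b : ℝ → ℝ} (hb : ContDiff ℝ ∞ b) (i : ℕ) (x : ℝ) : HasDerivAt (iteratedDeriv i b) (iteratedDeriv (i+1) b x) x := by
  rw [iteratedDeriv_succ]; exact ((idv_cd hb i).differentiable bs x).hasDerivAt

theorem dd_tp {a b : ℝ → ℝ} {a' b' : ℝ} {x : P2} (ha : HasDerivAt a a' x.1) (hb : HasDerivAt b b' x.2) :
    dd Ex (fun x => a x.1 * b x.2) x = a' * b x.2 ∧ dd Ey (fun x => a x.1 * b x.2) x = a x.1 * b' := by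
  have h1 : HasFDerivAt (fun x : P2 => a x.1) _ x := ha.hasFDerivAt.comp x hasFDerivAt_fst
  have h2 : HasFDerivAt (fun x : P2 => b x.2) _ x := hb.hasFDerivAt.comp x hasFDerivAt_snd
  have := (h1.mul h2).fderiv
  constructor <;> rw [dd, show (fun x : P2 => a x.1 * b x.2) = (fun x : P2 => a x.1) * (fun x : P2 => b x.2) from rfl, this] <;> simp <;> ring

theorem WF_ex (κ : ℝ) : ∃ K, 1 ≤ K ∧ ∀ ℓ r : ℝ, 0 < ℓ → ℓ⁻¹ ≤ r → 1 ≤ r → ∃ θ, WF ℓ κ K r θ := by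
  let β : ContDiffBump R0 := ⟨1/2, 3/4, by norm_num, by norm_num⟩
  have b1 : ContDiff ℝ ∞ β := β.contDiff
  have b2 : HasCompactSupport β := β.hasCompactSupport
  have b3 : ∀ x : ℝ, 3/4 < x → β x = 0 := fun x hx => β.zero_of_le_dist (by
    rw [Real.dist_eq, sub_zero, abs_of_pos bL]; exact hx.le)
  set γ : ℝ → ℝ := fun y => β y * Real.exp (-(κ/2) * y) with hγ
  have g1 : ContDiff ℝ ∞ γ := b1.mul bf
  have g2 : HasCompactSupport γ := b2.mul_right
  have g3 : ∀ x : ℝ, 3/4 < x → γ x = 0 := fun x hx => by simp [hγ, b3 x hx]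
  have hB : ∀ b : ℝ → ℝ, ContDiff ℝ ∞ b → HasCompactSupport b → ∃ M, 1 ≤ M ∧ ∀ i ≤ 3, ∀ x, |iteratedDeriv i b x| ≤ M := by
    intro b hb hc
    choose M hM using fun i => (idv_cs hc i).exists_bound_of_continuous (idv_cd hb i).continuous
    refine ⟨1 + ∑ i ∈ Finset.range 4, |M i|, by have := Finset.sum_nonneg (s := Finset.range 4) fun i _ => abs_nonneg (M i); linarith, fun i hi x => ?_⟩
    have := Finset.single_le_sum (s := Finset.range 4) (f := fun i => |M i|) (fun i _ => abs_nonneg _) (Finset.mem_range.2 (by omega : i < 4))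
    have := hM i x; rw [Real.norm_eq_abs] at this; have := le_abs_self (M i); linarith
  obtain ⟨M, hM1, hM⟩ := hB _ b1 b2
  obtain ⟨N, hN1, hN⟩ := hB _ g1 g2
  have hMN : 1 ≤ M * N := one_le_mul_of_one_le_of_one_le hM1 hN1
  have ep := Real.exp_pos (|κ|)
  refine ⟨M * N + Real.exp |κ|, by linarith, fun ℓ r hl hr h1 => ⟨fun i j x => (ℓ⁻¹ ^ i * iteratedDeriv i β (ℓ⁻¹ * x.1)) * iteratedDeriv j γ x.2, ?_⟩⟩
  have li : 0 < ℓ⁻¹ := bp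
  have hd : ∀ i t, HasDerivAt (fun t => ℓ⁻¹ ^ i * iteratedDeriv i β (ℓ⁻¹ * t)) (ℓ⁻¹ ^ (i+1) * iteratedDeriv (i+1) β (ℓ⁻¹ * t)) t := fun i t => by
    have := ((idv_hda b1 i (ℓ⁻¹ * t)).comp t ((hasDerivAt_id t).const_mul ℓ⁻¹)).const_mul (ℓ⁻¹ ^ i)
    refine this.congr_deriv ?_; rw [pow_succ]; simp only [mul_one]; ring
  have bd : ∀ i j, i ≤ 3 → j ≤ 3 → ∀ x : P2, |(ℓ⁻¹ ^ i * iteratedDeriv i β (ℓ⁻¹ * x.1)) * iteratedDeriv j γ x.2| ≤ (M * N + Real.exp |κ|) * ℓ⁻¹ ^ i := fun i j hi hj x => by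
    rw [abs_mul, abs_mul, abs_of_pos (by positivity : 0 < ℓ⁻¹ ^ i)]
    calc _ ≤ ℓ⁻¹ ^ i * M * N := by gcongr; exacts [hM i hi _, hN j hj _]
      _ = (M * N) * ℓ⁻¹ ^ i := by ring
      _ ≤ _ := by gcongr; linarith
  refine ⟨fun i j => ?_, fun i j => ?_, fun i j => ?_, fun i j => ?_, fun i j hij x => ?_, fun x => ⟨?_, ?_, ?_, ?_⟩, fun i j x hx => ?_, fun x => ?_, fun x h0 h1 h2 h3 => ?_⟩
  · have := idv_cd b1 i; have := idv_cd g1 j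
    unfold SM; fun_prop
  · obtain ⟨a, ha⟩ := (idv_cs b2 i).isCompact.isBounded.subset_closedBall 0
    obtain ⟨b, hb⟩ := (idv_cs g2 j).isCompact.isBounded.subset_closedBall 0
    refine HasCompactSupport.intro (K := Metric.closedBall 0 (ℓ * a) ×ˢ Metric.closedBall 0 b) ((isCompact_closedBall _ _).prod (isCompact_closedBall _ _)) fun x hx => ?_
    by_contra h
    have n1 : iteratedDeriv i β (ℓ⁻¹ * x.1) ≠ 0 := fun h' => h (by simp [h'])
    have n2 : iteratedDeriv j γ x.2 ≠ 0 := fun h' => h (by simp [h'])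
    refine hx ⟨?_, hb (subset_tsupport _ n2)⟩
    have := ha (subset_tsupport _ n1)
    rw [mem_closedBall_zero_iff, Real.norm_eq_abs] at this ⊢
    rw [abs_mul, abs_of_pos li, inv_mul_le_iff₀ hl] at this; exact this
  · funext x; exact (dd_tp (hd i x.1) (idv_hda g1 j x.2)).1
  · funext x; exact (dd_tp (hd i x.1) (idv_hda g1 j x.2)).2
  · refine (bd i j (by omega) (by omega) x).trans ?_
    have : ℓ⁻¹ ^ i ≤ r ^ (i + j) := (pow_le_pow_left₀ li.le hr i).trans (pow_le_pow_right₀ h1 (by omega))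
    gcongr
  · have := mlL (bd 1 0 (by omega) (by omega) x) hl.le
    refine this.trans (le_of_eq ?_); field_simp
  · have := mlL (bd 2 0 (by omega) (by omega) x) hl.le
    refine this.trans (le_trans (le_of_eq ?_) (mlL hr bp)); field_simp
  · simpa using bd 0 1 (by omega) (by omega) x
  · have := bd 0 2 (by omega) (by omega) x
    rw [pow_zero, mul_one] at this; exact this.trans (le_mul_of_one_le_right bp h1)
  · rcases hx with hx | hx
    · have : 1 ≤ ℓ⁻¹ * x.1 := by rw [inv_mul_eq_div, one_le_div hl]; exact hx
      simp [idv_van b3 i (ℓ⁻¹ * x.1) bL]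
    · simp [idv_van g3 j x.2 bL]
  · have e1 : (β : ℝ → ℝ) =ᶠ[𝓝 0] 1 := β.eventuallyEq_one
    have : HasDerivAt γ (-(κ/2)) 0 := by
      have h : HasDerivAt (fun y => Real.exp (-(κ/2) * y)) (-(κ/2)) 0 := by
        have := ((hasDerivAt_id R0).const_mul (-(κ/2))).exp
        simpa using this
      refine h.congr_of_eventuallyEq ?_
      filter_upwards [e1] with y hy; simp [hγ, hy]
    have g0 : γ 0 = 1 := by simp [hγ, e1.eq_of_nhds]
    simp only [zero_add, iteratedDeriv_one, iteratedDeriv_zero, this.deriv, g0]; ring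
  · have e1 : β (ℓ⁻¹ * x.1) = 1 := β.one_of_mem_closedBall (by
      rw [mem_closedBall_zero_iff, Real.norm_eq_abs, abs_of_nonneg bp, inv_mul_le_iff₀ hl]; show x.1 ≤ ℓ * (1/2); linarith)
    have e2 : β x.2 = 1 := β.one_of_mem_closedBall (by
      rw [mem_closedBall_zero_iff, Real.norm_eq_abs, abs_of_nonneg h2]; exact h3)
    simp only [pow_zero, iteratedDeriv_zero, e1, hγ, e2, one_mul]
    have : Real.exp (-|κ|) ≤ Real.exp (-(κ/2) * x.2) := by
      apply Real.exp_le_exp.2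
      have := abs_nonneg κ; have := le_abs_self κ; have h5 := mlL h3 (abs_nonneg κ)
      nlinarith [mlR (le_abs_self κ) h2]
    calc 1 = Real.exp |κ| * Real.exp (-|κ|) := by rw [← Real.exp_add]; simp
      _ ≤ (M * N + Real.exp |κ|) * Real.exp (-(κ/2) * x.2) := by gcongr; linarith

structure LC (ℓ μ κ : ℝ) (u1 u2 ψ p f1 f2 : F2) : Prop where
  c1 : ContDiff ℝ 2 u1
  c2 : ContDiff ℝ 2 u2
  c3 : ContDiff ℝ 2 ψ
  cp : ContDiff ℝ 1 p
  k1 : Continuous f1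
  k2 : Continuous f2
  e : ∀ x : P2, 0 ≤ x.1 → x.1 ≤ ℓ → 0 ≤ x.2 → x.2 ≤ 1 → dd Ey ψ x = u1 x ∧ dd Ex ψ x = - u2 x ∧ dd Ex u1 x + dd Ey u2 x = 0 ∧
    -μ * (dd Ex (dd Ex u1) x + dd Ey (dd Ey u1) x) + dd Ex p x = f1 x ∧
    -μ * (dd Ex (dd Ex u2) x + dd Ey (dd Ey u2) x) + dd Ey p x = f2 x
  hx : ∀ y, 0 ≤ y → y ≤ 1 → u1 (0, y) = 0 ∧ u2 (0, y) = 0 ∧ ψ (0, y) = 0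
  hy : ∀ x, 0 ≤ x → x ≤ ℓ → u2 (x, 0) = 0 ∧ ψ (x, 0) = 0 ∧ dd Ey u1 (x, 0) = κ * u1 (x, 0)

def om (u1 u2 : F2) (x : P2) : ℝ := dd Ex u2 x - dd Ey u1 x
def rr (θ : ℕ → ℕ → F2) (u1 u2 ψ : F2) (x : P2) : ℝ := 2 * (θ 1 0 x * u2 x) - 2 * (θ 0 1 x * u1 x) - ψ x * (θ 2 0 x + θ 0 2 x)

theorem dd_k (c : ℝ) (e : P2) : dd e (fun _ => c) = fun _ => 0 := by funext x; simp [dd]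

theorem dd_loc {f g : F2} {O : Set P2} (hO : IsOpen O) (h : ∀ x ∈ O, f x = g x) (e : P2) : ∀ x ∈ O, dd e f x = dd e g x := fun x hx => by
  rw [dd, dd, Filter.EventuallyEq.fderiv_eq (f₁ := f) (f := g)]
  filter_upwards [hO.mem_nhds hx] with y hy using h y hy

def RO (ℓ : ℝ) : Set P2 := Ioo 0 ℓ ×ˢ Ioo 0 1
theorem RO_open (ℓ : ℝ) : IsOpen (RO ℓ) := isOpen_Ioo.prod isOpen_Ioo

section
variable {ℓ μ κ : ℝ} {u1 u2 ψ p f1 f2 : F2}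
theorem LC.o (H : LC ℓ μ κ u1 u2 ψ p f1 f2) (x : P2) (hx : x ∈ RO ℓ) : dd Ey ψ x = u1 x ∧ dd Ex ψ x = - u2 x ∧ dd Ex u1 x + dd Ey u2 x = 0 ∧
    -μ * (dd Ex (dd Ex u1) x + dd Ey (dd Ey u1) x) + dd Ex p x = f1 x ∧
    -μ * (dd Ex (dd Ex u2) x + dd Ey (dd Ey u2) x) + dd Ey p x = f2 x := H.e x hx.1.1.le hx.1.2.le hx.2.1.le hx.2.2.le
theorem LC.dv (H : LC ℓ μ κ u1 u2 ψ p f1 f2) (e x : P2) (hx : x ∈ RO ℓ) : dd e (dd Ex u1) x + dd e (dd Ey u2) x = 0 := by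
  have a := (dd_cd (m := 1) Ex H.c1 bn).differentiable bs
  have b := (dd_cd (m := 1) Ey H.c2 bn).differentiable bs
  have := dd_loc (RO_open ℓ) (f := fun x => dd Ex u1 x + dd Ey u2 x) (g := fun _ => 0) (fun x hx => (LC.o H x hx).2.2.1) e x hx
  rw [dd_add a b] at this; beta_reduce at this; rw [this]; simp [dd]
theorem LC.om_c (H : LC ℓ μ κ u1 u2 ψ p f1 f2) : ContDiff ℝ 1 (om u1 u2) := (dd_cd (m := 1) Ex H.c2 bn).sub (dd_cd (m := 1) Ey H.c1 bn)
theorem LC.om_d (H : LC ℓ μ κ u1 u2 ψ p f1 f2) (e : P2) : dd e (om u1 u2) = fun x => dd e (dd Ex u2) x - dd e (dd Ey u1) x :=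
  dd_sub ((dd_cd (m := 1) Ex H.c2 bn).differentiable bs) ((dd_cd (m := 1) Ey H.c1 bn).differentiable bs) e
theorem LC.om_x (H : LC ℓ μ κ u1 u2 ψ p f1 f2) (x : P2) (hx : x ∈ RO ℓ) : μ * dd Ex (om u1 u2) x = dd Ey p x - f2 x ∧ μ * dd Ey (om u1 u2) x = f1 x - dd Ex p x := by
  have h := LC.o H x hx
  have a := LC.dv H Ey x hx
  have b := LC.dv H Ex x hx
  rw [dd_comm H.c1 Ey Ex] at a
  rw [dd_comm H.c2 Ex Ey] at b
  simp only [LC.om_d H]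
  constructor
  · linear_combination -μ * a - h.2.2.2.2
  · linear_combination μ * b + h.2.2.2.1

theorem LQ (H : LC ℓ μ κ u1 u2 ψ p f1 f2) {K r : ℝ} {θ : ℕ → ℕ → F2} (hl : 0 < ℓ) (hμ : 0 < μ) (W : WF ℓ κ K r θ) {h1 h2 H1 H2 : F2}
    (e1 : h1 = fun x => -(f2 x * θ 1 0 x / μ) + om u1 u2 x * θ 2 0 x) (e2 : h2 = fun x => f1 x * θ 0 1 x / μ + om u1 u2 x * θ 0 2 x)
    (q1 : Continuous H1) (q2 : Continuous H2) (s1 : HasCompactSupport H1) (s2 : HasCompactSupport H2)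
    (w1 : ∀ φ : F2, ContDiff ℝ 1 φ → (∀ y, φ (0, y) = 0) → ∫ x in QQ, (h1 x * φ x - H1 x * pd1 φ x) = 0)
    (w2 : ∀ φ : F2, ContDiff ℝ 1 φ → (∀ y, φ (y, 0) = 0) → ∫ x in QQ, (h2 x * φ x - H2 x * pd2 φ x) = 0) :
    QH (fun x => θ 0 0 x * u1 x + θ 0 1 x * ψ x) (fun x => θ 0 0 x * u2 x - θ 1 0 x * ψ x) (fun x => θ 0 0 x * om u1 u2 x + rr θ u1 u2 ψ x)
      (fun x => -(θ 0 0 x * f2 x / μ) + 2 * om u1 u2 x * θ 1 0 x + dd Ex (rr θ u1 u2 ψ) x + H1 x)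
      (fun x => θ 0 0 x * f1 x / μ + 2 * om u1 u2 x * θ 0 1 x + dd Ey (rr θ u1 u2 ψ) x + H2 x) := by
  have s : ∀ i j (f : F2), HasCompactSupport fun x => θ i j x * f x := fun i j f => (W.cs i j).mul_right
  have s' : ∀ i j (f : F2), HasCompactSupport fun x => f x * θ i j x := fun i j f => (W.cs i j).mul_left
  have t2 : ∀ i j, ContDiff ℝ 2 (θ i j) := fun i j => (W.sm i j).c2
  have t1 : ∀ i j, ContDiff ℝ 1 (θ i j) := fun i j => (W.sm i j).c1
  have td : ∀ i j, Differentiable ℝ (θ i j) := fun i j => (W.sm i j).di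
  have tc : ∀ i j, Continuous (θ i j) := fun i j => (td i j).continuous
  have v1 := H.c1; have v2 := H.c2; have v3 := H.c3
  have y1 : ContDiff ℝ 1 u1 := v1.of_le bn
  have y2 : ContDiff ℝ 1 u2 := v2.of_le bn
  have y3 : ContDiff ℝ 1 ψ := v3.of_le bn
  have d1 := y1.differentiable bs
  have d2 := y2.differentiable bs
  have d3 := y3.differentiable bs
  have oc := LC.om_c H
  have od := oc.differentiable bs
  have oo := oc.continuous
  have rc : ContDiff ℝ 1 (rr θ u1 u2 ψ) := by unfold rr; fun_prop
  have rs : HasCompactSupport (rr θ u1 u2 ψ) := by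
    refine HasCompactSupport.sub (HasCompactSupport.sub ?_ ?_) ?_
    · exact (s 1 0 u2).mul_left
    · exact (s 0 1 u1).mul_left
    · exact ((W.cs 2 0).add (W.cs 0 2)).mul_left
  have rd := rc.differentiable bs
  have pc := H.cp.continuous
  have cF1 := H.k1; have cF2 := H.k2
  have out : ∀ x : P2, 0 < x.1 → 0 < x.2 → x ∉ RO ℓ → ∀ i j, θ i j x = 0 := fun x a b hx i j => W.v i j x (by
    by_contra! h; exact hx ⟨⟨a, h.1⟩, b, h.2⟩)
  have out' : ∀ x : P2, ¬ (x.1 ≤ ℓ ∧ x.2 ≤ 1) → ∀ i j, θ i j x = 0 := fun x hx i j => W.v i j x (by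
    by_contra! h; exact hx ⟨h.1.le, h.2.le⟩)
  have G1c : Continuous (fun x => -(θ 0 0 x * f2 x / μ) + 2 * om u1 u2 x * θ 1 0 x + dd Ex (rr θ u1 u2 ψ) x + H1 x) := by
    have := dd_cont Ex rc; fun_prop
  have G2c : Continuous (fun x => θ 0 0 x * f1 x / μ + 2 * om u1 u2 x * θ 0 1 x + dd Ey (rr θ u1 u2 ψ) x + H2 x) := by
    have := dd_cont Ey rc; fun_prop
  have G1s : HasCompactSupport (fun x => -(θ 0 0 x * f2 x / μ) + 2 * om u1 u2 x * θ 1 0 x + dd Ex (rr θ u1 u2 ψ) x + H1 x) := by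
    have a : HasCompactSupport fun x => -(θ 0 0 x * f2 x / μ) := by simpa [neg_div, div_eq_mul_inv, mul_assoc] using (s 0 0 fun x => -(f2 x * μ⁻¹))
    exact ((a.add (s' 1 0 _)).add (dd_cs _ rs)).add s1
  have G2s : HasCompactSupport (fun x => θ 0 0 x * f1 x / μ + 2 * om u1 u2 x * θ 0 1 x + dd Ey (rr θ u1 u2 ψ) x + H2 x) := by
    have a : HasCompactSupport fun x => (θ 0 0 x * f1 x / μ) := by simpa [div_eq_mul_inv, mul_assoc] using (s 0 0 fun x => (f1 x * μ⁻¹))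
    exact ((a.add (s' 0 1 _)).add (dd_cs _ rs)).add s2
  have Fc : ContDiff ℝ 1 (fun x => θ 0 0 x * om u1 u2 x + rr θ u1 u2 ψ x) := bf
  have Fs : HasCompactSupport (fun x => θ 0 0 x * om u1 u2 x + rr θ u1 u2 ψ x) := (s 0 0 _).add rs
  refine ⟨by fun_prop, by fun_prop, (s 0 0 u1).add (s 0 1 ψ), (s 0 0 u2).sub (s 1 0 ψ), Fc, Fs, G1c, G2c, G1s, G2s, fun x a b => ?_, fun x a b => ?_, fun y hy => ?_, fun x hx => ?_, fun φ hφ φx φy => ?_⟩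
  · simp (disch := fun_prop) only [pd1_eq, pd2_eq, dd_add, dd_sub, dd_mul, W.d1, W.d2, rr, om]
    by_cases hx : x.1 ≤ ℓ ∧ x.2 ≤ 1
    · obtain ⟨a1, a2, -⟩ := H.e x a hx.1 b hx.2
      rw [a1, a2]; ring
    · simp [out' x hx]
  · simp (disch := fun_prop) only [pd1_eq, pd2_eq, dd_add, dd_sub, dd_mul, W.d1, W.d2]
    by_cases hx : x.1 ≤ ℓ ∧ x.2 ≤ 1
    · obtain ⟨a1, a2, a3, -⟩ := H.e x a hx.1 b hx.2
      rw [a1, a2]; linear_combination θ 0 0 x * a3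
    · simp [out' x hx]
  · by_cases h : y ≤ 1
    · simp [H.hx y hy h]
    · simp [out' (0, y) (fun h' => h h'.2)]
  · by_cases h : x ≤ ℓ
    · obtain ⟨a1, a2, a3⟩ := H.hy x hx h
      simp (disch := fun_prop) only [pd2_eq, dd_add, dd_mul, W.d2, a1, a2, a3, W.b0, (H.e (x, 0) hx h le_rfl zero_le_one).1, mul_zero, sub_zero, true_and]
      ring
    · simp (disch := fun_prop) only [pd2_eq, dd_add, dd_mul, W.d2, out' (x, 0) (fun h' => h h'.1)]; simp
  · have f1' : ContDiff ℝ 1 φ := SM.c1 hφ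
    have fx : ContDiff ℝ 1 (dd Ex φ) := SM.c1 (SM.dd hφ _)
    have fy : ContDiff ℝ 1 (dd Ey φ) := SM.c1 (SM.dd hφ _)
    have fd := f1'.differentiable bs
    have fxd := fx.differentiable bs
    have fyd := fy.differentiable bs
    have pd := H.cp.differentiable bs
    have pC := H.cp
    have fxc := fx.continuous; have fyc := fy.continuous; have fc := fd.continuous
    have z1 : ∀ y, dd Ey φ (0, y) = 0 := fun y => bdry2 fd fun t _ => φx t
    have z2 : ∀ y, dd Ex φ (y, 0) = 0 := fun y => bdry1 fd fun t _ => φy t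
    set W1 : F2 := fun x => μ⁻¹ * (p x * (θ 0 1 x * φ x + θ 0 0 x * dd Ey φ x)) + φ x * (θ 1 0 x * om u1 u2 x) with hW1
    set W2 : F2 := fun x => μ⁻¹ * (p x * (θ 1 0 x * φ x + θ 0 0 x * dd Ex φ x)) - φ x * (θ 0 1 x * om u1 u2 x) with hW2
    have c1 : ContDiff ℝ 1 W1 := bf
    have c2 : ContDiff ℝ 1 W2 := bf
    have S1 : HasCompactSupport W1 := HasCompactSupport.add (((s 0 1 φ).add (s 0 0 (dd Ey φ))).mul_left.mul_left) ((s 1 0 _).mul_left)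
    have S2 : HasCompactSupport W2 := HasCompactSupport.sub (((s 1 0 φ).add (s 0 0 (dd Ex φ))).mul_left.mul_left) ((s 0 1 _).mul_left)
    have I1 := int_QQ_pd1 c1 S1 (fun y _ => by simp [hW1, z1, φx])
    have I2 := int_QQ_pd2 c2 S2 (fun y _ => by simp [hW2, z2, φy])
    have J1 := w1 φ f1' φx
    have J2 := w2 φ f1' φy
    have ii : ∀ {g : F2}, Continuous g → HasCompactSupport g → IntegrableOn g QQ := fun a b => (a.integrable_of_hasCompactSupport b).integrableOn
    have c1' : Continuous h1 := by rw [e1]; fun_prop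
    have c2' : Continuous h2 := by rw [e2]; fun_prop
    have s1' : HasCompactSupport h1 := by
      rw [e1]; refine HasCompactSupport.add ?_ (s' 2 0 _)
      simpa [neg_div, div_eq_mul_inv, mul_assoc, mul_comm, mul_left_comm] using (s 1 0 fun x => -(f2 x * μ⁻¹))
    have s2' : HasCompactSupport h2 := by
      rw [e2]; refine HasCompactSupport.add ?_ (s' 0 2 _)
      simpa [div_eq_mul_inv, mul_assoc, mul_comm, mul_left_comm] using (s 0 1 fun x => (f1 x * μ⁻¹))
    have i1 : IntegrableOn (pd1 W1) QQ := ii (dd_cont _ c1) (dd_cs _ S1)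
    have i2 : IntegrableOn (pd2 W2) QQ := ii (dd_cont _ c2) (dd_cs _ S2)
    have i3 : IntegrableOn (fun x => h1 x * φ x - H1 x * pd1 φ x) QQ := ii (by rw [pd1_eq]; fun_prop) (s1'.mul_right.sub s1.mul_right)
    have i4 : IntegrableOn (fun x => h2 x * φ x - H2 x * pd2 φ x) QQ := ii (by rw [pd2_eq]; fun_prop) (s2'.mul_right.sub s2.mul_right)
    have i5 : IntegrableOn (fun x => pd2 W2 x - pd1 W1 x) QQ := i2.sub i1
    have i6 : IntegrableOn (fun x => (h1 x * φ x - H1 x * pd1 φ x) + (h2 x * φ x - H2 x * pd2 φ x)) QQ := i3.add i4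
    rw [← sub_eq_zero, ← integral_sub]
    · have key : ∫ x in QQ, ((pd2 W2 x - pd1 W1 x) + ((h1 x * φ x - H1 x * pd1 φ x) + (h2 x * φ x - H2 x * pd2 φ x))) = 0 := by
        rw [integral_add i5 i6, integral_sub i2 i1, integral_add i3 i4, I1, I2, J1, J2]; simp
      refine Eq.trans ?_ key
      refine setIntegral_congr_fun QQ_meas fun x hx => ?_
      simp (disch := fun_prop) only [pd1_eq, pd2_eq, dd_add, dd_sub, dd_mul, dd_k, W.d1, W.d2, hW1, hW2, e1, e2]
      by_cases hR : x ∈ RO ℓ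
      · obtain ⟨a, b⟩ := LC.om_x H x hR
        have a' : dd Ex (om u1 u2) x = (dd Ey p x - f2 x) / μ := by rw [← a]; field_simp
        have b' : dd Ey (om u1 u2) x = (f1 x - dd Ex p x) / μ := by rw [← b]; field_simp
        rw [a', b', dd_comm (SM.c2 hφ) Ey Ex]
        field_simp; ring
      · simp only [out x hx.1 hx.2 hR]; simp; ring
    · exact ii (by have := dd_cont Ex Fc; have := dd_cont Ey Fc; rw [pd1_eq, pd2_eq, pd1_eq, pd2_eq]; fun_prop) ((dd_cs _ Fs).mul_right.add (dd_cs _ Fs).mul_right)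
    · exact ii (by rw [pd1_eq, pd2_eq]; fun_prop) (G1s.mul_right.add G2s.mul_right)
end

def RC (ℓ : ℝ) : Set P2 := Icc 0 ℓ ×ˢ Icc 0 1
theorem RC_cpt (ℓ : ℝ) : IsCompact (RC ℓ) := isCompact_Icc.prod isCompact_Icc
theorem RO_RC (ℓ : ℝ) : RO ℓ ⊆ RC ℓ := prod_mono Ioo_subset_Icc_self Ioo_subset_Icc_self
theorem RO_QQ (ℓ : ℝ) : RO ℓ ⊆ QQ := prod_mono (fun _ h => h.1) (fun _ h => h.1)

theorem lq_supp {q : ℝ} (hq : 1 < q) {ℓ A : ℝ} (hA : 0 ≤ A) {v z : F2} (hz : Continuous z)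
    (h : ∀ x ∈ RO ℓ, |v x| ≤ A * z x) (h0 : ∀ x ∈ QQ, x ∉ RO ℓ → v x = 0) : lqNorm q QQ v ≤ A * lqNorm q (RC ℓ) z := by
  have m : ML q (RC ℓ) z := ML_cpt (RC_cpt ℓ) hz.continuousOn
  have e : lqNorm q QQ v = lqNorm q (RO ℓ) v := by
    rw [lqNorm, lqNorm, setIntegral_eq_of_subset_of_forall_diff_eq_zero QQ_meas (RO_QQ ℓ) fun x hx => by
      rw [h0 x hx.1 hx.2, abs_zero, Real.zero_rpow bL]]
  have m' : ML q (RO ℓ) z := m.mono_measure (Measure.restrict_mono (RO_RC ℓ) le_rfl)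
  rw [e, ← abs_of_nonneg hA, ← lq_cmul hq]
  refine (lq_mono hq (RO_open ℓ).measurableSet (ML_cmul m' A) fun x hx => (h x hx).trans (le_abs_self _)).trans ?_
  exact lq_sub_set hq (ML_cmul m A) (RO_RC ℓ)

theorem dd2_mul {f g : F2} (hf : ContDiff ℝ 2 f) (hg : ContDiff ℝ 2 g) (e e' x : P2) : dd e (dd e' (fun x => f x * g x)) x =
    dd e (dd e' f) x * g x + dd e' f x * dd e g x + dd e f x * dd e' g x + f x * dd e (dd e' g) x := by
  have d1 := hf.differentiable bs
  have d2 := hg.differentiable bs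
  have d3 := (dd_cd (m := 1) e' hf bn).differentiable bs
  have d4 := (dd_cd (m := 1) e' hg bn).differentiable bs
  simp (disch := fun_prop) only [dd_mul, dd_add]; ring

def zz (r : ℝ) (u1 u2 ψ f1 f2 : F2) (x : P2) : ℝ := |f1 x| + |f2 x| + r * (|dd Ex u1 x| + |dd Ey u1 x| + |dd Ex u2 x| + |dd Ey u2 x|)
  + r ^ 2 * (|u1 x| + |u2 x|) + r ^ 3 * |ψ x|

theorem local_est {p q : ℝ} (hpq : p.HolderConjugate q) {μ : ℝ} (hμ : 0 < μ) (κ : ℝ) : ∃ C, 0 < C ∧ ∀ ℓ r, 0 < ℓ → ℓ⁻¹ ≤ r → 1 ≤ r →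
    ∀ u1 u2 ψ p f1 f2, LC ℓ μ κ u1 u2 ψ p f1 f2 → ∀ U e e', (U = u1 ∨ U = u2) → unitv e → unitv e' →
    lqNorm q (Ioc 0 (ℓ/2) ×ˢ Ioc 0 (1/2)) (dd e (dd e' U)) ≤ C * lqNorm q (RC ℓ) (zz r u1 u2 ψ f1 f2) := by
  obtain ⟨Cq, hCq, HQ⟩ := quarter hpq
  obtain ⟨K, hK, HW⟩ := WF_ex κ
  have hq : 1 < q := hpq.symm.lt
  have K0 : 0 < K := bL
  set B := K * (μ⁻¹ + 20) with hB
  have B0 : 0 < B := bp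
  refine ⟨K * (Cq * (4 * B)) + K * (7 * K), by positivity, fun ℓ r hl hlr hr u1 u2 ψ p f1 f2 H U e e' hU he he' => ?_⟩
  obtain ⟨θ, W⟩ := HW ℓ r hl hlr hr
  set z := zz r u1 u2 ψ f1 f2 with hz
  have r0 : 0 < r := bL
  have v1 := H.c1; have v2 := H.c2; have v3 := H.c3
  have y1 : ContDiff ℝ 1 u1 := v1.of_le bn
  have y2 : ContDiff ℝ 1 u2 := v2.of_le bn
  have d1 := y1.differentiable bs
  have d2 := y2.differentiable bs
  have d3 := v3.differentiable bs
  have td : ∀ i j, Differentiable ℝ (θ i j) := fun i j => (W.sm i j).di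
  have t2 : ∀ i j, ContDiff ℝ 2 (θ i j) := fun i j => (W.sm i j).c2
  have t1 : ∀ i j, ContDiff ℝ 1 (θ i j) := fun i j => (W.sm i j).c1
  have tc : ∀ i j, Continuous (θ i j) := fun i j => (td i j).continuous
  have zc : Continuous z := by
    have := dd_cont Ex y1; have := dd_cont Ey y1; have := dd_cont Ex y2; have := dd_cont Ey y2
    have := y1.continuous; have := y2.continuous; have := d3.continuous; have := H.k1; have := H.k2
    rw [hz]; unfold zz; fun_prop
  -- elementary bounds by z
  have zb : ∀ x, 0 ≤ z x ∧ |f1 x| ≤ z x ∧ |f2 x| ≤ z x ∧ r * |dd Ex u1 x| ≤ z x ∧ r * |dd Ey u1 x| ≤ z x ∧ r * |dd Ex u2 x| ≤ z x ∧ r * |dd Ey u2 x| ≤ z x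
      ∧ r^2 * |u1 x| ≤ z x ∧ r^2 * |u2 x| ≤ z x ∧ r^3 * |ψ x| ≤ z x := fun x => by
    have a1 := abs_nonneg (f1 x); have a2 := abs_nonneg (f2 x)
    have a3 : 0 ≤ r * |dd Ex u1 x| := bp
    have a4 : 0 ≤ r * |dd Ey u1 x| := bp
    have a5 : 0 ≤ r * |dd Ex u2 x| := bp
    have a6 : 0 ≤ r * |dd Ey u2 x| := bp
    have a7 : 0 ≤ r^2 * |u1 x| := bp
    have a8 : 0 ≤ r^2 * |u2 x| := bp
    have a9 : 0 ≤ r^3 * |ψ x| := bp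
    rw [hz]; unfold zz
    refine ⟨?_, ?_, ?_, ?_, ?_, ?_, ?_, ?_, ?_, ?_⟩ <;> linarith
  have tb : ∀ (n : ℕ) (t g : ℝ) (x : P2), |t| ≤ K * r ^ n → r ^ n * |g| ≤ z x → |t * g| ≤ K * z x := fun n t g x h1 h2 => by
    rw [abs_mul]
    calc _ ≤ K * r ^ n * |g| := by gcongr
      _ = K * (r ^ n * |g|) := by ring
      _ ≤ _ := by gcongr
  have T : ∀ (i j n : ℕ) (g : ℝ) (x : P2), i + j = n → n ≤ 3 → r ^ n * |g| ≤ z x → -(K * z x) ≤ θ i j x * g ∧ θ i j x * g ≤ K * z x := fun i j n g x h1 h2 h3 => by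
    subst h1; exact abs_le.1 (tb _ _ _ x (W.bd i j h2 x) h3)
  have out : ∀ x ∈ QQ, x ∉ RO ℓ → ∀ i j, θ i j x = 0 := fun x a hx i j => W.v i j x (by
    by_contra! h; exact hx ⟨⟨a.1, h.1⟩, a.2, h.2⟩)
  have kz : ∀ x, 0 ≤ K * z x := fun x => mul_nonneg K0.le (zb x).1
  have pw : ∀ {a : ℝ} {x : P2}, r * a ≤ z x → r ^ 1 * a ≤ z x := fun h => by simpa using h
  -- h1, h2
  have oc := LC.om_c H
  have oo := oc.continuous
  have cF1 := H.k1; have cF2 := H.k2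
  have fz : ∀ (i j : ℕ) (f : F2), HasCompactSupport fun x => f x * θ i j x := fun i j f => (W.cs i j).mul_left
  obtain ⟨H1, q1, s1, w1, n1⟩ := Hx hq (h := fun x => -(f2 x * θ 1 0 x / μ) + om u1 u2 x * θ 2 0 x) bf
    (HasCompactSupport.add (by simpa [neg_div, div_eq_mul_inv, mul_assoc, mul_comm, mul_left_comm] using (fz 1 0 fun x => -(f2 x * μ⁻¹))) (fz 2 0 _)) hl
    (fun x y h => by simp [W.v _ _ (x, y) (Or.inl h)])
  obtain ⟨H2, q2, s2, w2, n2⟩ := Hy hq (h := fun x => f1 x * θ 0 1 x / μ + om u1 u2 x * θ 0 2 x) bf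
    (HasCompactSupport.add (by simpa [div_eq_mul_inv, mul_assoc, mul_comm, mul_left_comm] using (fz 0 1 fun x => f1 x * μ⁻¹)) (fz 0 2 _)) zero_lt_one
    (fun x y h => by simp [W.v _ _ (x, y) (Or.inr h)])
  have Q := LQ H hl hμ W rfl rfl q1 q2 s1 s2 w1 w2
  have om_b : ∀ x, r * |om u1 u2 x| ≤ 2 * z x := fun x => by
    have := zb x
    have h : |om u1 u2 x| ≤ |dd Ex u2 x| + |dd Ey u1 x| := abs_sub _ _
    have := mlL h r0.le; linarith
  have h1b : lqNorm q QQ H1 ≤ B * lqNorm q (RC ℓ) z := by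
    refine n1.trans ?_
    rw [← abs_of_pos hl, ← lq_cmul hq, abs_of_pos hl]
    refine lq_supp hq B0.le zc (fun x hx => ?_) (fun x a b => by simp [out x a b])
    obtain ⟨a, b, -⟩ := W.bl x
    rw [show ℓ * (-(f2 x * θ 1 0 x / μ) + om u1 u2 x * θ 2 0 x) = -(μ⁻¹ * (ℓ * θ 1 0 x * f2 x)) + ℓ * θ 2 0 x * om u1 u2 x by field_simp]
    refine (abs_add_le _ _).trans ?_
    have e1 : |ℓ * θ 1 0 x * f2 x| ≤ K * z x := by
      rw [abs_mul, abs_mul, abs_of_pos hl]; exact mul_le_mul a (zb x).2.2.1 (abs_nonneg _) K0.le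
    have e2 : |ℓ * θ 2 0 x * om u1 u2 x| ≤ K * (2 * z x) := by
      rw [abs_mul, abs_mul, abs_of_pos hl]
      calc _ ≤ K * r * |om u1 u2 x| := by gcongr
        _ = K * (r * |om u1 u2 x|) := by ring
        _ ≤ _ := mlL (om_b x) K0.le
    rw [abs_neg, abs_mul, abs_of_pos (inv_pos.2 hμ)]
    have := mlL e1 (inv_pos.2 hμ).le
    have := kz x; rw [hB]; linarith
  have h2b : lqNorm q QQ H2 ≤ B * lqNorm q (RC ℓ) z := by
    refine n2.trans ?_
    rw [one_mul]
    refine lq_supp hq B0.le zc (fun x hx => ?_) (fun x a b => by simp [out x a b])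
    rw [show f1 x * θ 0 1 x / μ + om u1 u2 x * θ 0 2 x = μ⁻¹ * (θ 0 1 x * f1 x) + θ 0 2 x * om u1 u2 x by field_simp]
    refine (abs_add_le _ _).trans ?_
    obtain ⟨-, -, a, b⟩ := W.bl x
    have e1 : |θ 0 1 x * f1 x| ≤ K * z x := by
      rw [abs_mul]; exact mul_le_mul a (zb x).2.1 (abs_nonneg _) K0.le
    have e2 : |θ 0 2 x * om u1 u2 x| ≤ K * (2 * z x) := by
      rw [abs_mul]
      calc _ ≤ K * r * |om u1 u2 x| := by gcongr
        _ = K * (r * |om u1 u2 x|) := by ring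
        _ ≤ _ := mlL (om_b x) K0.le
    rw [abs_mul, abs_of_pos (inv_pos.2 hμ)]
    have := mlL e1 (inv_pos.2 hμ).le
    have := kz x; rw [hB]; linarith
  -- G bounds
  have rc : ContDiff ℝ 1 (rr θ u1 u2 ψ) := by
    have := v3.of_le (show (1 : WithTop ℕ∞) ≤ 2 by norm_num); unfold rr; fun_prop
  have rv : ∀ e, unitv e → ∀ x ∈ QQ, x ∉ RO ℓ → dd e (rr θ u1 u2 ψ) x = 0 := fun e he x a b => by
    unfold rr
    rcases he with rfl | rfl <;> simp (disch := fun_prop) only [dd_add, dd_sub, dd_mul, dd_k, W.d1, W.d2, out x a b] <;> simp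
  have gb : ∀ (t : ℝ), |t| ≤ K * μ⁻¹ → ∀ x, ∀ f, |f| ≤ z x → |t * f| ≤ K * μ⁻¹ * z x := fun t ht x f hf => by
    rw [abs_mul]; exact mul_le_mul ht hf (abs_nonneg _) bp
  have tm : ∀ x, |θ 0 0 x * μ⁻¹| ≤ K * μ⁻¹ := fun x => by
    rw [abs_mul, abs_of_pos (inv_pos.2 hμ)]; have := W.bd 0 0 bn x; simp only [add_zero, pow_zero, mul_one] at this; gcongr
  have m1 : lqNorm q QQ (fun x => -(θ 0 0 x * f2 x / μ) + 2 * om u1 u2 x * θ 1 0 x + dd Ex (rr θ u1 u2 ψ) x) ≤ B * lqNorm q (RC ℓ) z := by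
    refine lq_supp hq B0.le zc (fun x hx => ?_) (fun x a b => by rw [rv _ il x a b]; simp [out x a b])
    obtain ⟨b0, b1, b2, b3, b4, b5, b6, b7, b8, b9⟩ := zb x
    obtain ⟨p2, p1, -⟩ := LC.o H x hx
    unfold rr om
    simp (disch := fun_prop) only [dd_add, dd_sub, dd_mul, dd_k, W.d1, W.d2, p1]
    have c0 := abs_le.1 (gb _ (tm x) x _ b2)
    have c1 := T 1 0 1 _ x rfl bn (pw b5)
    have c2 := T 1 0 1 _ x rfl bn (pw b4)
    have c3 := T 2 0 2 _ x rfl bn b8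
    have c4 := T 1 1 2 _ x rfl bn b7
    have c5 := T 0 1 1 _ x rfl bn (pw b3)
    have c6 := T 0 2 2 _ x rfl bn b8
    have c7 := T 3 0 3 _ x rfl bn b9
    have c8 := T 1 2 3 _ x rfl bn b9
    have := kz x
    rw [hB, div_eq_mul_inv, abs_le]; constructor <;> linarith
  have m2 : lqNorm q QQ (fun x => θ 0 0 x * f1 x / μ + 2 * om u1 u2 x * θ 0 1 x + dd Ey (rr θ u1 u2 ψ) x) ≤ B * lqNorm q (RC ℓ) z := by
    refine lq_supp hq B0.le zc (fun x hx => ?_) (fun x a b => by rw [rv _ ir x a b]; simp [out x a b])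
    obtain ⟨b0, b1, b2, b3, b4, b5, b6, b7, b8, b9⟩ := zb x
    obtain ⟨p2, p1, -⟩ := LC.o H x hx
    unfold rr om
    simp (disch := fun_prop) only [dd_add, dd_sub, dd_mul, dd_k, W.d1, W.d2, p2]
    have c0 := abs_le.1 (gb _ (tm x) x _ b1)
    have c1 := T 0 1 1 _ x rfl bn (pw b5)
    have c2 := T 0 1 1 _ x rfl bn (pw b4)
    have c3 := T 1 1 2 _ x rfl bn b8
    have c4 := T 0 2 2 _ x rfl bn b7
    have c5 := T 1 0 1 _ x rfl bn (pw b6)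
    have c6 := T 2 0 2 _ x rfl bn b7
    have c7 := T 2 1 3 _ x rfl bn b9
    have c8 := T 0 3 3 _ x rfl bn b9
    have := kz x
    rw [hB, div_eq_mul_inv, abs_le]; constructor <;> linarith
  have rs : HasCompactSupport (rr θ u1 u2 ψ) :=
    HasCompactSupport.sub (HasCompactSupport.sub (W.cs 1 0).mul_right.mul_left (W.cs 0 1).mul_right.mul_left) ((W.cs 2 0).add (W.cs 0 2)).mul_left
  have dc1 := dd_cont Ex rc
  have dc2 := dd_cont Ey rc
  have a1 := lq_add hq (Ω := QQ) (ML_cs (f := fun x => -(θ 0 0 x * f2 x / μ) + 2 * om u1 u2 x * θ 1 0 x + dd Ex (rr θ u1 u2 ψ) x) bf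
    (((by simpa [neg_div, div_eq_mul_inv, mul_assoc, mul_comm, mul_left_comm] using (fz 0 0 fun x => -(f2 x * μ⁻¹)) : HasCompactSupport fun x => -(θ 0 0 x * f2 x / μ)).add (fz 1 0 _)).add (dd_cs _ rs))) (ML_cs q1 s1)
  have a2 := lq_add hq (Ω := QQ) (ML_cs (f := fun x => θ 0 0 x * f1 x / μ + 2 * om u1 u2 x * θ 0 1 x + dd Ey (rr θ u1 u2 ψ) x) bf
    (((by simpa [div_eq_mul_inv, mul_assoc, mul_comm, mul_left_comm] using (fz 0 0 fun x => (f1 x * μ⁻¹)) : HasCompactSupport fun x => (θ 0 0 x * f1 x / μ)).add (fz 0 1 _)).add (dd_cs _ rs))) (ML_cs q2 s2)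
  -- second derivatives
  have t0 : ∀ (i j n : ℕ) (e), unitv e → i + j + 1 = n → n ≤ 3 → ∀ x, |dd e (θ i j) x| ≤ K * r ^ n := fun i j n e he h h' x => by
    subst h
    rcases he with rfl | rfl
    · rw [W.d1]; have := W.bd (i+1) j (by omega) x; rwa [show i + 1 + j = i + j + 1 by ring] at this
    · rw [W.d2]; exact W.bd i (j+1) (by omega) x
  have t00 : ∀ (i j n : ℕ), i + j + 2 = n → n ≤ 3 → ∀ x, |dd e (dd e' (θ i j)) x| ≤ K * r ^ n := fun i j n h h' x => by
    rcases he' with rfl | rfl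
    · rw [W.d1]; exact t0 (i+1) j n e he (by omega) h' x
    · rw [W.d2]; exact t0 i (j+1) n e he (by omega) h' x
  have pz : ∀ e, unitv e → ∀ x ∈ RO ℓ, r ^ 2 * |dd e ψ x| ≤ z x := fun e he x hx => by
    obtain ⟨p2, p1, -⟩ := LC.o H x hx
    obtain ⟨b0, b1, b2, b3, b4, b5, b6, b7, b8, b9⟩ := zb x
    rcases he with rfl | rfl
    · rwa [p1, abs_neg]
    · rwa [p2]
  have ub : ∀ e, unitv e → ∀ x, r * |dd e u1 x| ≤ z x ∧ r * |dd e u2 x| ≤ z x := fun e he x => by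
    obtain ⟨b0, b1, b2, b3, b4, b5, b6, b7, b8, b9⟩ := zb x
    rcases he with rfl | rfl <;> constructor <;> assumption
  have pzz : ∀ x ∈ RO ℓ, r ^ 1 * |dd e (dd e' ψ) x| ≤ z x := fun x hx => by
    rcases he' with rfl | rfl
    · rw [dd_loc (RO_open ℓ) (f := dd Ex ψ) (g := fun x => - u2 x) (fun x hx => (LC.o H x hx).2.1) e x hx, dd_neg, abs_neg]; exact pw (ub e he x).2
    · rw [dd_loc (RO_open ℓ) (f := dd Ey ψ) (g := u1) (fun x hx => (LC.o H x hx).1) e x hx]; exact pw (ub e he x).1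
  have fin : ∀ (V u w : F2) (i j : ℕ), ContDiff ℝ 2 u → ContDiff ℝ 2 V → HasCompactSupport V → (∀ x, r^2 * |u x| ≤ z x) → (∀ e, unitv e → ∀ x, r * |dd e u x| ≤ z x) →
      i + j = 1 → (∀ x, dd e (dd e' V) x = dd e (dd e' (fun x => θ 0 0 x * u x)) x + w x) → (∀ x, |w x| = |dd e (dd e' (fun x => θ i j x * ψ x)) x|) →
      lqNorm q QQ (dd e (dd e' V)) ≤ Cq * (4 * B * lqNorm q (RC ℓ) z) →
      lqNorm q (Ioc 0 (ℓ/2) ×ˢ Ioc 0 (1/2)) (dd e (dd e' u)) ≤ (K * (Cq * (4 * B)) + K * (7 * K)) * lqNorm q (RC ℓ) z := by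
    intro V u w i j cu cV sV u0 ue hij hV hw hn
    have sub : Ioc 0 (ℓ/2) ×ˢ Ioc 0 (1/2) ⊆ RO ℓ := fun x hx => ⟨⟨hx.1.1, by have := hx.1.2; linarith⟩, hx.2.1, by have := hx.2.2; linarith⟩
    have key : ∀ x ∈ Ioc 0 (ℓ/2) ×ˢ Ioc R0 (1/2), |dd e (dd e' u) x| ≤ |K * |dd e (dd e' V) x| + K * (7 * K) * z x| := fun x hx => by
      have hR := sub hx
      have lo := W.lo x hx.1.1.le hx.1.2 hx.2.1.le hx.2.2
      have h := hV x
      rw [dd2_mul (t2 0 0) cu] at h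
      have g1 := tb 2 _ _ x (t00 0 0 2 rfl bn x) (u0 x)
      have g2 := tb 1 _ _ x (t0 0 0 1 e' he' rfl bn x) (pw (ue e he x))
      have g3 := tb 1 _ _ x (t0 0 0 1 e he rfl bn x) (pw (ue e' he' x))
      have g4 := hw x
      rw [dd2_mul (t2 i j) v3] at g4
      have g5 := tb 3 _ _ x (t00 i j 3 (by omega) bn x) (zb x).2.2.2.2.2.2.2.2.2
      have g6 := tb 2 _ _ x (t0 i j 2 e' he' (by omega) bn x) (pz e he x hR)
      have g7 := tb 2 _ _ x (t0 i j 2 e he (by omega) bn x) (pz e' he' x hR)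
      have g8 := tb 1 (θ i j x) _ x (by have := W.bd i j (by omega) x; rwa [hij] at this) (pzz x hR)
      have g9 : |w x| ≤ 4 * (K * z x) := by
        rw [g4, abs_le]; rw [abs_le] at g5 g6 g7 g8; constructor <;> linarith
      have g10 : θ 0 0 x * |dd e (dd e' u) x| ≤ |dd e (dd e' V) x| + 7 * (K * z x) := by
        have : 0 ≤ θ 0 0 x := by by_contra! hh; have := mul_neg_of_pos_of_neg K0 hh; linarith
        rw [show θ 0 0 x * |dd e (dd e' u) x| = |θ 0 0 x * dd e (dd e' u) x| by rw [abs_mul, abs_of_nonneg this]]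
        rw [show θ 0 0 x * dd e (dd e' u) x = dd e (dd e' V) x - (dd e (dd e' (θ 0 0)) x * u x) - (dd e' (θ 0 0) x * dd e u x) - (dd e (θ 0 0) x * dd e' u x) - w x by rw [h]; ring]
        generalize dd e (dd e' V) x = A at *
        rw [abs_le] at g1 g2 g3 g9
        have := neg_abs_le A; have := le_abs_self A
        rw [abs_le]; constructor <;> linarith
      refine le_trans ?_ (le_abs_self _)
      calc |dd e (dd e' u) x| ≤ (K * θ 0 0 x) * |dd e (dd e' u) x| := le_mul_of_one_le_left (abs_nonneg _) lo
        _ = K * (θ 0 0 x * |dd e (dd e' u) x|) := by ring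
        _ ≤ K * (|dd e (dd e' V) x| + 7 * (K * z x)) := by gcongr
        _ = _ := by ring
    have cD : Continuous (dd e (dd e' V)) := dd_cont e (dd_cd e' cV bn)
    have mD : ML q QQ (fun x => |dd e (dd e' V) x|) := ML_cs cD.abs ((dd_cs _ (dd_cs _ sV)).comp_left (g := fun t : ℝ => |t|) abs_zero)
    have mz : ML q (RC ℓ) z := ML_cpt (RC_cpt ℓ) zc.continuousOn
    have sQ := sub.trans (RO_QQ ℓ)
    have sC := sub.trans (RO_RC ℓ)
    have mD' := mD.mono_measure (Measure.restrict_mono sQ le_rfl)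
    have mz' := mz.mono_measure (Measure.restrict_mono sC le_rfl)
    refine (lq_mono hq (measurableSet_Ioc.prod measurableSet_Ioc) (ML_add (ML_cmul mD' K) (ML_cmul mz' (K * (7 * K)))) key).trans ((lq_add hq (ML_cmul mD' K) (ML_cmul mz' _)).trans ?_)
    rw [lq_cmul hq, lq_cmul hq, abs_of_pos K0, abs_of_pos bp]
    have x1 := lq_sub_set hq mD sQ
    have x2 := lq_sub_set hq mz sC
    have x3 : lqNorm q QQ (fun x => |dd e (dd e' V) x|) = lqNorm q QQ (dd e (dd e' V)) := by simp [lqNorm]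
    rw [x3] at x1
    calc _ ≤ K * (Cq * (4 * B * lqNorm q (RC ℓ) z)) + K * (7 * K) * lqNorm q (RC ℓ) z := by gcongr; exact x1.trans hn
      _ = _ := by ring
  have qn : ∀ V, (V = (fun x => θ 0 0 x * u1 x + θ 0 1 x * ψ x) ∨ V = (fun x => θ 0 0 x * u2 x - θ 1 0 x * ψ x)) → lqNorm q QQ (dd e (dd e' V)) ≤ Cq * (4 * B * lqNorm q (RC ℓ) z) := fun V hV =>
    (HQ _ _ _ _ _ Q V e e' hV he he').trans (mlL bL hCq.le)
  have cm : ∀ (i j : ℕ) (g : F2), ContDiff ℝ 2 g → ContDiff ℝ 1 (dd e' (fun x => θ i j x * g x)) := fun i j g hg => dd_cd e' ((t2 i j).mul hg) bn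
  rcases hU with rfl | rfl
  · refine fin _ _ (fun x => dd e (dd e' (fun x => θ 0 1 x * ψ x)) x) 0 1 v1 Q.u1 Q.s1 (fun x => (zb x).2.2.2.2.2.2.2.1) (fun e he x => (ub e he x).1) rfl (fun x => ?_) (fun x => rfl) (qn _ il)
    have i1 := (cm 0 0 _ v1).differentiable bs
    have i2 := (cm 0 1 _ v3).differentiable bs
    simp (disch := fun_prop) only [dd_add]
  · refine fin _ _ (fun x => -dd e (dd e' (fun x => θ 1 0 x * ψ x)) x) 1 0 v2 Q.u2 Q.s2 (fun x => (zb x).2.2.2.2.2.2.2.2.1) (fun e he x => (ub e he x).2) rfl (fun x => ?_) (fun x => abs_neg _) (qn _ ir)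
    have i1 := (cm 0 0 _ v2).differentiable bs
    have i2 := (cm 1 0 _ v3).differentiable bs
    simp (disch := fun_prop) only [dd_sub]; ring

section
structure GS (R μ k0 k1 : ℝ) (u1 u2 ψ p f1 f2 : F2) : Prop where
  c1 : ContDiff ℝ 2 u1
  c2 : ContDiff ℝ 2 u2
  c3 : ContDiff ℝ 2 ψ
  cp : ContDiff ℝ 1 p
  g1 : Continuous f1
  g2 : Continuous f2
  e : ∀ x ∈ OmegaR R, dd Ey ψ x = u1 x ∧ dd Ex ψ x = - u2 x ∧ dd Ex u1 x + dd Ey u2 x = 0 ∧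
    -μ * (dd Ex (dd Ex u1) x + dd Ey (dd Ey u1) x) + dd Ex p x = f1 x ∧
    -μ * (dd Ex (dd Ex u2) x + dd Ey (dd Ey u2) x) + dd Ey p x = f2 x
  hx : ∀ s y, (s = R ∨ s = -R) → 0 ≤ y → y ≤ 1 → u1 (s, y) = 0 ∧ u2 (s, y) = 0 ∧ ψ (s, y) = 0
  hy : ∀ x y, -R ≤ x → x ≤ R → (y = 0 ∨ y = 1) → u2 (x, y) = 0 ∧ ψ (x, y) = 0
  h0 : ∀ x, -R ≤ x → x ≤ R → dd Ey u1 (x, 0) = -(k0 / μ) * u1 (x, 0)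
  h1 : ∀ x, -R ≤ x → x ≤ R → dd Ey u1 (x, 1) = (k1 / μ) * u1 (x, 1)

def Tm (R s t : ℝ) : P2 → P2 := aff s (-(s * R)) t ((1 - t) / 2)
def sg (s : ℝ) : Prop := s = 1 ∨ s = -1

theorem Tm_inj {R s t : ℝ} (hs : sg s) (ht : sg t) : Function.Injective (Tm R s t) := fun x y h => by
  simp only [Tm, aff, Prod.mk.injEq] at h
  rcases hs with rfl | rfl <;> rcases ht with rfl | rfl <;> (ext <;> linarith [h.1, h.2])

theorem mp1 {s : ℝ} (hs : sg s) (a : ℝ) : MeasurePreserving (fun x : ℝ => s * x + a) := by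
  rcases hs with rfl | rfl
  · simpa using measurePreserving_add_right (volume : Measure ℝ) a
  · simpa [neg_mul, sub_eq_neg_add, add_comm] using Measure.measurePreserving_sub_left (volume : Measure ℝ) a

theorem Tm_mp (R : ℝ) {s t : ℝ} (hs : sg s) (ht : sg t) : MeasurePreserving (Tm R s t) := (mp1 hs _).prod (mp1 ht _)

theorem lq_T (q R : ℝ) {s t : ℝ} (hs : sg s) (ht : sg t) (A : Set P2) (g : F2) :
    lqNorm q (Tm R s t ⁻¹' A) (fun x => g (Tm R s t x)) = lqNorm q A g := by
  have em : MeasurableEmbedding (Tm R s t) := (aff_cd (n := 1) _ _ _ _).continuous.measurableEmbedding (Tm_inj hs ht)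
  unfold lqNorm; congr 1
  exact (Tm_mp R hs ht).setIntegral_preimage_emb em (fun x => |g x| ^ q) A

theorem ddT (R : ℝ) {s t : ℝ} {e : P2} (he : unitv e) : ∃ σ, (σ = s ∨ σ = t) ∧ ∀ f : F2, Differentiable ℝ f → ∀ c : ℝ,
    dd e (fun x => c * f (Tm R s t x)) = fun x => c * σ * dd e f (Tm R s t x) := by
  have d : ∀ f : F2, Differentiable ℝ f → Differentiable ℝ (fun x => f (Tm R s t x)) := fun f hf => hf.comp ((aff_cd (n := 1) _ _ _ _).differentiable bs)
  rcases he with rfl | rfl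
  · refine ⟨s, Or.inl rfl, fun f hf c => ?_⟩
    rw [dd_cmul (d f hf)]; funext x; rw [mul_assoc]; congr 1
    exact congrFun (pd1_aff hf _ _ _ _) x
  · refine ⟨t, Or.inr rfl, fun f hf c => ?_⟩
    rw [dd_cmul (d f hf)]; funext x; rw [mul_assoc]; congr 1
    exact congrFun (pd2_aff hf _ _ _ _) x

variable {R μ k0 k1 : ℝ} {u1 u2 ψ p f1 f2 : F2}

theorem dT (R : ℝ) (s t : ℝ) (f : F2) (hf : Differentiable ℝ f) (c : ℝ) :
    dd Ex (fun x => c * f (Tm R s t x)) = (fun x => c * s * dd Ex f (Tm R s t x)) ∧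
    dd Ey (fun x => c * f (Tm R s t x)) = (fun x => c * t * dd Ey f (Tm R s t x)) := by
  have d : Differentiable ℝ (fun x => f (Tm R s t x)) := hf.comp ((aff_cd (n := 1) _ _ _ _).differentiable bs)
  rw [dd_cmul d, dd_cmul d]
  constructor <;> (funext x; rw [mul_assoc]; congr 1)
  · exact congrFun (pd1_aff hf _ _ _ _) x
  · exact congrFun (pd2_aff hf _ _ _ _) x

theorem GS.lc (H : GS R μ k0 k1 u1 u2 ψ p f1 f2) {s t : ℝ} (hs : sg s) (ht : sg t) :
    LC (2 * R) μ (if t = 1 then -(k0/μ) else -(k1/μ)) (fun x => s * u1 (Tm R s t x)) (fun x => t * u2 (Tm R s t x)) (fun x => s * t * ψ (Tm R s t x))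
      (fun x => 1 * p (Tm R s t x)) (fun x => s * f1 (Tm R s t x)) (fun x => t * f2 (Tm R s t x)) := by
  have cT : ∀ {n}, ContDiff ℝ n (Tm R s t) := aff_cd _ _ _ _
  have ct : Continuous (Tm R s t) := (cT (n := 1)).continuous
  have s2 : s * s = 1 := by rcases hs with rfl | rfl <;> norm_num
  have t2 : t * t = 1 := by rcases ht with rfl | rfl <;> norm_num
  have mm : ∀ x : P2, 0 ≤ x.1 → x.1 ≤ 2 * R → 0 ≤ x.2 → x.2 ≤ 1 → Tm R s t x ∈ OmegaR R := fun x a b c d => by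
    simp only [Tm, aff, OmegaR, mem_prod, mem_Icc]
    rcases hs with rfl | rfl <;> rcases ht with rfl | rfl <;> refine ⟨⟨?_, ?_⟩, ?_, ?_⟩ <;> linarith
  have D1 := H.c1.differentiable bs
  have D2 := H.c2.differentiable bs
  have D3 := H.c3.differentiable bs
  have D4 := H.cp.differentiable bs
  have d2 : ∀ e, ∀ u : F2, ContDiff ℝ 2 u → Differentiable ℝ (dd e u) := fun e u hu => (dd_cd (m := 1) e hu bn).differentiable bs
  refine ⟨contDiff_const.mul (H.c1.comp cT), contDiff_const.mul (H.c2.comp cT), contDiff_const.mul (H.c3.comp cT), contDiff_const.mul (H.cp.comp cT),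
    continuous_const.mul (H.g1.comp ct), continuous_const.mul (H.g2.comp ct), fun x a b c d => ?_, fun y a b => ?_, fun x a b => ?_⟩
  · obtain ⟨a1, a2, a3, a4, a5⟩ := H.e _ (mm x a b c d)
    rw [(dT R s t _ D3 _).1, (dT R s t _ D3 _).2, (dT R s t _ D1 _).1, (dT R s t _ D1 _).2, (dT R s t _ D2 _).1, (dT R s t _ D2 _).2, (dT R s t _ D4 _).1, (dT R s t _ D4 _).2,
      (dT R s t _ (d2 _ _ H.c1) _).1, (dT R s t _ (d2 _ _ H.c1) _).2, (dT R s t _ (d2 _ _ H.c2) _).1, (dT R s t _ (d2 _ _ H.c2) _).2]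
    refine ⟨?_, ?_, ?_, ?_, ?_⟩
    · beta_reduce; rw [a1]; linear_combination s * u1 (Tm R s t x) * t2
    · beta_reduce; rw [a2]; linear_combination -t * u2 (Tm R s t x) * s2
    · linear_combination a3 + dd Ex u1 (Tm R s t x) * s2 + dd Ey u2 (Tm R s t x) * t2
    · linear_combination s * a4 - μ * s * dd Ex (dd Ex u1) (Tm R s t x) * s2 - μ * s * dd Ey (dd Ey u1) (Tm R s t x) * t2
    · linear_combination t * a5 - μ * t * dd Ex (dd Ex u2) (Tm R s t x) * s2 - μ * t * dd Ey (dd Ey u2) (Tm R s t x) * t2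
  · obtain ⟨e1, e2, e3⟩ := H.hx (-(s * R)) (t * y + (1 - t)/2) (by rcases hs with rfl | rfl <;> simp)
      (by rcases ht with rfl | rfl <;> linarith) (by rcases ht with rfl | rfl <;> linarith)
    have : Tm R s t (0, y) = (-(s * R), t * y + (1 - t)/2) := by simp [Tm, aff]
    simp only [this, e1, e2, e3, mul_zero, and_self]
  · have g1 : -R ≤ s * x + -(s * R) := by rcases hs with rfl | rfl <;> linarith
    have g2 : s * x + -(s * R) ≤ R := by rcases hs with rfl | rfl <;> linarith
    obtain ⟨e2, e3⟩ := H.hy (s * x + -(s * R)) ((1 - t)/2) g1 g2 (by rcases ht with rfl | rfl <;> norm_num)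
    have j0 := H.h0 _ g1 g2; have j1 := H.h1 _ g1 g2
    have e : Tm R s t (x, 0) = (s * x + -(s * R), (1 - t)/2) := by simp [Tm, aff]
    rw [(dT R s t _ D1 _).2]
    simp only [e, e2, e3, mul_zero, true_and]
    rcases ht with rfl | rfl
    · simp only [sub_self, zero_div, if_true] at *; rw [j0]; ring
    · norm_num at *; rw [j1]; ring

theorem OmegaR_cpt (R : ℝ) : IsCompact (OmegaR R) := isCompact_Icc.prod isCompact_Icc

theorem lq_union {q : ℝ} (hq : 1 < q) {A B : Set P2} (hB : MeasurableSet B) {g : F2} (m : ML q (A ∪ B) g) : lqNorm q (A ∪ B) g ≤ lqNorm q A g + lqNorm q B g := by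
  have i := ML_int hq m
  have h0 : ∀ C : Set P2, 0 ≤ ∫ x in C, |g x| ^ q := fun C => integral_nonneg fp
  have hh : ∫ x in A ∪ B, |g x| ^ q ≤ (∫ x in A, |g x| ^ q) + ∫ x in B, |g x| ^ q := by
    rw [← diff_union_self (s := A) (t := B), setIntegral_union disjoint_sdiff_left hB (i.mono_set (by intro x hx; exact Or.inl hx.1)) (i.mono_set subset_union_right)]
    exact add_le_add (setIntegral_mono_set (i.mono_set subset_union_left) (ae_of_all _ fp) diff_subset.eventuallyLE) le_rfl
  refine (Real.rpow_le_rpow (h0 _) hh bp).trans (Real.rpow_add_le_add_rpow (h0 _) (h0 _) bp ?_)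
  rw [div_le_one bL]; exact hq.le

theorem global_est {p' q : ℝ} (hpq : p'.HolderConjugate q) {μ : ℝ} (hμ : 0 < μ) (k0 k1 : ℝ) : ∃ C, 0 < C ∧ ∀ R r, 0 < R → (2 * R)⁻¹ ≤ r → 1 ≤ r →
    ∀ u1 u2 ψ p f1 f2, GS R μ k0 k1 u1 u2 ψ p f1 f2 → ∀ U e e', (U = u1 ∨ U = u2) → unitv e → unitv e' →
    nO q R (dd e (dd e' U)) ≤ C * nO q R (zz r u1 u2 ψ f1 f2) := by
  have hq : 1 < q := hpq.symm.lt
  obtain ⟨C0, p0, h0⟩ := local_est hpq hμ (-(k0/μ))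
  obtain ⟨C1, p1, h1⟩ := local_est hpq hμ (-(k1/μ))
  refine ⟨2 * (C0 + C1), by positivity, fun R r hR hr h1r u1 u2 ψ p f1 f2 H U e e' hU he he' => ?_⟩
  set N := nO q R (zz r u1 u2 ψ f1 f2) with hN
  have N0 : 0 ≤ N := lq_nonneg _ _ _
  have cU : ContDiff ℝ 2 U := by rcases hU with rfl | rfl; exacts [H.c1, H.c2]
  have dU := cU.differentiable bs
  have dU' : Differentiable ℝ (dd e' U) := (dd_cd (m := 1) e' cU bn).differentiable bs
  have cg : Continuous (dd e (dd e' U)) := dd_cont e (dd_cd e' cU bn)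
  have ab : ∀ s, sg s → |s| = 1 := fun s hs => by rcases hs with rfl | rfl <;> simp
  set S : Set P2 := Icc 0 R ×ˢ Icc 0 (1/2) with hS
  -- the estimate on each of the four pieces
  have piece : ∀ s t, sg s → sg t → ∀ A : Set P2, Tm R s t ⁻¹' A = S → lqNorm q A (dd e (dd e' U)) ≤ (if t = 1 then C0 else C1) * N := fun s t hs ht A hA => by
    have L := H.lc hs ht
    have key : ∀ C κ, (∀ ℓ r, 0 < ℓ → ℓ⁻¹ ≤ r → 1 ≤ r →
        ∀ u1 u2 ψ p f1 f2, LC ℓ μ κ u1 u2 ψ p f1 f2 → ∀ U e e', (U = u1 ∨ U = u2) → unitv e → unitv e' →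
        lqNorm q (Ioc 0 (ℓ/2) ×ˢ Ioc 0 (1/2)) (dd e (dd e' U)) ≤ C * lqNorm q (RC ℓ) (zz r u1 u2 ψ f1 f2)) →
        LC (2 * R) μ κ (fun x => s * u1 (Tm R s t x)) (fun x => t * u2 (Tm R s t x)) (fun x => s * t * ψ (Tm R s t x))
          (fun x => 1 * p (Tm R s t x)) (fun x => s * f1 (Tm R s t x)) (fun x => t * f2 (Tm R s t x)) →
        lqNorm q A (dd e (dd e' U)) ≤ C * N := fun C κ h L => by
      obtain ⟨σ, hσ, W⟩ : ∃ σ, sg σ ∧ lqNorm q (Ioc 0 (2*R/2) ×ˢ Ioc 0 (1/2)) (dd e (dd e' (fun x => σ * U (Tm R s t x)))) ≤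
          C * lqNorm q (RC (2*R)) (zz r (fun x => s * u1 (Tm R s t x)) (fun x => t * u2 (Tm R s t x)) (fun x => s * t * ψ (Tm R s t x)) (fun x => s * f1 (Tm R s t x)) (fun x => t * f2 (Tm R s t x))) := by
        rcases hU with rfl | rfl
        · exact ⟨s, hs, h _ r bp hr h1r _ _ _ _ _ _ L _ e e' il he he'⟩
        · exact ⟨t, ht, h _ r bp hr h1r _ _ _ _ _ _ L _ e e' ir he he'⟩
      obtain ⟨τ', b', w'⟩ := ddT R (s := s) (t := t) he'
      obtain ⟨τ, b, w⟩ := ddT R (s := s) (t := t) he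
      have sτ : sg τ := by rcases b with rfl | rfl <;> assumption
      have sτ' : sg τ' := by rcases b' with rfl | rfl <;> assumption
      rw [w' U dU, w _ dU'] at W
      have zeq : zz r (fun x => s * u1 (Tm R s t x)) (fun x => t * u2 (Tm R s t x)) (fun x => s * t * ψ (Tm R s t x)) (fun x => s * f1 (Tm R s t x)) (fun x => t * f2 (Tm R s t x))
          = fun x => zz r u1 u2 ψ f1 f2 (Tm R s t x) := by
        funext x
        unfold zz
        rw [(dT R s t _ (H.c1.differentiable bs) _).1, (dT R s t _ (H.c1.differentiable bs) _).2, (dT R s t _ (H.c2.differentiable bs) _).1, (dT R s t _ (H.c2.differentiable bs) _).2]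
        simp only [abs_mul, ab s hs, ab t ht, one_mul]
      have rc : RC (2 * R) = Tm R s t ⁻¹' OmegaR R := by
        ext x; simp only [RC, OmegaR, Tm, aff, mem_preimage, mem_prod, mem_Icc]
        rcases hs with rfl | rfl <;> rcases ht with rfl | rfl <;> constructor <;> rintro ⟨⟨_, _⟩, _, _⟩ <;> refine ⟨⟨?_, ?_⟩, ?_, ?_⟩ <;> linarith
      rw [zeq, rc, lq_T q R hs ht] at W
      refine le_trans (le_of_eq ?_) W
      rw [← lq_T q R hs ht, hA]
      have ae : (Ioc 0 (2*R/2) ×ˢ Ioc 0 (1/2) : Set P2) =ᵐ[volume] S := by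
        rw [hS, show 2 * R / 2 = R by ring]
        exact Measure.set_prod_ae_eq Ioc_ae_eq_Icc Ioc_ae_eq_Icc
      unfold lqNorm
      rw [setIntegral_congr_set ae]
      simp only [abs_mul, ab _ hσ, ab _ sτ, ab _ sτ', one_mul]
    split_ifs with h
    · rw [if_pos h] at L; exact key _ _ h0 L
    · rw [if_neg h] at L; exact key _ _ h1 L
  have one : sg 1 := Or.inl rfl
  have mone : sg (-1) := Or.inr rfl
  have ms : ∀ a b c d : ℝ, MeasurableSet (Icc a b ×ˢ Icc c d : Set P2) := fun a b c d => measurableSet_Icc.prod measurableSet_Icc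
  have q1 := piece 1 1 one one (Icc (-R) 0 ×ˢ Icc 0 (1/2)) (by
    ext x; simp only [hS, Tm, aff, mem_preimage, mem_prod, mem_Icc]
    constructor <;> rintro ⟨⟨_, _⟩, _, _⟩ <;> refine ⟨⟨?_, ?_⟩, ?_, ?_⟩ <;> linarith)
  have q2 := piece (-1) 1 mone one (Icc 0 R ×ˢ Icc 0 (1/2)) (by
    ext x; simp only [hS, Tm, aff, mem_preimage, mem_prod, mem_Icc]
    constructor <;> rintro ⟨⟨_, _⟩, _, _⟩ <;> refine ⟨⟨?_, ?_⟩, ?_, ?_⟩ <;> linarith)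
  have q3 := piece 1 (-1) one mone (Icc (-R) 0 ×ˢ Icc (1/2) 1) (by
    ext x; simp only [hS, Tm, aff, mem_preimage, mem_prod, mem_Icc]
    constructor <;> rintro ⟨⟨_, _⟩, _, _⟩ <;> refine ⟨⟨?_, ?_⟩, ?_, ?_⟩ <;> linarith)
  have q4 := piece (-1) (-1) mone mone (Icc 0 R ×ˢ Icc (1/2) 1) (by
    ext x; simp only [hS, Tm, aff, mem_preimage, mem_prod, mem_Icc]
    constructor <;> rintro ⟨⟨_, _⟩, _, _⟩ <;> refine ⟨⟨?_, ?_⟩, ?_, ?_⟩ <;> linarith)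
  have cov : OmegaR R = ((Icc (-R) 0 ×ˢ Icc 0 (1/2)) ∪ (Icc 0 R ×ˢ Icc 0 (1/2))) ∪ ((Icc (-R) 0 ×ˢ Icc (1/2) 1) ∪ (Icc 0 R ×ˢ Icc (1/2) 1)) := by
    rw [← union_prod, ← union_prod, ← prod_union, Icc_union_Icc_eq_Icc bL hR.le, Icc_union_Icc_eq_Icc bn bn]; rfl
  have M : ML q (OmegaR R) (dd e (dd e' U)) := ML_cpt (OmegaR_cpt R) cg.continuousOn
  rw [cov] at M ⊢
  have M1 := M.mono_measure (Measure.restrict_mono subset_union_left le_rfl)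
  have M2 := M.mono_measure (Measure.restrict_mono subset_union_right le_rfl)
  have r1 := lq_union hq ((ms _ _ _ _).union (ms _ _ _ _)) M
  have r2 := lq_union hq (ms _ _ _ _) M1
  have r3 := lq_union hq (ms _ _ _ _) M2
  norm_num at q1 q2 q3 q4
  norm_num at r1 r2 r3 ⊢
  linarith
end

theorem ftc_abs {g g' : ℝ → ℝ} (h : ∀ t, HasDerivAt g (g' t) t) (hc : Continuous g') {a b s t : ℝ} (hs : s ∈ Icc a b) (ht : t ∈ Icc a b) :
    |g t - g s| ≤ ∫ x in Ioc a b, |g' x| := by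
  rw [← intervalIntegral.integral_eq_sub_of_hasDerivAt (fun x _ => h x) (hc.intervalIntegrable s t)]
  refine (intervalIntegral.norm_integral_le_integral_norm_uIoc (f := g') (a := s) (b := t) (μ := volume)).trans ?_
  refine setIntegral_mono_set (hc.abs.integrableOn_Ioc) (ae_of_all _ fun x => abs_nonneg _) (ae_of_all _ (Ioc_subset_Ioc (le_min hs.1 ht.1) (max_le hs.2 ht.2)))

theorem mink {q : ℝ} (hq : 1 < q) {D Ω : Set P2} (hD : MeasurableSet D) (hΩ : IsCompact Ω) {e : P2} {h : ℝ} (hh : 0 < h)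
    (hs : ∀ x ∈ D, ∀ s ∈ Icc 0 h, x + s • e ∈ Ω) {G : F2} (hG : Continuous G) :
    lqNorm q D (fun x => ∫ s in Ioc 0 h, |G (x + s • e)|) ≤ h * lqNorm q Ω G := by
  have q0 : 0 ≤ q := bL
  have DΩ : D ⊆ Ω := fun x hx => by simpa using hs x hx 0 ⟨le_rfl, hh.le⟩
  have cF : Continuous (fun z : P2 × ℝ => |G (z.1 + z.2 • e)| ^ q) := (hG.comp bf).abs.rpow_const fun _ => Or.inr q0
  have iF : Integrable (fun z : P2 × ℝ => |G (z.1 + z.2 • e)| ^ q) ((volume.restrict D).prod (volume.restrict (Ioc 0 h))) := by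
    rw [Measure.prod_restrict]
    exact (cF.continuousOn.integrableOn_compact (hΩ.prod (isCompact_Icc (a := 0) (b := h)))).mono_set (prod_mono DΩ Ioc_subset_Icc_self)
  refine lq_le hq (mul_nonneg hh.le (lq_nonneg _ _ _)) ?_
  rw [Real.mul_rpow hh.le (lq_nonneg _ _ _), lq_pow hq]
  have st : ∀ s ∈ Ioc 0 h, ∫ x in D, |G (x + s • e)| ^ q ≤ ∫ x in Ω, |G x| ^ q := fun s hs' => by
    have mp := measurePreserving_add_right (volume : Measure P2) (s • e)
    rw [← mp.setIntegral_preimage_emb (measurableEmbedding_addRight _) (fun x => |G x| ^ q) Ω]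
    refine setIntegral_mono_set ?_ (ae_of_all _ fp) (ae_of_all _ fun x hx => hs x hx s (Ioc_subset_Icc_self hs'))
    refine (mp.integrableOn_comp_preimage (f := fun x => |G x| ^ q) (measurableEmbedding_addRight _)).2 ?_
    exact (hG.abs.rpow_const fun _ => Or.inr q0).continuousOn.integrableOn_compact hΩ
  calc ∫ x in D, |(∫ s in Ioc 0 h, |G (x + s • e)|)| ^ q ≤ ∫ x in D, h ^ (q - 1) * ∫ s in Ioc 0 h, |G (x + s • e)| ^ q := by
        refine integral_mono_of_nonneg (ae_of_all _ fp) (iF.integral_prod_left.const_mul _) (ae_of_all _ fun x => ?_)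
        beta_reduce
        rw [abs_of_nonneg (integral_nonneg fun x => abs_nonneg _)]
        exact jens hq (g := fun s => G (x + s • e)) (hG.comp bf) hh
    _ = h ^ (q - 1) * ∫ s in Ioc 0 h, ∫ x in D, |G (x + s • e)| ^ q := by
        rw [integral_const_mul, integral_integral_swap iF]
    _ ≤ h ^ (q - 1) * ∫ s in Ioc 0 h, ∫ x in Ω, |G x| ^ q := by
        gcongr ?_ * ?_
        exact setIntegral_mono_on iF.integral_prod_right (integrable_const _) measurableSet_Ioc st
    _ = _ := by
        rw [integral_const]; simp only [MeasurableSet.univ, measureReal_restrict_apply, univ_inter, Real.volume_real_Ioc, smul_eq_mul, sub_zero, max_eq_left hh.le]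
        rw [← mul_assoc, ← Real.rpow_add_one hh.ne', sub_add_cancel]

theorem interp0 {q : ℝ} (hq : 1 < q) {D Ω : Set P2} (hD : MeasurableSet D) (hΩ : IsCompact Ω) {e : P2} {h : ℝ} (hh : 0 < h)
    (hs : ∀ x ∈ D, ∀ s ∈ Icc 0 h, x + s • e ∈ Ω) {g : F2} (hg : ContDiff ℝ 2 g) :
    lqNorm q D (dd e g) ≤ 2 / h * lqNorm q Ω g + h * lqNorm q Ω (dd e (dd e g)) := by
  have g1 : ContDiff ℝ 1 (dd e g) := dd_cd e hg bn
  have d0 := hg.differentiable bs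
  have d1 := g1.differentiable bs
  have c2 := dd_cont e g1
  have DΩ : D ⊆ Ω := fun x hx => by simpa using hs x hx 0 ⟨le_rfl, hh.le⟩
  have fin : volume D < ⊤ := (measure_mono DΩ).trans_lt hΩ.measure_lt_top
  have sub : ∀ f : F2, Continuous f → ML q D f := fun f hf => (ML_cpt hΩ hf.continuousOn).mono_measure (Measure.restrict_mono DΩ le_rfl)
  have key : ∀ x, |dd e g x| ≤ (h⁻¹ * |g (x + h • e)| + h⁻¹ * |g x|) + ∫ s in Ioc 0 h, |dd e (dd e g) (x + s • e)| := fun x => by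
    obtain ⟨ξ, hξ, e1⟩ := exists_hasDerivAt_eq_slope (fun s => g (x + s • e)) (fun s => dd e g (x + s • e)) hh (by have := d0.continuous; fun_prop) (fun s _ => dd_hda d0 e x s)
    have e2 := ftc_abs (fun s => dd_hda d1 e x s) (c2.comp bf) (a := 0) (b := h) (t := 0) (s := ξ) ⟨hξ.1.le, hξ.2.le⟩ ⟨le_rfl, hh.le⟩
    simp only [zero_smul, add_zero, sub_zero] at e1 e2
    rw [e1] at e2
    have e3 : |(g (x + h • e) - g x) / h| ≤ h⁻¹ * |g (x + h • e)| + h⁻¹ * |g x| := by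
      rw [abs_div, abs_of_pos hh, div_eq_inv_mul, ← mul_add]
      exact mlL (abs_sub _ _) bp
    have := abs_sub_abs_le_abs_sub (dd e g x) ((g (x + h • e) - g x) / h)
    linarith
  have cI : Continuous (fun x => ∫ s in Ioc 0 h, |dd e (dd e g) (x + s • e)|) := by
    simp_rw [← intervalIntegral.integral_of_le hh.le]
    exact intervalIntegral.continuous_parametric_intervalIntegral_of_continuous' bf 0 h
  have cg := d0.continuous
  have m1 := sub (fun x => h⁻¹ * |g (x + h • e)|) bf
  have m2 := sub (fun x => h⁻¹ * |g x|) bf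
  have m3 := sub _ cI
  have b1 := lq_mono hq hD (f := dd e g) (ML_add (ML_add m1 m2) m3) (fun x _ => (key x).trans (le_abs_self _))
  have b2 := lq_add hq (ML_add m1 m2) m3
  have b3 := lq_add hq m1 m2
  have b4 := mink hq hD hΩ hh hs c2
  rw [lq_cmul hq, lq_cmul hq, abs_of_pos (inv_pos.2 hh)] at b3
  have b5 : lqNorm q D (fun x => |g x|) ≤ lqNorm q Ω g := by
    refine le_trans (le_of_eq ?_) (lq_sub_set hq (ML_cpt hΩ cg.continuousOn) DΩ); simp [lqNorm]
  have b6 : lqNorm q D (fun x => |g (x + h • e)|) ≤ lqNorm q Ω g := by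
    have mp := measurePreserving_add_right (volume : Measure P2) (h • e)
    have m : ML q Ω g := ML_cpt hΩ cg.continuousOn
    have ii := ML_int hq m
    unfold lqNorm
    rw [← mp.setIntegral_preimage_emb (measurableEmbedding_addRight _) (fun x => |g x| ^ q) Ω]
    simp only [abs_abs]
    refine Real.rpow_le_rpow (integral_nonneg fp) ?_ bp
    refine setIntegral_mono_set ?_ (ae_of_all _ fp) (ae_of_all _ fun x hx => hs x hx h ⟨hh.le, le_rfl⟩)
    exact (mp.integrableOn_comp_preimage (f := fun x => |g x| ^ q) (measurableEmbedding_addRight _)).2 ii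
  have b7 := mlL b5 (inv_pos.2 hh).le
  have b8 := mlL b6 (inv_pos.2 hh).le
  rw [div_eq_mul_inv]; linarith

theorem interp {q : ℝ} (hq : 1 < q) {R h : ℝ} (hh : 0 < h) (hR : h ≤ R) (h2 : h ≤ 1/2) {e : P2} (he : unitv e) {g : F2} (hg : ContDiff ℝ 2 g) :
    nO q R (dd e g) ≤ 4 / h * nO q R g + 2 * h * nO q R (dd e (dd e g)) := by
  have ms : ∀ a b c d : ℝ, MeasurableSet (Icc a b ×ˢ Icc c d : Set P2) := fun a b c d => measurableSet_Icc.prod measurableSet_Icc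
  have ng : ∀ f : F2, dd (-e) f = fun x => - dd e f x := fun f => by funext x; simp [dd]
  obtain ⟨A, B, mA, mB, hAB, h1, h3⟩ : ∃ A B : Set P2, MeasurableSet A ∧ MeasurableSet B ∧ OmegaR R = A ∪ B ∧ (∀ x ∈ A, ∀ s ∈ Icc 0 h, x + s • e ∈ OmegaR R) ∧
      (∀ x ∈ B, ∀ s ∈ Icc 0 h, x + s • (-e) ∈ OmegaR R) := by
    rcases he with rfl | rfl
    · refine ⟨Icc (-R) 0 ×ˢ Icc 0 1, Icc 0 R ×ˢ Icc 0 1, ms _ _ _ _, ms _ _ _ _, ?_, ?_, ?_⟩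
      · rw [← union_prod, Icc_union_Icc_eq_Icc bL bL]; rfl
      all_goals
        rintro x ⟨⟨_, _⟩, _, _⟩ s ⟨_, _⟩
        simp only [OmegaR, mem_prod, mem_Icc, Prod.fst_add, Prod.snd_add, Prod.smul_fst, Prod.smul_snd, smul_eq_mul, Prod.fst_neg, Prod.snd_neg]
        refine ⟨⟨?_, ?_⟩, ?_, ?_⟩ <;> linarith
    · refine ⟨Icc (-R) R ×ˢ Icc 0 (1/2), Icc (-R) R ×ˢ Icc (1/2) 1, ms _ _ _ _, ms _ _ _ _, ?_, ?_, ?_⟩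
      · rw [← prod_union, Icc_union_Icc_eq_Icc bL bL]; rfl
      all_goals
        rintro x ⟨⟨_, _⟩, _, _⟩ s ⟨_, _⟩
        simp only [OmegaR, mem_prod, mem_Icc, Prod.fst_add, Prod.snd_add, Prod.smul_fst, Prod.smul_snd, smul_eq_mul, Prod.fst_neg, Prod.snd_neg]
        refine ⟨⟨?_, ?_⟩, ?_, ?_⟩ <;> linarith
  have j1 := interp0 hq mA (OmegaR_cpt R) hh h1 hg
  have j2 := interp0 hq mB (OmegaR_cpt R) hh h3 hg
  have c : Continuous (dd e g) := dd_cont e (hg.of_le bn)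
  have m : ML q (OmegaR R) (dd e g) := ML_cpt (OmegaR_cpt R) c.continuousOn
  have e1 : ∀ (D : Set P2) (f : F2), lqNorm q D (dd (-e) f) = lqNorm q D (dd e f) := fun D f => by rw [ng]; simp [lqNorm]
  have e2 : nO q R (dd (-e) (dd (-e) g)) = nO q R (dd e (dd e g)) := by
    rw [e1, ng, dd_neg]; simp [lqNorm]
  rw [e1, e2] at j2
  have u : nO q R (dd e g) ≤ lqNorm q A (dd e g) + lqNorm q B (dd e g) := by
    rw [hAB] at m ⊢; exact lq_union hq mB m
  rw [show 4 / h = 2 / h + 2 / h by ring]; linarith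

theorem ker_int {τ : ℝ} (hτ : 0 < τ) (c : ℝ) : Integrable (fun y : ℝ => Real.exp (-(τ * |y - c|))) ∧ ∫ y : ℝ, Real.exp (-(τ * |y - c|)) = 2 / τ := by
  have h : ∫ y : ℝ, Real.exp (-(τ * |y - c|)) = 2 / τ := by
    rw [integral_sub_right_eq_self (fun y => Real.exp (-(τ * |y|))) c, integral_comp_abs (f := fun y => Real.exp (-(τ * y)))]
    simp_rw [← neg_mul]
    rw [integral_exp_mul_Ioi bL]; simp; ring
  refine ⟨?_, h⟩
  by_contra hc
  rw [integral_undef hc] at h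
  have : 0 < 2 / τ := bp
  linarith

theorem ker_le {τ R : ℝ} (hτ : 0 < τ) (hR : 0 < R) (c : ℝ) : ∫ z in OmegaR R, Real.exp (-(τ * |z.2 - c|)) ≤ 4 * R / τ := by
  have := setIntegral_prod_mul (μ := (volume : Measure ℝ)) (ν := (volume : Measure ℝ)) (fun _ : ℝ => (1:ℝ)) (fun y => Real.exp (-(τ * |y - c|))) (Icc (-R) R) (Icc 0 1)
  simp only [one_mul] at this
  unfold OmegaR
  rw [show (volume : Measure (ℝ × ℝ)) = volume.prod volume from rfl, this]
  obtain ⟨i, h⟩ := ker_int hτ c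
  have h2 : ∫ y in Icc 0 1, Real.exp (-(τ * |y - c|)) ≤ 2 / τ := h ▸ setIntegral_le_integral i (ae_of_all _ fp)
  simp only [integral_const, MeasurableSet.univ, measureReal_restrict_apply, univ_inter, Real.volume_real_Icc, smul_eq_mul, mul_one]
  rw [max_eq_left bL]
  calc _ ≤ (R - -R) * (2 / τ) := by gcongr; linarith
    _ = _ := by ring

theorem kop {p q : ℝ} (hpq : p.HolderConjugate q) {τ R : ℝ} (hτ : 0 < τ) (hR : 0 < R) {g : F2} (hg : Continuous g) :
    nO q R (fun x => ∫ z in OmegaR R, Ek τ z x * |g z|) ≤ 4 * R / τ * nO q R g := by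
  have hq : 1 < q := hpq.symm.lt
  have hp : 1 < p := hpq.lt
  have q0 : 0 ≤ q := bL
  set Ω := OmegaR R with hΩ
  have cΩ : IsCompact Ω := OmegaR_cpt R
  set M := 4 * R / τ with hM
  have M0 : 0 < M := bp
  have cF : Continuous (fun z : P2 × P2 => Real.exp (-(τ * |z.2.2 - z.1.2|)) * |g z.2| ^ q) :=
    Continuous.mul bf ((hg.comp bf).abs.rpow_const fun _ => Or.inr q0)
  have iF : Integrable (fun z : P2 × P2 => Real.exp (-(τ * |z.2.2 - z.1.2|)) * |g z.2| ^ q) ((volume.restrict Ω).prod (volume.restrict Ω)) := by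
    rw [Measure.prod_restrict]
    exact cF.continuousOn.integrableOn_compact (cΩ.prod cΩ)
  have io : ∀ {f : F2}, Continuous f → IntegrableOn f Ω := fun hf => hf.continuousOn.integrableOn_compact cΩ
  have pt : ∀ x : P2, |(∫ z in Ω, Ek τ z x * |g z|)| ^ q ≤ M ^ (q - 1) * ∫ z in Ω, Ek τ z x * |g z| ^ q := fun x => by
    have e1 : ∀ z : P2, |Real.exp (-(τ * |z.2 - x.2|) / p)| ^ p = Ek τ z x := fun z => by
      rw [Real.abs_exp, ← Real.exp_mul]; congr 1; field_simp
    have e2 : ∀ z : P2, |Real.exp (-(τ * |z.2 - x.2|) / q) * (|g z|)| ^ q = Ek τ z x * |g z| ^ q := fun z => by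
      rw [abs_mul, Real.abs_exp, abs_abs, Real.mul_rpow bp bp, ← Real.exp_mul]; congr 2; field_simp
    have e3 : ∀ z : P2, |Real.exp (-(τ * |z.2 - x.2|) / p)| * |Real.exp (-(τ * |z.2 - x.2|) / q) * (|g z|)| = Ek τ z x * |g z| := fun z => by
      rw [abs_mul, Real.abs_exp, abs_abs, Real.abs_exp, ← mul_assoc, ← Real.exp_add]; congr 2
      have := hpq.inv_add_inv_eq_one
      rw [div_eq_mul_inv, div_eq_mul_inv, ← mul_add, this, mul_one]
    have H := (holder hpq (ν := volume.restrict Ω) (f := fun z : P2 => Real.exp (-(τ * |z.2 - x.2|) / p)) (g := fun z : P2 => Real.exp (-(τ * |z.2 - x.2|) / q) * |g z|)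
      (Continuous.aestronglyMeasurable bf) (Continuous.aestronglyMeasurable bf) (by simp_rw [e1]; exact io bf)
      (by simp_rw [e2]; exact io (Continuous.mul bf (hg.abs.rpow_const fun _ => Or.inr q0)))).2
    simp_rw [e1, e2, e3] at H
    have n1 : 0 ≤ ∫ z in Ω, Ek τ z x * |g z| ^ q := integral_nonneg fp
    have n2 : 0 ≤ ∫ z in Ω, Ek τ z x := integral_nonneg fp
    rw [abs_of_nonneg (integral_nonneg fp)]
    refine (Real.rpow_le_rpow (integral_nonneg fp) (H.trans (mlR (Real.rpow_le_rpow n2 (ker_le hτ hR x.2) bp) bp)) q0).trans (le_of_eq ?_)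
    rw [Real.mul_rpow bp bp, ← Real.rpow_mul bp, ← Real.rpow_mul n1, one_div_mul_cancel bL, Real.rpow_one]
    congr 2
    have := hpq.inv_add_inv_eq_one
    field_simp at this ⊢; linarith
  refine lq_le hq (mul_nonneg M0.le (lq_nonneg _ _ _)) ?_
  rw [Real.mul_rpow M0.le (lq_nonneg _ _ _), lq_pow hq]
  calc _ ≤ ∫ x in Ω, M ^ (q - 1) * ∫ z in Ω, Ek τ z x * |g z| ^ q :=
        integral_mono_of_nonneg (ae_of_all _ fp) (iF.integral_prod_left.const_mul _) (ae_of_all _ pt)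
    _ = M ^ (q - 1) * ∫ z in Ω, ∫ x in Ω, Ek τ z x * |g z| ^ q := by
        rw [integral_const_mul, integral_integral_swap iF]
    _ ≤ M ^ (q - 1) * ∫ z in Ω, M * |g z| ^ q := by
        gcongr ?_ * ?_
        refine integral_mono iF.integral_prod_right ((io (hg.abs.rpow_const fun _ => Or.inr q0)).const_mul _) fun z => ?_
        beta_reduce
        rw [integral_mul_const]
        refine mlR ?_ bp
        have := ker_le hτ hR z.2
        simpa only [abs_sub_comm] using this
    _ = _ := by
        rw [integral_const_mul, ← mul_assoc, ← Real.rpow_add_one M0.ne', sub_add_cancel]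

theorem win {g g' : ℝ → ℝ} (h : ∀ t, HasDerivAt g (g' t) t) (hc : Continuous g') {R c : ℝ} (hR : 0 < R) (hR1 : R ≤ 1) (h0 : 0 ≤ c) (h1 : c ≤ 1)
    {w : ℝ → ℝ} (cw : Continuous w) (w0 : ∀ s, 0 ≤ w s) (w1 : ∀ s, |s - c| ≤ R → 1 ≤ w s) : |g c| ≤ ∫ s in Icc 0 1, w s * (|g' s| + |g s| / R) := by
  have cg : Continuous g := continuous_iff_continuousAt.2 fun t => (h t).continuousAt
  set a := min c (1 - R) with ha
  have a1 : a ≤ c := min_le_left _ _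
  have a2 : a ≤ 1 - R := min_le_right _ _
  have a3 : 0 ≤ a := le_min h0 bL
  have a4 : c ≤ a + R := by rcases min_choice c (1 - R) with e | e <;> rw [ha, e] <;> linarith
  have io : ∀ {f : ℝ → ℝ}, Continuous f → IntegrableOn f (Ioc a (a+R)) := fun hf => hf.integrableOn_Ioc
  have A : |g c| * R ≤ ∫ s in Ioc a (a+R), (|g s| + ∫ t in Ioc a (a+R), |g' t|) := by
    calc _ = ∫ s in Ioc a (a+R), |g c| := by simp [Real.volume_real_Ioc, hR.le, mul_comm]
      _ ≤ _ := setIntegral_mono_on (io bf) (io bf) measurableSet_Ioc fun s hs => by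
        have := ftc_abs h hc (a := a) (b := a+R) (t := c) (s := s) ⟨hs.1.le, hs.2⟩ ⟨a1, a4⟩
        have := abs_sub_abs_le_abs_sub (g c) (g s); linarith
  rw [integral_add (io bf) (io bf)] at A
  simp only [integral_const, MeasurableSet.univ, measureReal_restrict_apply, univ_inter, Real.volume_real_Ioc, smul_eq_mul, add_sub_cancel_left, max_eq_left hR.le] at A
  have B : ∫ s in Ioc a (a+R), (|g' s| + |g s| / R) = (∫ s in Ioc a (a+R), |g' s|) + (∫ s in Ioc a (a+R), |g s|) / R := by
    rw [integral_add (io bf) (io bf), integral_div]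
  have C : |g c| ≤ ∫ s in Ioc a (a+R), (|g' s| + |g s| / R) := by
    rw [B, ← sub_le_iff_le_add', le_div_iff₀ hR]; linarith
  refine C.trans ((setIntegral_mono_on (g := fun s => w s * (|g' s| + |g s| / R)) (io bf) (io bf) measurableSet_Ioc fun s hs => ?_).trans ?_)
  · refine le_mul_of_one_le_left bp (w1 s ?_)
    rw [abs_le]; constructor <;> linarith [hs.1, hs.2]
  · refine setIntegral_mono_set (Continuous.continuousOn bf).integrableOn_Icc (ae_of_all _ fun s => mul_nonneg (w0 s) bp) (ae_of_all _ fun s hs => ?_)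
    exact ⟨by linarith [hs.1], by linarith [hs.2]⟩

theorem win2 {V : F2} (hV : ContDiff ℝ 1 V) {R c : ℝ} (hR : 0 < R) (hR1 : R ≤ 1) (h0 : 0 ≤ c) (h1 : c ≤ 1)
    {w : ℝ → ℝ} (cw : Continuous w) (w0 : ∀ s, 0 ≤ w s) (w1 : ∀ s, |s - c| ≤ R → 1 ≤ w s) {ψ : F2} (hψ : ContDiff ℝ 1 ψ)
    (hd : ∀ t, -R ≤ t → t ≤ R → |dd Ex ψ (t, c)| = |V (t, c)|) (hz : ψ (-R, c) = 0) {x : ℝ} (hx : -R ≤ x) (hx' : x ≤ R) :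
    |ψ (x, c)| ≤ ∫ z in OmegaR R, w z.2 * (|dd Ey V z| + |V z| / R) := by
  have cV := hV.continuous
  have dV := hV.differentiable bs
  have cD := dd_cont Ey hV
  have A := ftc_abs (fun t => pd1_hda (hψ.differentiable bs) t c) (a := -R) (b := R) (t := x) (s := -R) ((dd_cont Ex hψ).comp bf) ⟨le_rfl, by linarith⟩ ⟨hx, hx'⟩
  rw [pd1_eq, hz, sub_zero, setIntegral_congr_fun measurableSet_Ioc (fun t ht => hd t ht.1.le ht.2), ← integral_Icc_eq_integral_Ioc] at A
  refine A.trans ?_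
  have i2 : IntegrableOn (fun z : P2 => w z.2 * (|dd Ey V z| + |V z| / R)) (OmegaR R) (volume.prod volume) := (Continuous.continuousOn bf).integrableOn_compact (OmegaR_cpt R)
  have := setIntegral_prod _ i2
  rw [show (volume : Measure (ℝ × ℝ)) = volume.prod volume from rfl]
  refine le_trans ?_ this.ge
  have i3 := i2
  rw [IntegrableOn, OmegaR, ← Measure.prod_restrict] at i3
  exact setIntegral_mono_on (Continuous.continuousOn bf).integrableOn_Icc i3.integral_prod_left measurableSet_Icc fun t _ =>
    win (fun y => pd2_hda dV t y) (cD.comp bf) hR hR1 h0 h1 cw w0 w1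

theorem io_cpt {R : ℝ} {f : F2} (hf : Continuous f) : IntegrableOn f (OmegaR R) := hf.continuousOn.integrableOn_compact (OmegaR_cpt R)

theorem div_x {R : ℝ} (hR : 0 < R) {G : F2} (hG : ContDiff ℝ 1 G) (h : ∀ y, 0 ≤ y → y ≤ 1 → G (R, y) = 0 ∧ G (-R, y) = 0) : ∫ z in OmegaR R, dd Ex G z = 0 := by
  have i : IntegrableOn (dd Ex G) (OmegaR R) (volume.prod volume) := io_cpt (dd_cont _ hG)
  have i' : Integrable (fun z : P2 => dd Ex G z) ((volume.restrict (Icc (-R) R)).prod (volume.restrict (Icc 0 1))) := by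
    rw [Measure.prod_restrict]; exact i
  rw [show (volume : Measure (ℝ × ℝ)) = volume.prod volume from rfl, OmegaR, setIntegral_prod _ i, integral_integral_swap i']
  refine (setIntegral_congr_fun (g := fun _ => R0) measurableSet_Icc fun y hy => ?_).trans bs
  beta_reduce
  rw [integral_Icc_eq_integral_Ioc, ← intervalIntegral.integral_of_le bL]
  have := intervalIntegral.integral_eq_sub_of_hasDerivAt (a := -R) (b := R) (fun t _ => pd1_hda (hG.differentiable bs) t y) (((dd_cont Ex hG).comp bf).intervalIntegrable _ _)
  rw [pd1_eq] at this
  rw [this, (h y hy.1 hy.2).1, (h y hy.1 hy.2).2]; simp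

theorem div_y {R : ℝ} {G : F2} (hG : ContDiff ℝ 1 G) (h : ∀ x, -R ≤ x → x ≤ R → G (x, 0) ≤ G (x, 1)) : 0 ≤ ∫ z in OmegaR R, dd Ey G z := by
  have i : IntegrableOn (dd Ey G) (OmegaR R) (volume.prod volume) := io_cpt (dd_cont _ hG)
  rw [show (volume : Measure (ℝ × ℝ)) = volume.prod volume from rfl, OmegaR, setIntegral_prod _ i]
  refine setIntegral_nonneg measurableSet_Icc fun x hx => ?_
  rw [integral_Icc_eq_integral_Ioc, ← intervalIntegral.integral_of_le bL]
  have := intervalIntegral.integral_eq_sub_of_hasDerivAt (a := 0) (b := 1) (fun t _ => pd2_hda (hG.differentiable bs) x t) (((dd_cont Ey hG).comp bf).intervalIntegrable _ _)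
  rw [pd2_eq] at this
  rw [this]; linarith [h x hx.1 hx.2]

theorem pw {η h1 h2 a b c d X Y Z x : ℝ} (hη : 0 ≤ η) (b1 : |h1| ≤ η / 32) (b2 : |h2| ≤ η / 32) (hx : |x| ≤ 1) :
    η * (d ^ 2 + Y ^ 2) / 16 ≤ (η * (a^2+b^2+c^2+d^2) + 2 * h1 * Y * d + b * (h2 * Z + 2 * h1 * X)) + (η * X ^ 2 + 2 * x * η * X * a) / 16 +
      5 / 16 * (η * Y ^ 2 + 2 * x * η * Y * c) + (η * Z ^ 2 - 2 * x * η * Z * Y) / 32 := by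
  have m : ∀ {l e s t : ℝ}, |l| ≤ e → -(e * (s ^ 2 + t ^ 2)) ≤ 2 * (l * (s * t)) := fun {l e s t} hl => by
    have e0 : 0 ≤ e := (abs_nonneg l).trans hl
    have h1 : |2 * (l * (s * t))| ≤ e * (2 * (|s| * |t|)) := by
      rw [abs_mul, abs_mul, abs_mul, abs_two]
      have := mlR hl (mul_nonneg (abs_nonneg s) (abs_nonneg t)); linarith
    have h2 : e * (2 * (|s| * |t|)) ≤ e * (s ^ 2 + t ^ 2) := mlL (by rw [← sq_abs s, ← sq_abs t]; linarith [two_mul_le_add_sq |s| |t|]) e0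
    linarith [neg_abs_le (2 * (l * (s * t)))]
  have po : ∀ s t : ℝ, η * s ^ 2 ≤ 2 * (η * s ^ 2 + 2 * x * η * s * t) + 4 * η * t ^ 2 := fun s t => by
    have e : 2 * (η * s ^ 2 + 2 * x * η * s * t) + 4 * η * t ^ 2 - η * s ^ 2 = η * ((s + 2 * x * t) ^ 2 + 4 * (1 - x ^ 2) * t ^ 2) := by ring
    have : x ^ 2 ≤ 1 := (sq_le_one_iff_abs_le_one x).2 hx
    have : 0 ≤ η * ((s + 2 * x * t) ^ 2 + 4 * (1 - x ^ 2) * t ^ 2) := mul_nonneg hη (add_nonneg (sq_nonneg _) (mul_nonneg bL (sq_nonneg t)))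
    linarith
  have m1 := m b1 (s := Y) (t := d)
  have m2 := m b2 (s := b) (t := Z)
  have m3 := m b1 (s := b) (t := X)
  have p1 := po X a
  have p2 := po Y c
  have p3 := po Z (-Y)
  have n1 : 0 ≤ η * a ^ 2 := bp
  have n2 : 0 ≤ η * b ^ 2 := bp
  have n3 : 0 ≤ η * c ^ 2 := bp
  have n4 : 0 ≤ η * d ^ 2 := bp
  have n5 : 0 ≤ η * Y ^ 2 := bp
  linarith

theorem dd_w {h h1 : ℝ → ℝ} (hd : ∀ y, HasDerivAt h (h1 y) y) (e : P2) : dd e (fun z : P2 => h z.2) = fun z => e.2 * h1 z.2 := by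
  funext z
  have := ((hd z.2).comp_hasFDerivAt z (hasFDerivAt_snd (𝕜 := ℝ) (p := z))).fderiv
  rw [Function.comp_def] at this
  rw [dd, this]; simp [mul_comm]

theorem dd_x1 (e : P2) : dd e (fun z : P2 => z.1) = fun _ => e.1 := by
  funext z; rw [dd, (hasFDerivAt_fst (𝕜 := ℝ) (p := z)).fderiv]; simp

theorem cd_of {h h1 : ℝ → ℝ} (hd : ∀ y, HasDerivAt h (h1 y) y) (hc : Continuous h1) : ContDiff ℝ 1 h :=
  contDiff_one_iff_deriv.2 ⟨fun y => (hd y).differentiableAt, by rwa [show deriv h = h1 from funext fun y => (hd y).deriv]⟩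

theorem energy {R μ k0 k1 : ℝ} {u1 u2 ψ p f1 f2 : F2} (hμ : 0 < μ) (hk0 : k0 ≤ 0) (hk1 : k1 ≤ 0) (hR : 0 < R) (H : GS R μ k0 k1 u1 u2 ψ p f1 f2)
    {h h1 h2 : ℝ → ℝ} (d1 : ∀ y, HasDerivAt h (h1 y) y) (d2 : ∀ y, HasDerivAt h1 (h2 y) y) (ch : Continuous h2) (hn : ∀ y, 0 ≤ h y)
    (b1 : ∀ y, |h1 y * R| ≤ h y / 32) (b2 : ∀ y, |h2 y * R ^ 2| ≤ h y / 32) :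
    ∫ z in OmegaR R, h z.2 * (dd Ey u2 z ^ 2 + (u2 z / R) ^ 2) ≤ 16 / μ * ∫ z in OmegaR R, h z.2 * (W3 f1 f2 u1 u2 ψ R z) := by
  obtain ⟨c1, c2, c3, cp, g1, g2, e, hx, hy, h0', h1'⟩ := H
  have ch1 : ContDiff ℝ 1 h1 := cd_of d2 ch
  have ch0 : ContDiff ℝ 1 h := cd_of d1 ch1.continuous
  have cW : ContDiff ℝ 1 (fun z : P2 => h z.2) := ch0.comp contDiff_snd
  have cW1 : ContDiff ℝ 1 (fun z : P2 => h1 z.2) := ch1.comp contDiff_snd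
  have k1' := c1.of_le one_le_two
  have k2' := c2.of_le one_le_two
  have k3' := c3.of_le one_le_two
  have q1 := dd_cd (m := 1) Ex c1 bn
  have q2 := dd_cd (m := 1) Ey c1 bn
  have q3 := dd_cd (m := 1) Ex c2 bn
  have q4 := dd_cd (m := 1) Ey c2 bn
  set v : F2 := fun z => h1 z.2 * ψ z + h z.2 * u1 z with hv
  set w : F2 := fun z => h z.2 * u2 z with hw
  have cv : ContDiff ℝ 1 v := (cW1.mul k3').add (cW.mul k1')
  have cw : ContDiff ℝ 1 w := cW.mul k2'
  set S : F2 := fun z => z.1 * (h z.2 * (1 / (16 * R ^ 2) * (u1 z * u1 z) + 5 / (16 * R ^ 2) * (u2 z * u2 z) + 1 / (32 * R ^ 4) * (ψ z * ψ z))) with hS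
  have cS : ContDiff ℝ 1 S := contDiff_fst.mul (cW.mul (((contDiff_const.mul (k1'.mul k1')).add (contDiff_const.mul (k2'.mul k2'))).add (contDiff_const.mul (k3'.mul k3'))))
  set G1 : F2 := fun z => 1 / μ * (p z * v z) - (dd Ex u1 z * v z + dd Ex u2 z * w z) with hG1
  set G2 : F2 := fun z => 1 / μ * (p z * w z) - (dd Ey u1 z * v z + dd Ey u2 z * w z) with hG2
  have cG1 : ContDiff ℝ 1 G1 := (contDiff_const.mul (cp.mul cv)).sub ((q1.mul cv).add (q3.mul cw))
  have cG2 : ContDiff ℝ 1 G2 := (contDiff_const.mul (cp.mul cw)).sub ((q2.mul cv).add (q4.mul cw))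
  have eG : ∀ z ∈ OmegaR R, h z.2 * (dd Ey u2 z ^ 2 + (u2 z / R) ^ 2) ≤ 16 / μ * (h z.2 * (W3 f1 f2 u1 u2 ψ R z))
      - 16 * dd Ex G1 z - 16 * dd Ey G2 z + 16 * dd Ex S z := fun z hz => by
    have z1 := cW.differentiable bs
    have z2 := cW1.differentiable bs
    have z3 := k1'.differentiable bs
    have z4 := k2'.differentiable bs
    have z5 := k3'.differentiable bs
    have z6 := q1.differentiable bs
    have z7 := q2.differentiable bs
    have z8 := q3.differentiable bs
    have z9 := q4.differentiable bs
    have zp := cp.differentiable bs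
    have zv := cv.differentiable bs
    have zw := cw.differentiable bs
    have Dv : ∀ e, dd e v z = e.2 * h2 z.2 * ψ z + h1 z.2 * dd e ψ z + (e.2 * h1 z.2 * u1 z + h z.2 * dd e u1 z) := fun e => by
      simp (disch := fun_prop) only [hv, dd_add, dd_mul, dd_w d1, dd_w d2]
    have Dw : ∀ e, dd e w z = e.2 * h1 z.2 * u2 z + h z.2 * dd e u2 z := fun e => by
      simp (disch := fun_prop) only [hw, dd_mul, dd_w d1]
    have DS : dd Ex S z = h z.2 * (1 / (16 * R ^ 2) * (u1 z * u1 z) + 5 / (16 * R ^ 2) * (u2 z * u2 z) + 1 / (32 * R ^ 4) * (ψ z * ψ z)) +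
       z.1 * h z.2 * (1 / (8 * R ^ 2) * (u1 z * dd Ex u1 z) + 5 / (8 * R ^ 2) * (u2 z * dd Ex u2 z) + 1 / (16 * R ^ 4) * (ψ z * dd Ex ψ z)) := by
      simp (disch := fun_prop) only [hS, dd_add, dd_mul, dd_w d1, dd_x1, dd_k]
      field_simp; ring
    have DG1 : dd Ex G1 z = 1 / μ * (dd Ex p z * v z + p z * dd Ex v z) - (dd Ex (dd Ex u1) z * v z + dd Ex u1 z * dd Ex v z + (dd Ex (dd Ex u2) z * w z + dd Ex u2 z * dd Ex w z)) := by
      simp (disch := fun_prop) only [hG1, dd_sub, dd_add, dd_mul, dd_k]; ring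
    have DG2 : dd Ey G2 z = 1 / μ * (dd Ey p z * w z + p z * dd Ey w z) - (dd Ey (dd Ey u1) z * v z + dd Ey u1 z * dd Ey v z + (dd Ey (dd Ey u2) z * w z + dd Ey u2 z * dd Ey w z)) := by
      simp (disch := fun_prop) only [hG2, dd_sub, dd_add, dd_mul, dd_k]; ring
    obtain ⟨e1, e2, e3, e4, e5⟩ := e z hz
    have P := pw (h1 := h1 z.2 * R) (h2 := h2 z.2 * R ^ 2) (a := dd Ex u1 z) (b := dd Ey u1 z) (c := dd Ex u2 z) (d := dd Ey u2 z)
      (X := u1 z / R) (Y := u2 z / R) (Z := ψ z / R ^ 2) (x := z.1 / R) (hn z.2) (b1 _) (b2 _)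
      (by rw [abs_div, abs_of_pos hR, div_le_one hR]; exact abs_le.2 hz.1)
    have F : (f1 z * v z + f2 z * w z) ≤ h z.2 * (W3 f1 f2 u1 u2 ψ R z) := by
      have t1 : |v z| ≤ h z.2 * (|u1 z| + |ψ z| / R) := by
        have := b1 z.2
        rw [abs_mul, abs_of_pos hR] at this
        have : |h1 z.2| ≤ h z.2 / R := by rw [le_div_iff₀ hR]; linarith [hn z.2]
        calc _ ≤ |h1 z.2 * ψ z| + |h z.2 * u1 z| := abs_add_le _ _
          _ ≤ h z.2 / R * |ψ z| + h z.2 * |u1 z| := by rw [abs_mul, abs_mul, abs_of_nonneg (hn z.2)]; gcongr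
          _ = _ := by ring
      have t2 : |w z| = h z.2 * |u2 z| := by rw [hw, abs_mul, abs_of_nonneg (hn _)]
      calc _ ≤ |f1 z| * |v z| + |f2 z| * |w z| := by rw [← abs_mul, ← abs_mul]; exact add_le_add (le_abs_self _) (le_abs_self _)
        _ ≤ |f1 z| * (h z.2 * (|u1 z| + |ψ z| / R)) + |f2 z| * (h z.2 * |u2 z|) := by rw [t2]; gcongr
        _ ≤ |f1 z| * (h z.2 * (|u1 z| + |u2 z| + |ψ z| / R)) + |f2 z| * (h z.2 * (|u1 z| + |u2 z| + |ψ z| / R)) := by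
          have := hn z.2
          gcongr
          · linarith [abs_nonneg (u2 z)]
          · have : 0 ≤ |ψ z| / R := bp
            linarith [abs_nonneg (u1 z)]
        _ = _ := by ring
    have F' : 1 / μ * (f1 z * v z + f2 z * w z) ≤ 1 / μ * (h z.2 * (W3 f1 f2 u1 u2 ψ R z)) := mlL F bp
    have I : 1 / μ * (f1 z * v z + f2 z * w z) - dd Ex G1 z - dd Ey G2 z = h z.2 * (dd Ex u1 z ^ 2 + dd Ey u1 z ^ 2 + dd Ex u2 z ^ 2 + dd Ey u2 z ^ 2) + 2 * (h1 z.2 * R) * (u2 z / R) * dd Ey u2 z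
        + dd Ey u1 z * (h2 z.2 * R ^ 2 * (ψ z / R ^ 2) + 2 * (h1 z.2 * R) * (u1 z / R)) := by
      rw [DG1, DG2, Dv, Dv, Dw, Dw, ← e4, ← e5, e1, e2, eq_neg_of_add_eq_zero_left e3]
      field_simp; ring
    have J : dd Ex S z = (h z.2 * (u1 z / R) ^ 2 + 2 * (z.1 / R) * h z.2 * (u1 z / R) * dd Ex u1 z) / 16 +
      5 / 16 * (h z.2 * (u2 z / R) ^ 2 + 2 * (z.1 / R) * h z.2 * (u2 z / R) * dd Ex u2 z) + (h z.2 * (ψ z / R ^ 2) ^ 2 - 2 * (z.1 / R) * h z.2 * (ψ z / R ^ 2) * (u2 z / R)) / 32 := by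
      rw [DS, e2]; field_simp; ring
    have e16 : 16 / μ * (h z.2 * (W3 f1 f2 u1 u2 ψ R z)) = 16 * (1 / μ * (h z.2 * (W3 f1 f2 u1 u2 ψ R z))) := by ring
    rw [e16]; linarith
  have cu1 := c1.continuous
  have cu2 := c2.continuous
  have cψ := c3.continuous
  have q4' := q4.continuous
  have hc0 := ch0.continuous
  have cR := hR.ne'
  have i0 : IntegrableOn (fun z : P2 => h z.2 * (W3 f1 f2 u1 u2 ψ R z)) (OmegaR R) := io_cpt bf
  have i1 : IntegrableOn (fun z : P2 => 16 * dd Ex G1 z) (OmegaR R) := (io_cpt (dd_cont _ cG1)).const_mul _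
  have i2 : IntegrableOn (fun z : P2 => 16 * dd Ey G2 z) (OmegaR R) := (io_cpt (dd_cont _ cG2)).const_mul _
  have i3 : IntegrableOn (fun z : P2 => 16 * dd Ex S z) (OmegaR R) := (io_cpt (dd_cont _ cS)).const_mul _
  have M := setIntegral_mono_on (io_cpt (R := R) (f := fun z : P2 => h z.2 * (dd Ey u2 z ^ 2 + (u2 z / R) ^ 2)) bf) ((((i0.const_mul (16 / μ)).sub i1).sub i2).add i3) (OmegaR_cpt R).measurableSet eG
  have X1 := div_x hR cG1 fun y y0 y1 => by simp [hG1, hv, hw, hx R y il y0 y1, hx (-R) y ir y0 y1]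
  have X2 := div_x hR cS fun y y0 y1 => by simp [hS, hx R y il y0 y1, hx (-R) y ir y0 y1]
  refine M.trans ?_
  rw [integral_add' (((i0.const_mul (16 / μ)).sub i1).sub i2) i3, integral_sub' ((i0.const_mul (16 / μ)).sub i1) i2, integral_sub' (i0.const_mul (16 / μ)) i1, integral_const_mul, integral_const_mul, integral_const_mul, integral_const_mul,
    X1, X2]
  · have := div_y cG2 fun x x0 x1 => by
      have := (hy x 0 x0 x1 il)
      have := (hy x 1 x0 x1 ir)
      simp only [hG2, hv, hw, h0' x x0 x1, h1' x x0 x1, hy x 0 x0 x1 il, hy x 1 x0 x1 ir]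
      have m0 : 0 ≤ h 0 * (-k0 / μ) * u1 (x, 0) ^ 2 := mul_nonneg (mul_nonneg (hn _) (div_nonneg bL hμ.le)) (sq_nonneg _)
      have m1 : 0 ≤ h 1 * (-k1 / μ) * u1 (x, 1) ^ 2 := mul_nonneg (mul_nonneg (hn _) (div_nonneg bL hμ.le)) (sq_nonneg _)
      have e0 : h 0 * (-k0 / μ) * u1 (x, 0) ^ 2 = -(1 / μ * (p (x, 0) * (h 0 * 0)) - (-(k0 / μ) * u1 (x, 0) * (h1 0 * 0 + h 0 * u1 (x, 0)) + dd Ey u2 (x,0) * (h 0 * 0))) := by ring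
      have e1 : h 1 * (-k1 / μ) * u1 (x, 1) ^ 2 = (1 / μ * (p (x, 1) * (h 1 * 0)) - (k1 / μ * u1 (x, 1) * (h1 1 * 0 + h 1 * u1 (x, 1)) + dd Ey u2 (x,1) * (h 1 * 0))) := by ring
      linarith
    linarith

theorem sech_wt (t c : ℝ) : ∃ h h1 h2 : ℝ → ℝ, (∀ y, HasDerivAt h (h1 y) y) ∧ (∀ y, HasDerivAt h1 (h2 y) y) ∧ Continuous h2 ∧
    (∀ y, |h1 y| ≤ |t| * h y) ∧ (∀ y, |h2 y| ≤ t ^ 2 * h y) ∧ (∀ y, Real.exp (-|t * (y - c)|) ≤ h y) ∧ ∀ y, h y ≤ 2 * Real.exp (-|t * (y - c)|) := by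
  have P : ∀ y, 0 < Real.cosh (t * (y - c)) := fun y => Real.cosh_pos _
  have A : ∀ y, HasDerivAt (fun y => t * (y - c)) t y := fun y => by simpa using ((hasDerivAt_id y).sub_const c).const_mul t
  have sc : ∀ x : ℝ, |Real.sinh x| ≤ Real.cosh x := fun x => by
    rw [abs_le, Real.sinh_eq, Real.cosh_eq]; constructor <;> linarith [Real.exp_pos x, Real.exp_pos (-x)]
  have ce : ∀ x : ℝ, Real.cosh x = (Real.exp |x| + Real.exp (-|x|)) / 2 := fun x => by rw [← Real.cosh_abs, Real.cosh_eq]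
  refine ⟨fun y => (Real.cosh (t * (y - c)))⁻¹, fun y => -(Real.sinh (t * (y - c)) * t) / Real.cosh (t * (y - c)) ^ 2,
    fun y => t ^ 2 * ((2 * Real.sinh (t * (y - c)) ^ 2 - Real.cosh (t * (y - c)) ^ 2) / Real.cosh (t * (y - c)) ^ 3), fun y => ?_, fun y => ?_, ?_, fun y => ?_, fun y => ?_, fun y => ?_, fun y => ?_⟩
  · exact (A y).cosh.inv (P y).ne'
  · have := (((A y).sinh.mul_const t).neg).div ((A y).cosh.pow 2) (pow_ne_zero 2 (P y).ne')
    refine this.congr_deriv ?_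
    have := (P y).ne'
    field_simp; simp; ring
  · have : ∀ y, Real.cosh (t * (y - c)) ^ 3 ≠ 0 := fun y => pow_ne_zero 3 (P y).ne'
    fun_prop (disch := assumption)
  · rw [abs_div, abs_neg, abs_mul, abs_of_pos (pow_pos (P y) 2), div_le_iff₀ (pow_pos (P y) 2), mul_comm]
    have := sc (t * (y - c))
    have := P y
    have e : |t| * (Real.cosh (t * (y - c)))⁻¹ * Real.cosh (t * (y - c)) ^ 2 = |t| * Real.cosh (t * (y - c)) := by field_simp
    rw [e]; gcongr
  · rw [abs_mul, abs_of_nonneg (sq_nonneg t)]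
    refine mlL ?_ (sq_nonneg t)
    have := P y
    rw [abs_div, abs_of_pos (pow_pos (P y) 3), div_le_iff₀ (pow_pos (P y) 3)]
    have e : (Real.cosh (t * (y - c)))⁻¹ * Real.cosh (t * (y - c)) ^ 3 = Real.cosh (t * (y - c)) ^ 2 := by field_simp
    rw [e, abs_le]
    have := Real.cosh_sq (t * (y - c))
    constructor <;> linarith [sq_nonneg (Real.sinh (t * (y - c)))]
  · rw [Real.exp_neg]; refine inv_anti₀ (P y) ?_
    rw [ce]; linarith [Real.exp_le_exp.2 (neg_le_self (abs_nonneg (t * (y - c))))]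
  · rw [Real.exp_neg, inv_le_iff_one_le_mul₀ (P y), ce]
    have := Real.exp_pos |t * (y - c)|
    have := Real.exp_pos (-|t * (y - c)|)
    have e : 2 * (Real.exp |t * (y - c)|)⁻¹ * ((Real.exp |t * (y - c)| + Real.exp (-|t * (y - c)|)) / 2) = 1 + (Real.exp |t * (y - c)|)⁻¹ * Real.exp (-|t * (y - c)|) := by field_simp
    rw [e]; have : 0 < (Real.exp |t * (y - c)|)⁻¹ * Real.exp (-|t * (y - c)|) := bp
    linarith

/-- the exponential kernel -/
def kk (R c s : ℝ) : ℝ := Real.exp (-((64 * R)⁻¹ * |s - c|))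
def DD (R : ℝ) (u1 u2 : F2) (z : P2) : ℝ := |dd Ey (dd Ex u1) z| + |dd Ex u1 z| / R + (|dd Ey (dd Ex u2) z| + |dd Ex u2 z| / R)

theorem kk_pos (R c s : ℝ) : 0 < kk R c s := Real.exp_pos _
theorem kk_c (R c : ℝ) : Continuous (kk R c) := by unfold kk; fun_prop
theorem kk_tri {R : ℝ} (hR : 0 < R) (c s z : ℝ) : kk R c s * kk R s z ≤ kk R c z := by
  rw [kk, kk, kk, ← Real.exp_add, Real.exp_le_exp]
  have h := abs_sub_le z s c
  have : 0 < (64 * R)⁻¹ := bp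
  have := mlL h this.le
  linarith
theorem kk_1 {R c s : ℝ} (hR : 0 < R) (h : |s - c| ≤ R) : 1 ≤ 2 * kk R c s := by
  have : (64 * R)⁻¹ * |s - c| ≤ 1 / 64 := by
    calc _ ≤ (64 * R)⁻¹ * R := by gcongr
      _ = _ := by field_simp
  have := Real.add_one_le_exp (-((64 * R)⁻¹ * |s - c|))
  unfold kk; linarith

theorem DD_c (R : ℝ) {u1 u2 : F2} (c1 : ContDiff ℝ 2 u1) (c2 : ContDiff ℝ 2 u2) : Continuous (DD R u1 u2) := by
  have q1 := dd_cd (m := 1) Ex c1 bn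
  have q3 := dd_cd (m := 1) Ex c2 bn
  have := q1.continuous
  have := q3.continuous
  have := dd_cont Ey q1
  have := dd_cont Ey q3
  unfold DD; fun_prop

theorem psi_pt {R μ k0 k1 : ℝ} {u1 u2 ψ p f1 f2 : F2} (hμ : 0 < μ) (hk0 : k0 ≤ 0) (hk1 : k1 ≤ 0) (hR : 0 < R) (hR1 : R ≤ 1) (H : GS R μ k0 k1 u1 u2 ψ p f1 f2)
    {δ : ℝ} (hδ : 0 < δ) {x c : ℝ} (x0 : -R ≤ x) (x1 : x ≤ R) (c0 : 0 ≤ c) (c1 : c ≤ 1) :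
    |ψ (x, c)| ≤ (512 + 64 / μ) * R * ∫ z in OmegaR R, kk R c z.2 * (δ * DD R u1 u2 z + δ⁻¹ * (|f1 z| + |f2 z|)) := by
  have cD := DD_c R H.c1 H.c2
  have g1 := H.g1
  have g2 := H.g2
  have cu2 := H.c2.continuous
  have hk := kk_c R
  have mΩ := (OmegaR_cpt R).measurableSet
  have D0 : ∀ z, 0 ≤ DD R u1 u2 z := fun z => by unfold DD; positivity
  set T : ℝ → ℝ := fun y => ∫ z in OmegaR R, kk R y z.2 * DD R u1 u2 z with hT
  set S : ℝ := ∫ z in OmegaR R, kk R c z.2 * (|f1 z| + |f2 z|) with hS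
  have T0 : ∀ y, 0 ≤ T y := fun y => integral_nonneg fun z => mul_nonneg (kk_pos _ _ _).le (D0 z)
  have S0 : 0 ≤ S := integral_nonneg fun z => mul_nonneg (kk_pos _ _ _).le bp
  have hU : ∀ U, (U = u1 ∨ U = u2) → ∀ x y, -R ≤ x → x ≤ R → 0 ≤ y → y ≤ 1 → |U (x, y)| ≤ 2 * T y := fun U hU x y x0 x1 y0 y1 => by
    have cU : ContDiff ℝ 2 U := by rcases hU with rfl | rfl; exacts [H.c1, H.c2]
    have q := dd_cd (m := 1) Ex cU bn
    have qc := q.continuous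
    have qc' := dd_cont Ey q
    have hz : U (-R, y) = 0 := by
      have := H.hx (-R) y ir y0 y1
      rcases hU with rfl | rfl; exacts [this.1, this.2.1]
    refine (win2 q hR hR1 y0 y1 (w := fun s => 2 * kk R y s) bf (fun s => mul_nonneg zero_le_two (kk_pos _ _ _).le) (fun s hs => kk_1 hR hs) (cU.of_le one_le_two) (fun _ _ _ => rfl) hz x0 x1).trans ?_
    rw [hT, ← integral_const_mul]
    refine integral_mono (io_cpt bf) (io_cpt bf) fun z => ?_
    beta_reduce
    rw [mul_assoc]
    refine mlL (mlL ?_ (kk_pos _ _ _).le) zero_le_two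
    have n1 : 0 ≤ |dd Ey (dd Ex u1) z| + |dd Ex u1 z| / R := bp
    have n2 : 0 ≤ |dd Ey (dd Ex u2) z| + |dd Ex u2 z| / R := bp
    rcases hU with rfl | rfl <;> (unfold DD; linarith)
  have hψ : ∀ x y, -R ≤ x → x ≤ R → 0 ≤ y → y ≤ 1 → |ψ (x, y)| / R ≤ 4 * T y := fun x y x0 x1 y0 y1 => by
    have := (convex_Icc (-R) R).norm_image_sub_le_of_norm_hasDerivWithin_le (f := fun t => ψ (t, y)) (C := 2 * T y)
      (fun t ht => (pd1_hda (H.c3.differentiable bs) t y).hasDerivWithinAt) (fun t ht => by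
        rw [pd1_eq, (H.e (t, y) ⟨ht, y0, y1⟩).2.1, norm_neg]; exact hU u2 ir t y ht.1 ht.2 y0 y1) (x := -R) (y := x) ⟨le_rfl, by linarith⟩ ⟨x0, x1⟩
    beta_reduce at this
    rw [(H.hx (-R) y ir y0 y1).2.2, sub_zero, Real.norm_eq_abs, Real.norm_eq_abs, abs_of_nonneg (a := x - -R) bL] at this
    rw [div_le_iff₀ hR]
    have : 2 * T y * (x - -R) ≤ 2 * T y * (2 * R) := mlL bL (by linarith [T0 y])
    linarith
  obtain ⟨h, h1, h2, d1, d2, ch2, b1, b2, lo, up⟩ := sech_wt ((32 * R)⁻¹) c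
  have ch : Continuous h := continuous_iff_continuousAt.2 fun y => (d1 y).continuousAt
  have hn : ∀ y, 0 ≤ h y := fun y => (Real.exp_pos _).le.trans (lo y)
  have t0 : 0 < (32 * R)⁻¹ := bp
  have hk2 : ∀ y, Real.exp (-|(32 * R)⁻¹ * (y - c)|) = kk R c y * kk R c y := fun y => by
    rw [kk, ← Real.exp_add, abs_mul, abs_of_pos t0]; congr 1; field_simp; ring
  have E := energy hμ hk0 hk1 hR H d1 d2 ch2 hn (fun y => by
      rw [abs_mul, abs_of_pos hR]
      have := mlR (b1 y) hR.le
      rw [abs_of_pos t0] at this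
      refine this.trans (le_of_eq (by field_simp))) (fun y => by
      rw [abs_mul, abs_of_pos (pow_pos hR 2)]
      have := mlR (b2 y) (pow_pos hR 2).le
      refine this.trans ?_
      have e : ((32 * R)⁻¹) ^ 2 * h y * R ^ 2 = h y / 1024 := by rw [mul_inv]; field_simp; ring
      rw [e]; linarith [hn y])
  set EE := ∫ z in OmegaR R, h z.2 * (dd Ey u2 z ^ 2 + (u2 z / R) ^ 2) with hEE
  have cu1 := H.c1.continuous
  have cψ := H.c3.continuous
  have q4 := dd_cont Ey (H.c2.of_le one_le_two)
  have E2 : EE ≤ 256 / μ * (T c * S) := by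
    refine E.trans ?_
    have : ∫ z in OmegaR R, h z.2 * (W3 f1 f2 u1 u2 ψ R z) ≤ ∫ z in OmegaR R, 16 * T c * (kk R c z.2 * (|f1 z| + |f2 z|)) := by
      refine setIntegral_mono_on (io_cpt bf) (io_cpt bf) mΩ fun z hz => ?_
      have a1 := hU u1 il z.1 z.2 hz.1.1 hz.1.2 hz.2.1 hz.2.2
      have a2 := hU u2 ir z.1 z.2 hz.1.1 hz.1.2 hz.2.1 hz.2.2
      have a3 := hψ z.1 z.2 hz.1.1 hz.1.2 hz.2.1 hz.2.2
      have a4 : kk R c z.2 * T z.2 ≤ T c := by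
        rw [hT, ← integral_const_mul]
        refine integral_mono (io_cpt bf) (io_cpt bf) fun w => ?_
        beta_reduce
        rw [← mul_assoc]
        exact mlR (kk_tri hR _ _ _) (D0 w)
      have a5 := up z.2
      rw [hk2] at a5
      have k0 := kk_pos R c z.2
      have F0 : 0 ≤ |f1 z| + |f2 z| := bp
      calc _ ≤ (2 * (kk R c z.2 * kk R c z.2)) * ((|f1 z| + |f2 z|) * (8 * T z.2)) := by
            refine mul_le_mul a5 (mlL ?_ F0) bp bp
            linarith
        _ = 16 * (kk R c z.2 * (|f1 z| + |f2 z|)) * (kk R c z.2 * T z.2) := by ring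
        _ ≤ 16 * (kk R c z.2 * (|f1 z| + |f2 z|)) * T c := mlL a4 bp
        _ = _ := by ring
    rw [integral_const_mul] at this
    calc _ ≤ 16 / μ * (16 * T c * S) := mlL this bp
      _ = _ := by ring
  have hh : ∫ z in OmegaR R, h z.2 ≤ 256 * R ^ 2 := by
    calc _ ≤ ∫ z in OmegaR R, 2 * Real.exp (-((32 * R)⁻¹ * |z.2 - c|)) := integral_mono (io_cpt bf) (io_cpt bf) fun z => by
            have := up z.2
            rwa [abs_mul, abs_of_pos t0] at this
      _ ≤ 2 * (4 * R / (32 * R)⁻¹) := by rw [integral_const_mul]; exact mlL (ker_le t0 hR c) zero_le_two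
      _ = _ := by field_simp; norm_num
  have W : ∀ l : ℝ, 0 < l → |ψ (x, c)| ≤ 512 * R ^ 2 * l + EE / l := fun l hl => by
    have w1 : ∀ s, |s - c| ≤ R → 1 ≤ 2 * h s := fun s hs => by
      have := lo s
      have t : |(32 * R)⁻¹ * (s - c)| ≤ 1 / 32 := by
        rw [abs_mul, abs_of_pos t0]
        calc _ ≤ (32 * R)⁻¹ * R := by gcongr
          _ = _ := by field_simp
      have := Real.add_one_le_exp (-|(32 * R)⁻¹ * (s - c)|)
      linarith
    refine (win2 (H.c2.of_le one_le_two) hR hR1 c0 c1 (w := fun s => 2 * h s) bf (fun s => by linarith [hn s]) w1 (H.c3.of_le one_le_two)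
      (fun t t0 t1 => by rw [(H.e (t, c) ⟨⟨t0, t1⟩, c0, c1⟩).2.1, abs_neg]) (H.hx (-R) c ir c0 c1).2.2 x0 x1).trans ?_
    calc _ ≤ ∫ z in OmegaR R, ((2 * l) * h z.2 + l⁻¹ * (h z.2 * (dd Ey u2 z ^ 2 + (u2 z / R) ^ 2))) := by
          refine integral_mono (io_cpt bf) (io_cpt bf) fun z => ?_
          beta_reduce
          have y : ∀ a : ℝ, 2 * |a| ≤ l + l⁻¹ * a ^ 2 := fun a => by
            have : l + l⁻¹ * a ^ 2 - 2 * |a| = l⁻¹ * (l - |a|) ^ 2 := by rw [← sq_abs a]; field_simp; ring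
            have : 0 ≤ l⁻¹ * (l - |a|) ^ 2 := bp
            linarith
          have y1 := y (dd Ey u2 z)
          have y2 := y (u2 z / R)
          rw [abs_div, abs_of_pos hR] at y2
          have := mlL (add_le_add y1 y2) (hn z.2)
          linarith
      _ = (2 * l) * (∫ z in OmegaR R, h z.2) + l⁻¹ * EE := by
          rw [integral_add (io_cpt bf) (io_cpt bf), integral_const_mul, integral_const_mul]
      _ ≤ (2 * l) * (256 * R ^ 2) + l⁻¹ * EE := by gcongr
      _ = _ := by rw [div_eq_inv_mul]; ring
  have eM : ∫ z in OmegaR R, kk R c z.2 * (δ * DD R u1 u2 z + δ⁻¹ * (|f1 z| + |f2 z|)) = δ * T c + δ⁻¹ * S := by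
    rw [hT, hS, ← integral_const_mul, ← integral_const_mul, ← integral_add (io_cpt bf) (io_cpt bf)]
    congr 1; funext z; ring
  rw [eM]
  set M := δ * T c + δ⁻¹ * S with hM
  have M0 : 0 ≤ M := add_nonneg (mul_nonneg hδ.le (T0 c)) (mul_nonneg bp S0)
  have TS : T c * S ≤ M ^ 2 / 4 := by
    have : M ^ 2 / 4 - T c * S = (δ * T c - δ⁻¹ * S) ^ 2 / 4 := by rw [hM]; field_simp; ring
    have : 0 ≤ (δ * T c - δ⁻¹ * S) ^ 2 / 4 := bp
    linarith
  have K0 : 0 < (512 + 64 / μ) * R := bp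
  refine le_of_forall_pos_le_add fun κ hκ => ?_
  set κ' := κ / ((512 + 64 / μ) * R) with hκ'
  have κ0 : 0 < κ' := bp
  have N0 : 0 < M + κ' := bL
  have EN : EE ≤ 64 / μ * (M + κ') ^ 2 := by
    have : M ^ 2 ≤ (M + κ') ^ 2 := pow_le_pow_left₀ M0 bL 2
    calc _ ≤ 256 / μ * ((M + κ') ^ 2 / 4) := E2.trans (mlL bL bp)
      _ = _ := by ring
  calc _ ≤ 512 * R ^ 2 * ((M + κ') / R) + EE / ((M + κ') / R) := W _ bp
    _ ≤ 512 * R ^ 2 * ((M + κ') / R) + (64 / μ * (M + κ') ^ 2) / ((M + κ') / R) := by gcongr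
    _ = (512 + 64 / μ) * R * M + (512 + 64 / μ) * R * κ' := by field_simp
    _ = _ := by rw [hκ']; field_simp

theorem psi_lq {a q : ℝ} (hpq : a.HolderConjugate q) {R μ k0 k1 : ℝ} {u1 u2 ψ p f1 f2 : F2} (hμ : 0 < μ) (hk0 : k0 ≤ 0) (hk1 : k1 ≤ 0) (hR : 0 < R) (hR1 : R ≤ 1)
    (H : GS R μ k0 k1 u1 u2 ψ p f1 f2) {δ : ℝ} (hδ : 0 < δ) :
    nO q R ψ ≤ (512 + 64 / μ) * 256 * R ^ 3 * nO q R (fun z => δ * DD R u1 u2 z + δ⁻¹ * (|f1 z| + |f2 z|)) := by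
  have hq : 1 < q := hpq.symm.lt
  have cD := DD_c R H.c1 H.c2
  have g1 := H.g1
  have g2 := H.g2
  have t0 : 0 < (64 * R)⁻¹ := bp
  set g : F2 := fun z => δ * DD R u1 u2 z + δ⁻¹ * (|f1 z| + |f2 z|) with hg
  have cg : Continuous g := bf
  have g0 : ∀ z, |g z| = g z := fun z => abs_of_nonneg (by simp only [hg, DD]; positivity)
  have K := kop hpq t0 hR cg
  have c : Continuous (fun x : P2 => ∫ z in OmegaR R, Real.exp (-((64 * R)⁻¹ * |z.2 - x.2|)) * |g z|) :=
    continuous_parametric_integral_of_continuous (by unfold Function.uncurry; fun_prop) (OmegaR_cpt R)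
  have K0 : 0 < (512 + 64 / μ) * R := bp
  calc _ ≤ nO q R (fun x => ((512 + 64 / μ) * R) * ∫ z in OmegaR R, Real.exp (-((64 * R)⁻¹ * |z.2 - x.2|)) * |g z|) := by
        refine lq_mono hq (OmegaR_cpt R).measurableSet (ML_cpt (OmegaR_cpt R) (c.const_mul _).continuousOn) fun x hx => ?_
        refine le_trans ?_ (le_abs_self _)
        simp_rw [g0]
        exact psi_pt hμ hk0 hk1 hR hR1 H hδ hx.1.1 hx.1.2 hx.2.1 hx.2.2
    _ ≤ ((512 + 64 / μ) * R) * (4 * R / (64 * R)⁻¹ * nO q R g) := by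
        rw [lq_cmul hq, abs_of_pos K0]; exact mlL K K0.le
    _ = _ := by field_simp; ring

theorem eqd {R : ℝ} (hR : 0 < R) {f g : F2} (hf : ContDiff ℝ 1 f) (hg : ContDiff ℝ 1 g) (h : ∀ x ∈ OmegaR R, f x = g x) (e : P2) : ∀ x ∈ OmegaR R, dd e f x = dd e g x := by
  have o : IsOpen (Ioo (-R) R ×ˢ Ioo R0 1) := isOpen_Ioo.prod isOpen_Ioo
  have := Set.EqOn.closure (f := dd e f) (g := dd e g) (dd_loc o (fun x hx => h x ⟨Ioo_subset_Icc_self hx.1, Ioo_subset_Icc_self hx.2⟩) e) (dd_cont e hf) (dd_cont e hg)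
  rwa [closure_prod_eq, closure_Ioo bL, closure_Ioo bn] at this

theorem absorb {C0 K : ℝ} (h0 : 0 < C0) (hK : 0 < K) : ∃ θ θ' δ C : ℝ, 0 < θ ∧ θ ≤ 1/2 ∧ 0 < θ' ∧ θ' ≤ 1/2 ∧ 0 < δ ∧ 0 < C ∧ ∀ A b c d F : ℝ, 0 ≤ A → 0 ≤ b → 0 ≤ c → 0 ≤ d → 0 ≤ F →
    A ≤ C0 * (F + b + c + d) → b ≤ 8 * θ * A + 8 / θ * c → c ≤ 2 * θ' * b + 8 / θ' * d → d ≤ K * (δ * (2 * A + b) + δ⁻¹ * F) → A ≤ C * F := by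
  obtain ⟨θ, hθ, hθ1, hθ2⟩ : ∃ θ : ℝ, 0 < θ ∧ θ ≤ 1/2 ∧ 32 * C0 * θ ≤ 1/4 := by
    refine ⟨min (1/2) (1 / (128 * C0)), by positivity, min_le_left _ _, ?_⟩
    calc _ ≤ 32 * C0 * (1 / (128 * C0)) := by gcongr; exact min_le_right _ _
      _ ≤ _ := by field_simp; norm_num
  obtain ⟨θ', hθ', ht1, ht2⟩ : ∃ θ' : ℝ, 0 < θ' ∧ θ' ≤ 1/2 ∧ 8 / θ * (2 * θ') ≤ 1/2 := by
    refine ⟨θ / 32, by positivity, by linarith, ?_⟩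
    have : 8 / θ * (2 * (θ / 32)) = 1/2 := by field_simp; norm_num
    exact this.le
  set C2 := 128 / (θ * θ') with hC2
  set C1 := 2 * C0 * C2 + C0 * (1 + 8 / θ') with hC1
  have C20 : 0 < C2 := bp
  have C10 : 0 < C1 := bp
  obtain ⟨δ, hδ, d1, d2⟩ : ∃ δ : ℝ, 0 < δ ∧ K * δ * C2 ≤ 1/2 ∧ C1 * (20 * K * δ) ≤ 1/4 := by
    refine ⟨min (1 / (2 * K * C2)) (1 / (80 * C1 * K)), by positivity, ?_, ?_⟩
    · calc _ ≤ K * (1 / (2 * K * C2)) * C2 := by gcongr; exact min_le_left _ _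
        _ ≤ _ := by field_simp; norm_num
    · calc _ ≤ C1 * (20 * K * (1 / (80 * C1 * K))) := by gcongr; exact min_le_right _ _
        _ ≤ _ := by field_simp; norm_num
  refine ⟨θ, θ', δ, 2 * (C0 + C1 * (2 * K * δ⁻¹)), hθ, hθ1, hθ', ht1, hδ, by positivity, fun A b c d F A0 b0 c0 d0 F0 hA hb hc hd => ?_⟩
  have b1 : b ≤ 16 * θ * A + C2 * d := by
    have s1 : 8 / θ * c ≤ 8 / θ * (2 * θ' * b + 8 / θ' * d) := mlL hc bp
    have s2 : 8 / θ * (2 * θ' * b + 8 / θ' * d) = 8 / θ * (2 * θ') * b + C2 / 2 * d := by rw [hC2]; field_simp; ring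
    have s3 := mlR ht2 b0
    linarith
  have c1 : c ≤ b + 8 / θ' * d := by
    have : 2 * θ' * b ≤ 1 * b := mlR bL b0
    linarith
  have A1 : A ≤ C0 * F + 1/4 * A + C1 * d := by
    have s1 : C0 * (F + b + c + d) ≤ C0 * (F + 2 * (16 * θ * A + C2 * d) + (1 + 8 / θ') * d) := mlL bL h0.le
    have s2 : C0 * (F + 2 * (16 * θ * A + C2 * d) + (1 + 8 / θ') * d) = C0 * F + 32 * C0 * θ * A + C1 * d := by rw [hC1]; ring
    have := mlR hθ2 A0
    linarith
  have dd1 : d ≤ 20 * K * δ * A + 2 * K * δ⁻¹ * F := by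
    have s1 : b ≤ 8 * A + C2 * d := by
      have := mlR hθ1 A0; linarith
    have s2 : K * (δ * (2 * A + b) + δ⁻¹ * F) ≤ K * (δ * (10 * A + C2 * d) + δ⁻¹ * F) := mlL (add_le_add_left (mlL bL hδ.le) _) hK.le
    have s3 := mlR d1 d0
    linarith
  have s1 := mlL dd1 C10.le
  have s2 := mlR d2 A0
  linarith

theorem zz_lq {q : ℝ} (hq : 1 < q) {R μ k0 k1 : ℝ} {u1 u2 ψ p f1 f2 : F2} (H : GS R μ k0 k1 u1 u2 ψ p f1 f2) {r : ℝ} (hr : 0 < r) :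
    nO q R (zz r u1 u2 ψ f1 f2) ≤ (nO q R f1 + nO q R f2) +
      r * (nO q R (dd Ex u1) + nO q R (dd Ey u1) + nO q R (dd Ex u2) + nO q R (dd Ey u2)) +
      r ^ 2 * (nO q R u1 + nO q R u2) + r ^ 3 * nO q R ψ := by
  have g1 := H.g1
  have g2 := H.g2
  have g3 := H.c1.continuous
  have g4 := H.c2.continuous
  have g5 := H.c3.continuous
  have g6 := dd_cont Ex (H.c1.of_le one_le_two)
  have g7 := dd_cont Ey (H.c1.of_le one_le_two)
  have g8 := dd_cont Ex (H.c2.of_le one_le_two)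
  have g9 := dd_cont Ey (H.c2.of_le one_le_two)
  have add : ∀ {f g : F2}, Continuous f → Continuous g → nO q R (fun x => f x + g x) ≤ nO q R f + nO q R g := fun hf hg =>
    lq_add hq (ML_cpt (OmegaR_cpt R) hf.continuousOn) (ML_cpt (OmegaR_cpt R) hg.continuousOn)
  have ab : ∀ f : F2, nO q R (fun x => |f x|) = nO q R f := fun f => by simp [lqNorm]
  have c0 := add (f := fun x => |f1 x|) (g := fun x => |f2 x|) bf bf
  have c1 := add (f := fun x => |u1 x|) (g := fun x => |u2 x|) bf bf
  have c2 := add (f := fun x => |dd Ex u1 x|) (g := fun x => |dd Ey u1 x|) bf bf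
  have c3 := add (f := fun x => |dd Ex u1 x| + |dd Ey u1 x|) (g := fun x => |dd Ex u2 x|) bf bf
  have c4 := add (f := fun x => |dd Ex u1 x| + |dd Ey u1 x| + |dd Ex u2 x|) (g := fun x => |dd Ey u2 x|) bf bf
  have m1 := add (f := fun x => |f1 x| + |f2 x|) (g := fun x => r * (|dd Ex u1 x| + |dd Ey u1 x| + |dd Ex u2 x| + |dd Ey u2 x|)) bf bf
  have m2 := add (f := fun x => |f1 x| + |f2 x| + r * (|dd Ex u1 x| + |dd Ey u1 x| + |dd Ex u2 x| + |dd Ey u2 x|)) (g := fun x => r ^ 2 * (|u1 x| + |u2 x|)) bf bf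
  have m3 := add (f := fun x => |f1 x| + |f2 x| + r * (|dd Ex u1 x| + |dd Ey u1 x| + |dd Ex u2 x| + |dd Ey u2 x|) + r ^ 2 * (|u1 x| + |u2 x|)) (g := fun x => r ^ 3 * |ψ x|) bf bf
  rw [lq_cmul hq, abs_of_pos bp] at m1 m2 m3
  simp only [ab] at c0 c1 c2 c3 c4 m1 m2 m3
  have n1 := mlL (c4.trans (add_le_add_left (c3.trans (add_le_add_left c2 _)) _)) hr.le
  have n2 := mlL c1 (pow_pos hr 2).le
  have e : zz r u1 u2 ψ f1 f2 = fun x => |f1 x| + |f2 x| + r * (|dd Ex u1 x| + |dd Ey u1 x| + |dd Ex u2 x| + |dd Ey u2 x|) + r ^ 2 * (|u1 x| + |u2 x|) + r ^ 3 * |ψ x| := rfl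
  rw [e]; linarith

theorem small_est {a q : ℝ} (hpq : a.HolderConjugate q) {μ k0 k1 : ℝ} (hμ : 0 < μ) (hk0 : k0 ≤ 0) (hk1 : k1 ≤ 0) :
    ∃ C, 0 < C ∧ ∀ R, 0 < R → R ≤ 1 → ∀ u1 u2 ψ p f1 f2, GS R μ k0 k1 u1 u2 ψ p f1 f2 → ∀ U e e', (U = u1 ∨ U = u2) → unitv e → unitv e' →
      nO q R (dd e (dd e' U)) ≤ C * (nO q R f1 + nO q R f2) := by
  have hq : 1 < q := hpq.symm.lt
  obtain ⟨C0, h0, G⟩ := global_est hpq hμ k0 k1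
  have hK : 0 < (512 + 64 / μ) * 256 := bp
  obtain ⟨θ, θ', δ, C, hθ, hθ1, hθ', ht1, hδ, hC, B⟩ := absorb h0 hK
  refine ⟨C, hC, fun R hR hR1 u1 u2 ψ p f1 f2 H U e e' hU he he' => ?_⟩
  have hr : 0 < R⁻¹ := bp
  set n := nO q R with hn
  have n0 : ∀ f, 0 ≤ n f := lq_nonneg q (OmegaR R)
  have Z := zz_lq hq H hr
  rw [← hn] at Z
  set A := C0 * n (zz R⁻¹ u1 u2 ψ f1 f2) with hA
  have GA : ∀ U e e', (U = u1 ∨ U = u2) → unitv e → unitv e' → n (dd e (dd e' U)) ≤ A := fun U e e' =>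
    G R R⁻¹ hR (by rw [mul_inv]; linarith [hr]) ((one_le_inv₀ hR).2 hR1) u1 u2 ψ p f1 f2 H U e e'
  have ex : unitv Ex := Or.inl rfl
  have ey : unitv Ey := Or.inr rfl
  refine (GA U e e' hU he he').trans (B A (R⁻¹ * (n (dd Ex u1) + n (dd Ey u1) + n (dd Ex u2) + n (dd Ey u2))) (R⁻¹ ^ 2 * (n u1 + n u2)) (R⁻¹ ^ 3 * n ψ) (n f1 + n f2)
    (mul_nonneg h0.le (n0 _)) ?_ ?_ ?_ ?_ (mlL Z h0.le) ?_ ?_ ?_)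
  · have := n0 (dd Ex u1); have := n0 (dd Ey u1); have := n0 (dd Ex u2); have := n0 (dd Ey u2); positivity
  · have := n0 u1; have := n0 u2; positivity
  · have := n0 ψ; positivity
  · have := n0 f1; have := n0 f2; positivity
  · have I : ∀ U e, (U = u1 ∨ U = u2) → unitv e → R⁻¹ * n (dd e U) ≤ 4 / θ * (R⁻¹ ^ 2 * n U) + 2 * θ * A := fun U e hU he => by
      have cU : ContDiff ℝ 2 U := by rcases hU with rfl | rfl; exacts [H.c1, H.c2]
      have := interp hq (h := θ * R) (R := R) bp (mul_le_of_le_one_left hR.le bL) ((mul_le_of_le_one_right hθ.le hR1).trans hθ1) he cU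
      rw [← hn] at this
      have g := GA U e e hU he he
      calc _ ≤ R⁻¹ * (4 / (θ * R) * n U + 2 * (θ * R) * A) := by gcongr; exact this.trans (by gcongr)
        _ = _ := by field_simp
    have := I u1 _ il ex
    have := I u1 _ il ey
    have := I u2 _ ir ex
    have := I u2 _ ir ey
    have e8 : 8 / θ * (R⁻¹ ^ 2 * (n u1 + n u2)) = 2 * (4 / θ * (R⁻¹ ^ 2 * n u1)) + 2 * (4 / θ * (R⁻¹ ^ 2 * n u2)) := by ring
    linarith
  · have cg : ∀ {f g : F2}, Continuous f → Continuous g → (∀ x ∈ OmegaR R, |f x| = |g x|) → n f = n g := fun hf hg h =>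
      le_antisymm (lq_mono hq (OmegaR_cpt R).measurableSet (ML_cpt (OmegaR_cpt R) hg.continuousOn) fun x hx => (h x hx).le)
        (lq_mono hq (OmegaR_cpt R).measurableSet (ML_cpt (OmegaR_cpt R) hf.continuousOn) fun x hx => (h x hx).ge)
    have I : ∀ U e (s : ℝ), (U = u1 ∨ U = u2) → unitv e → |s| = 1 → (∀ x ∈ OmegaR R, dd e ψ x = s * U x) → R⁻¹ ^ 2 * n U ≤ 4 / θ' * (R⁻¹ ^ 3 * n ψ) + 2 * θ' * (R⁻¹ * n (dd e U)) := fun U e s hU he hs h => by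
      have cU : ContDiff ℝ 2 U := by rcases hU with rfl | rfl; exacts [H.c1, H.c2]
      have cψ := dd_cd (m := 1) e H.c3 bn
      have := interp hq (h := θ' * R) (R := R) bp (mul_le_of_le_one_left hR.le bL) ((mul_le_of_le_one_right hθ'.le hR1).trans ht1) he H.c3
      rw [← hn, cg (f := dd e ψ) (g := U) cψ.continuous cU.continuous fun x hx => by rw [h x hx, abs_mul, hs, one_mul],
        cg (f := dd e (dd e ψ)) (g := dd e U) (dd_cont e cψ) (dd_cont e (cU.of_le one_le_two)) fun x hx => by
          rw [eqd hR cψ (contDiff_const.mul (cU.of_le one_le_two)) h e x hx, dd_cmul (cU.differentiable bs), abs_mul, hs, one_mul]] at this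
      calc _ ≤ R⁻¹ ^ 2 * (4 / (θ' * R) * n ψ + 2 * (θ' * R) * n (dd e U)) := by gcongr
        _ = _ := by field_simp
    have i1 := I u1 Ey 1 il ey bs fun x hx => by rw [(H.e x hx).1, one_mul]
    have i2 := I u2 Ex (-1) ir ex bs fun x hx => by rw [(H.e x hx).2.1]; ring
    have j1 : 0 ≤ 2 * θ' * (R⁻¹ * n (dd Ex u1)) := by have := n0 (dd Ex u1); positivity
    have j2 : 0 ≤ 2 * θ' * (R⁻¹ * n (dd Ey u2)) := by have := n0 (dd Ey u2); positivity
    have e8 : 8 / θ' * (R⁻¹ ^ 3 * n ψ) = 2 * (4 / θ' * (R⁻¹ ^ 3 * n ψ)) := by ring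
    linarith
  · have P := psi_lq hpq hμ hk0 hk1 hR hR1 H hδ
    rw [← hn] at P
    have g1 := H.g1
    have g2 := H.g2
    have q1 := dd_cd (m := 1) Ex H.c1 bn
    have q3 := dd_cd (m := 1) Ex H.c2 bn
    have g3 := q1.continuous
    have g4 := q3.continuous
    have g5 := dd_cont Ey q1
    have g6 := dd_cont Ey q3
    have add : ∀ {f g : F2}, Continuous f → Continuous g → n (fun x => f x + g x) ≤ n f + n g := fun hf hg =>
      lq_add hq (ML_cpt (OmegaR_cpt R) hf.continuousOn) (ML_cpt (OmegaR_cpt R) hg.continuousOn)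
    have ab : ∀ f : F2, n (fun x => |f x|) = n f := fun f => by simp [hn, lqNorm]
    have c := DD_c R H.c1 H.c2
    have m1 := add (f := fun z => δ * DD R u1 u2 z) (g := fun z => δ⁻¹ * (|f1 z| + |f2 z|)) bf bf
    have m2 := add (f := fun x => |f1 x|) (g := fun x => |f2 x|) bf bf
    have m3 := add (f := fun z => |dd Ey (dd Ex u1) z| + |dd Ex u1 z| / R) (g := fun z => |dd Ey (dd Ex u2) z| + |dd Ex u2 z| / R) bf bf
    have m4 := add (f := fun z => |dd Ey (dd Ex u1) z|) (g := fun z => |dd Ex u1 z| / R) bf bf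
    have m5 := add (f := fun z => |dd Ey (dd Ex u2) z|) (g := fun z => |dd Ex u2 z| / R) bf bf
    have dv : ∀ f : F2, n (fun x => |f x| / R) = R⁻¹ * n f := fun f => by
      simp_rw [div_eq_inv_mul]; rw [hn, lq_cmul hq, abs_of_pos hr, ← hn, ab]
    have cm : ∀ c : ℝ, 0 < c → ∀ f : F2, n (fun x => c * f x) = c * n f := fun c hc f => by rw [hn, lq_cmul hq, abs_of_pos hc]
    simp only [ab, dv] at m2 m3 m4 m5
    rw [cm δ hδ, cm δ⁻¹ bp] at m1
    have a1 := GA u1 _ _ il ey ex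
    have a2 := GA u2 _ _ ir ey ex
    have eD : n (DD R u1 u2) ≤ 2 * A + R⁻¹ * (n (dd Ex u1) + n (dd Ey u1) + n (dd Ex u2) + n (dd Ey u2)) := by
      have j1 := mul_nonneg hr.le (n0 (dd Ey u1))
      have j2 := mul_nonneg hr.le (n0 (dd Ey u2))
      have : n (DD R u1 u2) ≤ _ := m3
      linarith
    calc _ ≤ R⁻¹ ^ 3 * ((512 + 64 / μ) * 256 * R ^ 3 * (δ * n (DD R u1 u2) + δ⁻¹ * n (fun z => |f1 z| + |f2 z|))) := by gcongr; exact P.trans (by gcongr)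
      _ = (512 + 64 / μ) * 256 * (δ * n (DD R u1 u2) + δ⁻¹ * n (fun z => |f1 z| + |f2 z|)) := by field_simp
      _ ≤ _ := by gcongr

def Jt (g : F2) (z : P2) : ℝ := ∫ s in R0..z.2, g (z.1, s)

theorem Jt_cont {g : F2} (hg : Continuous g) : Continuous (Jt g) :=
  intervalIntegral.continuous_parametric_intervalIntegral_of_continuous (f := fun (z : P2) s => g (z.1, s)) (by unfold Function.uncurry; fun_prop) continuous_snd

theorem Jt_x {g : F2} (hg : ContDiff ℝ 1 g) (x y : ℝ) : HasDerivAt (fun t => Jt g (t, y)) (Jt (dd Ex g) (x, y)) x := by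
  have c := dd_cont Ex hg
  have cg := hg.continuous
  obtain ⟨C, hC⟩ := ((isCompact_closedBall x 1).prod (isCompact_uIcc (a := 0) (b := y))).exists_bound_of_continuousOn c.continuousOn
  refine (intervalIntegral.hasDerivAt_integral_of_dominated_loc_of_deriv_le (F := fun t s => g (t, s)) (F' := fun t s => dd Ex g (t, s)) (bound := fun _ => C)
    (Metric.closedBall_mem_nhds x one_pos) (Ef fun t => Continuous.aestronglyMeasurable bf) (Continuous.intervalIntegrable bf _ _)
    (Continuous.aestronglyMeasurable bf) (ae_of_all _ fun s hs t ht => hC (t, s) ⟨ht, uIoc_subset_uIcc hs⟩) bs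
    (ae_of_all _ fun s _ t _ => pd1_hda (hg.differentiable bs) t s)).2

theorem Jt_fd {g : F2} (hg : ContDiff ℝ 1 g) (z : P2) :
    HasFDerivAt (Jt g) (Jt (dd Ex g) z • ContinuousLinearMap.fst ℝ ℝ ℝ + g z • ContinuousLinearMap.snd ℝ ℝ ℝ) z := by
  have c := Jt_cont (dd_cont Ex hg)
  have cg := hg.continuous
  have := (hasStrictFDerivAt_uncurry_coprod (u := z) (f := fun x y => Jt g (x, y)) (f₁ := fun x y => Jt (dd Ex g) (x, y) • ContinuousLinearMap.id ℝ ℝ)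
    (f₂ := fun x y => g (x, y) • ContinuousLinearMap.id ℝ ℝ)
    (Ef fun v => (Jt_x hg v.1 v.2).hasFDerivAt.congr_fderiv (by ext; simp only [ContinuousLinearMap.toSpanSingleton_apply, one_smul]; exact (mul_one _).symm))
    (Ef fun v => (intervalIntegral.integral_hasDerivAt_right (Continuous.intervalIntegrable bf _ _)
      (Continuous.stronglyMeasurableAtFilter bf _ _) (Continuous.continuousAt bf) :
        HasDerivAt (fun t => ∫ s in R0..t, g (v.1, s)) (g (v.1, v.2)) v.2).hasFDerivAt.congr_fderiv (by ext; simp only [ContinuousLinearMap.toSpanSingleton_apply, one_smul]; exact (mul_one _).symm))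
    (c.smul continuous_const).continuousAt (cg.smul continuous_const).continuousAt).hasFDerivAt
  have h2 : HasFDerivAt (Jt g) ((Jt (dd Ex g) z • ContinuousLinearMap.id ℝ ℝ).coprod (g z • ContinuousLinearMap.id ℝ ℝ)) z := this
  exact h2.congr_fderiv (by ext <;> simp)

theorem Jt_dd {g : F2} (hg : ContDiff ℝ 1 g) (e : P2) (z : P2) : dd e (Jt g) z = Jt (dd Ex g) z * e.1 + g z * e.2 := by
  rw [dd, (Jt_fd hg z).fderiv]; simp

theorem Jt_1 {g : F2} (hg : ContDiff ℝ 1 g) : ContDiff ℝ 1 (Jt g) := by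
  have c := Jt_cont (dd_cont Ex hg)
  have cg := hg.continuous
  refine contDiff_one_iff_fderiv.2 ⟨fun z => (Jt_fd hg z).differentiableAt, ?_⟩
  rw [funext fun z => (Jt_fd hg z).fderiv]
  fun_prop

theorem Jt_2 {g : F2} (hg : ContDiff ℝ 2 g) : ContDiff ℝ 2 (Jt g) := by
  have g1 := hg.of_le one_le_two
  have c := Jt_1 (dd_cd (m := 1) Ex hg bn)
  refine (contDiff_succ_iff_fderiv (n := 1)).2 ⟨fun z => (Jt_fd g1 z).differentiableAt, by simp, ?_⟩
  rw [funext fun z => (Jt_fd g1 z).fderiv]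
  fun_prop

theorem mkGS {R μ k0 k1 : ℝ} (hR : 0 < R) {u1 u2 p f1 f2 : F2} (g1 : Continuous f1) (g2 : Continuous f2) (c1 : ContDiff ℝ 2 u1) (c2 : ContDiff ℝ 2 u2) (cp : ContDiff ℝ 1 p)
    (hs : ∀ x ∈ OmegaR R, -μ * (pd1 (pd1 u1) x + pd2 (pd2 u1) x) + pd1 p x = f1 x ∧ -μ * (pd1 (pd1 u2) x + pd2 (pd2 u2) x) + pd2 p x = f2 x)
    (hd : ∀ x ∈ OmegaR R, pd1 u1 x + pd2 u2 x = 0)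
    (hl : ∀ y ∈ Icc (0 : ℝ) 1, u1 (-R, y) = 0 ∧ u1 (R, y) = 0 ∧ u2 (-R, y) = 0 ∧ u2 (R, y) = 0)
    (hn : ∀ x ∈ Icc (-R) R, u2 (x, 0) = 0 ∧ u2 (x, 1) = 0 ∧ pd2 u1 (x, 1) = (k1 / μ) * u1 (x, 1) ∧ pd2 u1 (x, 0) = -(k0 / μ) * u1 (x, 0)) :
    GS R μ k0 k1 u1 u2 (Jt u1) p f1 f2 := by
  have d1 := c1.of_le one_le_two
  have d2 := c2.of_le one_le_two
  have ex : ∀ x ∈ OmegaR R, dd Ex (Jt u1) x = - u2 x := fun z hz => by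
    obtain ⟨x, y⟩ := z
    have : Jt (dd Ex u1) (x, y) = ∫ s in R0..y, - pd2 u2 (x, s) := intervalIntegral.integral_congr fun s hs => by
      rw [uIcc_of_le hz.2.1] at hs
      exact eq_neg_of_add_eq_zero_left (hd (x, s) ⟨hz.1, hs.1, hs.2.trans hz.2.2⟩)
    rw [Jt_dd d1, this, intervalIntegral.integral_neg, intervalIntegral.integral_eq_sub_of_hasDerivAt (fun t _ => pd2_hda (d2.differentiable bs) x t) (((dd_cont Ey d2).comp bf).intervalIntegrable _ _),
      (hn x hz.1).1]
    simp
  have s0 : ∀ s y, (s = R ∨ s = -R) → 0 ≤ y → y ≤ 1 → Jt u1 (s, y) = 0 := fun s y hs y0 y1 => by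
    refine (intervalIntegral.integral_congr (g := fun _ => R0) fun t ht => ?_).trans bs
    rw [uIcc_of_le y0] at ht
    have := hl t ⟨ht.1, ht.2.trans y1⟩
    rcases hs with rfl | rfl
    exacts [this.2.1, this.1]
  refine ⟨c1, c2, Jt_2 c1, cp, g1, g2, fun x hx => ⟨by rw [Jt_dd d1]; simp, ex x hx, hd x hx, (hs x hx).1, (hs x hx).2⟩, fun s y h y0 y1 => ⟨?_, ?_, s0 s y h y0 y1⟩,
    fun x y x0 x1 h => ⟨?_, ?_⟩, fun x x0 x1 => (hn x ⟨x0, x1⟩).2.2.2, fun x x0 x1 => (hn x ⟨x0, x1⟩).2.2.1⟩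
  · have := hl y ⟨y0, y1⟩; rcases h with rfl | rfl; exacts [this.2.1, this.1]
  · have := hl y ⟨y0, y1⟩; rcases h with rfl | rfl; exacts [this.2.2.2, this.2.2.1]
  · have := hn x ⟨x0, x1⟩; rcases h with rfl | rfl; exacts [this.1, this.2.1]
  · rcases h with rfl | rfl
    · simp [Jt]
    · have h := (Jt_2 c1).of_le one_le_two
      have := intervalIntegral.integral_eq_sub_of_hasDerivAt (a := -R) (b := x) (fun t _ => pd1_hda (h.differentiable bs) t 1) (((dd_cont Ex h).comp bf).intervalIntegrable _ _)
      rw [s0 (-R) 1 ir bn le_rfl, sub_zero] at this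
      rw [← this]
      refine (intervalIntegral.integral_congr (g := fun _ => R0) fun t ht => ?_).trans bs
      rw [uIcc_of_le x0] at ht
      have hm : t ∈ Icc (-R) R := ⟨ht.1, ht.2.trans x1⟩
      rw [pd1_eq, ex (t, 1) ⟨hm, by norm_num, le_rfl⟩, (hn t hm).2.1]; simp

theorem Jt_lq {q : ℝ} (hq : 1 < q) {R : ℝ} {u : F2} (hu : Continuous u) : nO q R (Jt u) ≤ nO q R u := by
  refine lq_le hq (lq_nonneg _ _ _) ?_
  rw [lq_pow hq]
  have q0 : 0 ≤ q := bL
  have ca : ∀ {f : F2}, Continuous f → Continuous fun z => |f z| ^ q := fun hf => hf.abs.rpow_const fun _ => Or.inr q0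
  have i : IntegrableOn (fun z => |u z| ^ q) (OmegaR R) (volume.prod volume) := io_cpt (ca hu)
  have j : IntegrableOn (fun z => |Jt u z| ^ q) (OmegaR R) (volume.prod volume) := io_cpt (ca (Jt_cont hu))
  rw [show (volume : Measure (ℝ × ℝ)) = volume.prod volume from rfl, OmegaR, setIntegral_prod _ i, setIntegral_prod _ j]
  have ii : ∀ {f : F2}, Continuous f → IntegrableOn (fun x => ∫ y in Icc R0 1, f (x, y)) (Icc (-R) R) := fun hf => by
    refine Continuous.integrableOn_Icc ?_
    exact continuous_parametric_integral_of_continuous (by unfold Function.uncurry; fun_prop) isCompact_Icc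
  refine setIntegral_mono_on (ii (ca (Jt_cont hu))) (ii (ca hu)) measurableSet_Icc fun x hx => ?_
  have cx : Continuous fun y => u (x, y) := bf
  have cJ := ca (Jt_cont hu)
  calc _ ≤ ∫ y in Icc R0 1, (∫ s in Icc R0 1, |u (x, s)| ^ q) := by
        refine setIntegral_mono_on (Continuous.integrableOn_Icc (cJ.comp (f := fun y => (x, y)) bf)) bs measurableSet_Icc fun y hy => ?_
        have h1 : |Jt u (x, y)| ≤ ∫ s in Ioc R0 1, |u (x, s)| := by
          refine (intervalIntegral.norm_integral_le_integral_norm_uIoc (f := fun s => u (x, s)) (a := 0) (b := y) (μ := volume)).trans ?_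
          rw [uIoc_of_le hy.1]
          exact setIntegral_mono_set (cx.abs.integrableOn_Ioc) (ae_of_all _ fun x => abs_nonneg _) (ae_of_all _ (Ioc_subset_Ioc le_rfl hy.2))
        have h2 := jens hq cx one_pos
        rw [Real.one_rpow, one_mul, ← integral_Icc_eq_integral_Ioc (f := fun s => |u (x, s)| ^ q)] at h2
        exact (Real.rpow_le_rpow (abs_nonneg _) h1 q0).trans h2
    _ = _ := bs

theorem root_ge {q a S : ℝ} (hq : 1 < q) (ha : 0 ≤ a) (h : a ^ q ≤ S) : a ≤ S ^ (1 / q) := by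
  have := Real.rpow_le_rpow bp h (z := 1 / q) bp
  rwa [← Real.rpow_mul ha, mul_one_div_cancel bL, Real.rpow_one] at this

theorem root_le {q M S : ℝ} (hq : 1 < q) (hM : 0 ≤ M) (h0 : 0 ≤ S) (h : S ≤ 8 * M ^ q) : S ^ (1 / q) ≤ 8 * M := by
  have : S ≤ (8 * M) ^ q := by
    rw [Real.mul_rpow bn hM]
    have : (8:ℝ) ≤ 8 ^ q := Real.self_le_rpow_of_one_le bn hq.le
    exact h.trans (by gcongr)
  have := Real.rpow_le_rpow h0 this (z := 1 / q) bp
  rwa [← Real.rpow_mul bp, mul_one_div_cancel bL, Real.rpow_one] at this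

theorem press {q : ℝ} (hq : 1 < q) {R μ X K : ℝ} (hμ : 0 < μ) {a b f g : F2} (ha : Continuous a) (hb : Continuous b) (hf : Continuous f)
    (h : ∀ x ∈ OmegaR R, -μ * (a x + b x) + g x = f x) (na : nO q R a ≤ K * X) (nb : nO q R b ≤ K * X) (nf : nO q R f ≤ X) :
    nO q R g ≤ (1 + 2 * μ * K) * X := by
  have m := fun {f : F2} (hf : Continuous f) => ML_cpt (q := q) (OmegaR_cpt R) hf.continuousOn
  have h1 := lq_mono (f := g) hq (OmegaR_cpt R).measurableSet (m (f := fun x => f x + μ * (a x + b x)) bf) fun x hx => by rw [← h x hx]; ring_nf; rfl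
  have h2 := lq_add hq (m hf) (m (f := fun x => μ * (a x + b x)) bf)
  have h3 := lq_add hq (m ha) (m hb)
  rw [lq_cmul hq, abs_of_pos hμ] at h2
  have := mlL (h3.trans (add_le_add na nb)) hμ.le
  linarith

/-- Stokes estimate under Navier boundary conditions with constant
independent of the horizontal length `R`. -/
theorem stokes_estimate (q : ℝ) (hq : 1 < q) (μ k0 k1 : ℝ)
    (hμ : 0 < μ) (hk0 : k0 ≤ 0) (hk1 : k1 ≤ 0) :
    ∃ C : ℝ, 0 < C ∧ ∀ R : ℝ, 0 < R → ∀ f1 f2 u1 u2 p : ℝ × ℝ → ℝ,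
      Continuous f1 → Continuous f2 →
      ContDiff ℝ 2 u1 → ContDiff ℝ 2 u2 → ContDiff ℝ 1 p →
      -- the Stokes system −μΔu + ∇p = f on Ω_R
      (∀ x ∈ OmegaR R,
        -μ * (pd1 (pd1 u1) x + pd2 (pd2 u1) x) + pd1 p x = f1 x ∧
        -μ * (pd1 (pd1 u2) x + pd2 (pd2 u2) x) + pd2 p x = f2 x) →
      -- incompressibility
      (∀ x ∈ OmegaR R, pd1 u1 x + pd2 u2 x = 0) →
      -- zero boundary values on the lateral sides
      (∀ x₂ ∈ Icc (0 : ℝ) 1,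
        u1 (-R, x₂) = 0 ∧ u1 (R, x₂) = 0 ∧ u2 (-R, x₂) = 0 ∧ u2 (R, x₂) = 0) →
      -- Navier boundary conditions on the top and bottom
      (∀ x₁ ∈ Icc (-R) R,
        u2 (x₁, 0) = 0 ∧ u2 (x₁, 1) = 0 ∧
        pd2 u1 (x₁, 1) = (k1 / μ) * u1 (x₁, 1) ∧
        pd2 u1 (x₁, 0) = -(k0 / μ) * u1 (x₁, 0)) →
      hessLqNorm q (OmegaR R) u1 u2 + lqNormVec q (OmegaR R) (pd1 p) (pd2 p) ≤
        C * (lqNormVec q (OmegaR R) f1 f2 + w1qNormVec q (OmegaR R) u1 u2) := by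
  have hpq : (Real.conjExponent q).HolderConjugate q := (Real.HolderConjugate.conjExponent hq).symm
  obtain ⟨C0, p0, G⟩ := global_est hpq hμ k0 k1
  obtain ⟨C1, p1, S⟩ := small_est hpq hμ hk0 hk1
  set K := 7 * C0 + 2 * C1 with hK
  have K0 : 0 < K := bp
  refine ⟨8 * K + 8 * (1 + 2 * μ * K), by positivity, fun R hR f1 f2 u1 u2 p g1 g2 c1 c2 cp hs hd hl hn => ?_⟩
  have H := mkGS hR g1 g2 c1 c2 cp hs hd hl hn
  have n0 := fun f => lq_nonneg q (OmegaR R) f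
  have r0 := fun f => Real.rpow_nonneg (n0 f) q
  have a1 := r0 f1
  have a2 := r0 f2
  have b1 := r0 u1
  have b2 := r0 u2
  have b3 := r0 (pd1 u1)
  have b4 := r0 (pd2 u1)
  have b5 := r0 (pd1 u2)
  have b6 := r0 (pd2 u2)
  have A1 : nO q R f1 ≤ lqNormVec q (OmegaR R) f1 f2 := root_ge hq (n0 _) bL
  have A2 : nO q R f2 ≤ lqNormVec q (OmegaR R) f1 f2 := root_ge hq (n0 _) bL
  have B1 : nO q R u1 ≤ w1qNormVec q (OmegaR R) u1 u2 := root_ge hq (n0 _) bL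
  have B2 : nO q R u2 ≤ w1qNormVec q (OmegaR R) u1 u2 := root_ge hq (n0 _) bL
  have B3 : nO q R (dd Ex u1) ≤ w1qNormVec q (OmegaR R) u1 u2 := root_ge hq (n0 _) (by rw [← pd1_eq]; linarith)
  have B4 : nO q R (dd Ey u1) ≤ w1qNormVec q (OmegaR R) u1 u2 := root_ge hq (n0 _) (by rw [← pd2_eq]; linarith)
  have B5 : nO q R (dd Ex u2) ≤ w1qNormVec q (OmegaR R) u1 u2 := root_ge hq (n0 _) (by rw [← pd1_eq]; linarith)
  have B6 : nO q R (dd Ey u2) ≤ w1qNormVec q (OmegaR R) u1 u2 := root_ge hq (n0 _) (by rw [← pd2_eq]; linarith)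
  clear a1 a2 b1 b2 b3 b4 b5 b6
  have X1 := (n0 _).trans A1
  have X2 := (n0 _).trans B1
  set X := lqNormVec q (OmegaR R) f1 f2 + w1qNormVec q (OmegaR R) u1 u2 with hX
  have X0 : 0 ≤ X := add_nonneg X1 X2
  have main : ∀ U e e', (U = u1 ∨ U = u2) → unitv e → unitv e' → nO q R (dd e (dd e' U)) ≤ K * X := fun U e e' hU he he' => by
    have k0 := mul_nonneg p0.le X0
    have k1 := mul_nonneg p1.le X0
    rcases le_total R 1 with h | h
    · have s := S R hR h u1 u2 _ p f1 f2 H U e e' hU he he'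
      have := mlL (show nO q R f1 + nO q R f2 ≤ 2 * X by linarith) p1.le
      rw [hK]; linarith
    · have s := G R 1 hR (inv_le_one_of_one_le₀ bL) le_rfl u1 u2 _ p f1 f2 H U e e' hU he he'
      have z := zz_lq hq H one_pos
      have j := Jt_lq hq (R := R) c1.continuous
      have := mlL (show nO q R (zz 1 u1 u2 (Jt u1) f1 f2) ≤ 7 * X by simp only [one_mul, one_pow] at z; linarith) p0.le
      rw [hK]; linarith
  have ex : unitv Ex := Or.inl rfl
  have ey : unitv Ey := Or.inr rfl
  have q0 : 0 ≤ q := bL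
  have KX : 0 ≤ K * X := bp
  have pX : 0 ≤ (1 + 2 * μ * K) * X := bp
  have pw := fun U e e' hU he he' => Real.rpow_le_rpow (n0 _) (main U e e' hU he he') q0
  have hc : ∀ {U : F2}, ContDiff ℝ 2 U → ∀ e, Continuous (dd e (dd e U)) := fun h e => dd_cont e (dd_cd (m := 1) e h bn)
  have hess : hessLqNorm q (OmegaR R) u1 u2 ≤ 8 * (K * X) := by
    refine root_le hq KX (by repeat' (first | exact r0 _ | apply add_nonneg)) ?_
    have w1 := pw u1 _ _ il ex ex
    have w2 := pw u1 _ _ il ex ey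
    have w3 := pw u1 _ _ il ey ex
    have w4 := pw u1 _ _ il ey ey
    have w5 := pw u2 _ _ ir ex ex
    have w6 := pw u2 _ _ ir ex ey
    have w7 := pw u2 _ _ ir ey ex
    have w8 := pw u2 _ _ ir ey ey
    simp only [pd1_eq, pd2_eq]
    linarith
  have P1 := press (g := pd1 p) hq hμ (hc c1 Ex) (hc c1 Ey) g1 (fun x hx => (hs x hx).1) (main u1 _ _ il ex ex) (main u1 _ _ il ey ey) bL
  have P2' := press (g := pd2 p) hq hμ (hc c2 Ex) (hc c2 Ey) g2 (fun x hx => (hs x hx).2) (main u2 _ _ ir ex ex) (main u2 _ _ ir ey ey) bL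
  have pr : lqNormVec q (OmegaR R) (pd1 p) (pd2 p) ≤ 8 * ((1 + 2 * μ * K) * X) := by
    refine root_le hq pX (add_nonneg (r0 _) (r0 _)) ?_
    have w1 := Real.rpow_le_rpow (n0 _) P1 q0
    have w2 := Real.rpow_le_rpow (n0 _) P2' q0
    have := Real.rpow_nonneg pX q
    linarith
  linarith
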